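/- Assume the Riemann hypothesis and the generalized Lindelöf hypothesis. Then there exist polynomials P1 and P2 of degree at most 1 with real coefficients such that for every ε > 0 there is a constant C > 0 with | Σ_{d ≥ 1, d odd} μ(d)² · Φ(d/X) · L(1/2, χ_{8d}) − X·P1(log X) − X^{1/3}·P2(log X) | ≤ C·X^{1/4+ε} for every real X ≥ 2. -/

import Mathlib

open Complex

noncomputable section

/-- The generalized Lindelöf hypothesis for Dirichlet L-functions. -/
def GLH : Prop :=
  ∀ ε : ℝ, 0 < ε → ∀ σ : ℝ, 1 / 2 ≤ σ → ∀ t : ℝ, ∃ C : ℝ, 0 < C ∧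
    ∀ (q : ℕ) [NeZero q] (χ : DirichletCharacter ℂ q), χ.IsPrimitive →
      ‖χ.LFunction ((σ : ℂ) + (t : ℂ) * Complex.I)‖ ≤ C * (q : ℝ) ^ ε

section

open MeasureTheory Filter Topology Set

/-! ### Vertical line integrals -/

lemma integrable_inv_one_add_sq_mul (C : ℝ) : Integrable (fun y : ℝ => C / (1 + y ^ 2)) := by
  simpa [div_eq_mul_inv] using integrable_inv_one_add_sq.const_mul C

lemma integrable_vertical {f : ℂ → ℂ} {x C : ℝ} (hf : Continuous fun y : ℝ => f (x + y * I))
    (hb : ∀ y : ℝ, ‖f (x + y * I)‖ ≤ C / (1 + y ^ 2)) :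
    Integrable (fun y : ℝ => f (x + y * I)) :=
  (integrable_inv_one_add_sq_mul C).mono' hf.aestronglyMeasurable (ae_of_all _ hb)

/-- Moving a vertical line of integration across a strip of holomorphy. -/
lemma integral_vertical_eq {f : ℂ → ℂ} {a b C : ℝ} (hab : a ≤ b)
    (hd : ∀ s : ℂ, a ≤ s.re → s.re ≤ b → DifferentiableAt ℂ f s)
    (hb : ∀ s : ℂ, a ≤ s.re → s.re ≤ b → ‖f s‖ ≤ C / (1 + s.im ^ 2)) :
    ∫ y : ℝ, f (a + y * I) = ∫ y : ℝ, f (b + y * I) := by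
  have hcont : ∀ x : ℝ, a ≤ x → x ≤ b → Continuous fun y : ℝ => f (x + y * I) := by
    intro x h1 h2
    rw [continuous_iff_continuousAt]
    intro y
    refine ContinuousAt.comp (f := fun y : ℝ => (x + y * I : ℂ)) (g := f) ?_ (by fun_prop)
    exact (hd _ (by simpa using h1) (by simpa using h2)).continuousAt
  have h_integrable : ∀ x : ℝ, a ≤ x → x ≤ b → Integrable (fun y : ℝ => f (x + y * I)) := by
    intro x h1 h2
    exact integrable_vertical (hcont x h1 h2)
      (fun y => by simpa using hb (x + y * I) (by simpa using h1) (by simpa using h2))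
  have hlim : ∀ x : ℝ, a ≤ x → x ≤ b → Tendsto (fun T : ℝ => ∫ y in (-T)..T, f (x + y * I)) atTop
      (𝓝 (∫ y : ℝ, f (x + y * I))) := fun x h1 h2 =>
    intervalIntegral_tendsto_integral (h_integrable x h1 h2) tendsto_neg_atTop_atBot tendsto_id
  have hhor : ∀ σ : ℝ, |σ| = 1 →
      Tendsto (fun T : ℝ => ∫ x in a..b, f (x + (σ * T : ℝ) * I)) atTop (𝓝 0) := by
    intro σ hσ
    have hC : Tendsto (fun T : ℝ => C / (1 + T ^ 2) * |b - a|) atTop (𝓝 0) := by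
      rw [← zero_mul |b - a|]
      refine Tendsto.mul_const _ (Tendsto.const_div_atTop ?_ _)
      exact tendsto_atTop_add_const_left _ _ (tendsto_pow_atTop two_ne_zero)
    refine squeeze_zero_norm (fun T => ?_) hC
    refine intervalIntegral.norm_integral_le_of_norm_le_const fun x hx => ?_
    rw [uIoc_of_le hab] at hx
    have := hb (x + (σ * T : ℝ) * I) (by simpa using hx.1.le) (by simpa using hx.2)
    have h2 : σ ^ 2 = 1 := by rw [← sq_abs, hσ]; norm_num
    simpa [mul_pow, h2] using this
  have hrect : ∀ T : ℝ, (∫ x in a..b, f (x + ((-1 : ℝ) * T : ℝ) * I))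
      - (∫ x in a..b, f (x + ((1 : ℝ) * T : ℝ) * I))
      + I * (∫ y in (-T)..T, f (b + y * I)) - I * (∫ y in (-T)..T, f (a + y * I)) = 0 := by
    intro T
    have := Complex.integral_boundary_rect_eq_zero_of_differentiableOn f (a + (-T : ℝ) * I)
      (b + (T : ℝ) * I) (by
        intro s hs
        have : s.re ∈ uIcc a b := by
          have := hs.1
          simpa using this
        rw [uIcc_of_le hab] at this
        exact (hd s this.1 this.2).differentiableWithinAt)
    simpa using this
  have hL := ((((hhor (-1) (by norm_num)).sub (hhor 1 (by norm_num))).add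
    ((hlim b hab le_rfl).const_mul I)).sub ((hlim a le_rfl hab).const_mul I))
  have h0 := tendsto_nhds_unique hL (by simp_rw [hrect]; exact tendsto_const_nhds)
  have : I * ((∫ y : ℝ, f (b + y * I)) - ∫ y : ℝ, f (a + y * I)) = 0 := by
    linear_combination h0
  rcases mul_eq_zero.mp this with h | h
  · exact absurd h I_ne_zero
  · exact (sub_eq_zero.mp h).symm

lemma norm_exp_sq (x y : ℝ) : ‖cexp ((x + y * I) ^ 2)‖ = Real.exp (x ^ 2) * Real.exp (-y ^ 2) := by
  rw [Complex.norm_exp, ← Real.exp_add]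
  congr 1
  simp [sq]; ring

lemma one_add_abs_pow_mul_exp_le (A : ℕ) : ∃ C : ℝ, 0 < C ∧ ∀ y : ℝ,
    (1 + |y|) ^ A * Real.exp (-y ^ 2) ≤ C / (1 + y ^ 2) := by
  refine ⟨Real.exp 2 * (A + 2).factorial * Real.exp 1, by positivity, fun y => ?_⟩
  have h1 : (1 + |y|) ^ (A + 2) ≤ (A + 2).factorial * Real.exp (1 + |y|) := by
    have := Real.pow_div_factorial_le_exp (1 + |y|) (by positivity) (A + 2)
    rwa [div_le_iff₀ (by positivity), mul_comm] at this
  have h2 : Real.exp (1 + |y|) ≤ Real.exp 2 * Real.exp 1 * Real.exp (y ^ 2) := by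
    rw [← Real.exp_add, ← Real.exp_add]
    apply Real.exp_le_exp.mpr
    nlinarith [sq_abs y, sq_nonneg (|y| - 1), abs_nonneg y]
  rw [le_div_iff₀ (by positivity)]
  have h3 : 1 + y ^ 2 ≤ (1 + |y|) ^ 2 := by nlinarith [sq_abs y, abs_nonneg y]
  have h4 : Real.exp (-y ^ 2) * Real.exp (y ^ 2) = 1 := by rw [← Real.exp_add]; simp
  calc (1 + |y|) ^ A * Real.exp (-y ^ 2) * (1 + y ^ 2)
      ≤ (1 + |y|) ^ A * Real.exp (-y ^ 2) * (1 + |y|) ^ 2 := by gcongr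
    _ = (1 + |y|) ^ (A + 2) * Real.exp (-y ^ 2) := by ring
    _ ≤ ((A + 2).factorial * (Real.exp 2 * Real.exp 1 * Real.exp (y ^ 2))) * Real.exp (-y ^ 2) := by
        gcongr; exact h1.trans (by gcongr)
    _ = Real.exp 2 * (A + 2).factorial * Real.exp 1 * (Real.exp (-y ^ 2) * Real.exp (y ^ 2)) := by ring
    _ = _ := by rw [h4, mul_one]

/-- The value of the Gaussian Cauchy kernel integrated over a vertical line. -/
lemma integral_exp_sq_div (c : ℝ) (hc : 0 < c) :
    ∫ y : ℝ, cexp ((c + y * I) ^ 2) / (c + y * I) = Real.pi := by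
  have hre : ∀ y : ℝ, 0 < (c + y * I : ℂ).re := fun y => by simpa using hc
  have h1 : ∀ y : ℝ, (1 : ℂ) / (c + y * I) = ∫ t in Ioi (0 : ℝ), cexp (-(c + y * I) * t) := by
    intro y
    have := integral_exp_mul_complex_Ioi (a := -(c + y * I)) (by simpa using hc) 0
    rw [this]; simp only [ofReal_zero, mul_zero, Complex.exp_zero, neg_div_neg_eq]
  have hgauss : ∀ t : ℝ, ∫ y : ℝ, cexp ((c + y * I) ^ 2) * cexp (-(c + y * I) * t)
      = Real.sqrt Real.pi * cexp (-(t : ℂ) ^ 2 / 4) := by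
    intro t
    have := integral_cexp_quadratic (b := -1) (by norm_num) (I * (2 * c - t)) (c ^ 2 - c * t)
    have e : ∀ y : ℝ, cexp ((c + y * I) ^ 2) * cexp (-(c + y * I) * t)
        = cexp (-1 * (y : ℂ) ^ 2 + I * (2 * c - t) * y + (c ^ 2 - c * t)) := by
      intro y
      rw [← Complex.exp_add]; congr 1; ring_nf; simp [I_sq]; ring
    simp_rw [e]
    rw [this]
    congr 1
    · rw [Real.sqrt_eq_rpow, Complex.ofReal_cpow Real.pi_pos.le]; norm_num
    · congr 1; ring_nf; simp [I_sq]; ring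
  have hmeas : Integrable (Function.uncurry fun (y t : ℝ) =>
      cexp ((c + y * I) ^ 2) * cexp (-(c + y * I) * t)) (volume.prod (volume.restrict (Ioi 0))) := by
    have h2 : Integrable (fun y : ℝ => Real.exp (c ^ 2) * Real.exp (-y ^ 2)) := by
      simpa using (integrable_exp_neg_mul_sq (b := 1) one_pos).const_mul (Real.exp (c ^ 2))
    have h3 : Integrable (fun t : ℝ => Real.exp (-c * t)) (volume.restrict (Ioi 0)) :=
      exp_neg_integrableOn_Ioi 0 hc
    refine (h2.mul_prod h3).mono' (by fun_prop) (ae_of_all _ fun p => ?_)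
    simp only [Function.uncurry, norm_mul, norm_exp_sq]
    gcongr
    rw [Complex.norm_exp]
    simp
  calc ∫ y : ℝ, cexp ((c + y * I) ^ 2) / (c + y * I)
      = ∫ y : ℝ, ∫ t in Ioi (0 : ℝ), cexp ((c + y * I) ^ 2) * cexp (-(c + y * I) * t) := by
        congr 1; ext y
        rw [integral_const_mul, ← h1]; ring
    _ = ∫ t in Ioi (0 : ℝ), ∫ y : ℝ, cexp ((c + y * I) ^ 2) * cexp (-(c + y * I) * t) :=
        integral_integral_swap hmeas
    _ = ∫ t in Ioi (0 : ℝ), ((Real.sqrt Real.pi * Real.exp (-(1 / 4) * t ^ 2) : ℝ) : ℂ) := by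
        congr 1; ext t
        rw [hgauss]; push_cast; congr 2; ring
    _ = Real.pi := by
        rw [integral_complex_ofReal, integral_const_mul, integral_gaussian_Ioi]
        congr 1
        rw [show Real.pi / (1 / 4) = Real.pi * 2 ^ 2 by ring, Real.sqrt_mul Real.pi_pos.le,
          Real.sqrt_sq (by norm_num)]
        linear_combination Real.mul_self_sqrt Real.pi_pos.le

/-- Cauchy's formula on a strip with the kernel `exp (s ^ 2) / s`. -/
lemma cauchy_strip {f : ℂ → ℂ} {c c' C : ℝ} {A : ℕ} (hc : 0 < c) (hc' : 0 < c')
    (hd : ∀ s : ℂ, -c' ≤ s.re → s.re ≤ c → DifferentiableAt ℂ f s)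
    (hb : ∀ s : ℂ, -c' ≤ s.re → s.re ≤ c → ‖f s‖ ≤ C * (1 + |s.im|) ^ A) :
    2 * Real.pi * f 0 = (∫ y : ℝ, f (c + y * I) * (cexp ((c + y * I) ^ 2) / (c + y * I)))
      - ∫ y : ℝ, f ((-c' : ℝ) + y * I) * (cexp (((-c' : ℝ) + y * I) ^ 2) / ((-c' : ℝ) + y * I)) := by
  set g : ℂ → ℂ := fun s => dslope f 0 s * cexp (s ^ 2) with hg
  obtain ⟨D, hD0, hD⟩ := one_add_abs_pow_mul_exp_le A
  have hC0 : 0 ≤ C := by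
    have := (norm_nonneg _).trans (hb 0 (by simp [hc'.le]) (by simp [hc.le]))
    simpa using this
  have hdf0 : DifferentiableAt ℂ f 0 := hd 0 (by simp [hc'.le]) (by simp [hc.le])
  set U : Set ℂ := {s : ℂ | -c' < s.re ∧ s.re < c}
  have hU : IsOpen U := (isOpen_lt continuous_const continuous_re).inter
    (isOpen_lt continuous_re continuous_const)
  have h0U : (0 : ℂ) ∈ U := ⟨by simpa using hc', by simpa using hc⟩
  have hgd : ∀ s : ℂ, -c' ≤ s.re → s.re ≤ c → DifferentiableAt ℂ g s := by
    intro s h1 h2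
    refine DifferentiableAt.mul ?_ (by fun_prop)
    by_cases hs : s = 0
    · subst hs
      have : DifferentiableOn ℂ (dslope f 0) U :=
        (Complex.differentiableOn_dslope (hU.mem_nhds h0U)).mpr
          fun s hs => (hd s hs.1.le hs.2.le).differentiableWithinAt
      exact this.differentiableAt (hU.mem_nhds h0U)
    · exact (differentiableAt_dslope_of_ne hs).mpr (hd s h1 h2)
  have hsq : ∀ s : ℂ, ‖cexp (s ^ 2)‖ = Real.exp (s.re ^ 2) * Real.exp (-s.im ^ 2) := by
    intro s
    have := norm_exp_sq s.re s.im
    rwa [re_add_im] at this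
  obtain ⟨B, hB⟩ : ∃ B, ∀ s ∈ {s : ℂ | -c' ≤ s.re ∧ s.re ≤ c ∧ |s.im| ≤ 1}, ‖dslope f 0 s‖ ≤ B := by
    have hK : IsCompact {s : ℂ | -c' ≤ s.re ∧ s.re ≤ c ∧ |s.im| ≤ 1} := by
      have : {s : ℂ | -c' ≤ s.re ∧ s.re ≤ c ∧ |s.im| ≤ 1} = Icc (-c') c ×ℂ Icc (-1) 1 := by
        ext s; simp [Complex.mem_reProdIm, abs_le, and_assoc]
      rw [this]
      exact isCompact_Icc.reProdIm isCompact_Icc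
    refine hK.exists_bound_of_continuousOn fun s hs => ContinuousAt.continuousWithinAt ?_
    by_cases h : s = 0
    · subst h; exact continuousAt_dslope_same.mpr hdf0
    · exact (continuousAt_dslope_of_ne h).mpr (hd s hs.1 hs.2.1).continuousAt
  set E : ℝ := (|B| + 2 * C) * Real.exp (c ^ 2 + c' ^ 2) * D
  have hgb : ∀ s : ℂ, -c' ≤ s.re → s.re ≤ c → ‖g s‖ ≤ E / (1 + s.im ^ 2) := by
    intro s h1 h2
    have e1 : ‖dslope f 0 s‖ ≤ (|B| + 2 * C) * (1 + |s.im|) ^ A := by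
      have hA : 1 ≤ (1 + |s.im|) ^ A := one_le_pow₀ (by linarith [abs_nonneg s.im])
      by_cases hs : |s.im| ≤ 1
      · calc _ ≤ B := hB s ⟨h1, h2, hs⟩
          _ ≤ |B| + 2 * C := by linarith [le_abs_self B]
          _ ≤ _ := le_mul_of_one_le_right (by positivity) hA
      · have hs0 : s ≠ 0 := by rintro rfl; simp at hs
        have hs1 : 1 ≤ ‖s‖ := (not_le.mp hs).le.trans (abs_im_le_norm s)
        rw [dslope_of_ne _ hs0, slope_def_field, sub_zero, norm_div]
        calc ‖f s - f 0‖ / ‖s‖ ≤ ‖f s - f 0‖ := div_le_self (norm_nonneg _) hs1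
          _ ≤ ‖f s‖ + ‖f 0‖ := norm_sub_le _ _
          _ ≤ C * (1 + |s.im|) ^ A + C * 1 := by
              gcongr
              · exact hb s h1 h2
              · simpa using hb 0 (by simp [hc'.le]) (by simp [hc.le])
          _ ≤ C * (1 + |s.im|) ^ A + C * (1 + |s.im|) ^ A := by gcongr
          _ ≤ _ := by nlinarith [mul_nonneg (abs_nonneg B) (zero_le_one.trans hA)]
    have e2 : Real.exp (s.re ^ 2) ≤ Real.exp (c ^ 2 + c' ^ 2) := by
      apply Real.exp_le_exp.mpr
      by_cases h : 0 ≤ s.re <;> nlinarith [sq_nonneg c, sq_nonneg c']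
    calc ‖g s‖ = ‖dslope f 0 s‖ * (Real.exp (s.re ^ 2) * Real.exp (-s.im ^ 2)) := by
          rw [hg, norm_mul, hsq]
      _ ≤ ((|B| + 2 * C) * (1 + |s.im|) ^ A) * (Real.exp (c ^ 2 + c' ^ 2) * Real.exp (-s.im ^ 2)) := by
          gcongr
      _ = (|B| + 2 * C) * Real.exp (c ^ 2 + c' ^ 2) * ((1 + |s.im|) ^ A * Real.exp (-s.im ^ 2)) := by ring
      _ ≤ (|B| + 2 * C) * Real.exp (c ^ 2 + c' ^ 2) * (D / (1 + s.im ^ 2)) := by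
          gcongr; exact hD _
      _ = _ := by ring
  have hshift := integral_vertical_eq (by linarith) hgd hgb
  have hcontg : ∀ x : ℝ, -c' ≤ x → x ≤ c → Integrable fun y : ℝ => g (x + y * I) := by
    intro x h1 h2
    refine integrable_vertical (C := E) ?_ fun y => by
      simpa using hgb (x + y * I) (by simpa using h1) (by simpa using h2)
    rw [continuous_iff_continuousAt]
    intro y
    refine ContinuousAt.comp (f := fun y : ℝ => (x + y * I : ℂ)) (g := g) ?_ (by fun_prop)
    exact (hgd _ (by simpa using h1) (by simpa using h2)).continuousAt
  have hker : ∀ x : ℝ, x ≠ 0 → Integrable fun y : ℝ => cexp ((x + y * I) ^ 2) / (x + y * I) := by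
    intro x hx
    have hne : ∀ y : ℝ, (x + y * I : ℂ) ≠ 0 := fun y h => hx (by simpa using congrArg re h)
    have h2 : Integrable (fun y : ℝ => Real.exp (x ^ 2) * Real.exp (-y ^ 2) / |x|) := by
      simpa using ((integrable_exp_neg_mul_sq (b := 1) one_pos).const_mul (Real.exp (x ^ 2))).div_const |x|
    refine h2.mono' (Continuous.aestronglyMeasurable ?_) (ae_of_all _ fun y => ?_)
    · exact Continuous.div (by fun_prop) (by fun_prop) hne
    · rw [norm_div, norm_exp_sq]
      gcongr
      simpa using abs_re_le_norm (x + y * I : ℂ)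
  have hsplit : ∀ x : ℝ, x ≠ 0 → -c' ≤ x → x ≤ c →
      ∫ y : ℝ, f (x + y * I) * (cexp ((x + y * I) ^ 2) / (x + y * I)) =
        (∫ y : ℝ, g (x + y * I)) + f 0 * ∫ y : ℝ, cexp ((x + y * I) ^ 2) / (x + y * I) := by
    intro x hx h1 h2
    rw [← integral_const_mul, ← integral_add (hcontg x h1 h2) ((hker x hx).const_mul _)]
    congr 1; ext y
    have hne : (x + y * I : ℂ) ≠ 0 := fun h => hx (by simpa using congrArg re h)
    simp only [hg, dslope_of_ne _ hne, slope_def_field, sub_zero]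
    field_simp
    ring
  rw [hsplit c hc.ne' (by linarith) le_rfl, hsplit (-c') (by linarith) le_rfl (by linarith), hshift,
    integral_exp_sq_div c hc]
  have hneg : ∫ y : ℝ, cexp (((-c' : ℝ) + y * I) ^ 2) / ((-c' : ℝ) + y * I) = -Real.pi := by
    rw [← integral_exp_sq_div c' hc', ← integral_neg, ← integral_neg_eq_self]
    congr 1; ext y
    have hne : (c' + y * I : ℂ) ≠ 0 := fun h => hc'.ne' (by simpa using congrArg re h)
    have : (((-c' : ℝ) : ℂ) + ((-y : ℝ) : ℂ) * I) = -(c' + y * I) := by push_cast; ring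
    rw [this, neg_sq, div_neg]
  rw [hneg]; ring

theorem integrableOn_rpow_mul_exp_neg_mul {x b : ℝ} (hx : -1 < x) (hb : 0 < b) :
    IntegrableOn (fun t : ℝ => t ^ x * Real.exp (-(b * t))) (Ioi 0) := by
  have := integrableOn_rpow_mul_exp_neg_mul_rpow (p := 1) hx one_pos hb
  simpa using this

/-- The Gamma integral along a rotated ray. -/
theorem integral_cpow_mul_exp_neg_mul_Ioi_complex {a r : ℂ} (ha : 0 < a.re) (hr : 0 < r.re) :
    ∫ t : ℝ in Ioi 0, (t:ℂ) ^ (a - 1) * cexp (-(r * t)) = (1 / r) ^ a * Gamma a := by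
  have hUo : IsOpen {r : ℂ | 0 < r.re} := isOpen_lt continuous_const continuous_re
  have hU : IsPreconnected {r : ℂ | 0 < r.re} := (convex_halfSpace_re_gt 0).isPreconnected
  have hmeas : ∀ r : ℂ, AEStronglyMeasurable (fun t : ℝ => (t:ℂ) ^ (a - 1) * cexp (-(r * t)))
      (volume.restrict (Ioi 0)) := fun r => (by fun_prop :
        Measurable (fun t : ℝ => (t:ℂ) ^ (a - 1) * cexp (-(r * t)))).aestronglyMeasurable
  have hnorm : ∀ r : ℂ, ∀ t : ℝ, 0 < t → ‖(t:ℂ) ^ (a - 1) * cexp (-(r * t))‖ =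
      t ^ (a.re - 1) * Real.exp (-(r.re * t)) := by
    intro r t ht
    rw [norm_mul, norm_cpow_eq_rpow_re_of_pos ht, norm_exp]
    simp
  have h1 : AnalyticOnNhd ℂ (fun r : ℂ => ∫ t : ℝ in Ioi 0, (t:ℂ) ^ (a - 1) * cexp (-(r * t)))
      {r : ℂ | 0 < r.re} := by
    apply DifferentiableOn.analyticOnNhd _ hUo
    intro r hr
    simp only [mem_ofPred_eq] at hr
    apply DifferentiableAt.differentiableWithinAt
    have hb : 0 < r.re / 2 := by linarith
    refine (hasDerivAt_integral_of_dominated_loc_of_deriv_le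
      (bound := fun t : ℝ => t ^ a.re * Real.exp (-(r.re / 2 * t)))
      (F' := fun (r : ℂ) (t : ℝ) => (t:ℂ) ^ (a - 1) * (cexp (-(r * t)) * (-t)))
      (s := Metric.ball r (r.re / 2)) (Metric.ball_mem_nhds _ hb)
      (Eventually.of_forall hmeas) ?_ ?_ ?_ ?_ ?_).2.differentiableAt
    · refine Integrable.mono' (integrableOn_rpow_mul_exp_neg_mul (x := a.re - 1) (by linarith) hr) (hmeas r) ?_
      filter_upwards [ae_restrict_mem measurableSet_Ioi] with t ht
      exact (hnorm r t ht).le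
    · exact (by fun_prop : Measurable (fun t : ℝ => (t:ℂ) ^ (a - 1) * (cexp (-(r * t)) * (-t)))).aestronglyMeasurable
    · filter_upwards [ae_restrict_mem measurableSet_Ioi] with t ht z hz
      simp only [mem_Ioi] at ht
      have hz2 : r.re / 2 ≤ z.re := by
        have h1 := (abs_re_le_norm (z - r)).trans (mem_ball_iff_norm.mp hz).le
        have h2 := (abs_le.mp h1).1
        simp at h2; linarith
      rw [← mul_assoc, norm_mul, hnorm z t ht, norm_neg, Complex.norm_real, Real.norm_of_nonneg ht.le]
      calc t ^ (a.re - 1) * Real.exp (-(z.re * t)) * t = t ^ a.re * Real.exp (-(z.re * t)) := by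
            rw [Real.rpow_sub_one ht.ne']; field_simp
        _ ≤ _ := by gcongr
    · exact integrableOn_rpow_mul_exp_neg_mul (by linarith) hb
    · filter_upwards with t z hz
      apply HasDerivAt.const_mul
      apply HasDerivAt.cexp
      simpa using ((hasDerivAt_id z).mul_const (t:ℂ)).fun_neg
  have h2 : AnalyticOnNhd ℂ (fun r : ℂ => (1 / r) ^ a * Gamma a) {r : ℂ | 0 < r.re} := by
    apply DifferentiableOn.analyticOnNhd _ hUo
    intro r hr
    simp only [mem_ofPred_eq] at hr
    have hr0 : r ≠ 0 := by rintro rfl; simp at hr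
    apply DifferentiableAt.differentiableWithinAt
    apply DifferentiableAt.mul_const
    apply DifferentiableAt.cpow_const
    · exact (differentiableAt_const _).div differentiableAt_id hr0
    · left
      rw [one_div, inv_re]
      exact div_pos hr (normSq_pos.mpr hr0)
  refine h1.eqOn_of_preconnected_of_frequently_eq h2 hU (z₀ := 1) (by simp) ?_ hr
  have hseq : Tendsto (fun x : ℝ => ((1 + x : ℝ) : ℂ)) (𝓝[>] 0) (𝓝[≠] 1) := by
    apply tendsto_nhdsWithin_iff.mpr ⟨?_, ?_⟩
    · have : Tendsto (fun x : ℝ => ((1 + x : ℝ) : ℂ)) (𝓝 0) (𝓝 ((1 + 0 : ℝ) : ℂ)) :=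
        (by fun_prop : Continuous fun x : ℝ => ((1 + x : ℝ) : ℂ)).tendsto 0
      simp only [add_zero, ofReal_one] at this
      exact this.mono_left nhdsWithin_le_nhds
    · filter_upwards [self_mem_nhdsWithin] with x hx
      simp only [mem_Ioi] at hx
      intro h
      have := congrArg re h
      simp at this; linarith
  apply hseq.frequently
  apply Eventually.frequently
  filter_upwards [self_mem_nhdsWithin] with x hx
  simp only [mem_Ioi] at hx
  exact integral_cpow_mul_exp_neg_mul_Ioi ha (by linarith)

theorem norm_Gamma_mul_exp_le {s : ℂ} (hs : 0 < s.re) {θ : ℝ} (hθ : |θ| < Real.pi / 2) :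
    ‖Gamma s‖ * Real.exp (θ * s.im) ≤ (1 / Real.cos θ) ^ s.re * Real.Gamma s.re := by
  have hcos : 0 < Real.cos θ := Real.cos_pos_of_mem_Ioo (abs_lt.mp hθ |>.imp (by intro h; linarith) id)
  have hr : (cexp (θ * I)).re = Real.cos θ := by
    rw [exp_ofReal_mul_I_re]
  have h1 := integral_cpow_mul_exp_neg_mul_Ioi_complex hs (r := cexp (θ * I)) (by rw [hr]; exact hcos)
  have h2 := Real.integral_rpow_mul_exp_neg_mul_Ioi hs hcos
  have h3 : ‖(1 / cexp (θ * I)) ^ s‖ = Real.exp (θ * s.im) := by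
    rw [one_div, ← Complex.exp_neg, cpow_def_of_ne_zero (exp_ne_zero _), Complex.log_exp, norm_exp]
    · congr 1; simp; 
    · have := (abs_lt.mp hθ).2
      have := Real.pi_pos
      simp; linarith
    · have := (abs_lt.mp hθ).1
      have := Real.pi_pos
      simp; linarith
  calc ‖Gamma s‖ * Real.exp (θ * s.im) = ‖(1 / cexp (θ * I)) ^ s * Gamma s‖ := by
        rw [norm_mul, h3, mul_comm]
    _ ≤ ∫ t in Ioi (0:ℝ), ‖(t:ℂ) ^ (s - 1) * cexp (-(cexp (θ * I) * t))‖ := by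
        rw [← h1]; exact norm_integral_le_integral_norm _
    _ = ∫ t in Ioi (0:ℝ), t ^ (s.re - 1) * Real.exp (-(Real.cos θ * t)) := by
        apply setIntegral_congr_fun measurableSet_Ioi
        intro t ht
        simp only [mem_Ioi] at ht
        simp only [norm_mul, norm_cpow_eq_rpow_re_of_pos ht, norm_exp]
        congr 2
        simp [hr]
    _ = _ := h2

theorem norm_Gamma_le {s : ℂ} (hs : 0 < s.re) :
    ‖Gamma s‖ * Real.exp (Real.pi / 2 * |s.im|) ≤
      Real.exp 1 * ((2 * (1 + |s.im|)) ^ s.re * Real.Gamma s.re) := by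
  set T := |s.im| with hT
  have hT0 : 0 ≤ T := abs_nonneg _
  have hpi := Real.pi_pos
  have hpi3 := Real.pi_gt_three
  set δ := 1 / (1 + T) with hδ
  have hδ0 : 0 < δ := by positivity
  have hδ1 : δ ≤ 1 := by rw [hδ, div_le_one (by positivity)]; linarith
  have hδT : δ * T ≤ 1 := by rw [hδ, div_mul_eq_mul_div, div_le_one (by positivity)]; linarith
  set θ := Real.pi / 2 - δ with hθ
  have hc : 1 / Real.cos θ ≤ 2 * (1 + T) := by
    rw [hθ, Real.cos_pi_div_two_sub]
    have h1 : 2 / Real.pi * δ ≤ Real.sin δ := Real.mul_le_sin hδ0.le (by linarith)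
    have h2 : δ / 2 ≤ Real.sin δ := by
      refine le_trans ?_ h1
      have : 1 / 2 ≤ 2 / Real.pi := by
        rw [div_le_div_iff₀ (by norm_num) hpi]; linarith [Real.pi_lt_four]
      nlinarith
    calc 1 / Real.sin δ ≤ 1 / (δ / 2) := by gcongr
      _ = 2 * (1 + T) := by rw [hδ]; field_simp
  have hc0 : 0 < Real.cos θ := Real.cos_pos_of_mem_Ioo ⟨by linarith, by linarith⟩
  have key : ‖Gamma s‖ * Real.exp (θ * T) ≤ (1 / Real.cos θ) ^ s.re * Real.Gamma s.re := by
    rcases le_total 0 s.im with h | h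
    · rw [hT, abs_of_nonneg h]
      exact norm_Gamma_mul_exp_le hs (abs_lt.mpr ⟨by linarith, by linarith⟩)
    · rw [hT, abs_of_nonpos h]
      have := norm_Gamma_mul_exp_le hs (θ := -θ) (abs_lt.mpr ⟨by linarith, by linarith⟩)
      rw [Real.cos_neg] at this
      convert this using 3
      ring
  have hG : 0 < Real.Gamma s.re := Real.Gamma_pos_of_pos hs
  calc ‖Gamma s‖ * Real.exp (Real.pi / 2 * T)
      = Real.exp (δ * T) * (‖Gamma s‖ * Real.exp (θ * T)) := by
        rw [mul_left_comm, ← Real.exp_add]; congr 2; rw [hθ]; ring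
    _ ≤ Real.exp 1 * ((1 / Real.cos θ) ^ s.re * Real.Gamma s.re) := by
        gcongr
    _ ≤ _ := by gcongr

theorem sum_range_zmod (N : ℕ) [NeZero N] (Φ : ZMod N → ℂ) :
    ∑ k ∈ Finset.range N, Φ (k : ZMod N) = ∑ j, Φ j := by
  symm
  apply Finset.sum_nbij' (fun j : ZMod N => j.val) (fun k : ℕ => (k : ZMod N))
  · intro a _; simpa using ZMod.val_lt a
  · intro a _; simp
  · intro a _; simp
  · intro a ha; exact ZMod.val_cast_of_lt (by simpa using ha)
  · intro a _; simp

theorem norm_sum_range_sub_le (N : ℕ) [NeZero N] (Φ : ZMod N → ℂ) {B : ℝ} (hΦ : ∀ j, ‖Φ j‖ ≤ B)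
    (n : ℕ) :
    ‖∑ k ∈ Finset.range n, Φ (k : ZMod N) - n * ((∑ j, Φ j) / N)‖ ≤ 2 * N * B := by
  have hB : 0 ≤ B := (norm_nonneg _).trans (hΦ 0)
  have hN : (N : ℂ) ≠ 0 := by exact_mod_cast NeZero.ne N
  have hN' : (0 : ℝ) < N := by exact_mod_cast NeZero.pos N
  set c := (∑ j, Φ j) / N with hc
  have hcB : ‖c‖ ≤ B := by
    rw [hc, norm_div, Complex.norm_natCast, div_le_iff₀ hN']
    calc ‖∑ j, Φ j‖ ≤ ∑ j : ZMod N, B := norm_sum_le_of_le _ (fun j _ => hΦ j)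
      _ = B * N := by simp [ZMod.card, mul_comm]
  have hper : ∀ n : ℕ, ∑ k ∈ Finset.range (n + N), Φ (k : ZMod N) =
      ∑ k ∈ Finset.range n, Φ (k : ZMod N) + N * c := by
    intro n
    induction n with
    | zero => simp [sum_range_zmod, hc, mul_div_cancel₀ _ hN]
    | succ n ih =>
      rw [show n + 1 + N = (n + N) + 1 by ring, Finset.sum_range_succ, ih, Finset.sum_range_succ]
      simp; ring
  induction n using Nat.strong_induction_on with
  | _ n ih =>
    rcases lt_or_ge n N with h | h
    · calc _ ≤ ‖∑ k ∈ Finset.range n, Φ (k : ZMod N)‖ + ‖n * c‖ := norm_sub_le _ _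
        _ ≤ n * B + n * B := by
          gcongr
          · calc _ ≤ ∑ k ∈ Finset.range n, B := norm_sum_le_of_le _ (fun j _ => hΦ _)
              _ = _ := by simp
          · rw [norm_mul, Complex.norm_natCast]; gcongr
        _ ≤ 2 * N * B := by
          have : (n:ℝ) ≤ N := by exact_mod_cast h.le
          nlinarith
    · obtain ⟨m, rfl⟩ := Nat.exists_eq_add_of_le' h
      have := ih m (by have := NeZero.pos N; omega)
      rw [hper]
      convert this using 2
      push_cast; ring

/-- The error term of the summatory function of a periodic function, cut off below `1`. -/
def sumErr (N : ℕ) [NeZero N] (Φ : ZMod N → ℂ) (t : ℝ) : ℂ :=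
  Set.indicator (Ioi 1) (fun t : ℝ => (∑ k ∈ Finset.Icc 1 ⌊t⌋₊, Φ (k : ZMod N))
    - t * ((∑ j, Φ j) / N)) t

theorem norm_sumErr_le (N : ℕ) [NeZero N] (Φ : ZMod N → ℂ) {B : ℝ} (hΦ : ∀ j, ‖Φ j‖ ≤ B) (t : ℝ) :
    ‖sumErr N Φ t‖ ≤ 4 * N * B := by
  have hB : 0 ≤ B := (norm_nonneg _).trans (hΦ 0)
  have hN' : (1 : ℝ) ≤ N := by exact_mod_cast NeZero.one_le
  have hN : (0 : ℝ) < N := by linarith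
  unfold sumErr
  by_cases ht : t ∈ Ioi (1:ℝ)
  · rw [indicator_of_mem ht]
    set c := (∑ j, Φ j) / N with hc
    have hcB : ‖c‖ ≤ B := by
      rw [hc, norm_div, Complex.norm_natCast, div_le_iff₀ hN]
      calc ‖∑ j, Φ j‖ ≤ ∑ j : ZMod N, B := norm_sum_le_of_le _ (fun j _ => hΦ j)
        _ = B * N := by simp [ZMod.card, mul_comm]
    set n := ⌊t⌋₊
    have ht0 : (0:ℝ) ≤ t := by simp at ht; linarith
    have h1 : (n : ℝ) ≤ t := Nat.floor_le ht0
    have h2 : t < n + 1 := Nat.lt_floor_add_one t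
    have hs : ∑ k ∈ Finset.Icc 1 n, Φ (k : ZMod N) =
        ∑ k ∈ Finset.range (n+1), Φ (k : ZMod N) - Φ 0 := by
      rw [Finset.sum_range_eq_add_Ico _ (by omega)]
      simp
      rfl
    have e : ∑ k ∈ Finset.Icc 1 n, Φ (k : ZMod N) - t * c =
        (∑ k ∈ Finset.range (n+1), Φ (k : ZMod N) - (n+1:ℕ) * c) - Φ 0 + (((n:ℝ) + 1 - t : ℝ) : ℂ) * c := by
      rw [hs]; push_cast; ring
    rw [e]
    calc _ ≤ 2 * N * B + B + 1 * B := by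
          refine (norm_add_le _ _).trans (add_le_add ((norm_sub_le _ _).trans (add_le_add (norm_sum_range_sub_le N Φ hΦ _) (hΦ 0))) ?_)
          rw [norm_mul, Complex.norm_real]
          gcongr
          rw [Real.norm_eq_abs, abs_le]; constructor <;> linarith
      _ ≤ _ := by nlinarith
  · rw [indicator_of_notMem ht]; simp; positivity

theorem measurable_sumErr (N : ℕ) [NeZero N] (Φ : ZMod N → ℂ) : Measurable (sumErr N Φ) := by
  unfold sumErr
  apply Measurable.indicator _ measurableSet_Ioi
  have h1 : Measurable (fun n : ℕ => ∑ k ∈ Finset.Icc 1 n, Φ (k : ZMod N)) := measurable_from_nat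
  exact (h1.comp Nat.measurable_floor).sub ((by fun_prop : Measurable fun t : ℝ => (t:ℂ)).mul_const _)

theorem differentiableAt_mellin_sumErr (N : ℕ) [NeZero N] (Φ : ZMod N → ℂ) {s : ℂ} (hs : s.re < 0) :
    DifferentiableAt ℂ (mellin (sumErr N Φ)) s := by
  obtain ⟨B, hB⟩ : ∃ B, ∀ j, ‖Φ j‖ ≤ B := by
    obtain ⟨B, hB⟩ := (Set.finite_range (fun j => ‖Φ j‖)).bddAbove
    exact ⟨B, fun j => hB ⟨j, rfl⟩⟩
  apply mellin_differentiableAt_of_isBigO_rpow (a := 0) (b := s.re - 1)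
  · apply LocallyIntegrable.locallyIntegrableOn
    intro x
    exact ⟨Icc (x-1) (x+1), Icc_mem_nhds (by linarith) (by linarith), 
      Measure.integrableOn_of_bounded (M := 4 * N * B) (by simp) (measurable_sumErr N Φ).aestronglyMeasurable
        (ae_of_all _ (norm_sumErr_le N Φ hB))⟩
  · apply Asymptotics.IsBigO.of_bound (4 * N * B)
    filter_upwards [eventually_gt_atTop 0] with x hx
    simpa using norm_sumErr_le N Φ hB x
  · exact hs
  · apply Asymptotics.IsBigO.of_bound 0
    filter_upwards [Ioo_mem_nhdsGT (zero_lt_one' ℝ)] with x hx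
    have : sumErr N Φ x = 0 := indicator_of_notMem (by simpa using hx.2.le) _
    simp [this]
  · linarith

theorem norm_mellin_sumErr_le (N : ℕ) [NeZero N] (Φ : ZMod N → ℂ) {B : ℝ} (hΦ : ∀ j, ‖Φ j‖ ≤ B)
    {s : ℂ} (hs : 0 < s.re) :
    ‖mellin (sumErr N Φ) (-s)‖ ≤ 4 * N * B / s.re := by
  have h0 : ∀ t : ℝ, sumErr N Φ t = indicator (Ioi 1) (sumErr N Φ) t := by
    intro t; by_cases h : t ∈ Ioi (1:ℝ) <;> simp [sumErr, h]
  have e : mellin (sumErr N Φ) (-s) = ∫ t in Ioi (1:ℝ), (t:ℂ)^(-s-1) * sumErr N Φ t := by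
    unfold mellin
    rw [← integral_indicator measurableSet_Ioi, ← integral_indicator measurableSet_Ioi]
    congr 1; ext t
    by_cases h : t ∈ Ioi (1:ℝ)
    · have : t ∈ Ioi (0:ℝ) := by simp at h ⊢; linarith
      simp only [indicator_of_mem h, indicator_of_mem this, smul_eq_mul]
    · rw [indicator_of_notMem h, indicator]
      split_ifs
      · rw [h0, indicator_of_notMem h, smul_zero]
      · rfl
  rw [e]
  have hi := integrableOn_Ioi_rpow_of_lt (a := -s.re - 1) (by linarith) zero_lt_one
  calc _ ≤ ∫ t in Ioi (1:ℝ), t^(-s.re-1) * (4 * N * B) := by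
        apply norm_integral_le_of_norm_le (hi.mul_const _)
        filter_upwards [ae_restrict_mem measurableSet_Ioi] with t ht
        have ht0 : (0:ℝ) < t := by simp at ht; linarith
        rw [norm_mul, norm_cpow_eq_rpow_re_of_pos ht0]
        simp only [sub_re, neg_re, one_re]
        gcongr
        exact norm_sumErr_le N Φ hΦ t
    _ = _ := by
        rw [integral_mul_const, integral_Ioi_rpow_of_lt (by linarith) zero_lt_one]
        simp; field_simp

theorem LFunction_eq_mellin_of_one_lt (N : ℕ) [NeZero N] (Φ : ZMod N → ℂ) {s : ℂ} (hs : 1 < s.re) :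
    (s - 1) * ZMod.LFunction Φ s = s * ((∑ j, Φ j) / N) +
      s * (s - 1) * mellin (sumErr N Φ) (-s) := by
  obtain ⟨B, hB⟩ : ∃ B, ∀ j, ‖Φ j‖ ≤ B := by
    obtain ⟨B, hB⟩ := (Set.finite_range (fun j => ‖Φ j‖)).bddAbove
    exact ⟨B, fun j => hB ⟨j, rfl⟩⟩
  have hs1 : s - 1 ≠ 0 := by
    intro h; rw [sub_eq_zero.mp h] at hs; simp at hs
  rw [ZMod.LFunction_eq_LSeries Φ hs]
  have hsum := ZMod.LSeriesSummable_of_one_lt_re Φ hs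
  rw [LSeries_eq_mul_integral (fun n : ℕ => Φ n) zero_le_one hs hsum]
  · set c := (∑ j, Φ j) / N with hc
    have hsplit : (∫ t in Ioi (1:ℝ), (∑ k ∈ Finset.Icc 1 ⌊t⌋₊, Φ (k : ZMod N)) * (t:ℂ)^(-(s+1))) =
        c / (s - 1) + mellin (sumErr N Φ) (-s) := by
      have hI1 : IntegrableOn (fun t : ℝ => c * (t:ℂ)^(-s)) (Ioi 1) := by
        apply Integrable.const_mul
        exact integrableOn_Ioi_cpow_of_lt (by simpa using hs) zero_lt_one
      have hI2 : IntegrableOn (fun t : ℝ => sumErr N Φ t * (t:ℂ)^(-(s+1))) (Ioi 1) := by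
        have hi := integrableOn_Ioi_rpow_of_lt (a := -s.re - 1) (by linarith) zero_lt_one
        apply Integrable.mono' (hi.const_mul (4 * N * B))
        · apply AEStronglyMeasurable.mul (measurable_sumErr N Φ).aestronglyMeasurable
          have : Measurable fun t : ℝ => (t:ℂ)^(-(s+1)) := by fun_prop
          exact this.aestronglyMeasurable
        · filter_upwards [ae_restrict_mem measurableSet_Ioi] with t ht
          have ht0 : (0:ℝ) < t := by simp at ht; linarith
          rw [norm_mul, norm_cpow_eq_rpow_re_of_pos ht0]
          have : (-(s+1)).re = -s.re - 1 := by simp; ring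
          rw [this]
          gcongr
          exact norm_sumErr_le N Φ hB t
      have e2 : mellin (sumErr N Φ) (-s) = ∫ t in Ioi (1:ℝ), sumErr N Φ t * (t:ℂ)^(-(s+1)) := by
        unfold mellin
        rw [← integral_indicator measurableSet_Ioi, ← integral_indicator measurableSet_Ioi]
        congr 1; ext t
        by_cases h : t ∈ Ioi (1:ℝ)
        · have : t ∈ Ioi (0:ℝ) := by simp at h ⊢; linarith
          simp only [indicator_of_mem h, indicator_of_mem this, smul_eq_mul]
          rw [mul_comm]; congr 2; ring
        · rw [indicator_of_notMem h, indicator]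
          split_ifs
          · simp [sumErr, indicator_of_notMem h]
          · rfl
      have e1 : c / (s - 1) = ∫ t in Ioi (1:ℝ), c * (t:ℂ)^(-s) := by
        rw [integral_const_mul, integral_Ioi_cpow_of_lt (by simpa using hs) zero_lt_one]
        simp
        rw [show -s + 1 = -(s-1) by ring]; field_simp
      rw [e1, e2, ← integral_add hI1 hI2]
      apply setIntegral_congr_fun measurableSet_Ioi
      intro t ht
      have ht0 : (t:ℂ) ≠ 0 := by simp at ht; exact_mod_cast (by linarith : (0:ℝ) < t).ne'
      simp only [sumErr, indicator_of_mem ht]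
      rw [← hc, show -s = -(s+1) + 1 by ring, cpow_add _ _ ht0, cpow_one]
      ring
    rw [hsplit]
    field_simp
  · simp only [Real.rpow_one]
    apply Asymptotics.IsBigO.of_bound B
    filter_upwards with n
    calc _ ≤ ∑ k ∈ Finset.Icc 1 n, B := norm_sum_le_of_le _ (fun j _ => hB _)
      _ = B * ‖(n:ℝ)‖ := by simp [mul_comm]

/-- The entire function extending `(s - 1) * L(Φ, s)`. -/
def polL {N : ℕ} [NeZero N] (Φ : ZMod N → ℂ) : ℂ → ℂ :=
  Function.update (fun s => (s - 1) * ZMod.LFunction Φ s) 1 ((∑ j, Φ j) / N)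

theorem polL_of_ne {N : ℕ} [NeZero N] (Φ : ZMod N → ℂ) {s : ℂ} (hs : s ≠ 1) :
    polL Φ s = (s - 1) * ZMod.LFunction Φ s := by
  rw [polL, Function.update_of_ne hs]

theorem differentiable_polL {N : ℕ} [NeZero N] (Φ : ZMod N → ℂ) : Differentiable ℂ (polL Φ) := by
  have hne : ∀ s : ℂ, s ≠ 1 → DifferentiableAt ℂ (polL Φ) s := by
    intro s hs
    have h : DifferentiableAt ℂ (fun s => (s - 1) * ZMod.LFunction Φ s) s :=
      (by fun_prop : DifferentiableAt ℂ (fun s : ℂ => s - 1) s).mul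
        (ZMod.differentiableAt_LFunction Φ s (Or.inl hs))
    apply h.congr_of_eventuallyEq
    filter_upwards [isOpen_ne.mem_nhds hs] with z hz
    exact polL_of_ne Φ hz
  intro s
  rcases eq_or_ne s 1 with rfl | hs
  · apply AnalyticAt.differentiableAt
    apply analyticAt_of_differentiable_on_punctured_nhds_of_continuousAt
    · filter_upwards [self_mem_nhdsWithin] with z hz using hne z hz
    · rw [polL, continuousAt_update_same]
      have := ZMod.LFunction_residue_one Φ
      convert this using 2
      rw [Finset.sum_div]
  · exact hne s hs

theorem polL_eq_mellin (N : ℕ) [NeZero N] (Φ : ZMod N → ℂ) {s : ℂ} (hs : 0 < s.re) :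
    polL Φ s = s * ((∑ j, Φ j) / N) + s * (s - 1) * mellin (sumErr N Φ) (-s) := by
  have hU : IsPreconnected {s : ℂ | 0 < s.re} := (convex_halfSpace_re_gt 0).isPreconnected
  have hUo : IsOpen {s : ℂ | 0 < s.re} := isOpen_lt continuous_const continuous_re
  have h1 : AnalyticOnNhd ℂ (polL Φ) {s : ℂ | 0 < s.re} :=
    (differentiable_polL Φ).differentiableOn.analyticOnNhd hUo
  have h2 : AnalyticOnNhd ℂ (fun s : ℂ => s * ((∑ j, Φ j) / N) +
      s * (s - 1) * mellin (sumErr N Φ) (-s)) {s : ℂ | 0 < s.re} := by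
    apply DifferentiableOn.analyticOnNhd _ hUo
    intro s hs
    have h3 : DifferentiableAt ℂ (fun s => mellin (sumErr N Φ) (-s)) s :=
      (differentiableAt_mellin_sumErr N Φ (s := -s) (by simpa using hs)).comp s
        (by fun_prop : DifferentiableAt ℂ (fun s : ℂ => -s) s)
    apply DifferentiableAt.differentiableWithinAt
    fun_prop
  refine h1.eqOn_of_preconnected_of_eventuallyEq h2 hU (z₀ := 2) (by simp) ?_ hs
  have : {s : ℂ | 1 < s.re} ∈ 𝓝 (2:ℂ) := (isOpen_lt continuous_const continuous_re).mem_nhds (by simp)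
  filter_upwards [this] with s hs
  rw [polL_of_ne Φ (by rintro rfl; simp at hs), LFunction_eq_mellin_of_one_lt N Φ hs]

theorem norm_polL_le {N : ℕ} [NeZero N] (Φ : ZMod N → ℂ) {B : ℝ} (hΦ : ∀ j, ‖Φ j‖ ≤ B)
    {s : ℂ} (hs : 1 / 2 ≤ s.re) :
    ‖polL Φ s‖ ≤ 8 * N * B * (1 + ‖s‖) ^ 2 := by
  have hB : 0 ≤ B := (norm_nonneg _).trans (hΦ 0)
  have hN' : (1 : ℝ) ≤ N := by exact_mod_cast NeZero.one_le
  have hN : (0 : ℝ) < N := by linarith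
  have hcB : ‖(∑ j, Φ j) / N‖ ≤ B := by
    rw [norm_div, Complex.norm_natCast, div_le_iff₀ hN]
    calc ‖∑ j, Φ j‖ ≤ ∑ j : ZMod N, B := norm_sum_le_of_le _ (fun j _ => hΦ j)
      _ = B * N := by simp [ZMod.card, mul_comm]
  rw [polL_eq_mellin N Φ (by linarith)]
  have hs0 := norm_nonneg s
  have h1 : ‖s - 1‖ ≤ ‖s‖ + 1 := by simpa using norm_sub_le s 1
  have h2 := norm_mellin_sumErr_le N Φ hΦ (s := s) (by linarith)
  have h3 : 4 * N * B / s.re ≤ 8 * N * B := by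
    rw [div_le_iff₀ (by linarith)]
    have : 0 ≤ N * B := by positivity
    nlinarith
  have h4 : 0 ≤ N * B := by positivity
  have h5 : B ≤ N * B := by nlinarith
  calc _ ≤ ‖s‖ * B + ‖s‖ * (‖s‖ + 1) * (8 * N * B) := by
        refine (norm_add_le _ _).trans (add_le_add ?_ ?_)
        · rw [norm_mul]; gcongr
        · rw [norm_mul, norm_mul]; gcongr; exact h2.trans h3
    _ ≤ ‖s‖ * (N * B) + ‖s‖ * (‖s‖ + 1) * (8 * N * B) := by gcongr
    _ ≤ _ := by nlinarith [mul_nonneg h4 hs0]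

theorem norm_LFunction_le_of_sum_eq_zero {N : ℕ} [NeZero N] (Φ : ZMod N → ℂ) {B : ℝ}
    (hΦ : ∀ j, ‖Φ j‖ ≤ B) (h0 : ∑ j, Φ j = 0) {s : ℂ} (hs : 1 / 2 ≤ s.re) :
    ‖ZMod.LFunction Φ s‖ ≤ 8 * N * B * ‖s‖ := by
  have hB : 0 ≤ B := (norm_nonneg _).trans (hΦ 0)
  have key : ∀ s : ℂ, 1 / 2 ≤ s.re → s ≠ 1 → ‖ZMod.LFunction Φ s‖ ≤ 8 * N * B * ‖s‖ := by
    intro s hs hs1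
    have h1 := polL_eq_mellin N Φ (s := s) (by linarith)
    rw [polL_of_ne Φ hs1, h0, zero_div, mul_zero, zero_add, mul_comm s, mul_assoc] at h1
    rw [mul_left_cancel₀ (sub_ne_zero.mpr hs1) h1, norm_mul, mul_comm]
    gcongr
    refine (norm_mellin_sumErr_le N Φ hΦ (s := s) (by linarith)).trans ?_
    rw [div_le_iff₀ (by linarith)]
    have : 0 ≤ N * B := by positivity
    nlinarith
  rcases eq_or_ne s 1 with rfl | hs1
  · have hcont : Continuous (ZMod.LFunction Φ) := (ZMod.differentiable_LFunction_of_sum_zero h0).continuous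
    have hseq : Tendsto (fun x : ℝ => ((1 + x : ℝ) : ℂ)) (𝓝[>] 0) (𝓝 1) := by
      have : Tendsto (fun x : ℝ => ((1 + x : ℝ) : ℂ)) (𝓝 0) (𝓝 ((1 + 0 : ℝ) : ℂ)) :=
        (by fun_prop : Continuous fun x : ℝ => ((1 + x : ℝ) : ℂ)).tendsto 0
      simp only [add_zero, ofReal_one] at this
      exact this.mono_left nhdsWithin_le_nhds
    refine le_of_tendsto_of_tendsto (((hcont.norm.tendsto 1)).comp hseq)
      (((continuous_const.mul continuous_norm).tendsto (1:ℂ)).comp hseq) ?_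
    filter_upwards [self_mem_nhdsWithin] with x hx
    simp only [mem_Ioi] at hx
    apply key
    · simp; linarith
    · intro h; have := congrArg re h; simp at this; linarith
  · exact key s hs hs1

theorem norm_dft_le {N : ℕ} [NeZero N] (Φ : ZMod N → ℂ) {B : ℝ} (hΦ : ∀ j, ‖Φ j‖ ≤ B) (k : ZMod N) :
    ‖(ZMod.dft Φ) k‖ ≤ N * B := by
  rw [ZMod.dft_apply]
  calc _ ≤ ∑ j : ZMod N, B := by
        apply norm_sum_le_of_le
        intro j _
        rw [norm_smul]
        have : ‖ZMod.stdAddChar (-(j * k))‖ = 1 := by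
          exact AddChar.norm_apply _ _
        rw [this, one_mul]; exact hΦ j
    _ = _ := by simp [ZMod.card]

theorem sum_dft {N : ℕ} [NeZero N] (Φ : ZMod N → ℂ) : ∑ k, (ZMod.dft Φ) k = N * Φ 0 := by
  have := congrFun (ZMod.dft_dft Φ) 0
  rw [ZMod.dft_apply] at this
  simpa using this

theorem norm_LFunction_le_of_apply_zero {N : ℕ} [NeZero N] (Φ : ZMod N → ℂ)
    (hΦ : ∀ j, ‖Φ j‖ ≤ 1) (h0 : Φ 0 = 0) {s : ℂ} (hs : -1 ≤ s.re) (hs' : s.re ≤ 1 / 2) :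
    ‖ZMod.LFunction Φ s‖ ≤ 10000 * N ^ 3 * (1 + |s.im|) ^ 3 := by
  have hN' : (1 : ℝ) ≤ N := by exact_mod_cast NeZero.one_le
  have hN : (0 : ℝ) < N := by linarith
  have hT := abs_nonneg s.im
  have hre : (1 - s).re = 1 - s.re := by simp
  have him : (1 - s).im = -s.im := by simp
  have hG := norm_Gamma_le (s := 1 - s) (by rw [hre]; linarith)
  have hpos : 0 < Real.exp (Real.pi / 2 * |s.im|) := Real.exp_pos _
  have hGam : Real.Gamma (1 - s.re) ≤ 2 := by
    have hc := Real.convexOn_Gamma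
    have h12 : Real.Gamma (1/2) ≤ 2 := by
      rw [Real.Gamma_one_half_eq, Real.sqrt_le_left (by norm_num)]; linarith [Real.pi_lt_four]
    have := hc.le_max_of_mem_Icc (x := 1/2) (y := 2) (z := 1 - s.re) (by simp) (by simp)
      ⟨by linarith, by linarith⟩
    refine this.trans (max_le h12 ?_)
    rw [Real.Gamma_two]; norm_num
  rw [him, hre, abs_neg] at hG
  have hpw : (2 * (1 + |s.im|)) ^ (1 - s.re) ≤ (2 * (1 + |s.im|)) ^ (2:ℝ) :=
    Real.rpow_le_rpow_of_exponent_le (by linarith) (by linarith)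
  have hG2 : ‖Gamma (1 - s)‖ * Real.exp (Real.pi / 2 * |s.im|) ≤ 24 * (1 + |s.im|)^2 := by
    refine hG.trans ?_
    have he : Real.exp 1 ≤ 3 := by linarith [Real.exp_one_lt_d9]
    have hG0 : 0 ≤ Real.Gamma (1 - s.re) := (Real.Gamma_pos_of_pos (by linarith)).le
    calc _ ≤ 3 * ((2 * (1 + |s.im|)) ^ (2:ℝ) * 2) := by gcongr
      _ = _ := by norm_cast; ring
  have hFE := ZMod.LFunction_one_sub Φ (s := 1 - s) (by
    intro n h; have := congrArg re h; simp at this; have : (0:ℝ) ≤ n := by positivity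
    linarith) (Or.inl h0)
  rw [sub_sub_cancel] at hFE
  rw [hFE]
  have hn : ‖s‖ ≤ 1 + |s.im| := by
    refine (norm_le_abs_re_add_abs_im s).trans ?_
    gcongr; rw [abs_le]; constructor <;> linarith
  have hn1 : ‖1 - s‖ ≤ 2 * (1 + |s.im|) := by
    refine (norm_sub_le _ _).trans ?_
    simp; linarith
  have hL : ∀ Ψ : ZMod N → ℂ, (∀ j, ‖Ψ j‖ ≤ 1) → Ψ 0 = 0 →
      ‖ZMod.LFunction (ZMod.dft Ψ) (1 - s)‖ ≤ 16 * N ^ 2 * (1 + |s.im|) := by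
    intro Ψ hΨ hΨ0
    refine (norm_LFunction_le_of_sum_eq_zero (ZMod.dft Ψ) (B := N * 1) (norm_dft_le Ψ hΨ)
      (by rw [sum_dft, hΨ0, mul_zero]) (by rw [hre]; linarith)).trans ?_
    calc 8 * N * (N * 1) * ‖1 - s‖ ≤ 8 * N * (N * 1) * (2 * (1 + |s.im|)) := by gcongr
      _ = _ := by ring
  have hL1 := hL Φ hΦ h0
  have hL2 := hL (fun x => Φ (-x)) (fun j => hΦ _) (by simpa using h0)
  have hE1 : ‖cexp (Real.pi * I * (1 - s) / 2)‖ ≤ Real.exp (Real.pi / 2 * |s.im|) := by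
    rw [norm_exp]
    apply Real.exp_le_exp.mpr
    have : (Real.pi * I * (1 - s) / 2).re = Real.pi / 2 * s.im := by simp; ring
    rw [this]
    exact mul_le_mul_of_nonneg_left (le_abs_self _) (by positivity)
  have hE2 : ‖cexp (-Real.pi * I * (1 - s) / 2)‖ ≤ Real.exp (Real.pi / 2 * |s.im|) := by
    rw [norm_exp]
    apply Real.exp_le_exp.mpr
    have : (-Real.pi * I * (1 - s) / 2).re = Real.pi / 2 * (-s.im) := by simp; ring
    rw [this]
    exact mul_le_mul_of_nonneg_left (neg_le_abs _) (by positivity)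
  have hN1 : ‖(N:ℂ) ^ (1 - s - 1)‖ ≤ N := by
    rw [norm_natCast_cpow_of_pos (NeZero.pos N)]
    calc (N:ℝ) ^ (1 - s - 1).re ≤ (N:ℝ)^(1:ℝ) := Real.rpow_le_rpow_of_exponent_le hN' (by simp; linarith)
      _ = N := Real.rpow_one _
  have hP : ‖(2 * Real.pi : ℂ) ^ (-(1 - s))‖ ≤ 1 := by
    have : (2 * Real.pi : ℂ) = ((2 * Real.pi : ℝ) : ℂ) := by push_cast; rfl
    rw [this, norm_cpow_eq_rpow_re_of_pos (by positivity)]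
    apply Real.rpow_le_one_of_one_le_of_nonpos
    · linarith [Real.pi_gt_three]
    · simp; linarith
  set E := Real.exp (Real.pi / 2 * |s.im|)
  calc _ ≤ N * 1 * ‖Gamma (1 - s)‖ * (E * (16 * N ^ 2 * (1 + |s.im|)) + E * (16 * N ^ 2 * (1 + |s.im|))) := by
        rw [norm_mul, norm_mul, norm_mul]
        gcongr
        refine (norm_add_le _ _).trans (add_le_add ?_ ?_)
        · rw [norm_mul]; gcongr
        · rw [norm_mul]; gcongr
    _ = (‖Gamma (1 - s)‖ * E) * (32 * N ^ 3 * (1 + |s.im|)) := by ring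
    _ ≤ (24 * (1 + |s.im|)^2) * (32 * N ^ 3 * (1 + |s.im|)) := by gcongr
    _ ≤ _ := by
        have : 0 ≤ (N:ℝ)^3 * (1 + |s.im|)^3 := by positivity
        nlinarith

theorem tsum_int_eq_sum_residues (N : ℕ) [NeZero N] (f : ℤ → ℂ) (hf : Summable f) :
    ∑' n, f n = ∑ r ∈ Finset.range N, ∑' n : ℤ, f (r + N * n) := by
  rw [← (Int.divModEquiv N).symm.tsum_eq f]
  have hs : Summable (fun x : ℤ × Fin N => f ((Int.divModEquiv N).symm x)) :=
    (Int.divModEquiv N).symm.summable_iff.mpr hf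
  have hs' := (Equiv.prodComm _ _).summable_iff.mpr hs
  rw [← (Equiv.prodComm (Fin N) ℤ).tsum_eq, Summable.tsum_prod (by exact hs'), tsum_fintype,
    ← Fin.sum_univ_eq_sum_range (fun r => ∑' n : ℤ, f (r + N * n))]
  apply Finset.sum_congr rfl
  intro r _
  apply tsum_congr
  intro n
  simp [Int.divModEquiv]
  ring_nf

theorem summable_exp_neg_mul_int_sq {x : ℝ} (hx : 0 < x) :
    Summable (fun n : ℤ => Real.exp (-Real.pi * x * n ^ 2)) := by
  have := summable_pow_mul_jacobiTheta₂_term_bound 0 hx 0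
  refine this.congr fun n => ?_
  simp
  ring

theorem norm_cexp_neg_quadratic (a : ℂ) (n : ℤ) :
    ‖cexp (-Real.pi * a * n ^ 2)‖ = Real.exp (-Real.pi * a.re * n ^ 2) := by
  rw [norm_exp]
  congr 1
  have : (-Real.pi * a * n ^ 2 : ℂ) = ((-Real.pi * n ^ 2 : ℝ) : ℂ) * a := by push_cast; ring
  rw [this, re_ofReal_mul]; ring

theorem summable_mul_cexp_neg_quadratic {a : ℂ} (ha : 0 < a.re) {c : ℤ → ℂ} {D : ℝ}
    (hc : ∀ n, ‖c n‖ ≤ D) :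
    Summable (fun n : ℤ => c n * cexp (-Real.pi * a * n ^ 2)) := by
  refine Summable.of_norm_bounded ((summable_exp_neg_mul_int_sq ha).mul_left D) fun n => ?_
  rw [norm_mul, norm_cexp_neg_quadratic]
  gcongr
  exact hc n

theorem exists_norm_le_zmod {N : ℕ} [NeZero N] (c : ZMod N → ℂ) : ∃ D, ∀ j, ‖c j‖ ≤ D := by
  obtain ⟨B, hB⟩ := (Set.finite_range (fun j => ‖c j‖)).bddAbove
  exact ⟨B, fun j => hB ⟨j, rfl⟩⟩

theorem re_inv_pos {a : ℂ} (ha : 0 < a.re) : 0 < (1 / a).re := by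
  rw [one_div, inv_re]
  exact div_pos ha (normSq_pos.mpr (by rintro rfl; simp at ha))

/-- Poisson summation for a Gaussian with periodic coefficients. -/
theorem tsum_periodic_gaussian {N : ℕ} [NeZero N] (c : ZMod N → ℂ) {a : ℂ} (ha : 0 < a.re) :
    ∑' n : ℤ, c n * cexp (-Real.pi * a * n ^ 2) =
      1 / (a * N ^ 2) ^ (1 / 2 : ℂ) *
        ∑' n : ℤ, ZMod.dft c (-n) * cexp (-Real.pi * (1 / (a * N ^ 2)) * n ^ 2) := by
  obtain ⟨D, hD⟩ := exists_norm_le_zmod c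
  have hN : (N : ℂ) ≠ 0 := by exact_mod_cast NeZero.ne N
  have ha0 : a ≠ 0 := by rintro rfl; simp at ha
  have haN : 0 < (a * N ^ 2).re := by
    have : (a * N ^ 2 : ℂ) = ((N ^ 2 : ℝ) : ℂ) * a := by push_cast; ring
    rw [this, re_ofReal_mul]
    have : (0:ℝ) < N := by exact_mod_cast NeZero.pos N
    positivity
  rw [tsum_int_eq_sum_residues N _ (summable_mul_cexp_neg_quadratic ha (fun n => hD _))]
  have hinner : ∀ r : ℕ, ∑' n : ℤ, c ((r + N * n : ℤ) : ZMod N) * cexp (-Real.pi * a * ((r + N * n : ℤ) : ℂ) ^ 2)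
      = 1 / (a * N ^ 2) ^ (1 / 2 : ℂ) * ∑' n : ℤ, c r * ZMod.stdAddChar ((r : ZMod N) * (n : ZMod N)) *
        cexp (-Real.pi * (1 / (a * N ^ 2)) * n ^ 2) := by
    intro r
    have h := Complex.tsum_exp_neg_quadratic haN (-(a * N * r))
    have e1 : ∀ n : ℤ, c ((r + N * n : ℤ) : ZMod N) * cexp (-Real.pi * a * ((r + N * n : ℤ) : ℂ) ^ 2) =
        (c r * cexp (-Real.pi * a * r ^ 2)) *
          cexp (-Real.pi * (a * N ^ 2) * n ^ 2 + 2 * Real.pi * (-(a * N * r)) * n) := by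
      intro n
      rw [mul_assoc (c (r : ZMod N)), ← Complex.exp_add]
      congr 2
      · simp
      · push_cast; ring
    rw [tsum_congr e1, tsum_mul_left, h, mul_left_comm, ← tsum_mul_left]
    congr 1
    apply tsum_congr
    intro n
    have e2 : ZMod.stdAddChar ((r : ZMod N) * (n : ZMod N)) = cexp (2 * Real.pi * I * (r * n) / N) := by
      have := ZMod.stdAddChar_coe (N := N) (r * n : ℤ)
      push_cast at this
      exact this
    rw [e2, mul_assoc (c (r : ZMod N)), mul_assoc (c (r : ZMod N)), ← Complex.exp_add, ← Complex.exp_add]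
    congr 2
    field_simp
    ring_nf
    simp only [I_sq]
    ring
  rw [Finset.sum_congr rfl fun r _ => hinner r, ← Finset.mul_sum]
  congr 1
  have hsum : ∀ r ∈ Finset.range N, Summable (fun n : ℤ => c r * ZMod.stdAddChar ((r : ZMod N) * (n : ZMod N)) *
        cexp (-Real.pi * (1 / (a * N ^ 2)) * n ^ 2)) := by
    intro r _
    apply summable_mul_cexp_neg_quadratic (re_inv_pos haN) (D := D)
    intro n
    rw [norm_mul, AddChar.norm_apply, mul_one]
    exact hD _
  rw [← Summable.tsum_finsetSum hsum]
  apply tsum_congr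
  intro n
  rw [← Finset.sum_mul, ZMod.dft_apply]
  congr 1
  rw [sum_range_zmod N (fun r => c r * ZMod.stdAddChar (r * (n : ZMod N)))]
  apply Finset.sum_congr rfl
  intro j _
  simp [mul_comm]

/-- The constant `∑ e^{-πn²}`. -/
def gaussTheta : ℝ := ∑' n : ℤ, Real.exp (-Real.pi * 1 * n ^ 2)

theorem norm_tsum_gaussian_sub_le {c : ℤ → ℂ} {D : ℝ} (hc : ∀ n, ‖c n‖ ≤ D) {b : ℂ} (hb : 1 ≤ b.re) :
    ‖∑' n : ℤ, c n * cexp (-Real.pi * b * n ^ 2) - c 0‖ ≤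
      D * gaussTheta * Real.exp (-Real.pi * (b.re - 1)) := by
  have hD : 0 ≤ D := (norm_nonneg _).trans (hc 0)
  have hs := summable_mul_cexp_neg_quadratic (a := b) (by linarith) hc
  have hsn := hs.norm
  have h1 := hs.tsum_eq_add_tsum_ite 0
  have hpi := Real.pi_pos
  rw [h1]
  simp only [Int.cast_zero, ne_eq, OfNat.ofNat_ne_zero, not_false_eq_true, zero_pow, mul_zero,
    Complex.exp_zero, mul_one, add_sub_cancel_left]
  have hst := ((summable_exp_neg_mul_int_sq one_pos).mul_left (D * Real.exp (-Real.pi * (b.re - 1))))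
  have : D * gaussTheta * Real.exp (-Real.pi * (b.re - 1)) =
      ∑' n : ℤ, D * Real.exp (-Real.pi * (b.re - 1)) * Real.exp (-Real.pi * 1 * n ^ 2) := by
    rw [tsum_mul_left, gaussTheta]; ring
  rw [this]
  refine tsum_of_norm_bounded hst.hasSum fun n => ?_
  split_ifs with h
  · simp; positivity
  · have h1 : (1:ℝ) ≤ n ^ 2 := by
      have : (1:ℤ) ≤ n^2 := by have := sq_pos_of_ne_zero (a := n) h; omega
      exact_mod_cast this
    calc ‖c n * cexp (-Real.pi * b * n ^ 2)‖ = ‖c n‖ * Real.exp (-Real.pi * b.re * n ^ 2) := by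
          rw [norm_mul, norm_cexp_neg_quadratic]
      _ ≤ D * Real.exp (-Real.pi * (b.re - 1) + -Real.pi * 1 * n ^ 2) := by
          gcongr
          · exact hc n
          · nlinarith [mul_nonneg (sub_nonneg.mpr hb) (sub_nonneg.mpr h1)]
      _ = _ := by rw [Real.exp_add]; ring

theorem tendsto_tsum_gaussian {c : ℤ → ℂ} {D : ℝ} (hc : ∀ n, ‖c n‖ ≤ D) {ι : Type*} {l : Filter ι}
    {b : ι → ℂ} (hb : Tendsto (fun i => (b i).re) l atTop) :
    Tendsto (fun i => ∑' n : ℤ, c n * cexp (-Real.pi * b i * n ^ 2)) l (𝓝 (c 0)) := by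
  rw [tendsto_iff_norm_sub_tendsto_zero]
  have h0 : Tendsto (fun i => D * gaussTheta * Real.exp (-Real.pi * ((b i).re - 1))) l (𝓝 0) := by
    have : Tendsto (fun i => Real.exp (-Real.pi * ((b i).re - 1))) l (𝓝 0) := by
      apply Real.tendsto_exp_atBot.comp
      have h1 : Tendsto (fun i => (b i).re - 1) l atTop := tendsto_atTop_add_const_right _ _ hb
      exact h1.const_mul_atTop_of_neg (neg_lt_zero.mpr Real.pi_pos)
    simpa using this.const_mul (D * gaussTheta)
  refine squeeze_zero' (Eventually.of_forall fun i => norm_nonneg _) ?_ h0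
  filter_upwards [hb.eventually_ge_atTop 1] with i hi
  exact norm_tsum_gaussian_sub_le hc hi

theorem ofReal_mul_cpow_of_pos {x : ℝ} (hx : 0 < x) {z : ℂ} (hz : z ≠ 0) (s : ℂ) :
    ((x : ℂ) * z) ^ s = (x : ℂ) ^ s * z ^ s := by
  have hx' : (x : ℂ) ≠ 0 := by exact_mod_cast hx.ne'
  rw [cpow_def_of_ne_zero (mul_ne_zero hx' hz), cpow_def_of_ne_zero hx', cpow_def_of_ne_zero hz,
    Complex.log_ofReal_mul hx hz, ← Complex.exp_add, ← Complex.ofReal_log hx.le]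
  congr 1; ring

/-- The sign factor of the quadratic Gauss sum of odd modulus `N`. -/
def epsN (N : ℕ) : ℂ := if N % 4 = 1 then 1 else I

theorem sum_stdAddChar_sq {N : ℕ} [NeZero N] (hN : Odd N) :
    ∑ n : ZMod N, ZMod.stdAddChar (n ^ 2) = epsN N * (Real.sqrt N : ℂ) := by
  have hN0 : (0:ℝ) < N := by exact_mod_cast NeZero.pos N
  have hNc : (N:ℂ) ≠ 0 := by exact_mod_cast NeZero.ne N
  set S := ∑ n : ZMod N, ZMod.stdAddChar (n ^ 2) with hS
  set c : ZMod N → ℂ := fun n => ZMod.stdAddChar (n ^ 2) with hc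
  set c2 : ZMod 2 → ℂ := fun n => if n = 0 then 1 else (-I) ^ N with hc2
  set T := ∑ n : ZMod 2, c2 n with hT
  have hTv : T = 1 + (-I) ^ N := by
    rw [hT, hc2, show (Finset.univ : Finset (ZMod 2)) = {0, 1} by rfl]
    rw [Finset.sum_pair (by decide)]; simp
  -- the parameters
  set a : ℝ → ℂ := fun ε => ε - 2 * I / N with ha
  set κ : ℝ → ℂ := fun ε => 4 * (1 - I * N * ε / 2) / (N ^ 2 * ε ^ 2 + 4) with hκ
  set d : ℝ → ℂ := fun ε => ε * N ^ 2 * κ ε / 4 with hd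
  have hare : ∀ ε, (a ε).re = ε := by intro ε; simp [ha, div_natCast_re]
  have hκpos : ∀ ε, 0 < (κ ε).re := by
    intro ε
    have : κ ε = ((4 / (N ^ 2 * ε ^ 2 + 4) : ℝ) : ℂ) * (1 - I * N * ε / 2) := by
      simp only [hκ]; push_cast; ring
    rw [this, re_ofReal_mul]
    have : (1 - I * N * ε / 2).re = 1 := by
      simp
    rw [this]; positivity
  have hκ0 : ∀ ε, κ ε ≠ 0 := fun ε h => by have := hκpos ε; rw [h] at this; simp at this
  have hdre : ∀ ε, 0 < ε → 0 < (d ε).re := by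
    intro ε hε
    have : d ε = ((ε * N ^ 2 / 4 : ℝ) : ℂ) * κ ε := by simp only [hd]; push_cast; ring
    rw [this, re_ofReal_mul]
    have := hκpos ε
    positivity
  have hinv : ∀ ε, 0 < ε → 1 / a ε = d ε + I * N / 2 := by
    intro ε hε
    have h1 : a ε ≠ 0 := by intro h; have := hare ε; rw [h] at this; simp at this; linarith
    have h2 : ((N:ℂ) ^ 2 * ε ^ 2 + 4) ≠ 0 := by
      have : (0:ℝ) < N ^ 2 * ε ^ 2 + 4 := by positivity
      exact_mod_cast this.ne'
    have hd' : d ε = ε * N ^ 2 * (1 - I * N * ε / 2) / ((N:ℂ) ^ 2 * ε ^ 2 + 4) := by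
      simp only [hd, hκ]; ring
    rw [div_eq_iff h1, hd', div_add' _ _ _ h2, div_mul_eq_mul_div, eq_div_iff h2]
    simp only [ha]
    field_simp
    ring_nf
    simp only [I_sq]
    ring
  obtain ⟨D, hD⟩ := exists_norm_le_zmod (ZMod.dft c)
  obtain ⟨D2, hD2⟩ := exists_norm_le_zmod (ZMod.dft c2)
  have key : ∀ ε : ℝ, 0 < ε →
      κ ε ^ (1 / 2 : ℂ) * a ε ^ (1 / 2 : ℂ) *
        (∑' n : ℤ, ZMod.dft c (-n) * cexp (-Real.pi * (1 / (ε * N ^ 2)) * n ^ 2)) =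
      ∑' n : ℤ, ZMod.dft c2 (-n) * cexp (-Real.pi * (1 / (d ε * (2:ℕ) ^ 2)) * n ^ 2) := by
    intro ε hε
    have h1 := tsum_periodic_gaussian c (a := (ε:ℂ)) (by simpa using hε)
    have h2 := tsum_periodic_gaussian c2 (hdre ε hε)
    have h3 := Complex.tsum_exp_neg_mul_int_sq (a := a ε) (by rw [hare]; exact hε)
    have e1 : ∀ n : ℤ, c n * cexp (-Real.pi * ε * n ^ 2) = cexp (-Real.pi * a ε * n ^ 2) := by
      intro n
      have : c n = cexp (2 * Real.pi * I * n ^ 2 / N) := by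
        have := ZMod.stdAddChar_coe (N := N) (n ^ 2)
        push_cast at this
        exact this
      rw [this, ← Complex.exp_add]
      congr 1
      simp only [ha]; ring
    have e2 : ∀ n : ℤ, c2 n * cexp (-Real.pi * d ε * n ^ 2) = cexp (-Real.pi / a ε * n ^ 2) := by
      intro n
      have h4 : -Real.pi / a ε * n ^ 2 = -Real.pi * d ε * n ^ 2 + (-Real.pi * I / 2 * N) * n ^ 2 := by
        rw [show -Real.pi / a ε = -Real.pi * (1 / a ε) by ring, hinv ε hε]; ring
      rw [h4, Complex.exp_add, mul_comm]
      congr 1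
      have hI : cexp (-Real.pi * I / 2 * N) = (-I) ^ N := by
        rw [mul_comm, Complex.exp_nat_mul]
        congr 1
        rw [show (-Real.pi * I / 2 : ℂ) = -(Real.pi / 2 * I) by ring, Complex.exp_neg, exp_pi_div_two_mul_I, inv_I]
      have hI4 : ∀ m : ℕ, ((-I) ^ N) ^ (4 * m) = 1 := by
        intro m
        rw [← pow_mul, show N * (4 * m) = 4 * (N * m) by ring, pow_mul, neg_pow, I_pow_four]
        norm_num
      have hnat : (n:ℂ) ^ 2 = ((n.natAbs ^ 2 : ℕ) : ℂ) := by
        have : (n ^ 2 : ℤ) = ((n.natAbs ^ 2 : ℕ) : ℤ) := by push_cast; exact (sq_abs n).symm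
        rw [← Int.cast_pow, this, Int.cast_natCast]
      rw [hnat, mul_comm, Complex.exp_nat_mul, hI]
      simp only [hc2]
      rcases Int.even_or_odd n with h | h
      · rw [if_pos ((ZMod.intCast_eq_zero_iff_even).mpr h)]
        obtain ⟨m, hm⟩ := Int.natAbs_even.mpr h
        rw [hm, show (m + m) ^ 2 = 4 * m ^ 2 by ring, hI4]
      · rw [if_neg (by rw [ZMod.intCast_eq_zero_iff_even]; exact Int.not_even_iff_odd.mpr h)]
        obtain ⟨m, hm⟩ := Int.natAbs_odd.mpr h
        rw [hm, show (2 * m + 1) ^ 2 = 4 * (m ^ 2 + m) + 1 by ring, pow_succ, hI4, one_mul]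
    rw [tsum_congr e1] at h1
    rw [tsum_congr e2] at h2
    rw [h3, h2] at h1
    have hx : (0:ℝ) < ε * N ^ 2 := by positivity
    have h5 : (d ε * (2:ℕ) ^ 2) = ((ε * N ^ 2 : ℝ) : ℂ) * κ ε := by
      simp only [hd]; push_cast; ring
    rw [h5, ofReal_mul_cpow_of_pos hx (hκ0 ε)] at h1
    have h6 : ((ε:ℂ) * N ^ 2) = ((ε * N ^ 2 : ℝ) : ℂ) := by push_cast; rfl
    rw [h5, h6]
    rw [h6] at h1
    have hx2 : ((ε * N ^ 2 : ℝ) : ℂ) ^ (1 / 2 : ℂ) ≠ 0 := by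
      rw [cpow_ne_zero_iff_of_exponent_ne_zero (by norm_num)]
      exact_mod_cast hx.ne'
    have hκ2 : κ ε ^ (1 / 2 : ℂ) ≠ 0 := by
      rw [cpow_ne_zero_iff_of_exponent_ne_zero (by norm_num)]; exact hκ0 ε
    have ha2 : a ε ^ (1 / 2 : ℂ) ≠ 0 := by
      rw [cpow_ne_zero_iff_of_exponent_ne_zero (by norm_num)]
      intro h; have := hare ε; rw [h] at this; simp at this; linarith
    generalize (∑' n : ℤ, ZMod.dft c (-n) * cexp (-Real.pi * (1 / ((ε * N ^ 2 : ℝ) : ℂ)) * n ^ 2)) = A at h1 ⊢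
    generalize (∑' n : ℤ, ZMod.dft c2 (-n) * cexp (-Real.pi * (1 / (((ε * N ^ 2 : ℝ) : ℂ) * κ ε)) * n ^ 2)) = B at h1 ⊢
    field_simp at h1
    rw [mul_comm (κ ε ^ (1 / 2 : ℂ))]
    linear_combination -h1
  -- limits
  have hcont_a : Tendsto a (𝓝[>] 0) (𝓝 (-(2 * I / N))) := by
    have : Continuous a := by simp only [ha]; fun_prop
    have h := this.tendsto 0
    simp only [ha, ofReal_zero, zero_sub] at h
    exact h.mono_left nhdsWithin_le_nhds
  have hcont_κ : Tendsto κ (𝓝[>] 0) (𝓝 1) := by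
    have : Continuous κ := by
      simp only [hκ]
      apply Continuous.div (by fun_prop) (by fun_prop)
      intro x
      have : (0:ℝ) < N ^ 2 * x ^ 2 + 4 := by positivity
      exact_mod_cast this.ne'
    have h := this.tendsto 0
    have h1 : κ 0 = 1 := by simp [hκ]
    rw [h1] at h
    exact h.mono_left nhdsWithin_le_nhds
  have hsq : (-(2 * I / N)) ^ (1 / 2 : ℂ) = (1 - I) / (Real.sqrt N : ℂ) := by
    have hsN : (Real.sqrt N : ℂ) ^ 2 = N := by
      rw [← ofReal_pow, Real.sq_sqrt hN0.le]; simp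
    have : -(2 * I / N) = ((1 - I) / (Real.sqrt N : ℂ)) ^ 2 := by
      rw [div_pow, hsN, sub_sq, I_sq]; ring
    rw [this, one_div, sq_cpow_two_inv]
    rw [div_ofReal_re]; simp
    exact NeZero.pos N
  have hslit : -(2 * I / N) ∈ slitPlane := by
    right
    have : -(2 * I / N) = ((-(2 / N) : ℝ) : ℂ) * I := by push_cast; ring
    rw [this, im_ofReal_mul]; simp
    exact NeZero.ne N
  have hl1 : Tendsto (fun ε => κ ε ^ (1 / 2 : ℂ) * a ε ^ (1 / 2 : ℂ)) (𝓝[>] 0)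
      (𝓝 ((1 - I) / (Real.sqrt N : ℂ))) := by
    have h1 : Tendsto (fun ε => κ ε ^ (1 / 2 : ℂ)) (𝓝[>] 0) (𝓝 ((1:ℂ) ^ (1 / 2 : ℂ))) :=
      hcont_κ.cpow tendsto_const_nhds (by simp)
    have h2 : Tendsto (fun ε => a ε ^ (1 / 2 : ℂ)) (𝓝[>] 0) (𝓝 ((-(2 * I / N)) ^ (1 / 2 : ℂ))) :=
      hcont_a.cpow tendsto_const_nhds hslit
    rw [hsq] at h2
    simpa using h1.mul h2
  have hl2 : Tendsto (fun ε : ℝ => ∑' n : ℤ, ZMod.dft c (-n) * cexp (-Real.pi * (1 / (ε * N ^ 2)) * n ^ 2))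
      (𝓝[>] 0) (𝓝 S) := by
    have h := tendsto_tsum_gaussian (c := fun n : ℤ => ZMod.dft c (-n)) (D := D) (fun n => hD _) (l := 𝓝[>] (0:ℝ))
      (b := fun ε : ℝ => 1 / (ε * N ^ 2)) (by
        have : ∀ ε : ℝ, (1 / ((ε:ℂ) * N ^ 2)).re = ε⁻¹ * (1 / N ^ 2) := by
          intro ε
          have : (1 / ((ε:ℂ) * N ^ 2)) = ((ε⁻¹ * (1 / N ^ 2) : ℝ) : ℂ) := by push_cast; ring
          rw [this, ofReal_re]
        simp_rw [this]
        exact tendsto_inv_nhdsGT_zero.atTop_mul_const (by positivity))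
    simpa [hS, hc, ZMod.dft_apply_zero] using h
  have hl3 : Tendsto (fun ε : ℝ => ∑' n : ℤ, ZMod.dft c2 (-n) * cexp (-Real.pi * (1 / (d ε * (2:ℕ) ^ 2)) * n ^ 2))
      (𝓝[>] 0) (𝓝 T) := by
    have h := tendsto_tsum_gaussian (c := fun n : ℤ => ZMod.dft c2 (-n)) (D := D2) (fun n => hD2 _) (l := 𝓝[>] (0:ℝ))
      (b := fun ε : ℝ => 1 / (d ε * (2:ℕ) ^ 2)) (by
        have : ∀ ε : ℝ, (1 / (d ε * (2:ℕ) ^ 2)).re = ε⁻¹ * ((1 / N ^ 2) * (1 / κ ε).re) := by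
          intro ε
          have : (1 / (d ε * (2:ℕ) ^ 2)) = ((ε⁻¹ * (1 / N ^ 2) : ℝ) : ℂ) * (1 / κ ε) := by
            simp only [hd]; push_cast; ring
          rw [this, re_ofReal_mul]; ring
        simp_rw [this]
        refine tendsto_inv_nhdsGT_zero.atTop_mul_pos (C := (1 / N ^ 2) * (1 / (1:ℂ)).re) (by simp; positivity) ?_
        apply Tendsto.const_mul
        exact (continuous_re.tendsto _).comp (tendsto_const_nhds.div hcont_κ one_ne_zero))
    simpa [hT, ZMod.dft_apply_zero] using h
  have hfin : (1 - I) / (Real.sqrt N : ℂ) * S = T := by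
    refine tendsto_nhds_unique ((hl1.mul hl2).congr' ?_) hl3
    filter_upwards [self_mem_nhdsWithin] with ε hε
    exact key ε hε
  have hsN0 : (Real.sqrt N : ℂ) ≠ 0 := by exact_mod_cast (Real.sqrt_pos.mpr hN0).ne'
  have h1I : (1 - I) ≠ 0 := by intro h; have := congrArg re h; simp at this
  have hS2 : S = T * (Real.sqrt N : ℂ) / (1 - I) := by
    rw [← hfin]; field_simp
  have hval : T / (1 - I) = epsN N := by
    rw [div_eq_iff h1I, hTv, epsN]
    obtain ⟨m, hm⟩ : ∃ m, N = 4 * m + 1 ∨ N = 4 * m + 3 := ⟨N / 4, by obtain ⟨k, hk⟩ := hN; omega⟩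
    have h4 : (-I) ^ 4 = 1 := by rw [neg_pow, I_pow_four]; norm_num
    rcases hm with hm | hm
    · rw [if_pos (by omega), hm, pow_succ, pow_mul, h4]; simp; ring
    · rw [if_neg (by omega), hm, pow_add, pow_mul, h4, one_pow, one_mul, neg_pow, pow_succ I 2, I_sq]
      rw [mul_sub, I_mul_I]; ring
  rw [hS2, mul_div_right_comm, hval]

/-- The Jacobi symbol `(c | N)` as a function on `ZMod N`. -/
def jac (N : ℕ) (c : ZMod N) : ℂ := (jacobiSym (c.val : ℤ) N : ℂ)

theorem jac_intCast (N : ℕ) [NeZero N] (a : ℤ) : jac N (a : ZMod N) = (jacobiSym a N : ℂ) := by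
  rw [jac, ZMod.val_intCast, ← jacobiSym.mod_left]

theorem jac_natCast (N : ℕ) [NeZero N] (a : ℕ) : jac N (a : ZMod N) = (jacobiSym a N : ℂ) := by
  exact_mod_cast jac_intCast N a

theorem jac_mul (N : ℕ) [NeZero N] (a b : ZMod N) : jac N (a * b) = jac N a * jac N b := by
  have := jac_intCast N (a.val * b.val)
  push_cast at this
  simp only [ZMod.natCast_val, ZMod.cast_id', id_eq] at this
  rw [this, jac, jac, jacobiSym.mul_left]
  simp only [ZMod.natCast_val]; push_cast; rfl

theorem norm_jacobiSym_le (a : ℤ) (N : ℕ) : ‖(jacobiSym a N : ℂ)‖ ≤ 1 := by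
  rcases jacobiSym.trichotomy a N with h | h | h <;> simp [h]

/-- The quadratic Gauss sum `∑_{c mod N} (c | N) e(ck/N)`. -/
def gJ (k : ℤ) (N : ℕ) : ℂ :=
  ∑ c ∈ Finset.range N, (jacobiSym c N : ℂ) * cexp (2 * Real.pi * I * (c * k) / N)

theorem gJ_eq (k : ℤ) (N : ℕ) [NeZero N] :
    gJ k N = ∑ c : ZMod N, jac N c * ZMod.stdAddChar (c * (k : ZMod N)) := by
  rw [← sum_range_zmod, gJ]
  apply Finset.sum_congr rfl
  intro c _
  have := ZMod.stdAddChar_coe (N := N) (c * k)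
  push_cast at this
  rw [jac_natCast, this]

theorem norm_gJ_le (k : ℤ) (N : ℕ) : ‖gJ k N‖ ≤ N := by
  calc _ ≤ ∑ c ∈ Finset.range N, (1:ℝ) := by
        apply norm_sum_le_of_le
        intro c _
        rw [norm_mul]
        have : ‖cexp (2 * Real.pi * I * (c * k) / N)‖ = 1 := by
          have := norm_exp_ofReal_mul_I (2 * Real.pi * (c * k) / N)
          convert this using 3
          push_cast; ring
        rw [this, mul_one]; exact norm_jacobiSym_le _ _
    _ = N := by simp

theorem gJ_one (k : ℤ) : gJ k 1 = 1 := by simp [gJ]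

theorem sum_zmod_mul {M N : ℕ} [NeZero M] [NeZero N] (h : Nat.Coprime M N) (F : ZMod (M * N) → ℂ) :
    ∑ c, F c = ∑ a : ZMod M, ∑ b : ZMod N, F ((a.val * N + b.val * M : ℕ) : ZMod (M * N)) := by
  rw [← Finset.sum_product']
  symm
  let f : ZMod M × ZMod N → ZMod (M * N) := fun x => ((x.1.val * N + x.2.val * M : ℕ) : ZMod (M * N))
  have hf : Function.Bijective f := by
    rw [Fintype.bijective_iff_injective_and_card]
    constructor
    · rintro ⟨a, b⟩ ⟨a', b'⟩ hab
      have h1 := (ZMod.natCast_eq_natCast_iff _ _ _).mp hab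
      simp only at h1
      have hM : a.val * N ≡ a'.val * N [MOD M] := by
        have h2 := h1.of_mul_right N
        simpa [Nat.ModEq, Nat.add_mod, Nat.mul_mod] using h2
      have hN : b.val * M ≡ b'.val * M [MOD N] := by
        have h2 := h1.of_mul_left M
        simpa [Nat.ModEq, Nat.add_mod, Nat.mul_mod] using h2
      have ha := Nat.ModEq.cancel_right_of_coprime (by simpa using h) hM
      have hb := Nat.ModEq.cancel_right_of_coprime (by simpa using h.symm) hN
      rw [← ZMod.natCast_eq_natCast_iff] at ha hb
      simp at ha hb
      rw [ha, hb]
    · simp [ZMod.card]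
  rw [Finset.univ_product_univ]
  exact hf.sum_comp F

theorem gJ_mul {M N : ℕ} [NeZero M] [NeZero N] (h : Nat.Coprime M N) (k : ℤ) :
    gJ k (M * N) = (jacobiSym M N : ℂ) * (jacobiSym N M : ℂ) * (gJ k M * gJ k N) := by
  have hM : (M:ℂ) ≠ 0 := by exact_mod_cast NeZero.ne M
  have hN : (N:ℂ) ≠ 0 := by exact_mod_cast NeZero.ne N
  rw [gJ_eq k (M * N), sum_zmod_mul h, gJ_eq k M, gJ_eq k N, Finset.sum_mul_sum, Finset.mul_sum]
  apply Finset.sum_congr rfl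
  intro a _
  rw [Finset.mul_sum]
  apply Finset.sum_congr rfl
  intro b _
  have e1 : jac (M * N) ((a.val * N + b.val * M : ℕ) : ZMod (M * N)) =
      (jacobiSym M N : ℂ) * (jacobiSym N M : ℂ) * (jac M a * jac N b) := by
    rw [jac_natCast, jacobiSym.mul_right]
    have h1 : jacobiSym ((a.val * N + b.val * M : ℕ) : ℤ) M = jacobiSym (a.val * N : ℤ) M := by
      apply jacobiSym.mod_left'
      push_cast; simp
    have h2 : jacobiSym ((a.val * N + b.val * M : ℕ) : ℤ) N = jacobiSym (b.val * M : ℤ) N := by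
      apply jacobiSym.mod_left'
      push_cast; simp
    rw [h1, h2, jacobiSym.mul_left, jacobiSym.mul_left, jac, jac]
    push_cast; ring
  have e2 : ZMod.stdAddChar (((a.val * N + b.val * M : ℕ) : ZMod (M * N)) * (k : ZMod (M * N))) =
      ZMod.stdAddChar (a * (k : ZMod M)) * ZMod.stdAddChar (b * (k : ZMod N)) := by
    have h0 := ZMod.stdAddChar_coe (N := M * N) ((a.val * N + b.val * M : ℕ) * k)
    have h1 := ZMod.stdAddChar_coe (N := M) (a.val * k)
    have h2 := ZMod.stdAddChar_coe (N := N) (b.val * k)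
    push_cast at h0 h1 h2
    simp only [ZMod.natCast_val, ZMod.cast_id', id_eq] at h1 h2
    push_cast
    simp only [ZMod.natCast_val] at h0 ⊢
    rw [h0, h1, h2, ← Complex.exp_add]
    congr 1
    field_simp
  rw [e1, e2]; ring

theorem epsN_mul {M N : ℕ} (hM : Odd M) (hN : Odd N) (h : Nat.Coprime M N) :
    epsN (M * N) * ((jacobiSym M N : ℂ) * (jacobiSym N M : ℂ)) = epsN M * epsN N := by
  have hsq : ((jacobiSym M N : ℂ)) ^ 2 = 1 := by
    exact_mod_cast jacobiSym.sq_one (a := M) (b := N) (by simpa using h)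
  have hmod : M * N % 4 = (M % 4) * (N % 4) % 4 := Nat.mul_mod _ _ _
  have hM4 : M % 4 = 1 ∨ M % 4 = 3 := by obtain ⟨k, hk⟩ := hM; omega
  have hN4 : N % 4 = 1 ∨ N % 4 = 3 := by obtain ⟨k, hk⟩ := hN; omega
  rcases hM4 with h1 | h1
  · rw [jacobiSym.quadratic_reciprocity_one_mod_four h1 hN] at *
    rw [h1, one_mul] at hmod
    have hsq' : (jacobiSym N M : ℂ) * (jacobiSym N M : ℂ) = 1 := by rw [← sq]; exact_mod_cast hsq
    rw [hsq']
    rcases hN4 with h2 | h2 <;> simp [epsN, h1, h2, hmod]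
  · rcases hN4 with h2 | h2
    · rw [jacobiSym.quadratic_reciprocity_one_mod_four' hM h2] at *
      have hsq' : (jacobiSym N M : ℂ) * (jacobiSym N M : ℂ) = 1 := by rw [← sq]; exact_mod_cast hsq
      rw [hsq']
      simp [epsN, h1, h2, hmod]
    · rw [jacobiSym.quadratic_reciprocity_three_mod_four h1 h2] at *
      have hsq' : ((-jacobiSym N M : ℤ) : ℂ) * (jacobiSym N M : ℂ) = -1 := by
        push_cast at hsq ⊢
        linear_combination -hsq
      rw [hsq']
      simp [epsN, h1, h2, hmod]

theorem epsN_ne_zero (N : ℕ) : epsN N ≠ 0 := by unfold epsN; split_ifs <;> simp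

theorem norm_epsN (N : ℕ) : ‖epsN N‖ = 1 := by unfold epsN; split_ifs <;> simp

/-- The normalized Gauss sum, multiplicative in the modulus. -/
def GJ (k : ℤ) (N : ℕ) : ℂ := if Odd N then gJ k N / epsN N else 0

theorem norm_GJ_le (k : ℤ) (N : ℕ) : ‖GJ k N‖ ≤ N := by
  unfold GJ
  split_ifs
  · rw [norm_div, norm_epsN, div_one]; exact norm_gJ_le k N
  · simp

theorem GJ_one (k : ℤ) : GJ k 1 = 1 := by simp [GJ, gJ_one, epsN]

theorem GJ_zero (k : ℤ) : GJ k 0 = 0 := by simp [GJ]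

theorem GJ_mul {M N : ℕ} (h : Nat.Coprime M N) (k : ℤ) : GJ k (M * N) = GJ k M * GJ k N := by
  unfold GJ
  by_cases hM : Odd M
  · by_cases hN : Odd N
    · have : NeZero M := ⟨by rintro rfl; simp at hM⟩
      have : NeZero N := ⟨by rintro rfl; simp at hN⟩
      have hsq : ((jacobiSym M N : ℂ)) ^ 2 = 1 := by
        exact_mod_cast jacobiSym.sq_one (a := M) (b := N) (by simpa using h)
      have hsq2 : ((jacobiSym N M : ℂ)) ^ 2 = 1 := by
        exact_mod_cast jacobiSym.sq_one (a := N) (b := M) (by simpa using h.symm)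
      rw [if_pos hM, if_pos hN, if_pos (hM.mul hN), gJ_mul h, div_mul_div_comm, ← epsN_mul hM hN h]
      have hx : (jacobiSym M N : ℂ) * (jacobiSym N M : ℂ) ≠ 0 := by
        intro h0
        have : ((jacobiSym M N : ℂ) * (jacobiSym N M : ℂ)) ^ 2 = 1 := by rw [mul_pow, hsq, hsq2, one_mul]
        rw [h0] at this; simp at this
      have he := epsN_ne_zero (M * N)
      rw [div_eq_div_iff he (mul_ne_zero he hx)]
      have : ((jacobiSym M N : ℂ) * (jacobiSym N M : ℂ)) ^ 2 = 1 := by rw [mul_pow, hsq, hsq2, one_mul]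
      linear_combination (gJ k M * gJ k N * epsN (M * N)) * this
    · rw [if_neg hN, if_neg (fun h => hN (Nat.odd_mul.mp h).2), mul_zero]
  · rw [if_neg hM, if_neg (fun h => hM (Nat.odd_mul.mp h).1), zero_mul]

theorem jac_prime (p : ℕ) [Fact p.Prime] (c : ZMod p) :
    jac p c = (quadraticChar (ZMod p) c : ℂ) := by
  rw [jac, ← jacobiSym.legendreSym.to_jacobiSym, legendreSym]
  simp

theorem gJ_one_prime (p : ℕ) [Fact p.Prime] (hp : p ≠ 2) : gJ 1 p = epsN p * (Real.sqrt p : ℂ) := by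
  have hodd : Odd p := (Fact.out : p.Prime).odd_of_ne_two hp
  rw [← sum_stdAddChar_sq hodd, gJ_eq]
  have hchar : ringChar (ZMod p) ≠ 2 := by rw [ZMod.ringChar_zmod_n]; exact hp
  have hsum0 : ∑ c : ZMod p, ZMod.stdAddChar c = 0 := by
    have := AddChar.sum_mulShift (R := ZMod p) (R' := ℂ) 1 (ZMod.isPrimitive_stdAddChar p)
    simpa using this
  calc ∑ c : ZMod p, jac p c * ZMod.stdAddChar (c * ((1:ℤ) : ZMod p))
      = ∑ c : ZMod p, (jac p c + 1) * ZMod.stdAddChar c := by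
        simp [add_mul, Finset.sum_add_distrib, hsum0]
    _ = ∑ c : ZMod p, ∑ x ∈ Finset.univ.filter (fun x : ZMod p => x ^ 2 = c), ZMod.stdAddChar (x ^ 2) := by
        apply Finset.sum_congr rfl
        intro c _
        have h1 : ∀ x ∈ Finset.univ.filter (fun x : ZMod p => x ^ 2 = c),
            (ZMod.stdAddChar (x ^ 2) : ℂ) = ZMod.stdAddChar c := by
          intro x hx; rw [(Finset.mem_filter.mp hx).2]
        rw [Finset.sum_congr rfl h1, Finset.sum_const, nsmul_eq_mul]
        congr 1
        have h2 := quadraticChar_card_sqrts hchar c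
        rw [jac_prime]
        have h3 : {x : ZMod p | x ^ 2 = c}.toFinset = Finset.univ.filter (fun x : ZMod p => x ^ 2 = c) := by
          ext x; simp
        rw [h3] at h2
        have h4 := congrArg (fun z : ℤ => (z : ℂ)) h2
        push_cast at h4
        exact h4.symm
    _ = _ := by rw [Finset.sum_fiberwise]

theorem gJ_prime (p : ℕ) [Fact p.Prime] (hp : p ≠ 2) (k : ℤ) :
    gJ k p = (jacobiSym k p : ℂ) * (epsN p * (Real.sqrt p : ℂ)) := by
  rw [← gJ_one_prime p hp, gJ_eq, gJ_eq, ← jac_intCast]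
  by_cases hk : (k : ZMod p) = 0
  · have h0 : jac p 0 = 0 := by rw [jac_prime]; simp
    have hchar : ringChar (ZMod p) ≠ 2 := by rw [ZMod.ringChar_zmod_n]; exact hp
    have hs := quadraticChar_sum_zero hchar
    rw [hk, h0, zero_mul]
    simp only [mul_zero, AddChar.map_zero_eq_one, mul_one, jac_prime]
    exact_mod_cast congrArg (fun z : ℤ => (z : ℂ)) hs
  · have hk2 : jac p k * jac p k = 1 := by
      rw [← jac_mul, ← sq, jac_prime, quadraticChar_sq_one' hk]; simp
    rw [Finset.mul_sum]
    refine Fintype.sum_equiv (Equiv.mulRight₀ (k : ZMod p) hk) _ _ fun c => ?_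
    have hE : Equiv.mulRight₀ (k : ZMod p) hk c = c * k := rfl
    simp only [hE, jac_mul, Int.cast_one, mul_one]
    linear_combination (-(jac p c * ZMod.stdAddChar (c * (k : ZMod p)))) * hk2

theorem GJ_prime {p : ℕ} (hpp : p.Prime) (hp : p ≠ 2) (k : ℤ) :
    GJ k p = (jacobiSym k p : ℂ) * (Real.sqrt p : ℂ) := by
  have := Fact.mk hpp
  rw [GJ, if_pos (hpp.odd_of_ne_two hp), gJ_prime p hp]
  field_simp [epsN_ne_zero p]

theorem gJ_prime_pow_eq_zero {p : ℕ} (hp : p.Prime) {j : ℕ} (hj : 2 ≤ j) {k : ℤ}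
    (hk : ¬ (p:ℤ) ^ (j - 1) ∣ k) : gJ k (p ^ j) = 0 := by
  have hp0 : p ≠ 0 := hp.ne_zero
  have : NeZero (p ^ j) := ⟨pow_ne_zero _ hp0⟩
  have : NeZero p := ⟨hp0⟩
  obtain ⟨i, hij, hi1, hi2⟩ : ∃ i, i + 2 ≤ j ∧ (p:ℤ) ^ i ∣ k ∧ ¬ (p:ℤ) ^ (i + 1) ∣ k := by
    classical
    have hex : ∃ i, ¬ (p:ℤ) ^ (i + 1) ∣ k := ⟨j - 2, by rwa [show j - 2 + 1 = j - 1 by omega]⟩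
    refine ⟨Nat.find hex, ?_, ?_, Nat.find_spec hex⟩
    · have := Nat.find_min' hex (m := j - 2) (by rwa [show j - 2 + 1 = j - 1 by omega])
      omega
    · rcases Nat.eq_zero_or_pos (Nat.find hex) with h | h
      · rw [h]; simp
      · have := Nat.find_min hex (m := Nat.find hex - 1) (by omega)
        rw [show Nat.find hex - 1 + 1 = Nat.find hex by omega] at this
        exact not_not.mp this
  set s : ℕ := p ^ (j - 1 - i) with hs
  have hps : p ∣ s := dvd_pow_self _ (by omega)
  have hjac : ∀ c : ZMod (p ^ j), jac (p ^ j) (c + (s : ZMod (p ^ j))) = jac (p ^ j) c := by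
    intro c
    have h1 := jac_natCast (p ^ j) (c.val + s)
    have h2 := jac_natCast (p ^ j) c.val
    push_cast at h1 h2
    simp only [ZMod.natCast_val, ZMod.cast_id', id_eq] at h1 h2
    rw [h1, h2, jacobiSym.pow_right, jacobiSym.pow_right]
    congr 2
    apply jacobiSym.mod_left'
    obtain ⟨m, hm⟩ := hps
    rw [hm]; push_cast; simp
  set ω : ℂ := ZMod.stdAddChar ((s : ZMod (p ^ j)) * (k : ZMod (p ^ j))) with hω
  have hω1 : ω ≠ 1 := by
    intro h
    rw [hω, ← AddChar.map_zero_eq_one (ZMod.stdAddChar (N := p ^ j))] at h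
    have h2 := ZMod.injective_stdAddChar h
    have h3 : (((s * k : ℤ)) : ZMod (p ^ j)) = 0 := by push_cast; exact_mod_cast h2
    rw [ZMod.intCast_zmod_eq_zero_iff_dvd] at h3
    apply hi2
    have h4 : ((p ^ j : ℕ) : ℤ) = (s:ℤ) * (p:ℤ) ^ (i + 1) := by
      rw [hs]; push_cast; rw [← pow_add]; congr 1; omega
    rw [h4] at h3
    exact (mul_dvd_mul_iff_left (by rw [hs]; push_cast; exact pow_ne_zero _ (by exact_mod_cast hp0))).mp h3
  have hshift : gJ k (p ^ j) = ω * gJ k (p ^ j) := by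
    conv_lhs => rw [gJ_eq, ← Equiv.sum_comp (Equiv.addRight (s : ZMod (p ^ j)))]
    rw [gJ_eq, Finset.mul_sum]
    apply Finset.sum_congr rfl
    intro c _
    simp only [Equiv.coe_addRight, hjac, add_mul, AddChar.map_add_eq_mul]
    ring
  have : (1 - ω) * gJ k (p ^ j) = 0 := by linear_combination hshift
  exact (mul_eq_zero.mp this).resolve_left (sub_ne_zero.mpr hω1.symm)

theorem GJ_prime_pow_eq_zero {p : ℕ} (hp : p.Prime) {j : ℕ} (hj : 2 ≤ j) {k : ℤ}
    (hk : ¬ (p:ℤ) ^ (j - 1) ∣ k) : GJ k (p ^ j) = 0 := by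
  unfold GJ; split_ifs
  · rw [gJ_prime_pow_eq_zero hp hj hk, zero_div]
  · rfl

theorem gJ_neg (k : ℤ) {N : ℕ} (hN : Odd N) : gJ (-k) N = (jacobiSym (-1) N : ℂ) * gJ k N := by
  have : NeZero N := ⟨by rintro rfl; simp at hN⟩
  rw [gJ_eq, gJ_eq, Finset.mul_sum]
  refine Fintype.sum_equiv (Equiv.neg (ZMod N)) _ _ fun c => ?_
  have h1 : jac N (-c) = (jacobiSym (-1) N : ℂ) * jac N c := by
    rw [← jac_intCast, ← jac_mul]; simp
  have h2 : (jacobiSym (-1) N : ℂ) ^ 2 = 1 := by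
    exact_mod_cast jacobiSym.sq_one (a := -1) (b := N) (by simp)
  simp only [Equiv.neg_apply, h1, Int.cast_neg, mul_neg, neg_mul]
  linear_combination (-(jac N c * ZMod.stdAddChar (-(c * (k : ZMod N))))) * h2

/-- The character `c ↦ (c | N)` restricted to odd `c`, as a function modulo `2N`. -/
def psiN (N : ℕ) (c : ZMod (2 * N)) : ℂ := if Odd c.val then (jacobiSym c.val N : ℂ) else 0

theorem psiN_natCast {N : ℕ} [NeZero N] (n : ℕ) :
    psiN N (n : ZMod (2 * N)) = if Odd n then (jacobiSym n N : ℂ) else 0 := by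
  have h1 : ((n : ZMod (2 * N)).val) = n % (2 * N) := ZMod.val_natCast _ _
  have h2 : Odd (n % (2 * N)) ↔ Odd n := by
    rw [Nat.odd_iff, Nat.odd_iff, Nat.mod_mul_right_mod]
  have h3 : jacobiSym ((n % (2 * N) : ℕ) : ℤ) N = jacobiSym n N := by
    apply jacobiSym.mod_left'
    have := Nat.mod_mul_left_mod n 2 N
    exact_mod_cast this
  rw [psiN, h1, h3]
  simp only [h2]

theorem norm_psiN_le (N : ℕ) (c : ZMod (2 * N)) : ‖psiN N c‖ ≤ 1 := by
  unfold psiN; split_ifs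
  · exact norm_jacobiSym_le _ _
  · simp

theorem psiN_zero {N : ℕ} [NeZero N] : psiN N 0 = 0 := by
  simp [psiN]

theorem dft_psiN {N : ℕ} [NeZero N] (hN : Odd N) (k : ℤ) :
    ZMod.dft (psiN N) (k : ZMod (2 * N)) = (-1) ^ k.natAbs * (jacobiSym 2 N : ℂ) * gJ (-k) N := by
  have hN0 : (N:ℂ) ≠ 0 := by exact_mod_cast NeZero.ne N
  rw [ZMod.dft_apply, sum_zmod_mul (Nat.coprime_two_left.mpr hN) (fun c => ZMod.stdAddChar (-(c * (k : ZMod (2 * N)))) • psiN N c)]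
  rw [show (Finset.univ : Finset (ZMod 2)) = {0, 1} by rfl, Finset.sum_pair (by decide)]
  have h0 : ∑ b : ZMod N, (ZMod.stdAddChar (-((((0:ZMod 2).val * N + b.val * 2 : ℕ) : ZMod (2 * N)) * (k : ZMod (2 * N))))) •
      psiN N (((0:ZMod 2).val * N + b.val * 2 : ℕ) : ZMod (2 * N)) = 0 := by
    apply Finset.sum_eq_zero
    intro b _
    rw [psiN_natCast, if_neg, smul_zero]
    simp
  rw [h0, zero_add, gJ_eq, Finset.mul_sum]
  apply Finset.sum_congr rfl
  intro b _
  have hv : (1 : ZMod 2).val = 1 := rfl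
  rw [hv, one_mul, psiN_natCast, if_pos (by rw [Nat.odd_add]; simp [hN])]
  have h1 : jacobiSym ((N + b.val * 2 : ℕ) : ℤ) N = jacobiSym b.val N * jacobiSym 2 N := by
    rw [← jacobiSym.mul_left]
    apply jacobiSym.mod_left'
    push_cast; simp
  have h2 : (ZMod.stdAddChar (-(((N + b.val * 2 : ℕ) : ZMod (2 * N)) * (k : ZMod (2 * N)))) : ℂ) =
      (-1) ^ k.natAbs * ZMod.stdAddChar (b * ((-k : ℤ) : ZMod N)) := by
    have e1 := ZMod.stdAddChar_coe (N := 2 * N) (-((N + b.val * 2 : ℕ) * k))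
    have e2 := ZMod.stdAddChar_coe (N := N) (b.val * (-k))
    have e3 : cexp (-(Real.pi * I * k)) = (-1) ^ k.natAbs := by
      rcases Int.natAbs_eq k with h | h
      · conv_lhs => rw [h]
        rw [Int.cast_natCast, show -(Real.pi * I * (k.natAbs:ℂ)) = (k.natAbs:ℂ) * (-(Real.pi * I)) by ring,
          Complex.exp_nat_mul, Complex.exp_neg, exp_pi_mul_I]
        norm_num
      · conv_lhs => rw [h]
        rw [Int.cast_neg, Int.cast_natCast, show -(Real.pi * I * -(k.natAbs:ℂ)) = (k.natAbs:ℂ) * (Real.pi * I) by ring,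
          Complex.exp_nat_mul, exp_pi_mul_I]
    push_cast at e1 e2 ⊢
    simp only [ZMod.natCast_val, ZMod.cast_id', id_eq] at e1 e2 ⊢
    rw [e1, e2, ← e3, ← Complex.exp_add]
    congr 1
    field_simp
    ring
  rw [h1, h2, smul_eq_mul, jac]
  push_cast; ring

theorem functional_equation_psiN {N : ℕ} [NeZero N] (hN : Odd N) {u : ℂ} (hu : u.re < 0) :
    (jacobiSym 2 N : ℂ) * ZMod.LFunction (psiN N) u =
      (2 * N : ℂ) ^ (-u) * (2 * Real.pi : ℂ) ^ (u - 1) * Gamma (1 - u) *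
      ∑' k : ℕ, (k : ℂ) ^ (u - 1) * (-1) ^ k *
        ((cos (Real.pi * (1 - u) / 2) + sin (Real.pi * (1 - u) / 2)) * GJ k N +
         (cos (Real.pi * (1 - u) / 2) - sin (Real.pi * (1 - u) / 2)) * GJ (-k) N) := by
  have hs : 1 < (1 - u).re := by rw [sub_re, one_re]; linarith
  have hFE := ZMod.LFunction_one_sub (psiN N) (s := 1 - u) (by
    intro n h; have := congrArg re h; simp at this; have : (0:ℝ) ≤ n := by positivity
    linarith) (Or.inl psiN_zero)
  rw [sub_sub_cancel] at hFE
  have hu1 : 1 - u ≠ 0 := by intro h; rw [h] at hs; simp at hs; linarith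
  have hu1' : u - 1 ≠ 0 := by intro h; apply hu1; linear_combination -h
  set θ := Real.pi * (1 - u) / 2 with hθ
  have hsq : (jacobiSym 2 N : ℂ) ^ 2 = 1 := by
    exact_mod_cast jacobiSym.sq_one (a := 2) (b := N) (Nat.coprime_two_left.mpr hN)
  have hS1 := ZMod.LSeriesSummable_of_one_lt_re (ZMod.dft (psiN N)) hs
  have hS2 := ZMod.LSeriesSummable_of_one_lt_re (ZMod.dft (fun x => psiN N (-x))) hs
  rw [hFE, ZMod.LFunction_eq_LSeries _ hs, ZMod.LFunction_eq_LSeries _ hs, LSeries, LSeries,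
    ← tsum_mul_left, ← tsum_mul_left,
    ← Summable.tsum_add (hS1.mul_left _) (hS2.mul_left _)]
  rw [mul_left_comm, show (1 - u - 1) = -u by ring, show -(1 - u) = u - 1 by ring]
  push_cast
  congr 1
  rw [← tsum_mul_left]
  apply tsum_congr
  intro k
  rcases Nat.eq_zero_or_pos k with rfl | hk
  · simp [zero_cpow hu1']
  · have hk0 : (k:ℂ) ≠ 0 := by exact_mod_cast hk.ne'
    have hd1 : ZMod.dft (psiN N) (k : ZMod (2 * N)) = (-1) ^ k * (jacobiSym 2 N : ℂ) * gJ (-k) N := by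
      have := dft_psiN hN (k : ℤ)
      simpa using this
    have hd2 : ZMod.dft (fun x => psiN N (-x)) (k : ZMod (2 * N)) = (-1) ^ k * (jacobiSym 2 N : ℂ) * gJ k N := by
      have := dft_psiN hN (-(k : ℤ))
      rw [ZMod.dft_comp_neg]
      simpa using this
    have hE1 : cexp (Real.pi * I * (1 - u) / 2) = cos θ + sin θ * I := by
      rw [← Complex.exp_mul_I]; congr 1; rw [hθ]; ring
    have hE2 : cexp (-Real.pi * I * (1 - u) / 2) = cos θ - sin θ * I := by
      have := Complex.exp_mul_I (-θ)
      rw [Complex.cos_neg, Complex.sin_neg] at this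
      rw [show cos θ - sin θ * I = cos θ + -sin θ * I by ring, ← this]; congr 1; rw [hθ]; ring
    rw [LSeries.term_of_ne_zero hk.ne', LSeries.term_of_ne_zero hk.ne', hd1, hd2, hE1, hE2, gJ_neg _ hN,
      show u - 1 = -(1 - u) by ring, cpow_neg, GJ, GJ, if_pos hN, if_pos hN, gJ_neg _ hN]
    have hkp : (k:ℂ) ^ (1 - u) ≠ 0 := by rw [cpow_ne_zero_iff_of_exponent_ne_zero hu1]; exact hk0
    have hN4 : N % 4 = 1 ∨ N % 4 = 3 := by obtain ⟨k, hk⟩ := hN; omega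
    rcases hN4 with h | h
    · have hm : jacobiSym (-1) N = 1 := by rw [jacobiSym.at_neg_one hN]; exact ZMod.χ₄_nat_one_mod_four h
      have he : epsN N = 1 := by simp [epsN, h]
      rw [hm, he]; push_cast
      field_simp
      linear_combination (2 * cos θ * gJ k N) * hsq
    · have hm : jacobiSym (-1) N = -1 := by rw [jacobiSym.at_neg_one hN]; exact ZMod.χ₄_nat_three_mod_four h
      have he : epsN N = I := by simp [epsN, h]
      rw [hm, he]; push_cast
      field_simp
      ring_nf
      simp only [I_sq, hsq]
      ring

theorem GJ_squarefree {N : ℕ} (hN : Odd N) (hsq : Squarefree N) (k : ℤ) :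
    GJ k N = (jacobiSym k N : ℂ) * (Real.sqrt N : ℂ) := by
  induction N using Nat.recOnPosPrimePosCoprime with
  | prime_pow p n hp hn =>
    have h1 : n = 1 := by
      by_contra h
      have := (Nat.squarefree_pow_iff hp.one_lt.ne' (by omega)).mp hsq
      exact h this.2
    subst h1
    rw [pow_one] at hN ⊢
    exact GJ_prime hp (by rintro rfl; exact absurd hN (by decide)) k
  | zero => simp at hN
  | one => simp [GJ_one]
  | coprime a b ha hb hab iha ihb =>
    have hodd := Nat.odd_mul.mp hN
    have hs := (Nat.squarefree_mul hab).mp hsq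
    have : NeZero a := ⟨by omega⟩
    have : NeZero b := ⟨by omega⟩
    rw [GJ_mul hab, iha hodd.1 hs.1, ihb hodd.2 hs.2, jacobiSym.mul_right]
    push_cast
    rw [Real.sqrt_mul (by positivity)]
    push_cast; ring

theorem gJ_squarefree {N : ℕ} (hN : Odd N) (hsq : Squarefree N) (k : ℤ) :
    gJ k N = epsN N * (jacobiSym k N : ℂ) * (Real.sqrt N : ℂ) := by
  have := GJ_squarefree hN hsq k
  rw [GJ, if_pos hN, div_eq_iff (epsN_ne_zero N)] at this
  rw [this]; ring

theorem chi4_chi8_sum (k : ℕ) :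
    ∑ a : ZMod 8, ((ZMod.χ₈ a : ℤ) : ℂ) * ZMod.stdAddChar (-(a * (k : ZMod 8))) =
      (Real.sqrt 8 : ℂ) * ((ZMod.χ₈ k : ℤ) : ℂ) ∧
    ∑ a : ZMod 8, ((ZMod.χ₈' a : ℤ) : ℂ) * ZMod.stdAddChar (-(a * (k : ZMod 8))) =
      -I * (Real.sqrt 8 : ℂ) * ((ZMod.χ₈' k : ℤ) : ℂ) := by
  set ω : ℂ := ZMod.stdAddChar (-1 : ZMod 8) with hω
  have hs2 : (Real.sqrt 2 : ℂ) ^ 2 = 2 := by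
    rw [← ofReal_pow, Real.sq_sqrt (by norm_num)]; simp
  have hs20 : (Real.sqrt 2 : ℂ) ≠ 0 := by
    intro h; rw [h] at hs2; norm_num at hs2
  have hs8 : (Real.sqrt 8 : ℂ) = 2 * Real.sqrt 2 := by
    rw [show (8:ℝ) = 2 ^ 2 * 2 by norm_num, Real.sqrt_mul (by norm_num), Real.sqrt_sq (by norm_num)]
    push_cast; rfl
  have hωv : ω = (1 - I) / Real.sqrt 2 := by
    have h1 := ZMod.stdAddChar_coe (N := 8) (-1)
    push_cast at h1
    rw [hω, h1, show (2 * Real.pi * I * -1 / 8 : ℂ) = (-(Real.pi / 4 : ℝ) : ℂ) * I by push_cast; ring,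
      Complex.exp_mul_I, Complex.cos_neg, Complex.sin_neg, ← ofReal_cos, ← ofReal_sin,
      Real.cos_pi_div_four, Real.sin_pi_div_four]
    push_cast
    field_simp
    linear_combination (1 - I) * hs2
  have hω2 : ω ^ 2 = -I := by
    rw [hωv, div_pow, hs2, sub_sq, I_sq]; ring
  have hω4 : ω ^ 4 = -1 := by
    rw [show (4:ℕ) = 2 * 2 by norm_num, pow_mul, hω2, neg_sq, I_sq]
  have h8 : (Real.sqrt 8 : ℂ) = ω * (2 + 2 * I) := by
    rw [hs8, hωv]; field_simp; rw [hs2]; ring_nf; rw [I_sq]; ring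
  have hpow : ∀ a : ZMod 8, (ZMod.stdAddChar (-(a * (k : ZMod 8))) : ℂ) = ω ^ (a.val * (k % 8)) := by
    intro a
    rw [hω, ← AddChar.map_nsmul_eq_pow]
    congr 1
    rw [nsmul_eq_mul]
    push_cast
    simp
  have hχ : ∀ c : ZMod 8 → ℤ, ∑ a : ZMod 8, ((c a : ℤ) : ℂ) * ZMod.stdAddChar (-(a * (k : ZMod 8))) =
      ∑ a : Fin 8, ((c a : ℤ) : ℂ) * ω ^ ((a : ℕ) * (k % 8)) := by
    intro c
    exact Finset.sum_congr rfl fun a _ => by rw [hpow a]; rfl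
  have hk8 : ((k : ℕ) : ZMod 8) = ((k % 8 : ℕ) : ZMod 8) := by simp
  have hlt : k % 8 < 8 := Nat.mod_lt _ (by norm_num)
  rw [hχ, hχ, hk8]
  generalize k % 8 = m at hlt
  have e3 : ω ^ 3 = -I * ω := by rw [pow_succ, hω2]
  have hr : ∀ n, ω ^ (n + 4) = - ω ^ n := by intro n; rw [pow_add, hω4]; ring
  simp only [Fin.sum_univ_eight]
  interval_cases m <;>
  · constructor <;>
    · norm_num [ZMod.χ₈, ZMod.χ₈', hr, e3, hω2, h8]
      try ring_nf
      try simp only [I_sq]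
      try ring

/-- The values of the Kronecker symbol `(8d / ·)`. -/
def chi8 (d n : ℕ) : ℂ := if Odd n then (jacobiSym (8 * d) n : ℂ) else 0

theorem norm_chi8_le (d n : ℕ) : ‖chi8 d n‖ ≤ 1 := by
  unfold chi8; split_ifs
  · exact norm_jacobiSym_le _ _
  · simp

theorem jacobiSym_eight {n : ℕ} (hn : Odd n) : jacobiSym 8 n = ZMod.χ₈ n := by
  have h2 : (jacobiSym 2 n) ^ 2 = 1 :=
    jacobiSym.sq_one (a := 2) (b := n) (Nat.coprime_two_left.mpr hn)
  rw [show (8:ℤ) = 2 ^ 3 by norm_num, jacobiSym.pow_left, pow_succ, h2, one_mul, jacobiSym.at_two hn]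

theorem chi8_eq {d : ℕ} (hd : Odd d) (n : ℕ) :
    chi8 d n = (if d % 4 = 1 then ((ZMod.χ₈ n : ℤ) : ℂ) else ((ZMod.χ₈' n : ℤ) : ℂ)) * (jacobiSym n d : ℂ) := by
  unfold chi8
  split_ifs with hn h1 h1
  · rw [jacobiSym.mul_left, jacobiSym_eight hn, jacobiSym.quadratic_reciprocity_one_mod_four h1 hn]
    push_cast; ring
  · have h3 : d % 4 = 3 := by obtain ⟨k, hk⟩ := hd; omega
    have hn4 : n % 4 = 1 ∨ n % 4 = 3 := by obtain ⟨k, hk⟩ := hn; omega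
    have hχ : ZMod.χ₈' n = ZMod.χ₄ n * ZMod.χ₈ n := by
      rw [← jacobiSym.at_neg_two hn, ← jacobiSym.at_two hn, ← jacobiSym.at_neg_one hn, ← jacobiSym.mul_left]
      norm_num
    rw [jacobiSym.mul_left, jacobiSym_eight hn, hχ]
    rcases hn4 with h4 | h4
    · rw [ZMod.χ₄_nat_one_mod_four h4, jacobiSym.quadratic_reciprocity_one_mod_four' hd h4]
      push_cast; ring
    · rw [ZMod.χ₄_nat_three_mod_four h4, jacobiSym.quadratic_reciprocity_three_mod_four h3 h4]
      push_cast; ring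
  all_goals
    have hev : n % 2 = 0 := by rw [Nat.not_odd_iff_even] at hn; exact Nat.even_iff.mp hn
    have : (ZMod.χ₈ n = 0) ∧ (ZMod.χ₈' n = 0) := by
      have hk8 : ((n : ℕ) : ZMod 8) = ((n % 8 : ℕ) : ZMod 8) := by simp
      rw [hk8]
      have hlt : n % 8 < 8 := Nat.mod_lt _ (by norm_num)
      have hev8 : n % 8 % 2 = 0 := by omega
      generalize n % 8 = m at hlt hev8
      interval_cases m <;> first | omega | decide
    simp [this.1, this.2]

theorem norm_jacobiSym_sq {a : ℤ} {n : ℕ} (h : a.gcd n = 1) : (jacobiSym a n : ℂ) ^ 2 = 1 := by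
  exact_mod_cast jacobiSym.sq_one h

theorem dft_chi8 {d : ℕ} [NeZero d] (hd : Odd d) (hsq : Squarefree d) (Φ : ZMod (8 * d) → ℂ)
    (hΦ : ∀ n : ℕ, Φ n = chi8 d n) (k : ZMod (8 * d)) :
    ZMod.dft Φ k = (Real.sqrt (8 * d) : ℂ) * Φ k := by
  have hd0 : (d:ℂ) ≠ 0 := by exact_mod_cast NeZero.ne d
  obtain ⟨k, rfl⟩ : ∃ n : ℕ, (n : ZMod (8 * d)) = k := ⟨k.val, by simp⟩
  have hcop : Nat.Coprime 8 d := by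
    rw [show 8 = 2 ^ 3 by norm_num]; exact Nat.Coprime.pow_left 3 (Nat.coprime_two_left.mpr hd)
  have hsqrt : (Real.sqrt (8 * d) : ℂ) = Real.sqrt 8 * Real.sqrt d := by
    rw [Real.sqrt_mul (by norm_num)]; push_cast; rfl
  set w : ZMod 8 → ℂ := fun a => if d % 4 = 1 then ((ZMod.χ₈ a : ℤ) : ℂ) else ((ZMod.χ₈' a : ℤ) : ℂ) with hw
  have hwd : w d * (jacobiSym 8 d : ℂ) = if d % 4 = 1 then 1 else -1 := by
    have h2 : (jacobiSym 2 d : ℂ) ^ 2 = 1 := norm_jacobiSym_sq (Nat.coprime_two_left.mpr hd)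
    simp only [hw]
    split_ifs with h
    · rw [jacobiSym_eight hd, ← jacobiSym.at_two hd, ← sq, h2]
    · have h3 : d % 4 = 3 := by obtain ⟨k, hk⟩ := hd; omega
      rw [jacobiSym_eight hd, ← jacobiSym.at_two hd, ← jacobiSym.at_neg_two hd,
        show (-2:ℤ) = -1 * 2 by norm_num, jacobiSym.mul_left, jacobiSym.at_neg_one hd,
        ZMod.χ₄_nat_three_mod_four h3]
      push_cast
      linear_combination -h2
  have hwmul : ∀ a b : ZMod 8, w (a * b) = w a * w b := by
    intro a b; simp only [hw]; split_ifs <;> rw [map_mul] <;> push_cast <;> rfl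
  rw [ZMod.dft_apply, sum_zmod_mul hcop (fun c => ZMod.stdAddChar (-(c * (k : ZMod (8 * d)))) • Φ c), hΦ, chi8_eq hd]
  have hterm : ∀ (a : ZMod 8) (b : ZMod d),
      (ZMod.stdAddChar (-(((a.val * d + b.val * 8 : ℕ) : ZMod (8 * d)) * (k : ZMod (8 * d)))) : ℂ) •
        Φ ((a.val * d + b.val * 8 : ℕ) : ZMod (8 * d)) =
      (w d * (jacobiSym 8 d : ℂ)) * ((w a * ZMod.stdAddChar (-(a * (k : ZMod 8)))) *
        (jac d b * ZMod.stdAddChar (b * ((-(k:ℤ) : ℤ) : ZMod d)))) := by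
    intro a b
    have h1 : (ZMod.stdAddChar (-(((a.val * d + b.val * 8 : ℕ) : ZMod (8 * d)) * (k : ZMod (8 * d)))) : ℂ) =
        ZMod.stdAddChar (-(a * (k : ZMod 8))) * ZMod.stdAddChar (b * ((-(k:ℤ) : ℤ) : ZMod d)) := by
      have e0 := ZMod.stdAddChar_coe (N := 8 * d) (-((a.val * d + b.val * 8 : ℕ) * k))
      have e1 := ZMod.stdAddChar_coe (N := 8) (-(a.val * k))
      have e2 := ZMod.stdAddChar_coe (N := d) (b.val * (-k))
      push_cast at e0 e1 e2 ⊢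
      simp only [ZMod.natCast_val, ZMod.cast_id', id_eq] at e0 e1 e2 ⊢
      rw [e0, e1, e2, ← Complex.exp_add]
      congr 1
      field_simp
      ring
    have h2 : Φ ((a.val * d + b.val * 8 : ℕ) : ZMod (8 * d)) =
        (w d * (jacobiSym 8 d : ℂ)) * (w a * jac d b) := by
      rw [hΦ, chi8_eq hd]
      have e1 : ((a.val * d + b.val * 8 : ℕ) : ZMod 8) = a * d := by
        push_cast
        rw [show (8 : ZMod 8) = 0 from rfl]; simp
      have e2 : jacobiSym ((a.val * d + b.val * 8 : ℕ) : ℤ) d = jacobiSym b.val d * jacobiSym 8 d := by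
        rw [← jacobiSym.mul_left]
        apply jacobiSym.mod_left'
        push_cast; simp
      have e3 : (if d % 4 = 1 then ((ZMod.χ₈ ((a.val * d + b.val * 8 : ℕ) : ZMod 8) : ℤ) : ℂ)
          else ((ZMod.χ₈' ((a.val * d + b.val * 8 : ℕ) : ZMod 8) : ℤ) : ℂ)) = w a * w d := by
        rw [e1, ← hwmul]
      rw [e3, e2, jac]
      push_cast; ring
    rw [h1, h2, smul_eq_mul]; ring
  simp_rw [hterm, ← Finset.mul_sum, ← Finset.sum_mul]
  rw [← gJ_eq, gJ_squarefree hd hsq, hwd]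
  have hneg : (jacobiSym (-(k:ℤ)) d : ℂ) = (jacobiSym (-1) d : ℂ) * (jacobiSym k d : ℂ) := by
    rw [show (-(k:ℤ)) = -1 * k by ring, jacobiSym.mul_left]; push_cast; rfl
  rw [hneg, jacobiSym.at_neg_one hd, hsqrt]
  obtain ⟨s1, s2⟩ := chi4_chi8_sum k
  simp only [hw]
  split_ifs with h
  · rw [s1, ZMod.χ₄_nat_one_mod_four h]
    simp [epsN, h]
    ring
  · have h3 : d % 4 = 3 := by obtain ⟨k, hk⟩ := hd; omega
    rw [s2, ZMod.χ₄_nat_three_mod_four h3]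
    simp [epsN, h3]
    ring_nf
    simp only [I_sq]; ring

theorem chi8_even {d : ℕ} [NeZero d] (hd : Odd d) (hsq : Squarefree d) (Φ : ZMod (8 * d) → ℂ)
    (hΦ : ∀ n : ℕ, Φ n = chi8 d n) : Φ.Even := by
  intro x
  have h1 := congrFun (ZMod.dft_dft Φ) x
  have hf : ZMod.dft Φ = (Real.sqrt (8 * d) : ℂ) • Φ := by
    ext k; rw [dft_chi8 hd hsq Φ hΦ]; rfl
  rw [hf, map_smul, hf] at h1
  have hr : (Real.sqrt (8 * d) : ℂ) * (Real.sqrt (8 * d) : ℂ) = ((8 * d : ℕ) : ℂ) := by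
    rw [← ofReal_mul, Real.mul_self_sqrt (by positivity)]; push_cast; rfl
  have h8 : ((8 * d : ℕ) : ℂ) ≠ 0 := by
    have := NeZero.ne d
    exact_mod_cast (by positivity : 8 * d ≠ 0)
  simp only [Pi.smul_apply, smul_eq_mul] at h1
  rw [← mul_assoc, hr] at h1
  exact (mul_left_cancel₀ h8 h1).symm

theorem chi8_sum_zero {d : ℕ} [NeZero d] (hd : Odd d) (hsq : Squarefree d) (Φ : ZMod (8 * d) → ℂ)
    (hΦ : ∀ n : ℕ, Φ n = chi8 d n) : Φ 0 = 0 ∧ ∑ j, Φ j = 0 := by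
  have h0 : Φ 0 = 0 := by simpa [chi8] using hΦ 0
  refine ⟨h0, ?_⟩
  rw [← ZMod.dft_apply_zero, dft_chi8 hd hsq Φ hΦ, h0, mul_zero]

theorem chi8_functional_equation {d : ℕ} [NeZero d] (hd : Odd d) (hsq : Squarefree d)
    (Φ : ZMod (8 * d) → ℂ) (hΦ : ∀ n : ℕ, Φ n = chi8 d n) (x : ℂ) :
    (8 * d : ℂ) ^ (-x / 2) * ZMod.completedLFunction Φ (1 / 2 - x) =
      (8 * d : ℂ) ^ (x / 2) * ZMod.completedLFunction Φ (1 / 2 + x) := by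
  obtain ⟨h0, h1⟩ := chi8_sum_zero hd hsq Φ hΦ
  have hFE := ZMod.completedLFunction_one_sub_even (chi8_even hd hsq Φ hΦ) (1 / 2 + x) (Or.inr h1) (Or.inr h0)
  have hf : ZMod.dft Φ = fun k => (Real.sqrt (8 * d) : ℂ) * Φ k := by
    ext k; rw [dft_chi8 hd hsq Φ hΦ]
  have hpos : (0:ℝ) < 8 * d := by have := NeZero.pos d; positivity
  have h8 : (8 * d : ℂ) ≠ 0 := by exact_mod_cast hpos.ne'
  rw [hf, ZMod.completedLFunction_const_mul, show 1 - (1 / 2 + x) = 1 / 2 - x by ring] at hFE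
  have hr : (Real.sqrt (8 * d) : ℂ) = (8 * d : ℂ) ^ (1 / 2 : ℂ) := by
    rw [Real.sqrt_eq_rpow, ofReal_cpow hpos.le]; push_cast; rfl
  rw [hFE, hr]
  push_cast
  rw [← mul_assoc, ← mul_assoc, ← cpow_add _ _ h8, ← cpow_add _ _ h8]
  congr 2; ring

/-- `p ^ (-s)` for odd primes `p`, and `0` for `p = 2`. -/
def po (p : ℕ) (s : ℂ) : ℂ := if p = 2 then 0 else (p : ℂ) ^ (-s)

theorem norm_po_le {p : ℕ} (hp : p.Prime) (s : ℂ) : ‖po p s‖ ≤ (p:ℝ) ^ (-s.re) := by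
  unfold po; split_ifs
  · simp; positivity
  · rw [norm_natCast_cpow_of_pos hp.pos, neg_re]

/-- The Riemann zeta function without its Euler factor at `2`. -/
def zo (s : ℂ) : ℂ := (1 - (2:ℂ) ^ (-s)) * riemannZeta s

theorem hasProd_finset_primes (S : Finset ℕ) (hS : ∀ p ∈ S, p.Prime) (g : ℕ → ℂ) :
    HasProd (fun p : Nat.Primes => if (p : ℕ) ∈ S then g p else 1) (∏ p ∈ S, g p) := by
  let F : ℕ → ℂ := fun p => if p ∈ S then g p else 1
  change HasProd (F ∘ Subtype.val (p := (· ∈ {x : ℕ | x.Prime}))) _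
  rw [hasProd_subtype_iff_mulIndicator]
  have : ∏ p ∈ S, g p = ∏ p ∈ S, ({x : ℕ | x.Prime}.mulIndicator F) p := by
    apply Finset.prod_congr rfl
    intro p hp
    rw [mulIndicator_of_mem (by exact hS p hp)]
    simp [F, hp]
  rw [this]
  apply hasProd_prod_of_ne_finset_one
  intro p hp
  by_cases h : p.Prime
  · rw [mulIndicator_of_mem (by exact h)]; simp [F, hp]
  · rw [mulIndicator_of_notMem (by exact h)]

theorem one_sub_two_cpow_ne_zero_of_pos {s : ℂ} (hs : 0 < s.re) : (1 - (2:ℂ) ^ (-s)) ≠ 0 := by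
  intro h
  have h1 : ‖(2:ℂ) ^ (-s)‖ = 1 := by rw [← sub_eq_zero.mp h]; simp
  have h2 := norm_natCast_cpow_of_pos (n := 2) (by norm_num) (-s)
  norm_num at h2
  rw [h1] at h2
  have : (2:ℝ) ^ (-s.re) < 1 := Real.rpow_lt_one_of_one_lt_of_neg (by norm_num) (by linarith)
  linarith

theorem hasProd_zo {s : ℂ} (hs : 1 < s.re) :
    HasProd (fun p : Nat.Primes => (1 - po p s)⁻¹) (zo s) := by
  have h1 := riemannZeta_eulerProduct_hasProd hs
  have h2 := hasProd_finset_primes {2} (by simp [Nat.prime_two]) (fun p => 1 - (p:ℂ) ^ (-s))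
  have h3 := h2.mul h1
  rw [Finset.prod_singleton] at h3
  have h4 : HasProd (fun p : Nat.Primes => (1 - po p s)⁻¹) ((1 - ((2:ℕ):ℂ) ^ (-s)) * riemannZeta s) := by
    refine h3.congr_fun fun p => ?_
    by_cases hp : (p : ℕ) = 2
    · have hne : (1 - (2:ℂ) ^ (-s)) ≠ 0 := one_sub_two_cpow_ne_zero_of_pos (by linarith)
      simp [po, hp, hne]
    · simp [po, hp]
  simpa [zo] using h4

theorem zo_ne_zero {s : ℂ} (hs : 1 < s.re) : zo s ≠ 0 :=
  mul_ne_zero (one_sub_two_cpow_ne_zero_of_pos (by linarith)) (riemannZeta_ne_zero_of_one_lt_re hs)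

theorem hasProd_completely_multiplicative {f : ℕ → ℂ} (h0 : f 0 = 0) (h1 : f 1 = 1)
    (hmul : ∀ m n, f (m * n) = f m * f n) (hsum : Summable (fun n => ‖f n‖)) :
    HasProd (fun p : Nat.Primes => (1 - f p)⁻¹) (∑' n, f n) :=
  EulerProduct.eulerProduct_completely_multiplicative_hasProd
    (f := { toFun := f, map_zero' := h0, map_one' := h1, map_mul' := hmul }) hsum

theorem norm_tprod_le {ι : Type*} {f : ι → ℂ} {b : ι → ℝ} (hb : Summable b)
    (h : ∀ i, ‖f i - 1‖ ≤ b i) : Multipliable f ∧ ‖∏' i, f i‖ ≤ Real.exp (∑' i, b i) := by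
  have hb0 : ∀ i, 0 ≤ b i := fun i => (norm_nonneg _).trans (h i)
  have hs : Summable (fun i => ‖f i - 1‖) := Summable.of_nonneg_of_le (fun _ => norm_nonneg _) h hb
  have hm : Multipliable f := by
    have := multipliable_one_add_of_summable hs
    simpa using this
  refine ⟨hm, ?_⟩
  refine le_of_tendsto hm.hasProd.norm (Eventually.of_forall fun S => ?_)
  calc ∏ i ∈ S, ‖f i‖ ≤ ∏ i ∈ S, Real.exp (b i) := by
        apply Finset.prod_le_prod (fun _ _ => norm_nonneg _)
        intro i _
        have : ‖f i‖ ≤ 1 + b i := by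
          calc ‖f i‖ = ‖1 + (f i - 1)‖ := by congr 1; ring
            _ ≤ 1 + b i := (norm_add_le _ _).trans (by simpa using h i)
        linarith [Real.add_one_le_exp (b i)]
    _ = Real.exp (∑ i ∈ S, b i) := (Real.exp_sum _ _).symm
    _ ≤ _ := Real.exp_le_exp.mpr (hb.sum_le_tsum _ (fun i _ => hb0 i))

theorem differentiableOn_tprod {ι : Type*} {f : ι → ℂ → ℂ} {b : ι → ℝ} (hb : Summable b)
    {U : Set ℂ} (hU : IsOpen U) (hd : ∀ i, DifferentiableOn ℂ (f i) U)
    (h : ∀ i, ∀ x ∈ U, ‖f i x - 1‖ ≤ b i) : DifferentiableOn ℂ (fun x => ∏' i, f i x) U := by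
  have := Summable.hasProdLocallyUniformlyOn_one_add (f := fun i x => f i x - 1) hU hb
    (Eventually.of_forall h) (fun i => (hd i).continuousOn.sub continuousOn_const)
  simp only [add_sub_cancel] at this
  have h2 := hasProdLocallyUniformlyOn_iff_tendstoLocallyUniformlyOn.mp this
  refine h2.differentiableOn (Eventually.of_forall fun S => ?_) hU
  exact DifferentiableOn.fun_finsetProd fun i _ => hd i

theorem measurable_tprod_of_multipliable {α ι : Type*} [MeasurableSpace α] [Countable ι] {f : ι → α → ℂ}
    (hf : ∀ i, Measurable (f i)) (h : ∀ a, Multipliable (fun i => f i a)) :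
    Measurable (fun a => ∏' i, f i a) := by
  refine measurable_of_tendsto_metrizable' (Filter.atTop : Filter (Finset ι)) (f := fun S a => ∏ i ∈ S, f i a) ?_ ?_
  · intro S; exact Finset.measurable_fun_prod _ fun i _ => hf i
  · rw [tendsto_pi_nhds]; intro a; exact (h a).hasProd

theorem summable_primes_rpow {r : ℝ} (hr : r < -1) : Summable (fun p : Nat.Primes => (p:ℝ) ^ r) :=
  (Nat.Primes.summable_rpow).mpr hr

/-- The local factor weighting the ramified primes. -/
def bet (p : ℕ) (u z : ℂ) : ℂ := 1 + po p (2 * u) * (1 - po p (2 * z)) / (1 - po p (u + z)) ^ 2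

/-- The multiplicative weight `∏_{p ∣ N} β_p`. -/
def betaN (u z : ℂ) (N : ℕ) : ℂ := ∏ p ∈ N.primeFactors, bet p u z

/-- The local factor of the correction series attached to a sign `c`. -/
def ellp (p : ℕ) (c : ℂ) (u z : ℂ) : ℂ :=
  (1 - po p (u + z)) ^ 2 * (1 - c * (p:ℂ) ^ (-(1 / 2) : ℂ) * po p (u + z)) /
    ((1 - po p (2 * z)) * (1 - po p (2 * u))) + c * (p:ℂ) ^ (-(1 / 2) : ℂ) * po p (u + z)

/-- The correction factor `M_d(u, z)`, symmetric in `u` and `z` and equal to `1` on the diagonal. -/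
def Mfun (d : ℕ) (u z : ℂ) : ℂ := ∏' p : Nat.Primes, ellp p (chi8 d p) u z

theorem ellp_symm (p : ℕ) (c u z : ℂ) : ellp p c u z = ellp p c z u := by
  unfold ellp; rw [add_comm u z, mul_comm (1 - po p (2 * z))]

theorem Mfun_symm (d : ℕ) (u z : ℂ) : Mfun d u z = Mfun d z u := by
  unfold Mfun; simp_rw [ellp_symm _ _ u z]

theorem norm_po_lt {p : ℕ} (hp : p.Prime) {s : ℂ} (hs : 1 ≤ s.re) : ‖po p s‖ ≤ 1 / 3 := by
  unfold po; split_ifs with h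
  · simp
  · rw [norm_natCast_cpow_of_pos hp.pos, neg_re]
    have h3 : (3:ℝ) ≤ p := by
      have := hp.two_le
      exact_mod_cast (by omega : 3 ≤ p)
    calc (p:ℝ) ^ (-s.re) ≤ (p:ℝ) ^ (-1:ℝ) := by
          apply Real.rpow_le_rpow_of_exponent_le (by linarith) (by linarith)
      _ = 1 / p := by rw [Real.rpow_neg_one, one_div]
      _ ≤ 1 / 3 := by gcongr

theorem norm_one_sub_ge {x : ℂ} {r : ℝ} (h : ‖x‖ ≤ r) : 1 - r ≤ ‖1 - x‖ := by
  have := norm_sub_norm_le (1:ℂ) x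
  simp at this; linarith

theorem norm_p_half_le {p : ℕ} (hp : p.Prime) : ‖(p:ℂ) ^ (-(1 / 2) : ℂ)‖ ≤ 1 := by
  rw [norm_natCast_cpow_of_pos hp.pos]
  apply Real.rpow_le_one_of_one_le_of_nonpos
  · exact_mod_cast hp.one_lt.le
  · norm_num

theorem ellp_diag {p : ℕ} (hp : p.Prime) (c : ℂ) {u : ℂ} (hu : 1 ≤ u.re) : ellp p c u u = 1 := by
  have h := norm_one_sub_ge (norm_po_lt hp (s := 2 * u) (by simp; linarith))
  have h0 : 1 - po p (2 * u) ≠ 0 := by intro h'; rw [h'] at h; norm_num at h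
  unfold ellp
  rw [show u + u = 2 * u by ring]
  field_simp
  ring

theorem Mfun_diag (d : ℕ) {u : ℂ} (hu : 1 ≤ u.re) : Mfun d u u = 1 := by
  unfold Mfun
  rw [tprod_congr fun p : Nat.Primes => ellp_diag p.2 _ hu, tprod_one]

theorem norm_ellp_sub_one_le {p : ℕ} (hp : p.Prime) {c : ℂ} (hc : ‖c‖ ≤ 1) {u z : ℂ} (hu : 1 ≤ u.re)
    (hz : 1 ≤ z.re) : ‖ellp p c u z - 1‖ ≤ 30 * (p:ℝ) ^ (-2:ℝ) := by
  have hp1 : (1:ℝ) ≤ p := by exact_mod_cast hp.one_lt.le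
  have bnd : ∀ s : ℂ, 2 ≤ s.re → ‖po p s‖ ≤ (p:ℝ) ^ (-2:ℝ) := fun s hs =>
    (norm_po_le hp s).trans (Real.rpow_le_rpow_of_exponent_le hp1 (by linarith))
  have ht := bnd (u + z) (by simp; linarith)
  have hy := bnd (2 * u) (by simp; linarith)
  have hq := bnd (2 * z) (by simp; linarith)
  have ht3 := norm_po_lt hp (s := u + z) (by simp; linarith)
  have hy3 := norm_po_lt hp (s := 2 * u) (by simp; linarith)
  have hq3 := norm_po_lt hp (s := 2 * z) (by simp; linarith)
  have ha : ‖c * (p:ℂ) ^ (-(1 / 2) : ℂ)‖ ≤ 1 := by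
    rw [norm_mul]; exact mul_le_one₀ hc (norm_nonneg _) (norm_p_half_le hp)
  unfold ellp
  generalize po p (u + z) = t at *
  generalize po p (2 * u) = y at *
  generalize po p (2 * z) = q at *
  generalize c * (p:ℂ) ^ (-(1 / 2) : ℂ) = a at *
  generalize (p:ℝ) ^ (-2:ℝ) = r at *
  have hq' := norm_one_sub_ge hq3
  have hy' := norm_one_sub_ge hy3
  have hq0 : 1 - q ≠ 0 := by intro h'; rw [h'] at hq'; norm_num at hq'
  have hy0 : 1 - y ≠ 0 := by intro h'; rw [h'] at hy'; norm_num at hy'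
  have e : (1 - t) ^ 2 * (1 - a * t) / ((1 - q) * (1 - y)) + a * t - 1 =
      (t * (-2 + t - a * (1 - t) ^ 2) + q + y * (1 - q)) / ((1 - q) * (1 - y)) + a * t := by
    field_simp; ring
  rw [e]
  have hat : ‖a * t‖ ≤ r := by
    rw [norm_mul]; nlinarith [norm_nonneg t, norm_nonneg a]
  have h1t : ‖1 - t‖ ≤ 4 / 3 := by
    refine (norm_sub_le _ _).trans ?_; simp; linarith
  have h1q : ‖1 - q‖ ≤ 4 / 3 := by
    refine (norm_sub_le _ _).trans ?_; simp; linarith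
  have hr0 : 0 ≤ r := (norm_nonneg _).trans ht
  have hb1 : ‖-2 + t - a * (1 - t) ^ 2‖ ≤ 5 := by
    calc _ ≤ ‖(-2:ℂ)‖ + ‖t‖ + ‖a‖ * ‖1 - t‖ ^ 2 := by
          refine (norm_sub_le _ _).trans (add_le_add (norm_add_le _ _) ?_)
          rw [norm_mul, norm_pow]
      _ ≤ 2 + 1 / 3 + 1 * (4 / 3) ^ 2 := by gcongr; simp
      _ ≤ 5 := by norm_num
  have hnum : ‖t * (-2 + t - a * (1 - t) ^ 2) + q + y * (1 - q)‖ ≤ 8 * r := by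
    calc _ ≤ ‖t‖ * ‖-2 + t - a * (1 - t) ^ 2‖ + ‖q‖ + ‖y‖ * ‖1 - q‖ := by
          refine (norm_add_le _ _).trans (add_le_add ((norm_add_le _ _).trans (add_le_add ?_ le_rfl)) ?_)
          · rw [norm_mul]
          · rw [norm_mul]
      _ ≤ r * 5 + r + r * (4 / 3) := by gcongr
      _ ≤ 8 * r := by linarith
  have hden : 4 / 9 ≤ ‖(1 - q) * (1 - y)‖ := by
    rw [norm_mul]; nlinarith
  calc _ ≤ 8 * r / (4 / 9) + r := by
        refine (norm_add_le _ _).trans (add_le_add ?_ hat)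
        rw [norm_div]
        gcongr
    _ ≤ 30 * r := by linarith

theorem summable_thirty : Summable (fun p : Nat.Primes => 30 * (p:ℝ) ^ (-2:ℝ)) :=
  (summable_primes_rpow (by norm_num)).mul_left _

theorem hasProd_Mfun (d : ℕ) {u z : ℂ} (hu : 1 ≤ u.re) (hz : 1 ≤ z.re) :
    HasProd (fun p : Nat.Primes => ellp p (chi8 d p) u z) (Mfun d u z) :=
  (norm_tprod_le summable_thirty fun p => norm_ellp_sub_one_le p.2 (norm_chi8_le d p) hu hz).1.hasProd

theorem exists_norm_Mfun_le : ∃ C : ℝ, 0 < C ∧ ∀ (d : ℕ) (u z : ℂ), 1 ≤ u.re → 1 ≤ z.re →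
    ‖Mfun d u z‖ ≤ C :=
  ⟨_, Real.exp_pos _, fun d _ _ hu hz =>
    (norm_tprod_le summable_thirty fun p => norm_ellp_sub_one_le p.2 (norm_chi8_le d p) hu hz).2⟩

theorem differentiable_po {p : ℕ} (hp : p.Prime) : Differentiable ℂ (po p) := by
  unfold po
  split_ifs
  · fun_prop
  · intro s
    apply DifferentiableAt.const_cpow (by fun_prop)
    left; exact_mod_cast hp.ne_zero

theorem differentiableOn_Mfun (d : ℕ) {f g : ℂ → ℂ} {U : Set ℂ} (hU : IsOpen U)
    (hf : DifferentiableOn ℂ f U) (hg : DifferentiableOn ℂ g U) (hf1 : ∀ x ∈ U, 1 ≤ (f x).re)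
    (hg1 : ∀ x ∈ U, 1 ≤ (g x).re) : DifferentiableOn ℂ (fun x => Mfun d (f x) (g x)) U := by
  refine differentiableOn_tprod summable_thirty hU (fun p => ?_)
    fun p x hx => norm_ellp_sub_one_le p.2 (norm_chi8_le d p) (hf1 x hx) (hg1 x hx)
  have hpo := differentiable_po p.2
  have h1 : DifferentiableOn ℂ (fun x => po p (f x + g x)) U := hpo.comp_differentiableOn (hf.add hg)
  have h2 : DifferentiableOn ℂ (fun x => po p (2 * f x)) U := hpo.comp_differentiableOn (hf.const_mul 2)
  have h3 : DifferentiableOn ℂ (fun x => po p (2 * g x)) U := hpo.comp_differentiableOn (hg.const_mul 2)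
  unfold ellp
  refine DifferentiableOn.add (DifferentiableOn.div (((h1.const_sub 1).pow 2).mul
    ((h1.const_mul _).const_sub 1)) ((h3.const_sub 1).mul (h2.const_sub 1)) ?_) (h1.const_mul _)
  intro x hx
  refine mul_ne_zero ?_ ?_
  · have h := norm_one_sub_ge (norm_po_lt p.2 (s := 2 * g x) (by have := hg1 x hx; simp; linarith))
    intro h'; rw [h'] at h; norm_num at h
  · have h := norm_one_sub_ge (norm_po_lt p.2 (s := 2 * f x) (by have := hf1 x hx; simp; linarith))
    intro h'; rw [h'] at h; norm_num at h

theorem measurable_Mfun (d : ℕ) {α : Type*} [MeasurableSpace α] {f g : α → ℂ} (hf : Measurable f)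
    (hg : Measurable g) (hf1 : ∀ x, 1 ≤ (f x).re) (hg1 : ∀ x, 1 ≤ (g x).re) :
    Measurable (fun x => Mfun d (f x) (g x)) := by
  refine measurable_tprod_of_multipliable (fun p => ?_)
    fun x => (hasProd_Mfun d (hf1 x) (hg1 x)).multipliable
  have hpo : Measurable (po p) := (differentiable_po p.2).continuous.measurable
  unfold ellp
  have h1 : Measurable (fun x => po p (f x + g x)) := hpo.comp (hf.add hg)
  have h2 : Measurable (fun x => po p (2 * f x)) := hpo.comp (hf.const_mul 2)
  have h3 : Measurable (fun x => po p (2 * g x)) := hpo.comp (hg.const_mul 2)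
  fun_prop

theorem hasProd_squarefree {f : ℕ → ℂ} (h1 : f 1 = 1)
    (hmul : ∀ m n, f (m * n) = f m * f n) (hsum : Summable (fun n => ‖f n‖)) :
    HasProd (fun p : Nat.Primes => 1 + f p) (∑' n, if Squarefree n then f n else 0) := by
  have hs : Summable (fun n => ‖if Squarefree n then f n else 0‖) := by
    refine Summable.of_nonneg_of_le (fun _ => norm_nonneg _) (fun n => ?_) hsum
    split_ifs <;> simp
  have := EulerProduct.eulerProduct_hasProd (f := fun n => if Squarefree n then f n else 0) (by simp [h1]) ?_ hs (by simp)
  · refine this.congr_fun fun p => ?_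
    rw [tsum_eq_sum (s := {0, 1})]
    · rw [Finset.sum_pair (by norm_num)]
      simp [h1, p.2.squarefree]
    · intro e he
      have he2 : 2 ≤ e := by simp at he; omega
      rw [if_neg]
      intro hsq
      have := (Nat.squarefree_pow_iff p.2.one_lt.ne' (by omega)).mp hsq
      omega
  · intro m n hmn
    simp only [Nat.squarefree_mul hmn]
    by_cases h1 : Squarefree m <;> by_cases h2 : Squarefree n <;> simp [h1, h2, hmul]

theorem prod_primeFactors_mul {m n : ℕ} (h : Nat.Coprime m n) (g : ℕ → ℂ) :
    ∏ p ∈ (m * n).primeFactors, g p = (∏ p ∈ m.primeFactors, g p) * ∏ p ∈ n.primeFactors, g p := by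
  rw [h.primeFactors_mul, Finset.prod_union h.disjoint_primeFactors]

theorem hasProd_twisted {χ g : ℕ → ℂ} (h0 : χ 0 = 0) (h1 : χ 1 = 1)
    (hmul : ∀ m n, χ (m * n) = χ m * χ n)
    (hsum : Summable (fun n => ‖χ n * ∏ p ∈ n.primeFactors, g p‖))
    (hlt : ∀ p : Nat.Primes, ‖χ p‖ < 1) :
    HasProd (fun p : Nat.Primes => 1 + g p * (χ p / (1 - χ p)))
      (∑' n, χ n * ∏ p ∈ n.primeFactors, g p) := by
  have hpow : ∀ p e, χ (p ^ e) = χ p ^ e := by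
    intro p e
    induction e with
    | zero => simp [h1]
    | succ e ih => rw [pow_succ, hmul, ih, pow_succ]
  have := EulerProduct.eulerProduct_hasProd (f := fun n => χ n * ∏ p ∈ n.primeFactors, g p) (by simp [h1]) ?_ hsum (by simp [h0])
  · refine this.congr_fun fun p => ?_
    have hgeo := hasSum_geometric_of_norm_lt_one (hlt p)
    have hs : HasSum (fun e : ℕ => χ p ^ (e + 1) * g p) (g p * (χ p / (1 - χ p))) := by
      have := (hgeo.mul_left (g p * χ p))
      refine (this.congr_fun fun e => ?_).trans_eq ?_
      · ring
      · rw [div_eq_mul_inv]; ring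
    have hs2 : HasSum (fun e : ℕ => χ ((p:ℕ) ^ e) * ∏ q ∈ ((p:ℕ) ^ e).primeFactors, g q)
        (1 + g p * (χ p / (1 - χ p))) := by
      rw [← hasSum_nat_add_iff' 1]
      simp only [Finset.range_one, Finset.sum_singleton, pow_zero, h1, Nat.primeFactors_one,
        Finset.prod_empty, mul_one, add_sub_cancel_left]
      refine hs.congr_fun fun e => ?_
      rw [Nat.primeFactors_prime_pow (by omega) p.2, Finset.prod_singleton, hpow]
    exact hs2.tsum_eq.symm
  · intro m n hmn
    simp only [hmul, prod_primeFactors_mul hmn]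
    ring

theorem norm_natCast_cpow_le (n : ℕ) {s : ℂ} (hs : s.re ≠ 0) : ‖(n:ℂ) ^ (-s)‖ = (n:ℝ) ^ (-s.re) := by
  rw [norm_natCast_cpow_of_re_ne_zero n (by simpa using hs), neg_re]

theorem natCast_mul_cpow (m n : ℕ) (s : ℂ) : ((m * n : ℕ) : ℂ) ^ s = (m:ℂ) ^ s * (n:ℂ) ^ s := by
  push_cast; exact natCast_mul_natCast_cpow m n s

/-- The L-function of `psiN N`, with the convention `0` for `N = 0`. -/
def LpsiN (N : ℕ) (u : ℂ) : ℂ :=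
  if h : N = 0 then 0 else (haveI : NeZero N := ⟨h⟩; ZMod.LFunction (psiN N) u)

theorem summable_norm_mul_cpow {c : ℕ → ℂ} {B : ℝ} (hc : ∀ n, ‖c n‖ ≤ B) {s : ℂ} (hs : 1 < s.re) :
    Summable (fun n : ℕ => ‖c n * (n:ℂ) ^ (-s)‖) := by
  have : Summable (fun n : ℕ => B * (n:ℝ) ^ (-s.re)) :=
    (Real.summable_nat_rpow.mpr (by linarith)).mul_left B
  refine Summable.of_nonneg_of_le (fun _ => norm_nonneg _) (fun n => ?_) this
  rw [norm_mul, norm_natCast_cpow_le n (by linarith)]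
  gcongr
  exact hc n

theorem LFunction_psiN_factor {N : ℕ} [NeZero N] {u : ℂ} (hu : 1 < u.re) :
    ZMod.LFunction (psiN N) u =
      (∑' d : ℕ, if Squarefree d then psiN N (d : ZMod (2 * N)) * (d:ℂ) ^ (-u) else 0) *
        (zo (2 * u) * ∏ p ∈ N.primeFactors, (1 - po p (2 * u))) := by
  set f : ℕ → ℂ := fun n => psiN N (n : ZMod (2 * N)) * (n:ℂ) ^ (-u) with hf
  have h0 : f 0 = 0 := by simp [hf, psiN_zero]
  have h1 : f 1 = 1 := by
    have := psiN_natCast (N := N) 1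
    simp only [hf]; rw [this]; simp
  have hmul : ∀ m n, f (m * n) = f m * f n := by
    intro m n
    simp only [hf]
    rw [psiN_natCast, psiN_natCast, psiN_natCast, natCast_mul_cpow]
    by_cases hm : Odd m
    · by_cases hn : Odd n
      · rw [if_pos hm, if_pos hn, if_pos (hm.mul hn)]
        push_cast
        rw [jacobiSym.mul_left]; push_cast; ring
      · rw [if_neg hn, if_neg (fun h => hn (Nat.odd_mul.mp h).2)]; ring
    · rw [if_neg hm, if_neg (fun h => hm (Nat.odd_mul.mp h).1)]; ring
  have hsum : Summable (fun n => ‖f n‖) := summable_norm_mul_cpow (fun n => norm_psiN_le N _) hu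
  have hL : ZMod.LFunction (psiN N) u = ∑' n, f n := by
    rw [ZMod.LFunction_eq_LSeries _ hu, LSeries]
    apply tsum_congr
    intro n
    rcases Nat.eq_zero_or_pos n with rfl | hn
    · simp [h0]
    · rw [LSeries.term_of_ne_zero hn.ne']
      simp only [hf]
      rw [cpow_neg, div_eq_mul_inv]
  rw [hL]
  have hP1 := hasProd_completely_multiplicative h0 h1 hmul hsum
  have hP2 := hasProd_squarefree h1 hmul hsum
  have hP3 := hasProd_zo (s := 2 * u) (by simp; linarith)
  have hP4 := hasProd_finset_primes N.primeFactors (fun p hp => Nat.prime_of_mem_primeFactors hp) (fun p => 1 - po p (2 * u))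
  have hP5 := hP2.mul (hP3.mul hP4)
  refine hP1.unique (hP5.congr_fun fun p => ?_)
  have hlt : ‖f p‖ < 1 := by
    have h2 : ‖f p‖ ≤ (p:ℝ) ^ (-u.re) := by
      simp only [hf]
      rw [norm_mul, norm_natCast_cpow_le _ (by linarith)]
      calc _ ≤ 1 * (p:ℝ) ^ (-u.re) := by gcongr; exact norm_psiN_le N _
        _ = _ := one_mul _
    refine h2.trans_lt (Real.rpow_lt_one_of_one_lt_of_neg ?_ (by linarith))
    exact_mod_cast p.2.one_lt
  have hne1 : 1 - f p ≠ 0 := by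
    intro h; rw [← sub_eq_zero.mp h] at hlt; simp at hlt
  have hne2 : 1 + f p ≠ 0 := by
    intro h; rw [(by linear_combination h : f p = -1)] at hlt; simp at hlt
  have hpo1 := norm_one_sub_ge (norm_po_lt p.2 (s := 2 * u) (by simp; linarith))
  have hpo0 : 1 - po p (2 * u) ≠ 0 := by intro h'; rw [h'] at hpo1; norm_num at hpo1
  have key : f p ^ 2 = if (p:ℕ) ∈ N.primeFactors then 0 else po p (2 * u) := by
    simp only [hf]
    rw [psiN_natCast]
    by_cases hp2 : (p:ℕ) = 2
    · have : ¬ Odd (p:ℕ) := by rw [hp2]; decide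
      rw [if_neg this, po, if_pos hp2]; simp
    · have hodd : Odd (p:ℕ) := p.2.odd_of_ne_two hp2
      rw [if_pos hodd, mul_pow]
      split_ifs with hmem
      · have hdvd := (Nat.mem_primeFactors.mp hmem).2.1
        have : jacobiSym (p:ℕ) N = 0 := by
          rw [jacobiSym.eq_zero_iff_not_coprime]
          intro hg
          rw [Int.gcd_natCast_natCast] at hg
          exact (Nat.Prime.coprime_iff_not_dvd p.2).mp hg hdvd
        rw [this]; simp
      · have hcop : Nat.Coprime (p:ℕ) N := by
          rw [Nat.Prime.coprime_iff_not_dvd p.2]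
          intro hd; exact hmem (Nat.mem_primeFactors.mpr ⟨p.2, hd, NeZero.ne N⟩)
        rw [norm_jacobiSym_sq (by rw [Int.gcd_natCast_natCast]; exact hcop), one_mul, po, if_neg hp2,
          ← cpow_nat_mul]
        congr 1; push_cast; ring
  have : (1 - po p (2 * u))⁻¹ * (if (p:ℕ) ∈ N.primeFactors then 1 - po p (2 * u) else 1) = (1 - f p ^ 2)⁻¹ := by
    rw [key]; split_ifs
    · rw [inv_mul_cancel₀ hpo0]; simp
    · simp
  rw [this, show 1 - f p ^ 2 = (1 - f p) * (1 + f p) by ring, mul_inv]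
  field_simp

theorem chi8_mul (d m n : ℕ) : chi8 d (m * n) = chi8 d m * chi8 d n := by
  unfold chi8
  by_cases hm : Odd m
  · by_cases hn : Odd n
    · have : NeZero m := ⟨by rintro rfl; simp at hm⟩
      have : NeZero n := ⟨by rintro rfl; simp at hn⟩
      rw [if_pos hm, if_pos hn, if_pos (hm.mul hn), jacobiSym.mul_right]
      push_cast; ring
    · rw [if_neg hn, if_neg (fun h => hn (Nat.odd_mul.mp h).2)]; ring
  · rw [if_neg hm, if_neg (fun h => hm (Nat.odd_mul.mp h).1)]; ring

theorem chi8_zero (d : ℕ) : chi8 d 0 = 0 := by simp [chi8]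

theorem chi8_one (d : ℕ) : chi8 d 1 = 1 := by simp [chi8]

theorem prod_primeFactors_le {n : ℕ} (hn : n ≠ 0) {g : ℕ → ℂ} {A : ℕ} (hg : ∀ p ∈ n.primeFactors, ‖g p‖ ≤ (p:ℝ) ^ A) :
    ‖∏ p ∈ n.primeFactors, g p‖ ≤ (n:ℝ) ^ A := by
  rw [norm_prod]
  calc _ ≤ ∏ p ∈ n.primeFactors, (p:ℝ) ^ A := Finset.prod_le_prod (fun _ _ => norm_nonneg _) hg
    _ = ((∏ p ∈ n.primeFactors, p : ℕ) : ℝ) ^ A := by rw [Finset.prod_pow]; push_cast; rfl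
    _ ≤ (n:ℝ) ^ A := by
      gcongr
      exact Nat.le_of_dvd (Nat.pos_of_ne_zero hn) (Nat.prod_primeFactors_dvd n)

theorem norm_bet_le {p : ℕ} (hp : p.Prime) {u z : ℂ} (hu : 1 ≤ u.re) (hz : 1 ≤ z.re) :
    ‖bet p u z‖ ≤ 2 := by
  have ht := norm_po_lt hp (s := u + z) (by simp; linarith)
  have hy := norm_po_lt hp (s := 2 * u) (by simp; linarith)
  have hq := norm_po_lt hp (s := 2 * z) (by simp; linarith)
  have ht' := norm_one_sub_ge ht
  have hq' : ‖1 - po p (2 * z)‖ ≤ 4 / 3 := by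
    refine (norm_sub_le _ _).trans ?_; simp; linarith
  unfold bet
  calc _ ≤ 1 + ‖po p (2 * u)‖ * ‖1 - po p (2 * z)‖ / ‖1 - po p (u + z)‖ ^ 2 := by
        refine (norm_add_le _ _).trans ?_
        rw [norm_div, norm_mul, norm_pow]; simp
    _ ≤ 1 + (1 / 3) * (4 / 3) / (1 - 1 / 3) ^ 2 := by gcongr
    _ ≤ 2 := by norm_num

theorem tsum_chi8_mul_Mfun {u ζ : ℂ} (hu : 3 / 2 ≤ u.re) (hζ : 6 ≤ ζ.re) :
    ∑' d : ℕ, (if Odd d ∧ Squarefree d then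
      (d:ℂ) ^ (-u) * (∑' n : ℕ, chi8 d n * (n:ℂ) ^ (-(1 / 2 + ζ))) * Mfun d u (u + ζ) else 0) =
    zo (2 * (u + ζ)) / zo (2 * u + ζ) ^ 2 *
      ∑' N : ℕ, (if Odd N then (N:ℂ) ^ (-(1 / 2 + ζ)) * betaN u (u + ζ) N * (jacobiSym 2 N : ℂ) *
        LpsiN N u else 0) := by
  set z := u + ζ with hz
  set s := 1 / 2 + ζ with hs
  have hz1 : 1 ≤ z.re := by rw [hz, add_re]; linarith
  have hu1 : 1 ≤ u.re := by linarith
  have hsre : s.re = 1 / 2 + ζ.re := by rw [hs]; simp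
  have hw : 1 < (2 * u + ζ).re := by simp; linarith
  have huz : u + z = 2 * u + ζ := by rw [hz]; ring
  -- the coefficient attached to `N`
  set a : ℕ → ℂ := fun N => (N:ℂ) ^ (-s) * ∏ p ∈ N.primeFactors, (bet p u z * (1 - po p (2 * u))) with ha
  have hanorm : ∀ N : ℕ, ‖a N‖ ≤ (N:ℝ) ^ (-(4:ℝ)) := by
    intro N
    rcases Nat.eq_zero_or_pos N with rfl | hN
    · simp only [ha]
      rw [Nat.cast_zero, zero_cpow (by intro h; have := congrArg re h; simp at this; linarith)]
      simp
    · have hN1 : (1:ℝ) ≤ N := by exact_mod_cast hN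
      simp only [ha]
      rw [norm_mul, norm_natCast_cpow_le N (by linarith)]
      have h2 : ‖∏ p ∈ N.primeFactors, (bet p u z * (1 - po p (2 * u)))‖ ≤ (N:ℝ) ^ 2 := by
        apply prod_primeFactors_le hN.ne'
        intro p hp
        have hpp := Nat.prime_of_mem_primeFactors hp
        have h3 : ‖1 - po p (2 * u)‖ ≤ 2 := by
          refine (norm_sub_le _ _).trans ?_
          have := norm_po_lt hpp (s := 2 * u) (by simp; linarith)
          simp; linarith
        have h4 := norm_bet_le hpp hu1 hz1
        have h5 : (2:ℝ) ≤ p := by exact_mod_cast hpp.two_le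
        rw [norm_mul]
        nlinarith [norm_nonneg (bet p u z), norm_nonneg (1 - po p (2 * u))]
      calc _ ≤ (N:ℝ) ^ (-s.re) * (N:ℝ) ^ 2 := by gcongr
        _ = (N:ℝ) ^ (-s.re + 2) := by
          rw [Real.rpow_add (by linarith)]; norm_cast
        _ ≤ _ := Real.rpow_le_rpow_of_exponent_le hN1 (by linarith)
  have hasum : Summable (fun N => ‖a N‖) :=
    Summable.of_nonneg_of_le (fun _ => norm_nonneg _) hanorm (Real.summable_nat_rpow.mpr (by norm_num))
  set b : ℕ → ℂ := fun d => if Odd d ∧ Squarefree d then (d:ℂ) ^ (-u) else 0 with hb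
  have hbsum : Summable (fun d => ‖b d‖) := by
    refine Summable.of_nonneg_of_le (fun _ => norm_nonneg _) (fun d => ?_)
      (Real.summable_nat_rpow.mpr (by linarith : -u.re < -1))
    simp only [hb]
    split_ifs
    · rw [norm_natCast_cpow_le d (by linarith)]
    · simp; positivity
  -- the sum over `N`
  have hR : ∀ N : ℕ, (if Odd N then (N:ℂ) ^ (-s) * betaN u z N * (jacobiSym 2 N : ℂ) * LpsiN N u else 0) =
      ∑' d : ℕ, zo (2 * u) * (b d * (chi8 d N * a N)) := by
    intro N
    split_ifs with hN
    · have hN0 : N ≠ 0 := by rintro rfl; simp at hN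
      have : NeZero N := ⟨hN0⟩
      rw [LpsiN, dif_neg hN0, LFunction_psiN_factor (by linarith), ← tsum_mul_right, ← tsum_mul_left]
      apply tsum_congr
      intro d
      rw [psiN_natCast]
      simp only [hb, ha, betaN]
      by_cases hd : Squarefree d
      · by_cases hdo : Odd d
        · rw [if_pos hd, if_pos hdo, if_pos ⟨hdo, hd⟩, chi8, if_pos hN, jacobiSym.mul_left,
            jacobiSym_eight hN, ← jacobiSym.at_two hN, Finset.prod_mul_distrib]
          push_cast; ring
        · rw [if_pos hd, if_neg hdo, if_neg (fun h => hdo h.1)]; ring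
      · rw [if_neg hd, if_neg (fun h => hd h.2)]; ring
    · have : ∀ d, chi8 d N = 0 := fun d => by rw [chi8, if_neg hN]
      simp [this]
  rw [tsum_congr hR]
  have hsum2 : Summable (fun x : ℕ × ℕ => zo (2 * u) * (b x.2 * (chi8 x.2 x.1 * a x.1))) := by
    apply Summable.mul_left
    apply Summable.of_norm
    refine Summable.of_nonneg_of_le (fun _ => norm_nonneg _) (fun x => ?_)
      (hasum.mul_of_nonneg hbsum (fun _ => norm_nonneg _) (fun _ => norm_nonneg _))
    rw [norm_mul, norm_mul]
    have := norm_chi8_le x.2 x.1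
    have h1 := norm_nonneg (b x.2)
    have h2 := norm_nonneg (a x.1)
    calc _ ≤ ‖b x.2‖ * (1 * ‖a x.1‖) := by gcongr
      _ = _ := by ring
  rw [← Summable.tsum_comm (f := fun N d => zo (2 * u) * (b d * (chi8 d N * a N))) hsum2, ← tsum_mul_left]
  apply tsum_congr
  intro d
  rw [tsum_mul_left, tsum_mul_left]
  simp only [hb]
  split_ifs with hd
  swap
  · simp
  -- the Euler product for fixed `d`
  set χ : ℕ → ℂ := fun n => chi8 d n * (n:ℂ) ^ (-s) with hχ
  have h0 : χ 0 = 0 := by simp [hχ, chi8_zero]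
  have h1 : χ 1 = 1 := by simp [hχ, chi8_one]
  have hmul : ∀ m n, χ (m * n) = χ m * χ n := by
    intro m n; simp only [hχ]; rw [chi8_mul, natCast_mul_cpow]; ring
  have hχs : Summable (fun n => ‖χ n‖) := summable_norm_mul_cpow (fun n => norm_chi8_le d n) (by linarith)
  have hlt : ∀ p : Nat.Primes, ‖χ p‖ < 1 := by
    intro p
    have h2 : ‖χ p‖ ≤ (p:ℝ) ^ (-s.re) := by
      simp only [hχ]
      rw [norm_mul, norm_natCast_cpow_le _ (by linarith)]
      calc _ ≤ 1 * (p:ℝ) ^ (-s.re) := by gcongr; exact norm_chi8_le d _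
        _ = _ := one_mul _
    refine h2.trans_lt (Real.rpow_lt_one_of_one_lt_of_neg ?_ (by linarith))
    exact_mod_cast p.2.one_lt
  have hae : ∀ N, chi8 d N * a N = χ N * ∏ p ∈ N.primeFactors, (bet p u z * (1 - po p (2 * u))) := by
    intro N; simp only [hχ, ha]; ring
  simp_rw [hae]
  have hE1 := hasProd_twisted (g := fun p => bet p u z * (1 - po p (2 * u))) h0 h1 hmul (by
    refine Summable.of_nonneg_of_le (fun _ => norm_nonneg _) (fun N => ?_) hasum
    rw [← hae, norm_mul]
    have := norm_chi8_le d N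
    nlinarith [norm_nonneg (a N)]) hlt
  have hE2 := hasProd_completely_multiplicative h0 h1 hmul hχs
  have hE3 := hasProd_Mfun d hu1 hz1
  have hZz := hasProd_zo (s := 2 * z) (by simp; linarith)
  have hZu := hasProd_zo (s := 2 * u) (by simp; linarith)
  have hZw := hasProd_zo hw
  have hleft := (hZz.mul hZu).mul hE1
  have hright := ((hZw.mul hZw).mul hE2).mul hE3
  have heq : zo (2 * z) * zo (2 * u) * ∑' n, χ n * ∏ p ∈ n.primeFactors, (bet p u z * (1 - po p (2 * u))) =
      zo (2 * u + ζ) * zo (2 * u + ζ) * (∑' n, χ n) * Mfun d u z := by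
    refine hleft.unique (hright.congr_fun fun p => ?_)
    have ht := norm_one_sub_ge (norm_po_lt p.2 (s := 2 * u + ζ) (by linarith))
    have hy := norm_one_sub_ge (norm_po_lt p.2 (s := 2 * u) (by simp; linarith))
    have hq := norm_one_sub_ge (norm_po_lt p.2 (s := 2 * z) (by simp; linarith))
    have hx : 1 - χ p ≠ 0 := by
      intro h; have := hlt p; rw [← sub_eq_zero.mp h] at this; simp at this
    have hxy : χ p * po p (2 * u) = chi8 d p * ((p:ℕ):ℂ) ^ (-(1 / 2) : ℂ) * po p (2 * u + ζ) := by
      simp only [hχ, po]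
      split_ifs
      · simp
      · have hp0 : ((p:ℕ):ℂ) ≠ 0 := by exact_mod_cast p.2.ne_zero
        rw [mul_assoc, mul_assoc, ← cpow_add _ _ hp0, ← cpow_add _ _ hp0]
        congr 2; rw [hs]; ring
    unfold ellp bet
    rw [huz, ← hxy]
    generalize po p (2 * u + ζ) = t at *
    generalize po p (2 * u) = y at *
    generalize po p (2 * z) = q at *
    generalize χ p = x at *
    have ht0 : 1 - t ≠ 0 := by intro h'; rw [h'] at ht; norm_num at ht
    have hy0 : 1 - y ≠ 0 := by intro h'; rw [h'] at hy; norm_num at hy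
    have hq0 : 1 - q ≠ 0 := by intro h'; rw [h'] at hq; norm_num at hq
    field_simp
    ring
  have hzw := zo_ne_zero hw
  rw [div_mul_eq_mul_div, eq_div_iff (pow_ne_zero 2 hzw)]
  linear_combination (-(d:ℂ) ^ (-u)) * heq

/-- The values of the Kronecker symbol `(k / ·)` on odd arguments. -/
def chk (k : ℤ) (n : ℕ) : ℂ := if Odd n then (jacobiSym k n : ℂ) else 0

theorem norm_chk_le (k : ℤ) (n : ℕ) : ‖chk k n‖ ≤ 1 := by
  unfold chk; split_ifs
  · exact norm_jacobiSym_le _ _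
  · simp

theorem chk_zero (k : ℤ) : chk k 0 = 0 := by simp [chk]

theorem chk_one (k : ℤ) : chk k 1 = 1 := by simp [chk]

theorem chk_mul (k : ℤ) (m n : ℕ) : chk k (m * n) = chk k m * chk k n := by
  unfold chk
  by_cases hm : Odd m
  · by_cases hn : Odd n
    · have : NeZero m := ⟨by rintro rfl; simp at hm⟩
      have : NeZero n := ⟨by rintro rfl; simp at hn⟩
      rw [if_pos hm, if_pos hn, if_pos (hm.mul hn), jacobiSym.mul_right]
      push_cast; ring
    · rw [if_neg hn, if_neg (fun h => hn (Nat.odd_mul.mp h).2)]; ring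
  · rw [if_neg hm, if_neg (fun h => hm (Nat.odd_mul.mp h).1)]; ring

theorem chk_mod (k : ℤ) (n : ℕ) : chk k (n % (4 * k.natAbs)) = chk k n := by
  unfold chk
  have h2 : Odd (n % (4 * k.natAbs)) ↔ Odd n := by
    rw [Nat.odd_iff, Nat.odd_iff, show 4 * k.natAbs = 2 * (2 * k.natAbs) by ring, Nat.mod_mul_right_mod]
  by_cases h : Odd n
  · rw [if_pos h, if_pos (h2.mpr h), ← jacobiSym.mod_right k h]
  · rw [if_neg h, if_neg (fun h' => h (h2.mp h'))]

/-- The quadratic character `(k / ·)` modulo `4|k|`. -/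
def chiK (k : ℤ) (hk : k ≠ 0) : DirichletCharacter ℂ (4 * k.natAbs) where
  toFun c := chk k c.val
  map_one' := by
    have : NeZero k.natAbs := ⟨by simpa using hk⟩
    have h1 : ((1 : ZMod (4 * k.natAbs))).val = 1 % (4 * k.natAbs) := by
      have := ZMod.val_natCast (4 * k.natAbs) 1
      simpa using this
    rw [h1, chk_mod, chk_one]
  map_mul' a b := by
    have : NeZero k.natAbs := ⟨by simpa using hk⟩
    rw [ZMod.val_mul, chk_mod, chk_mul]
  map_nonunit' a ha := by
    have : NeZero k.natAbs := ⟨by simpa using hk⟩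
    have hc : ¬ Nat.Coprime a.val (4 * k.natAbs) := by
      intro h
      apply ha
      have := (ZMod.isUnit_iff_coprime a.val (4 * k.natAbs)).mpr h
      simpa using this
    change chk k a.val = 0
    unfold chk
    split_ifs with hodd
    · have h4 : Nat.Coprime a.val 4 :=
        Nat.Coprime.pow_right (k := a.val) 2 (Nat.coprime_two_right.mpr hodd)
      have hc2 : ¬ Nat.Coprime a.val k.natAbs := fun h => hc (Nat.Coprime.mul_right h4 h)
      have : NeZero a.val := ⟨by intro h; rw [h] at hodd; simp at hodd⟩
      have : jacobiSym k a.val = 0 := by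
        rw [jacobiSym.eq_zero_iff_not_coprime]
        intro h
        apply hc2
        rw [Nat.coprime_comm]
        exact h
      rw [this]; simp
    · rfl

theorem chiK_natCast (k : ℤ) (hk : k ≠ 0) (n : ℕ) : chiK k hk (n : ZMod (4 * k.natAbs)) = chk k n := by
  change chk k ((n : ZMod (4 * k.natAbs)).val) = _
  rw [ZMod.val_natCast, chk_mod]

/-- `(s - 1) L(s, (k / ·))`, with the convention `0` for `k = 0`. -/
def polK (k : ℤ) (s : ℂ) : ℂ :=
  if h : k = 0 then 0 else
    (haveI : NeZero (4 * k.natAbs) := ⟨by simpa using h⟩; polL (chiK k h) s)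

theorem differentiable_polK (k : ℤ) : Differentiable ℂ (polK k) := by
  by_cases h : k = 0
  · have : polK k = fun _ => 0 := by funext s; rw [polK, dif_pos h]
    rw [this]; exact differentiable_const 0
  · have : NeZero (4 * k.natAbs) := ⟨by simpa using h⟩
    have e : polK k = polL (chiK k h) := by funext s; rw [polK, dif_neg h]
    rw [e]; exact differentiable_polL _

theorem polK_eq_tsum {k : ℤ} (hk : k ≠ 0) {s : ℂ} (hs : 1 < s.re) :
    polK k s = (s - 1) * ∑' n : ℕ, chk k n * (n:ℂ) ^ (-s) := by
  have : NeZero (4 * k.natAbs) := ⟨by simpa using hk⟩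
  rw [polK, dif_neg hk, polL_of_ne _ (by rintro rfl; simp at hs), ZMod.LFunction_eq_LSeries _ hs, LSeries]
  congr 1
  apply tsum_congr
  intro n
  rcases Nat.eq_zero_or_pos n with rfl | hn
  · simp [chk_zero]
  · rw [LSeries.term_of_ne_zero hn.ne', chiK_natCast, cpow_neg, div_eq_mul_inv]

/-- The Euler factor of the correction series at the unramified primes. -/
def eUnr (k : ℤ) (p : ℕ) (u ζ : ℂ) : ℂ :=
  (1 + chk k p * po p (3 * u + ζ) * (1 - chk k p * po p (u + ζ)) / (1 - po p (2 * u + ζ)) ^ 2) *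
    (1 - chk k p * po p (3 * u + ζ))

/-- The Euler factor of the correction series at the ramified primes. -/
def eRam (k : ℤ) (p : ℕ) (u ζ : ℂ) : ℂ :=
  (1 - po p (2 * (u + ζ)))⁻¹ * (1 + bet p u (u + ζ) *
    ∑ e ∈ Finset.Icc 1 (k.natAbs.factorization p + 1), GJ k (p ^ e) * ((p ^ e : ℕ):ℂ) ^ (-(1 / 2 + (u + ζ))))

/-- The correction series `E_k`. -/
def Ek (k : ℤ) (u ζ : ℂ) : ℂ :=
  (∏' p : Nat.Primes, eUnr k p u ζ) * ∏ p ∈ k.natAbs.primeFactors, eRam k p u ζ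

theorem norm_po_half {p : ℕ} (hp : p.Prime) {s : ℂ} (hs : 1 / 2 ≤ s.re) : ‖po p s‖ ≤ 29 / 50 := by
  unfold po; split_ifs with h
  · norm_num
  · rw [norm_natCast_cpow_of_pos hp.pos, neg_re]
    have h3 : (3:ℝ) ≤ p := by
      have := hp.two_le
      exact_mod_cast (by omega : 3 ≤ p)
    calc (p:ℝ) ^ (-s.re) ≤ (p:ℝ) ^ (-(1 / 2):ℝ) := by
          apply Real.rpow_le_rpow_of_exponent_le (by linarith) (by linarith)
      _ = (Real.sqrt p)⁻¹ := by rw [Real.rpow_neg (by positivity), ← Real.sqrt_eq_rpow]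
      _ ≤ (50 / 29)⁻¹ := by
          gcongr
          apply Real.le_sqrt_of_sq_le
          norm_num; linarith
      _ = 29 / 50 := by norm_num

theorem norm_eUnr_sub_one_le {k : ℤ} {p : ℕ} (hp : p.Prime) {η : ℝ} (hη : 0 < η) {u ζ : ℂ}
    (hu : u.re = -η) (hζ : 1 / 2 + 4 * η ≤ ζ.re) :
    ‖eUnr k p u ζ - 1‖ ≤ 32 * (p:ℝ) ^ (-1 - 2 * η) := by
  have hp1 : (1:ℝ) ≤ p := by exact_mod_cast hp.one_lt.le
  have hp0 : (0:ℝ) < p := by linarith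
  set r : ℝ := (p:ℝ) ^ (-(1 / 2) - η) with hr
  have hr0 : 0 ≤ r := by positivity
  have bnd : ∀ s : ℂ, 1 / 2 + η ≤ s.re → ‖po p s‖ ≤ r := fun s hs =>
    (norm_po_le hp s).trans (Real.rpow_le_rpow_of_exponent_le hp1 (by linarith))
  have hA0 := bnd (3 * u + ζ) (by simp; linarith)
  have hB0 := bnd (u + ζ) (by simp; linarith)
  have ht := bnd (2 * u + ζ) (by simp; linarith)
  have ht2 := norm_po_half hp (s := 2 * u + ζ) (by simp; linarith)
  have hB2 := norm_po_half hp (s := u + ζ) (by simp; linarith)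
  have hc := norm_chk_le k p
  have hr2 : (p:ℝ) ^ (-1 - 2 * η) = r * r := by
    rw [hr, ← Real.rpow_add hp0]; congr 1; ring
  rw [hr2]
  unfold eUnr
  have hA : ‖chk k p * po p (3 * u + ζ)‖ ≤ r := by
    rw [norm_mul]; nlinarith [norm_nonneg (chk k p), norm_nonneg (po p (3 * u + ζ))]
  have hB : ‖chk k p * po p (u + ζ)‖ ≤ r := by
    rw [norm_mul]; nlinarith [norm_nonneg (chk k p), norm_nonneg (po p (u + ζ))]
  have hB3 : ‖chk k p * po p (u + ζ)‖ ≤ 29 / 50 := by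
    rw [norm_mul]; nlinarith [norm_nonneg (chk k p), norm_nonneg (po p (u + ζ))]
  generalize chk k p * po p (3 * u + ζ) = A at *
  generalize chk k p * po p (u + ζ) = B at *
  generalize po p (2 * u + ζ) = t at *
  have h1t := norm_one_sub_ge ht2
  have h1t0 : 1 - t ≠ 0 := by intro h'; rw [h'] at h1t; norm_num at h1t
  have hT : ‖1 / (1 - t) ^ 2‖ ≤ 6 := by
    rw [norm_div, norm_pow, norm_one]
    calc 1 / ‖1 - t‖ ^ 2 ≤ 1 / (1 - 29 / 50) ^ 2 := by gcongr
      _ ≤ 6 := by norm_num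
  have h1B : ‖1 - B‖ ≤ 79 / 50 := by
    refine (norm_sub_le _ _).trans ?_; simp; linarith
  have h2t : ‖2 - t‖ ≤ 129 / 50 := by
    refine (norm_sub_le _ _).trans ?_; simp; linarith
  have e : (1 + A * (1 - B) / (1 - t) ^ 2) * (1 - A) - 1 =
      A * (t * (2 - t) * (1 / (1 - t) ^ 2) - B * (1 / (1 - t) ^ 2)) - A * A * ((1 - B) * (1 / (1 - t) ^ 2)) := by
    field_simp; ring
  rw [e]
  generalize 1 / (1 - t) ^ 2 = T at *
  calc _ ≤ ‖A‖ * (‖t‖ * ‖2 - t‖ * ‖T‖ + ‖B‖ * ‖T‖) + ‖A‖ * ‖A‖ * (‖1 - B‖ * ‖T‖) := by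
        refine (norm_sub_le _ _).trans (add_le_add ?_ ?_)
        · rw [norm_mul]
          gcongr
          refine (norm_sub_le _ _).trans ?_
          rw [norm_mul, norm_mul, norm_mul]
        · rw [norm_mul, norm_mul, norm_mul]
    _ ≤ r * (r * (129 / 50) * 6 + r * 6) + r * r * ((79 / 50) * 6) := by gcongr
    _ ≤ 32 * (r * r) := by nlinarith [mul_nonneg hr0 hr0]

theorem summable_eUnr_bound {η : ℝ} (hη : 0 < η) :
    Summable (fun p : Nat.Primes => 32 * (p:ℝ) ^ (-1 - 2 * η)) :=
  (summable_primes_rpow (by linarith)).mul_left _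

theorem norm_bet_le_of_neg {p : ℕ} (hp : p.Prime) {η : ℝ} (hη : 0 < η) {u ζ : ℂ}
    (hu : -η ≤ u.re) (hζ : 1 / 2 + 4 * η ≤ ζ.re) :
    ‖bet p u (u + ζ)‖ ≤ 1 + 10 * (p:ℝ) ^ (2 * η) := by
  have hp1 : (1:ℝ) ≤ p := by exact_mod_cast hp.one_lt.le
  have ht := norm_one_sub_ge (norm_po_half hp (s := u + (u + ζ)) (by simp; linarith))
  have hq : ‖1 - po p (2 * (u + ζ))‖ ≤ 79 / 50 := by
    refine (norm_sub_le _ _).trans ?_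
    have := norm_po_half hp (s := 2 * (u + ζ)) (by simp; linarith)
    simp; linarith
  have hy : ‖po p (2 * u)‖ ≤ (p:ℝ) ^ (2 * η) := by
    refine (norm_po_le hp _).trans (Real.rpow_le_rpow_of_exponent_le hp1 ?_)
    simp; linarith
  unfold bet
  have h0 : (0:ℝ) ≤ (p:ℝ) ^ (2 * η) := by positivity
  calc _ ≤ 1 + ‖po p (2 * u)‖ * ‖1 - po p (2 * (u + ζ))‖ / ‖1 - po p (u + (u + ζ))‖ ^ 2 := by
        refine (norm_add_le _ _).trans ?_
        rw [norm_div, norm_mul, norm_pow]; simp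
    _ ≤ 1 + (p:ℝ) ^ (2 * η) * (79 / 50) / (1 - 29 / 50) ^ 2 := by gcongr
    _ ≤ _ := by
        rw [mul_div_assoc, mul_comm 10]
        gcongr
        norm_num

theorem norm_eRam_le {k : ℤ} {p : ℕ} (hp : p.Prime) {η : ℝ} (hη : 0 < η) {u ζ : ℂ}
    (hu : u.re = -η) (hζ : 1 / 2 + 4 * η ≤ ζ.re) :
    ‖eRam k p u ζ‖ ≤ 40 * (k.natAbs.factorization p + 1) := by
  have hp1 : (1:ℝ) ≤ p := by exact_mod_cast hp.one_lt.le
  have hp0 : (0:ℝ) < p := by linarith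
  have hq := norm_one_sub_ge (norm_po_half hp (s := 2 * (u + ζ)) (by simp; linarith))
  have hb := norm_bet_le_of_neg hp hη hu.ge hζ
  set v := k.natAbs.factorization p
  have hsum : ‖∑ e ∈ Finset.Icc 1 (v + 1), GJ k (p ^ e) * ((p ^ e : ℕ):ℂ) ^ (-(1 / 2 + (u + ζ)))‖ ≤
      (v + 1) * (p:ℝ) ^ (-3 * η) := by
    calc _ ≤ ∑ e ∈ Finset.Icc 1 (v + 1), (p:ℝ) ^ (-3 * η) := by
          apply norm_sum_le_of_le
          intro e he
          have he1 : 1 ≤ e := (Finset.mem_Icc.mp he).1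
          have hpe : (0:ℝ) < ((p ^ e : ℕ):ℝ) := by exact_mod_cast pow_pos hp.pos e
          have hpe1 : (p:ℝ) ≤ ((p ^ e : ℕ):ℝ) := by
            exact_mod_cast Nat.le_self_pow (by omega) p
          rw [norm_mul, norm_natCast_cpow_of_pos (pow_pos hp.pos e)]
          calc _ ≤ ((p ^ e : ℕ):ℝ) * ((p ^ e : ℕ):ℝ) ^ (-1 - 3 * η) := by
                gcongr
                · exact norm_GJ_le k _
                · exact_mod_cast Nat.one_le_pow _ _ hp.pos
                · simp; linarith
            _ = ((p ^ e : ℕ):ℝ) ^ (-(3 * η)) := by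
                rw [show -(3 * η) = 1 + (-1 - 3 * η) by ring, Real.rpow_add hpe, Real.rpow_one]
            _ ≤ (p:ℝ) ^ (-(3 * η)) :=
                Real.rpow_le_rpow_of_nonpos hp0 hpe1 (by linarith)
            _ = _ := by congr 1; ring
      _ = _ := by simp
  unfold eRam
  have hmul : (1 + 10 * (p:ℝ) ^ (2 * η)) * (p:ℝ) ^ (-3 * η) ≤ 11 := by
    have h1 : (p:ℝ) ^ (-3 * η) ≤ 1 := Real.rpow_le_one_of_one_le_of_nonpos hp1 (by linarith)
    have h2 : (p:ℝ) ^ (2 * η) * (p:ℝ) ^ (-3 * η) ≤ 1 := by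
      rw [← Real.rpow_add hp0]
      exact Real.rpow_le_one_of_one_le_of_nonpos hp1 (by linarith)
    linarith
  rw [norm_mul, norm_inv]
  calc _ ≤ (1 - 29 / 50)⁻¹ * (1 + (1 + 10 * (p:ℝ) ^ (2 * η)) * ((v + 1) * (p:ℝ) ^ (-3 * η))) := by
        gcongr
        refine (norm_add_le _ _).trans ?_
        rw [norm_one, norm_mul]
        gcongr
    _ = (1 - 29 / 50)⁻¹ * (1 + (v + 1) * ((1 + 10 * (p:ℝ) ^ (2 * η)) * (p:ℝ) ^ (-3 * η))) := by ring
    _ ≤ (1 - 29 / 50)⁻¹ * (1 + (v + 1) * 11) := by gcongr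
    _ ≤ _ := by
      have : (0:ℝ) ≤ v := by positivity
      norm_num; linarith

theorem exists_prod_factorization_le (c : ℝ) (hc : 1 ≤ c) {ε : ℝ} (hε : 0 < ε) :
    ∃ C : ℝ, 1 ≤ C ∧ ∀ n : ℕ, n ≠ 0 →
      ∏ p ∈ n.primeFactors, c * (n.factorization p + 1) ≤ C * (n:ℝ) ^ ε := by
  obtain ⟨C0, hC0⟩ : ∃ C0 : ℝ, ∀ v : ℕ, c * (v + 1) ≤ C0 * ((2:ℝ) ^ ε) ^ v := by
    have h2 : (1:ℝ) < (2:ℝ) ^ ε := Real.one_lt_rpow (by norm_num) hε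
    set δ := (2:ℝ) ^ ε - 1 with hδ
    have hδ0 : 0 < δ := by linarith
    refine ⟨c * (1 + 1 / δ), fun v => ?_⟩
    have hb := one_add_mul_le_pow (a := δ) (by linarith) v
    rw [show 1 + δ = (2:ℝ) ^ ε by rw [hδ]; ring] at hb
    have h3 : (v:ℝ) + 1 ≤ (1 + 1 / δ) * (1 + v * δ) := by
      have : (1 + 1 / δ) * (1 + v * δ) = 1 + v + v * δ + 1 / δ := by field_simp; ring
      rw [this]
      have : 0 ≤ v * δ + 1 / δ := by positivity
      linarith
    calc c * (v + 1) ≤ c * ((1 + 1 / δ) * (1 + v * δ)) := by gcongr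
      _ ≤ c * ((1 + 1 / δ) * ((2:ℝ) ^ ε) ^ v) := by gcongr
      _ = _ := by ring
  set D := max C0 1
  have hD1 : 1 ≤ D := le_max_right _ _
  obtain ⟨P, hP⟩ : ∃ P : ℕ, ∀ p : ℕ, P ≤ p → 2 * c ≤ (p:ℝ) ^ ε := by
    have := ((tendsto_rpow_atTop hε).comp tendsto_natCast_atTop_atTop).eventually_ge_atTop (2 * c)
    obtain ⟨P, hP⟩ := eventually_atTop.mp this
    exact ⟨P, hP⟩
  refine ⟨D ^ P, one_le_pow₀ hD1, fun n hn => ?_⟩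
  have hn' : (n:ℝ) ^ ε = ∏ p ∈ n.primeFactors, ((p:ℝ) ^ ε) ^ (n.factorization p) := by
    conv_lhs => rw [← Nat.prod_factorization_pow_eq_self hn]
    rw [Finsupp.prod, Nat.support_factorization]
    push_cast
    rw [← Real.finsetProd_rpow _ _ (fun p _ => by positivity)]
    apply Finset.prod_congr rfl
    intro p _
    rw [← Real.rpow_natCast, ← Real.rpow_natCast, ← Real.rpow_mul (by positivity), ← Real.rpow_mul (by positivity), mul_comm]
  have hstep : ∀ p ∈ n.primeFactors, c * (n.factorization p + 1) ≤
      (if p < P then D else 1) * ((p:ℝ) ^ ε) ^ (n.factorization p) := by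
    intro p hp
    have hpp := Nat.prime_of_mem_primeFactors hp
    have hv : 1 ≤ n.factorization p := (hpp.dvd_iff_one_le_factorization hn).mp (Nat.dvd_of_mem_primeFactors hp)
    set v := n.factorization p
    split_ifs with h
    · calc _ ≤ C0 * ((2:ℝ) ^ ε) ^ v := hC0 v
        _ ≤ D * ((p:ℝ) ^ ε) ^ v := by
          gcongr
          · exact le_max_left _ _
          · exact_mod_cast hpp.two_le
    · rw [one_mul]
      have hv2 : (v:ℝ) + 1 ≤ 2 ^ v := by
        exact_mod_cast Nat.lt_two_pow_self
      calc c * (v + 1) ≤ c ^ v * 2 ^ v := by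
            gcongr
            exact le_self_pow₀ hc (by omega)
        _ = (2 * c) ^ v := by rw [mul_pow]; ring
        _ ≤ _ := by
          gcongr
          exact hP p (by omega)
  calc _ ≤ ∏ p ∈ n.primeFactors, (if p < P then D else 1) * ((p:ℝ) ^ ε) ^ (n.factorization p) :=
        Finset.prod_le_prod (fun _ _ => by positivity) hstep
    _ = (∏ p ∈ n.primeFactors, (if p < P then D else 1)) * (n:ℝ) ^ ε := by
        rw [Finset.prod_mul_distrib, hn']
    _ ≤ _ := by
        gcongr
        rw [Finset.prod_ite, Finset.prod_const, Finset.prod_const_one, mul_one]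
        apply pow_le_pow_right₀ hD1
        calc _ ≤ (Finset.range P).card := by
              apply Finset.card_le_card
              intro p hp
              simp at hp ⊢; omega
          _ = P := Finset.card_range P

theorem exists_norm_Ek_le {η : ℝ} (hη : 0 < η) {ε : ℝ} (hε : 0 < ε) :
    ∃ C : ℝ, 0 < C ∧ ∀ (k : ℤ), k ≠ 0 → ∀ u ζ : ℂ, u.re = -η → 1 / 2 + 4 * η ≤ ζ.re →
      ‖Ek k u ζ‖ ≤ C * (k.natAbs:ℝ) ^ ε := by
  obtain ⟨C, hC1, hC⟩ := exists_prod_factorization_le 40 (by norm_num) hε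
  refine ⟨Real.exp (∑' p : Nat.Primes, 32 * (p:ℝ) ^ (-1 - 2 * η)) * C, by positivity, fun k hk u ζ hu hζ => ?_⟩
  unfold Ek
  rw [norm_mul, norm_prod, mul_assoc]
  gcongr
  · exact (norm_tprod_le (summable_eUnr_bound hη) fun p => norm_eUnr_sub_one_le p.2 hη hu hζ).2
  · refine le_trans (Finset.prod_le_prod (fun _ _ => norm_nonneg _) fun p hp => ?_) (hC k.natAbs (by simpa using hk))
    exact norm_eRam_le (Nat.prime_of_mem_primeFactors hp) hη hu hζ

theorem one_sub_po_ne_zero {p : ℕ} (hp : p.Prime) {s : ℂ} (hs : 1 / 2 ≤ s.re) : 1 - po p s ≠ 0 := by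
  have h := norm_one_sub_ge (norm_po_half hp hs)
  intro h'; rw [h'] at h; norm_num at h

theorem differentiableAt_bet {p : ℕ} (hp : p.Prime) (u : ℂ) {ζ : ℂ} (h : 1 / 2 ≤ (2 * u + ζ).re) :
    DifferentiableAt ℂ (fun ζ => bet p u (u + ζ)) ζ := by
  have hpo := differentiable_po hp
  have h1 : DifferentiableAt ℂ (fun ζ => po p (2 * (u + ζ))) ζ := (hpo _).comp ζ (by fun_prop)
  have h2 : DifferentiableAt ℂ (fun ζ => po p (u + (u + ζ))) ζ := (hpo _).comp ζ (by fun_prop)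
  unfold bet
  refine DifferentiableAt.add (by fun_prop) (DifferentiableAt.div ?_ ?_ (pow_ne_zero 2 ?_))
  · exact (differentiableAt_const _).mul ((differentiableAt_const _).sub h1)
  · exact ((differentiableAt_const _).sub h2).pow 2
  · rw [show u + (u + ζ) = 2 * u + ζ by ring]; exact one_sub_po_ne_zero hp h

theorem differentiableOn_Ek (k : ℤ) {η : ℝ} (hη : 0 < η) {u : ℂ} (hu : u.re = -η) :
    DifferentiableOn ℂ (Ek k u) {ζ | 1 / 2 + 4 * η < ζ.re} := by
  unfold Ek
  have hU : IsOpen {ζ : ℂ | 1 / 2 + 4 * η < ζ.re} := isOpen_lt continuous_const continuous_re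
  refine DifferentiableOn.mul ?_ ?_
  · refine differentiableOn_tprod (summable_eUnr_bound hη) hU (fun p ζ hζ => ?_)
      fun p ζ hζ => norm_eUnr_sub_one_le p.2 hη hu (le_of_lt hζ)
    have hpo := differentiable_po p.2
    have h1 : DifferentiableAt ℂ (fun ζ => po p (3 * u + ζ)) ζ := (hpo _).comp ζ (by fun_prop)
    have h2 : DifferentiableAt ℂ (fun ζ => po p (u + ζ)) ζ := (hpo _).comp ζ (by fun_prop)
    have h3 : DifferentiableAt ℂ (fun ζ => po p (2 * u + ζ)) ζ := (hpo _).comp ζ (by fun_prop)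
    apply DifferentiableAt.differentiableWithinAt
    unfold eUnr
    refine DifferentiableAt.mul ((differentiableAt_const _).add (DifferentiableAt.div ?_ ?_ (pow_ne_zero 2 ?_))) ?_
    · exact (h1.const_mul _).mul ((differentiableAt_const _).sub (h2.const_mul _))
    · exact ((differentiableAt_const _).sub h3).pow 2
    · apply one_sub_po_ne_zero p.2
      simp only [mem_ofPred_eq] at hζ; simp [hu]; linarith
    · exact (differentiableAt_const _).sub (h1.const_mul _)
  · apply DifferentiableOn.fun_finsetProd
    intro p hp ζ hζ
    have hpp := Nat.prime_of_mem_primeFactors hp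
    have hpo := differentiable_po hpp
    simp only [mem_ofPred_eq] at hζ
    apply DifferentiableAt.differentiableWithinAt
    unfold eRam
    have h1 : DifferentiableAt ℂ (fun ζ => po p (2 * (u + ζ))) ζ := (hpo _).comp ζ (by fun_prop)
    refine DifferentiableAt.mul (DifferentiableAt.inv ((differentiableAt_const _).sub h1) ?_)
      ((differentiableAt_const _).add (DifferentiableAt.mul ?_ (DifferentiableAt.fun_sum fun e _ => DifferentiableAt.mul (by fun_prop) ?_)))
    · apply one_sub_po_ne_zero hpp
      simp [hu]; linarith
    · apply differentiableAt_bet hpp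
      simp [hu]; linarith
    · apply DifferentiableAt.const_cpow (by fun_prop)
      left; exact_mod_cast (pow_pos hpp.pos e).ne'

theorem measurable_Ek (k : ℤ) {η : ℝ} (hη : 0 < η) {α : Type*} [MeasurableSpace α] {f g : α → ℂ}
    (hf : Measurable f) (hg : Measurable g) (hf1 : ∀ x, (f x).re = -η) (hg1 : ∀ x, 1 / 2 + 4 * η ≤ (g x).re) :
    Measurable (fun x => Ek k (f x) (g x)) := by
  unfold Ek
  refine Measurable.mul (measurable_tprod_of_multipliable (fun p => ?_) fun x =>
    (norm_tprod_le (summable_eUnr_bound hη) fun p => norm_eUnr_sub_one_le p.2 hη (hf1 x) (hg1 x)).1) ?_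
  · have hpo : Measurable (po p) := (differentiable_po p.2).continuous.measurable
    unfold eUnr
    fun_prop
  · apply Finset.measurable_fun_prod
    intro p hp
    have hpo : Measurable (po p) := (differentiable_po (Nat.prime_of_mem_primeFactors hp)).continuous.measurable
    unfold eRam bet
    fun_prop

theorem summable_GJ_coeff (k : ℤ) {u ζ : ℂ} (hu : -(1 / 16) ≤ u.re) (hζ : 6 ≤ ζ.re) :
    (∀ N : ℕ, N ≠ 0 → ‖betaN u (u + ζ) N‖ ≤ (N:ℝ) ^ 3) ∧
    Summable (fun N : ℕ => ‖(N:ℂ) ^ (-(1 / 2 + (u + ζ))) * betaN u (u + ζ) N * GJ k N‖) := by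
  have hbeta : ∀ N : ℕ, N ≠ 0 → ‖betaN u (u + ζ) N‖ ≤ (N:ℝ) ^ 3 := by
    intro N hN
    apply prod_primeFactors_le hN
    intro p hp
    have hpp := Nat.prime_of_mem_primeFactors hp
    by_cases h2 : p = 2
    · subst h2; simp [bet, po]; norm_num
    have hp3 : (3:ℝ) ≤ p := by
      have := hpp.two_le
      exact_mod_cast (by omega : 3 ≤ p)
    have h := norm_bet_le_of_neg hpp (η := 1 / 16) (by norm_num) hu (by linarith : 1 / 2 + 4 * (1 / 16) ≤ ζ.re)
    have h4 : (p:ℝ) ^ (2 * (1 / 16) : ℝ) ≤ (p:ℝ) ^ (1 / 2 : ℝ) :=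
      Real.rpow_le_rpow_of_exponent_le (by linarith) (by norm_num)
    rw [← Real.sqrt_eq_rpow] at h4
    have h5 : Real.sqrt p ≤ (p + 3) / 3 := by
      apply Real.sqrt_le_iff.mpr
      constructor
      · positivity
      · nlinarith [sq_nonneg ((p:ℝ) - 3)]
    have : (27:ℝ) ≤ p ^ 3 := by
      calc (27:ℝ) = 3 ^ 3 := by norm_num
        _ ≤ _ := by gcongr
    nlinarith [sq_nonneg ((p:ℝ) - 3)]
  refine ⟨hbeta, ?_⟩
  refine Summable.of_nonneg_of_le (fun _ => norm_nonneg _) (fun N => ?_)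
    (Real.summable_nat_rpow.mpr (by norm_num : (-2:ℝ) < -1))
  rcases Nat.eq_zero_or_pos N with rfl | hN
  · simp [GJ]
  have hN0 : (0:ℝ) < N := by exact_mod_cast hN
  have hN1 : (1:ℝ) ≤ N := by exact_mod_cast hN
  rw [norm_mul, norm_mul, norm_natCast_cpow_le N (by simp; linarith)]
  have hb := hbeta N hN.ne'
  calc _ ≤ (N:ℝ) ^ (-(6:ℝ)) * (N:ℝ) ^ 3 * N := by
        gcongr
        · simp; linarith
        · exact norm_GJ_le k N
    _ = (N:ℝ) ^ (-(6:ℝ) + 3 + 1) := by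
        rw [Real.rpow_add hN0, Real.rpow_add hN0, Real.rpow_one]; norm_cast
    _ = _ := by norm_num

theorem betaN_prime_pow {p : ℕ} (hp : p.Prime) {e : ℕ} (he : e ≠ 0) (u z : ℂ) :
    betaN u z (p ^ e) = bet p u z := by
  rw [betaN, Nat.primeFactors_prime_pow he hp, Finset.prod_singleton]

theorem chk_sq {k : ℤ} {p : ℕ} (hp : p.Prime) (h2 : p ≠ 2) (hk : ¬ (p:ℤ) ∣ k) : chk k p ^ 2 = 1 := by
  rw [chk, if_pos (hp.odd_of_ne_two h2)]
  apply norm_jacobiSym_sq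
  rw [Int.gcd_comm]
  have := (Nat.Prime.coprime_iff_not_dvd hp (n := k.natAbs)).mpr (fun h => hk (Int.natCast_dvd.mpr h))
  simpa [Int.gcd] using this

theorem chk_eq_zero {k : ℤ} {p : ℕ} (hp : p.Prime) (hk : (p:ℤ) ∣ k) : chk k p = 0 := by
  rw [chk]
  split_ifs
  · have : NeZero p := ⟨hp.ne_zero⟩
    have : jacobiSym k p = 0 := by
      rw [jacobiSym.eq_zero_iff_not_coprime]
      intro h
      have h1 : (p:ℤ) ∣ Int.gcd k p := Int.dvd_coe_gcd hk dvd_rfl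
      rw [h] at h1
      exact hp.one_lt.ne' (by exact_mod_cast Int.eq_one_of_dvd_one (by positivity) h1)
    rw [this]; simp
  · rfl

theorem tsum_GJ_prime_pow {k : ℤ} (hk : k ≠ 0) {p : ℕ} (hp : p.Prime) (u z : ℂ) :
    ∑' e : ℕ, ((p ^ e : ℕ):ℂ) ^ (-(1 / 2 + z)) * betaN u z (p ^ e) * GJ k (p ^ e) =
      1 + bet p u z * ∑ e ∈ Finset.Icc 1 (k.natAbs.factorization p + 1), GJ k (p ^ e) *
        ((p ^ e : ℕ):ℂ) ^ (-(1 / 2 + z)) := by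
  set v := k.natAbs.factorization p with hv
  rw [tsum_eq_sum (s := Finset.Icc 0 (v + 1))]
  · rw [← Finset.add_sum_Ioc_eq_sum_Icc (by omega), Finset.mul_sum]
    congr 1
    · simp [GJ_one, betaN]
    · apply Finset.sum_congr
      · ext e; simp; omega
      · intro e he
        rw [betaN_prime_pow hp (by simp at he; omega)]; ring
  · intro e he
    have he2 : v + 2 ≤ e := by simp at he; omega
    rw [GJ_prime_pow_eq_zero hp (by omega), mul_zero]
    intro hdvd
    have h1 : p ^ (e - 1) ∣ k.natAbs := by
      have := Int.natCast_dvd.mp (by push_cast; exact hdvd : ((p ^ (e - 1) : ℕ) : ℤ) ∣ k)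
      exact this
    have := (hp.pow_dvd_iff_le_factorization (by simpa using hk)).mp h1
    omega

theorem zo_mul_tsum_GJ {k : ℤ} (hk : k ≠ 0) {η : ℝ} (hη : 0 < η) (hη2 : η ≤ 1 / 16) {u ζ : ℂ}
    (hu : u.re = -η) (hζ : 6 ≤ ζ.re) :
    zo (2 * (u + ζ)) * ∑' N : ℕ, (N:ℂ) ^ (-(1 / 2 + (u + ζ))) * betaN u (u + ζ) N * GJ k N =
      (∑' n : ℕ, chk k n * (n:ℂ) ^ (-(u + ζ))) * (∑' n : ℕ, chk k n * (n:ℂ) ^ (-(3 * u + ζ))) *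
        Ek k u ζ := by
  set z := u + ζ with hz
  have hzre : z.re = -η + ζ.re := by rw [hz, add_re, hu]
  have hz're : (3 * u + ζ).re = -3 * η + ζ.re := by simp [hu]
  have hP1 := hasProd_zo (s := 2 * z) (by simp; linarith)
  have hP2 := EulerProduct.eulerProduct_hasProd
    (f := fun N : ℕ => (N:ℂ) ^ (-(1 / 2 + z)) * betaN u z N * GJ k N) (by simp [betaN, GJ_one])
    (by
      intro m n hmn
      simp only [natCast_mul_cpow, betaN, prod_primeFactors_mul hmn, GJ_mul hmn]; ring)
    (summable_GJ_coeff k (by linarith) hζ).2 (by simp [GJ_zero])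
  have hL : ∀ s : ℂ, 1 < s.re → HasProd (fun p : Nat.Primes => (1 - chk k p * ((p:ℕ):ℂ) ^ (-s))⁻¹)
      (∑' n : ℕ, chk k n * (n:ℂ) ^ (-s)) := by
    intro s hs
    apply hasProd_completely_multiplicative (f := fun n : ℕ => chk k n * (n:ℂ) ^ (-s))
    · simp [chk_zero]
    · simp [chk_one]
    · intro m n; simp only [natCast_mul_cpow, chk_mul]; ring
    · exact summable_norm_mul_cpow (norm_chk_le k) hs
  have hP3 := hL z (by linarith)
  have hP4 := hL (3 * u + ζ) (by linarith)
  have hP5 := (norm_tprod_le (summable_eUnr_bound hη) fun p : Nat.Primes =>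
    norm_eUnr_sub_one_le (k := k) (ζ := ζ) p.2 hη hu (by linarith)).1.hasProd
  have hP6 := hasProd_finset_primes k.natAbs.primeFactors (fun p hp => Nat.prime_of_mem_primeFactors hp)
    (fun p => eRam k p u ζ)
  refine (hP1.mul hP2).unique (((hP3.mul hP4).mul (hP5.mul hP6)).congr_fun fun p => ?_)
  rw [tsum_GJ_prime_pow hk p.2]
  have hmem : (p:ℕ) ∈ k.natAbs.primeFactors ↔ ((p:ℕ):ℤ) ∣ k := by
    rw [Nat.mem_primeFactors, Int.natCast_dvd]
    exact ⟨fun h => h.2.1, fun h => ⟨p.2, h, by simpa using hk⟩⟩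
  by_cases hpk : ((p:ℕ):ℤ) ∣ k
  · rw [if_pos (hmem.mpr hpk), eUnr, chk_eq_zero p.2 hpk, eRam, ← hz]
    simp
  rw [if_neg (fun h => hpk (hmem.mp h)), mul_one]
  have hv : k.natAbs.factorization p = 0 :=
    Nat.factorization_eq_zero_of_not_dvd (fun h => hpk (Int.natCast_dvd.mpr h))
  rw [hv]
  simp only [zero_add, Finset.Icc_self, Finset.sum_singleton, pow_one]
  by_cases hp2 : (p:ℕ) = 2
  · have h1 : chk k p = 0 := by rw [chk, if_neg]; rw [hp2]; decide
    have h2 : GJ k p = 0 := by rw [GJ, if_neg]; rw [hp2]; decide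
    rw [eUnr, h1, h2, po, if_pos hp2]; simp
  have hp0 : ((p:ℕ):ℂ) ≠ 0 := by exact_mod_cast p.2.ne_zero
  have hG : GJ k p * ((p:ℕ):ℂ) ^ (-(1 / 2 + z)) = chk k p * ((p:ℕ):ℂ) ^ (-z) := by
    rw [GJ_prime p.2 hp2, chk, if_pos (p.2.odd_of_ne_two hp2), mul_assoc]
    congr 1
    rw [Real.sqrt_eq_rpow, ofReal_cpow (by positivity), ofReal_natCast, ← cpow_add _ _ hp0]
    congr 1; push_cast; ring
  rw [hG]
  have hsq := chk_sq p.2 hp2 hpk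
  have hq : po p (2 * z) = (((p:ℕ):ℂ) ^ (-z)) ^ 2 := by
    rw [po, if_neg hp2, ← cpow_nat_mul]; congr 1; push_cast; ring
  have hA : po p (3 * u + ζ) = ((p:ℕ):ℂ) ^ (-z) * po p (2 * u) := by
    rw [po, if_neg hp2, po, if_neg hp2, ← cpow_add _ _ hp0]; congr 1; rw [hz]; ring
  have hA' : ((p:ℕ):ℂ) ^ (-(3 * u + ζ)) = po p (3 * u + ζ) := by rw [po, if_neg hp2]
  have hB' : po p z = ((p:ℕ):ℂ) ^ (-z) := by rw [po, if_neg hp2]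
  have ht0 := one_sub_po_ne_zero p.2 (s := 2 * u + ζ) (by simp [hu]; linarith)
  have hne : ∀ s : ℂ, 1 / 2 ≤ s.re → ∀ c : ℂ, ‖c‖ ≤ 1 → 1 - c * po p s ≠ 0 := by
    intro s hs c hc
    have h1 : ‖c * po p s‖ ≤ 29 / 50 := by
      rw [norm_mul]
      nlinarith [norm_po_half p.2 hs, norm_nonneg (po p s), norm_nonneg c]
    have h := norm_one_sub_ge h1
    intro h'; rw [h'] at h; norm_num at h
  have hc1 := norm_chk_le k p
  have hA0 := hne (3 * u + ζ) (by linarith) _ hc1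
  have hB0 := hne z (by linarith) _ hc1
  have hB1 := hne z (by linarith) (-chk k p) (by rwa [norm_neg])
  rw [eUnr, ← hz, hA', bet, hq, show u + z = 2 * u + ζ by rw [hz]; ring]
  rw [hB'] at *
  rw [hA] at *
  generalize ((p:ℕ):ℂ) ^ (-z) = B at *
  generalize po p (2 * u + ζ) = t at *
  generalize po p (2 * u) = y at *
  generalize chk k p = c at *
  have hBB : 1 - B ^ 2 = (1 - c * B) * (1 + c * B) := by linear_combination B ^ 2 * hsq
  rw [← mul_assoc] at hA0
  rw [neg_mul, sub_neg_eq_add] at hB1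
  rw [hBB, ← mul_assoc]
  field_simp
  ring

theorem exists_exp_eq_of_ball {f : ℂ → ℂ} {c : ℂ} {R : ℝ} (hR : 0 < R) (hf : DifferentiableOn ℂ f (Metric.ball c R))
    (h0 : ∀ z ∈ Metric.ball c R, f z ≠ 0) :
    ∃ g : ℂ → ℂ, DifferentiableOn ℂ g (Metric.ball c R) ∧ g c = 0 ∧
      ∀ z ∈ Metric.ball c R, f z = f c * cexp (g z) := by
  have hd : DifferentiableOn ℂ (fun z => deriv f z / f z) (Metric.ball c R) :=
    (hf.deriv Metric.isOpen_ball).div hf h0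
  obtain ⟨F, hF⟩ := hd.isExactOn_ball
  have hc : c ∈ Metric.ball c R := Metric.mem_ball_self hR
  refine ⟨fun z => F z - F c, fun z hz => ((hF z hz).differentiableAt.sub_const _).differentiableWithinAt, by simp, ?_⟩
  intro z hz
  have hconst : ∀ z ∈ Metric.ball c R, HasDerivAt (fun z => f z * cexp (-F z)) 0 z := by
    intro z hz
    have h1 := (hf.differentiableAt (Metric.isOpen_ball.mem_nhds hz)).hasDerivAt
    have h2 := (hF z hz).neg.cexp
    refine (h1.mul h2).congr_deriv ?_
    have := h0 z hz
    simp only [Pi.neg_apply]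
    field_simp
    ring
  have := (convex_ball c R).is_const_of_fderivWithin_eq_zero (𝕜 := ℂ) (f := fun z => f z * cexp (-F z))
    (fun z hz => (hconst z hz).differentiableAt.differentiableWithinAt) (fun z hz => by
      rw [fderivWithin_of_isOpen Metric.isOpen_ball hz]
      ext
      simp [(hconst z hz).hasFDerivAt.fderiv]) hz hc
  have h3 : cexp (F z) * cexp (-F z) = 1 := by rw [← Complex.exp_add]; simp
  change f z = f c * cexp (F z - F c)
  rw [show F z - F c = F z + -F c by ring, Complex.exp_add]
  linear_combination (f z) * (-h3) + cexp (F z) * this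

/-- `(s - 1) ζ(s)`. -/
def polZ (s : ℂ) : ℂ := polL (N := 1) (fun _ => 1) s

theorem differentiable_polZ : Differentiable ℂ polZ := differentiable_polL _

theorem polZ_of_ne {s : ℂ} (hs : s ≠ 1) : polZ s = (s - 1) * riemannZeta s := by
  rw [polZ, polL_of_ne _ hs, ZMod.LFunction_modOne_eq, one_mul]

theorem polZ_one : polZ 1 = 1 := by
  have h1 := differentiable_polZ.continuous.tendsto 1
  have h2 : Tendsto polZ (𝓝[≠] 1) (𝓝 1) := by
    refine riemannZeta_residue_one.congr' ?_
    filter_upwards [self_mem_nhdsWithin] with s hs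
    rw [polZ_of_ne hs]
  exact tendsto_nhds_unique (h1.mono_left nhdsWithin_le_nhds) h2

theorem polZ_ne_zero (hRH : RiemannHypothesis) {s : ℂ} (hs : 1 / 2 < s.re) : polZ s ≠ 0 := by
  by_cases h1 : s = 1
  · rw [h1, polZ_one]; exact one_ne_zero
  · rw [polZ_of_ne h1]
    refine mul_ne_zero (sub_ne_zero.mpr h1) fun h => ?_
    have := hRH s h ?_ h1
    · linarith
    · rintro ⟨n, rfl⟩
      have : (-2 * ((n:ℂ) + 1)).re = -2 * ((n:ℝ) + 1) := by simp
      rw [this] at hs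
      have : (0:ℝ) ≤ n := n.cast_nonneg
      linarith

theorem norm_polZ_le {s : ℂ} (hs : 1 / 2 ≤ s.re) : ‖polZ s‖ ≤ 8 * (1 + ‖s‖) ^ 2 := by
  have := norm_polL_le (N := 1) (Φ := fun _ => (1:ℂ)) (B := 1) (by simp) hs
  rw [polZ]
  simpa using this

theorem tsum_one_div_add_two_sq : HasSum (fun n : ℕ => 1 / ((n + 2 : ℕ):ℝ) ^ 2) (Real.pi ^ 2 / 6 - 1) := by
  have h := (hasSum_nat_add_iff' 2).mpr hasSum_zeta_two
  refine h.trans_eq ?_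
  norm_num [Finset.sum_range_succ]

theorem norm_riemannZeta_ge {s : ℂ} (hs : 2 ≤ s.re) : 1 / 3 ≤ ‖riemannZeta s‖ := by
  have hnorm : ∀ n : ℕ, ‖1 / ((n + 2 : ℕ) : ℂ) ^ s‖ ≤ 1 / ((n + 2 : ℕ):ℝ) ^ 2 := by
    intro n
    rw [norm_div, norm_one, norm_natCast_cpow_of_pos (by omega)]
    apply one_div_le_one_div_of_le (by positivity)
    rw [← Real.rpow_two]
    apply Real.rpow_le_rpow_of_exponent_le _ hs
    rw [Nat.one_le_cast]; omega
  have hs0 : Summable (fun n : ℕ => 1 / (n : ℂ) ^ s) :=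
    (Complex.summable_one_div_nat_cpow (p := s)).mpr (by linarith)
  have hz : riemannZeta s = 1 + ∑' n : ℕ, 1 / ((n + 2 : ℕ) : ℂ) ^ s := by
    rw [zeta_eq_tsum_one_div_nat_cpow (by linarith), ← hs0.sum_add_tsum_nat_add 2]
    have h0 : s ≠ 0 := by rintro rfl; norm_num at hs
    simp [Finset.sum_range_succ, zero_cpow h0]
  have htail := tsum_of_norm_bounded tsum_one_div_add_two_sq hnorm
  have hpi : Real.pi ^ 2 ≤ 9.95 := by nlinarith [Real.pi_lt_d2, Real.pi_pos]
  rw [hz]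
  have h5 := norm_sub_norm_le (1:ℂ) (-(∑' n : ℕ, 1 / ((n + 2 : ℕ) : ℂ) ^ s))
  rw [norm_neg, norm_one, sub_neg_eq_add] at h5
  linarith

theorem norm_polZ_ge_of_two_le {s : ℂ} (hs : 2 ≤ s.re) : 1 / 3 ≤ ‖polZ s‖ := by
  have hne : s ≠ 1 := by rintro rfl; norm_num at hs
  rw [polZ_of_ne hne, norm_mul]
  have h1 : 1 ≤ ‖s - 1‖ := by
    have := re_le_norm (s - 1); simp at this; linarith
  nlinarith [norm_riemannZeta_ge hs]

theorem exists_norm_polZ_inv_le (hRH : RiemannHypothesis) {δ : ℝ} (hδ : 0 < δ) :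
    ∃ (C : ℝ) (A : ℕ), 0 < C ∧ ∀ s : ℂ, 1 / 2 + δ ≤ s.re → ‖(polZ s)⁻¹‖ ≤ C * (1 + |s.im|) ^ A := by
  obtain ⟨A, hA⟩ := exists_nat_ge (3 / δ)
  refine ⟨3 * 2000 ^ A, 2 * A, by positivity, fun s hs => ?_⟩
  have ht1 : 1 ≤ 1 + |s.im| := by linarith [abs_nonneg s.im]
  rw [norm_inv]
  by_cases h2 : 2 ≤ s.re
  · have := norm_polZ_ge_of_two_le h2
    calc ‖polZ s‖⁻¹ ≤ (1 / 3)⁻¹ := by gcongr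
      _ = 3 * 1 * 1 := by norm_num
      _ ≤ _ := by
        gcongr
        · exact one_le_pow₀ (by norm_num)
        · exact one_le_pow₀ ht1
  push Not at h2
  set c : ℂ := 2 + s.im * I with hc
  have hcre : c.re = 2 := by simp [hc]
  have hball : ∀ z ∈ Metric.ball c (3 / 2), 1 / 2 < z.re := by
    intro z hz
    rw [Metric.mem_ball, dist_eq] at hz
    have := (abs_re_le_norm (z - c)).trans_lt hz
    rw [sub_re, hcre, abs_lt] at this
    linarith [this.1]
  obtain ⟨g, hg, hgc, hge⟩ := exists_exp_eq_of_ball (by norm_num) differentiable_polZ.differentiableOn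
    (fun z hz => polZ_ne_zero hRH (hball z hz))
  have hfc := norm_polZ_ge_of_two_le (s := c) hcre.ge
  set M := Real.log (2000 * (1 + |s.im|) ^ 2) with hM
  have hM1 : (1:ℝ) < 2000 * (1 + |s.im|) ^ 2 := by
    have : 1 ≤ (1 + |s.im|) ^ 2 := one_le_pow₀ ht1
    linarith
  have hM0 : 0 < M := Real.log_pos hM1
  have hMexp : Real.exp M = 2000 * (1 + |s.im|) ^ 2 := Real.exp_log (by linarith)
  have hre : ∀ z ∈ Metric.ball c (3 / 2), (g z).re ≤ M := by
    intro z hz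
    have h1 := congrArg norm (hge z hz)
    rw [norm_mul, norm_exp] at h1
    have h3 := norm_polZ_le (hball z hz).le
    have h4 : ‖z‖ ≤ 4 + |s.im| := by
      have e1 : ‖z - c‖ < 3 / 2 := by rwa [Metric.mem_ball, dist_eq] at hz
      have e2 : ‖c‖ ≤ 2 + |s.im| := by
        rw [hc]; refine (norm_add_le _ _).trans ?_; simp
      have e3 : ‖z‖ ≤ ‖z - c‖ + ‖c‖ := by simpa using norm_add_le (z - c) c
      linarith
    rw [← Real.exp_le_exp, hMexp]
    have h5 : 8 * (1 + ‖z‖) ^ 2 ≤ 200 * (1 + |s.im|) ^ 2 := by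
      calc 8 * (1 + ‖z‖) ^ 2 ≤ 8 * (5 * (1 + |s.im|)) ^ 2 := by
            gcongr; linarith [abs_nonneg s.im]
        _ = _ := by ring
    have h6 := Real.exp_pos (g z).re
    nlinarith [sq_nonneg (1 + |s.im|)]
  have hz : s - c ∈ Metric.ball (0:ℂ) (3 / 2) ∧ ‖s - c‖ ≤ 3 / 2 - δ := by
    have : s - c = ((s.re - 2 : ℝ) : ℂ) := by
      apply Complex.ext <;> simp [hc]
    rw [this, mem_ball_zero_iff, norm_real, Real.norm_eq_abs, abs_of_neg (by linarith)]
    constructor <;> linarith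
  have hB := borelCaratheodory_zero (f := fun w => g (c + w)) (R := 3 / 2) hM0
    (hg.comp (by fun_prop) (fun w hw => by
      rw [mem_ball_zero_iff] at hw
      rw [Metric.mem_ball, dist_eq]; simpa using hw))
    (fun w hw => hre _ (by
      rw [mem_ball_zero_iff] at hw
      rw [Metric.mem_ball, dist_eq]; simpa using hw))
    (by norm_num) hz.1 (by simpa using hgc)
  simp only [add_sub_cancel] at hB
  have hsb : s ∈ Metric.ball c (3 / 2) := by
    rw [Metric.mem_ball, dist_eq]; exact mem_ball_zero_iff.mp hz.1
  have hgA : ‖g s‖ ≤ A * M := by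
    refine hB.trans ?_
    have e1 : 0 ≤ ‖s - c‖ := norm_nonneg _
    calc 2 * M * ‖s - c‖ / (3 / 2 - ‖s - c‖) ≤ 2 * M * (3 / 2) / δ := by
          gcongr <;> linarith [hz.2]
      _ = 3 / δ * M := by ring
      _ ≤ A * M := by gcongr
  rw [hge s hsb, norm_mul, norm_exp, mul_inv, ← Real.exp_neg]
  have h7 : -(g s).re ≤ A * M := by
    have := abs_re_le_norm (g s)
    linarith [neg_abs_le (g s).re]
  calc ‖polZ c‖⁻¹ * Real.exp (-(g s).re) ≤ (1 / 3)⁻¹ * Real.exp (A * M) := by gcongr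
    _ = (1 / 3)⁻¹ * (2000 * (1 + |s.im|) ^ 2) ^ A := by rw [Real.exp_nat_mul, hMexp]
    _ = _ := by rw [mul_pow, ← pow_mul]; ring

/-- The analytic continuation of `1 / zo` to a half-plane where `zo` has no zeros. -/
def izo (s : ℂ) : ℂ := (s - 1) * (polZ s)⁻¹ * (1 - (2:ℂ) ^ (-s))⁻¹

theorem izo_eq {s : ℂ} (hs : s ≠ 1) : izo s = (zo s)⁻¹ := by
  rw [izo, polZ_of_ne hs, zo, mul_inv, mul_inv, ← mul_assoc, mul_inv_cancel₀ (sub_ne_zero.mpr hs)]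
  ring

theorem differentiableAt_izo (hRH : RiemannHypothesis) {s : ℂ} (hs : 1 / 2 < s.re) :
    DifferentiableAt ℂ izo s := by
  unfold izo
  refine DifferentiableAt.mul (DifferentiableAt.mul (by fun_prop)
    ((differentiable_polZ s).inv (polZ_ne_zero hRH hs))) (DifferentiableAt.inv ?_ ?_)
  · exact (differentiableAt_const _).sub (DifferentiableAt.const_cpow (by fun_prop) (by left; norm_num))
  · exact one_sub_two_cpow_ne_zero_of_pos (by linarith)

theorem measurable_izo : Measurable izo := by
  have := differentiable_polZ.continuous.measurable
  unfold izo
  fun_prop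

theorem exists_norm_izo_le (hRH : RiemannHypothesis) {δ : ℝ} (hδ : 0 < δ) :
    ∃ (C : ℝ) (A : ℕ), 0 < C ∧ ∀ s : ℂ, 1 / 2 + δ ≤ s.re → s.re ≤ 12 → ‖izo s‖ ≤ C * (1 + |s.im|) ^ A := by
  obtain ⟨C, A, hC, h⟩ := exists_norm_polZ_inv_le hRH hδ
  refine ⟨52 * C, A + 1, by positivity, fun s hs hs2 => ?_⟩
  unfold izo
  rw [norm_mul, norm_mul, norm_inv (1 - (2:ℂ) ^ (-s))]
  have h1 : ‖s - 1‖ ≤ 13 * (1 + |s.im|) := by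
    have := norm_le_abs_re_add_abs_im s
    have h3 : ‖s - 1‖ ≤ ‖s‖ + 1 := by simpa using norm_sub_le s 1
    rw [abs_of_pos (by linarith : 0 < s.re)] at this
    linarith [abs_nonneg s.im]
  have h2 : 1 / 4 ≤ ‖1 - (2:ℂ) ^ (-s)‖ := by
    have e : ‖(2:ℂ) ^ (-s)‖ ≤ 3 / 4 := by
      have h2 := norm_natCast_cpow_of_pos (n := 2) (by norm_num) (-s)
      norm_num at h2
      rw [h2]
      calc (2:ℝ) ^ (-s.re) ≤ (2:ℝ) ^ (-(1 / 2):ℝ) := by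
            apply Real.rpow_le_rpow_of_exponent_le (by norm_num) (by linarith)
        _ = (Real.sqrt 2)⁻¹ := by rw [Real.rpow_neg (by positivity), ← Real.sqrt_eq_rpow]
        _ ≤ (4 / 3)⁻¹ := by
            gcongr
            apply Real.le_sqrt_of_sq_le
            norm_num
        _ = 3 / 4 := by norm_num
    have := norm_one_sub_ge e
    linarith
  calc _ ≤ 13 * (1 + |s.im|) * (C * (1 + |s.im|) ^ A) * (1 / 4)⁻¹ := by
        gcongr
        exact h s hs
    _ = _ := by ring

theorem norm_cos_le_exp (z : ℂ) : ‖Complex.cos z‖ ≤ Real.exp |z.im| := by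
  rw [Complex.cos, norm_div]
  have h1 : ‖cexp (z * I)‖ ≤ Real.exp |z.im| := by
    rw [norm_exp]; simp; exact neg_le_abs _
  have h2 : ‖cexp (-z * I)‖ ≤ Real.exp |z.im| := by
    rw [norm_exp]; simp; exact le_abs_self _
  have := norm_add_le (cexp (z * I)) (cexp (-z * I))
  simp only [Complex.norm_ofNat]
  linarith

theorem norm_sin_le_exp (z : ℂ) : ‖Complex.sin z‖ ≤ Real.exp |z.im| := by
  rw [Complex.sin, norm_div, norm_mul, norm_I, mul_one]
  have h1 : ‖cexp (z * I)‖ ≤ Real.exp |z.im| := by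
    rw [norm_exp]; simp; exact neg_le_abs _
  have h2 : ‖cexp (-z * I)‖ ≤ Real.exp |z.im| := by
    rw [norm_exp]; simp; exact le_abs_self _
  have := norm_sub_le (cexp (-z * I)) (cexp (z * I))
  simp only [Complex.norm_ofNat]
  linarith

theorem exists_norm_gammaFactor_div_le {b : ℝ} (hb : 0 < b) (hb2 : b ≤ 1 / 4) :
    ∃ C : ℝ, 0 < C ∧ ∀ (q : ℕ) [NeZero q] (χ : DirichletCharacter ℂ q) (s : ℂ), s.re = 1 / 2 + b →
      ‖χ.gammaFactor s / χ.gammaFactor (1 - s)‖ ≤ C * (1 + |s.im|) := by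
  have hΓ : 0 < Real.Gamma (1 / 2 + b) := Real.Gamma_pos_of_pos (by linarith)
  refine ⟨2 * (Real.exp 1 * (2 * Real.Gamma (1 / 2 + b))), by positivity, fun q _ χ s hs => ?_⟩
  have hG := norm_Gamma_le (s := s) (by linarith)
  rw [hs] at hG
  have ht1 : 1 ≤ 1 + |s.im| := by linarith [abs_nonneg s.im]
  have hp : (2 * (1 + |s.im|)) ^ (1 / 2 + b) ≤ 2 * (1 + |s.im|) := by
    calc _ ≤ (2 * (1 + |s.im|)) ^ (1:ℝ) := Real.rpow_le_rpow_of_exponent_le (by linarith) (by linarith)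
      _ = _ := Real.rpow_one _
  have hC : ‖Gammaℂ s‖ * Real.exp (Real.pi / 2 * |s.im|) ≤ 2 * (Real.exp 1 * (2 * Real.Gamma (1 / 2 + b))) * (1 + |s.im|) := by
    rw [Gammaℂ, norm_mul, norm_mul]
    have h1 : ‖(2 * (Real.pi:ℂ)) ^ (-s)‖ ≤ 1 := by
      rw [show (2 * (Real.pi:ℂ)) = ((2 * Real.pi : ℝ) : ℂ) by push_cast; ring,
        norm_cpow_eq_rpow_re_of_pos (by positivity), neg_re]
      apply Real.rpow_le_one_of_one_le_of_nonpos
      · linarith [Real.pi_gt_three]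
      · linarith
    calc _ = 2 * ‖(2 * (Real.pi:ℂ)) ^ (-s)‖ * (‖Complex.Gamma s‖ * Real.exp (Real.pi / 2 * |s.im|)) := by
          simp only [Complex.norm_ofNat]; ring
      _ ≤ 2 * 1 * (Real.exp 1 * ((2 * (1 + |s.im|)) * Real.Gamma (1 / 2 + b))) := by
          refine mul_le_mul (by gcongr) (hG.trans ?_) (by positivity) (by positivity)
          gcongr
      _ = _ := by ring
  have him : |(Real.pi * s / 2).im| = Real.pi / 2 * |s.im| := by
    have : (Real.pi * s / 2).im = Real.pi / 2 * s.im := by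
      rw [show (Real.pi * s / 2 : ℂ) = ((Real.pi / 2 : ℝ) : ℂ) * s by push_cast; ring, im_ofReal_mul]
    rw [this, abs_mul, abs_of_pos (by positivity)]
  have hs0 : ∀ n : ℕ, s ≠ -(2 * n + 1) := by
    rintro n rfl
    simp at hs
    have : (0:ℝ) ≤ n := n.cast_nonneg
    linarith
  rcases χ.even_or_odd with h | h
  · rw [h.gammaFactor_def, h.gammaFactor_def, Gammaℝ_div_Gammaℝ_one_sub hs0, norm_mul]
    refine le_trans ?_ hC
    gcongr
    rw [← him]
    exact norm_cos_le_exp _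
  · have hs1 : ∀ n : ℕ, s ≠ -n := by
      rintro n rfl
      simp at hs
      have : (0:ℝ) ≤ n := n.cast_nonneg
      linarith
    have hne : Gammaℝ (s + 1) ≠ 0 := Gammaℝ_ne_zero_of_re_pos (by simp; linarith)
    rw [h.gammaFactor_def, h.gammaFactor_def, show 1 - s + 1 = 2 - s by ring, div_eq_mul_inv,
      inv_Gammaℝ_two_sub hs1, mul_comm, mul_assoc, inv_mul_cancel₀ hne, mul_one, norm_mul]
    refine le_trans ?_ hC
    gcongr
    rw [← him]
    exact norm_sin_le_exp _

theorem chiK_inv (k : ℤ) (hk : k ≠ 0) : (chiK k hk)⁻¹ = chiK k hk := by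
  apply inv_eq_of_mul_eq_one_left
  apply MulChar.ext
  intro a
  rw [MulChar.mul_apply, MulChar.one_apply_coe]
  have h0 : chiK k hk a ≠ 0 := (a.isUnit.map (chiK k hk)).ne_zero
  change chk k (a : ZMod (4 * k.natAbs)).val * chk k (a : ZMod (4 * k.natAbs)).val = 1
  change chk k (a : ZMod (4 * k.natAbs)).val ≠ 0 at h0
  generalize (a : ZMod (4 * k.natAbs)).val = n at *
  unfold chk at *
  split_ifs at * with hn
  · rcases jacobiSym.trichotomy k n with h | h | h
    · rw [h] at h0; simp at h0
    · rw [h]; simp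
    · rw [h]; simp
  · simp at h0

/-- A primitive real character has a functional equation with sign `± 1`. -/
theorem norm_LFunction_one_sub_of_primitive {q : ℕ} [NeZero q] {χ : DirichletCharacter ℂ q}
    (hχ : χ.IsPrimitive) (hinv : χ⁻¹ = χ) {s : ℂ} (hs0 : 0 < s.re) (hs1 : s.re < 1) :
    ‖χ.LFunction (1 - s)‖ = (q:ℝ) ^ (s.re - 1 / 2) * ‖χ.gammaFactor s / χ.gammaFactor (1 - s)‖ *
      ‖χ.LFunction s‖ := by
  have hq : 0 < q := Nat.pos_of_ne_zero (NeZero.ne q)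
  have hq0 : (q:ℂ) ≠ 0 := by exact_mod_cast hq.ne'
  have h1 := hχ.completedLFunction_one_sub s
  have h2 := hχ.completedLFunction_one_sub (1 - s)
  rw [hinv] at h1 h2
  rw [sub_sub_cancel] at h2
  have hne : s ≠ 0 := by rintro rfl; simp at hs0
  have hne1 : 1 - s ≠ 0 := by
    intro h; rw [sub_eq_zero] at h; rw [← h] at hs1; simp at hs1
  have hg : χ.gammaFactor s ≠ 0 := by
    rcases χ.even_or_odd with h | h
    · rw [h.gammaFactor_def]; exact Gammaℝ_ne_zero_of_re_pos hs0
    · rw [h.gammaFactor_def]; exact Gammaℝ_ne_zero_of_re_pos (by simp; linarith)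
  rw [χ.LFunction_eq_completed_div_gammaFactor s (Or.inl hne),
    χ.LFunction_eq_completed_div_gammaFactor (1 - s) (Or.inl hne1), norm_div, norm_div, norm_div]
  by_cases hΛ : χ.completedLFunction s = 0
  · rw [h1, hΛ]; simp
  have hW : ‖χ.rootNumber‖ = 1 := by
    rw [h1] at h2
    have e : (q:ℂ) ^ (1 - s - 1 / 2) * (q:ℂ) ^ (s - 1 / 2) = 1 := by
      rw [← cpow_add _ _ hq0, show 1 - s - 1 / 2 + (s - 1 / 2) = 0 by ring, cpow_zero]
    have h3 : χ.rootNumber ^ 2 = 1 := by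
      apply mul_left_cancel₀ hΛ
      linear_combination (-1) * h2 - χ.rootNumber ^ 2 * χ.completedLFunction s * e
    have h4 := congrArg norm h3
    rw [norm_pow, norm_one] at h4
    exact (pow_eq_one_iff_of_nonneg (norm_nonneg _) (by norm_num)).mp h4
  rw [h1, norm_mul, norm_mul, hW, norm_natCast_cpow_of_pos hq]
  have : ‖χ.gammaFactor s‖ ≠ 0 := norm_ne_zero_iff.mpr hg
  have e : (s - 1 / 2).re = s.re - 1 / 2 := by simp
  rw [e]
  field_simp

theorem exists_norm_polK_one_sub_le {b : ℝ} (hb : 0 < b) (hb2 : b ≤ 1 / 4) {ε : ℝ} (hε : 0 < ε) :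
    ∃ C : ℝ, 0 < C ∧ ∀ (k : ℤ), k ≠ 0 → ∀ s : ℂ, s.re = 1 / 2 + b →
      ‖polK k (1 - s)‖ ≤ C * (k.natAbs:ℝ) ^ (b + ε) * (1 + |s.im|) * ‖polK k s‖ := by
  obtain ⟨Cγ, hCγ, hγ⟩ := exists_norm_gammaFactor_div_le hb hb2
  obtain ⟨C8, hC8, h8⟩ := exists_prod_factorization_le 8 (by norm_num) hε
  refine ⟨5 * C8 * 4 ^ (b + ε) * Cγ, by positivity, fun k hk s hs => ?_⟩
  have hM : NeZero (4 * k.natAbs) := ⟨by simpa using hk⟩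
  set M := 4 * k.natAbs with hMdef
  set χ := chiK k hk with hχ
  set ψ := χ.primitiveCharacter with hψ
  have hc : NeZero χ.conductor := ⟨χ.conductor_ne_zero⟩
  have hlev : DirichletCharacter.changeLevel χ.conductor_dvd_level ψ = χ := χ.changeLevel_primitiveCharacter
  have hinv : ψ⁻¹ = ψ := by
    apply DirichletCharacter.changeLevel_injective χ.conductor_dvd_level
    rw [map_inv, hlev, chiK_inv]
  have hne : s ≠ 1 := by rintro rfl; simp at hs; linarith
  have hne' : 1 - s ≠ 1 := by intro h; have := congrArg re h; simp at this; linarith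
  have hL := fun (w : ℂ) (hw : w ≠ 1) => DirichletCharacter.LFunction_changeLevel χ.conductor_dvd_level ψ (s := w) (Or.inr hw)
  rw [hlev] at hL
  have hp1 : polK k s = (s - 1) * χ.LFunction s := by
    rw [polK, dif_neg hk, polL_of_ne _ hne]; rfl
  have hp2 : polK k (1 - s) = -s * χ.LFunction (1 - s) := by
    rw [polK, dif_neg hk, polL_of_ne _ hne', show 1 - s - 1 = -s by ring]; rfl
  have hpr := norm_LFunction_one_sub_of_primitive χ.primitiveCharacter_isPrimitive hinv (s := s) (by linarith) (by linarith)
  have hψ1 : ∀ p : ℕ, ‖ψ p‖ ≤ 1 := fun p => ψ.norm_le_one _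
  have hprod1 : ‖∏ p ∈ M.primeFactors, (1 - ψ p * (p:ℂ) ^ (-(1 - s)))‖ ≤ ∏ p ∈ M.primeFactors, (2:ℝ) := by
    rw [norm_prod]
    apply Finset.prod_le_prod (fun _ _ => norm_nonneg _)
    intro p hp
    have hpp := Nat.prime_of_mem_primeFactors hp
    refine (norm_sub_le _ _).trans ?_
    rw [norm_one, norm_mul, norm_natCast_cpow_of_pos hpp.pos]
    have : (p:ℝ) ^ (-(1 - s)).re ≤ 1 := by
      apply Real.rpow_le_one_of_one_le_of_nonpos
      · exact_mod_cast hpp.one_lt.le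
      · simp; linarith
    have h0 : 0 ≤ (p:ℝ) ^ (-(1 - s)).re := by positivity
    nlinarith [hψ1 p, norm_nonneg (ψ p)]
  have hprod2 : ∏ p ∈ M.primeFactors, (1 / 4 : ℝ) ≤ ‖∏ p ∈ M.primeFactors, (1 - ψ p * (p:ℂ) ^ (-s))‖ := by
    rw [norm_prod]
    apply Finset.prod_le_prod (fun _ _ => by positivity)
    intro p hp
    have hpp := Nat.prime_of_mem_primeFactors hp
    have h2p : (2:ℝ) ≤ p := by exact_mod_cast hpp.two_le
    have : (p:ℝ) ^ (-s).re ≤ 3 / 4 := by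
      calc (p:ℝ) ^ (-s).re ≤ (p:ℝ) ^ (-(1 / 2):ℝ) := by
            apply Real.rpow_le_rpow_of_exponent_le (by linarith)
            simp; linarith
        _ = (Real.sqrt p)⁻¹ := by rw [Real.rpow_neg (by positivity), ← Real.sqrt_eq_rpow]
        _ ≤ (4 / 3)⁻¹ := by
            gcongr
            apply Real.le_sqrt_of_sq_le
            norm_num; linarith
        _ = 3 / 4 := by norm_num
    have h5 : ‖ψ p * (p:ℂ) ^ (-s)‖ ≤ 3 / 4 := by
      rw [norm_mul, norm_natCast_cpow_of_pos hpp.pos]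
      have h0 : 0 ≤ (p:ℝ) ^ (-s).re := by positivity
      nlinarith [hψ1 p, norm_nonneg (ψ p)]
    have := norm_one_sub_ge h5
    linarith
  have hω : (∏ p ∈ M.primeFactors, (2:ℝ)) ≤ C8 * (M:ℝ) ^ ε * ∏ p ∈ M.primeFactors, (1 / 4 : ℝ) := by
    have h := h8 M (NeZero.ne M)
    have h' : ∏ p ∈ M.primeFactors, (8:ℝ) ≤ C8 * (M:ℝ) ^ ε := by
      refine le_trans (Finset.prod_le_prod (fun _ _ => by norm_num) fun p _ => ?_) h
      have : (0:ℝ) ≤ M.factorization p := by positivity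
      linarith
    calc (∏ p ∈ M.primeFactors, (2:ℝ)) = (∏ p ∈ M.primeFactors, (8:ℝ)) * ∏ p ∈ M.primeFactors, (1 / 4 : ℝ) := by
          rw [← Finset.prod_mul_distrib]; norm_num
      _ ≤ _ := by gcongr
  have hs5 : ‖s‖ ≤ 5 * ‖s - 1‖ := by
    have h1 : ‖s‖ ≤ ‖s - 1‖ + 1 := by simpa using norm_add_le (s - 1) 1
    have h2 : 1 / 4 ≤ ‖s - 1‖ := by
      have := abs_re_le_norm (s - 1)
      rw [sub_re, hs, one_re, abs_of_neg (by linarith)] at this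
      linarith
    linarith
  have hcond : (χ.conductor:ℝ) ≤ M := by
    exact_mod_cast Nat.le_of_dvd (Nat.pos_of_ne_zero (NeZero.ne M)) χ.conductor_dvd_level
  rw [hp1, hp2, hL s hne, hL (1 - s) hne', norm_mul, norm_mul, norm_mul, norm_mul, hpr, norm_neg, hs,
    show (1:ℝ) / 2 + b - 1 / 2 = b by ring]
  have hMk : (M:ℝ) ^ b * (M:ℝ) ^ ε = 4 ^ (b + ε) * (k.natAbs:ℝ) ^ (b + ε) := by
    have hM0 : (0:ℝ) < M := by exact_mod_cast Nat.pos_of_ne_zero (NeZero.ne M)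
    rw [← Real.rpow_add hM0, hMdef]
    push_cast
    rw [Real.mul_rpow (by norm_num) (by positivity)]
  calc _ ≤ (5 * ‖s - 1‖) * (((M:ℝ) ^ b * (Cγ * (1 + |s.im|)) * ‖ψ.LFunction s‖) *
        (C8 * (M:ℝ) ^ ε * ‖∏ p ∈ M.primeFactors, (1 - ψ p * (p:ℂ) ^ (-s))‖)) := by
        gcongr
        · exact hγ _ ψ s hs
        · refine hprod1.trans (hω.trans ?_)
          gcongr
    _ = 5 * C8 * ((M:ℝ) ^ b * (M:ℝ) ^ ε) * Cγ * (1 + |s.im|) * (‖s - 1‖ * (‖ψ.LFunction s‖ *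
        ‖∏ p ∈ M.primeFactors, (1 - ψ p * (p:ℂ) ^ (-s))‖)) := by ring
    _ = _ := by rw [hMk]; ring

theorem sqrt_mul_norm_tsum_gaussian_le {c : ℤ → ℂ} {D : ℝ} (hc : ∀ n, ‖c n‖ ≤ D) (h0 : c 0 = 0) {b : ℝ}
    (hb : 0 < b) : Real.sqrt b * ‖∑' n : ℤ, c n * cexp (-Real.pi * b * n ^ 2)‖ ≤ D * gaussTheta := by
  have hD : 0 ≤ D := (norm_nonneg _).trans (hc 0)
  have hθ : 0 ≤ gaussTheta := tsum_nonneg fun _ => (Real.exp_pos _).le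
  by_cases hb1 : 1 ≤ b
  · have h := norm_tsum_gaussian_sub_le hc (b := b) (by simpa using hb1)
    rw [h0, sub_zero, ofReal_re] at h
    have h1 : Real.sqrt b ≤ b := by
      rw [Real.sqrt_le_left (by linarith)]; nlinarith
    have h2 : b * Real.exp (-Real.pi * (b - 1)) ≤ 1 := by
      have e1 := Real.add_one_le_exp (b - 1)
      calc b * Real.exp (-Real.pi * (b - 1)) ≤ Real.exp (b - 1) * Real.exp (-Real.pi * (b - 1)) := by
            gcongr; linarith
        _ = Real.exp (-((Real.pi - 1) * (b - 1))) := by rw [← Real.exp_add]; congr 1; ring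
        _ ≤ 1 := by
            rw [Real.exp_le_one_iff]
            have := mul_nonneg (by linarith [Real.pi_gt_three] : 0 ≤ Real.pi - 1) (by linarith : 0 ≤ b - 1)
            linarith
    calc _ ≤ b * (D * gaussTheta * Real.exp (-Real.pi * (b - 1))) := by gcongr
      _ = D * gaussTheta * (b * Real.exp (-Real.pi * (b - 1))) := by ring
      _ ≤ D * gaussTheta * 1 := by gcongr
      _ = _ := mul_one _
  · push Not at hb1
    have hs := summable_exp_neg_mul_int_sq hb
    have h1 : ‖∑' n : ℤ, c n * cexp (-Real.pi * b * n ^ 2)‖ ≤ D * ∑' n : ℤ, Real.exp (-Real.pi * b * n ^ 2) := by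
      rw [← tsum_mul_left]
      refine tsum_of_norm_bounded (hs.mul_left D).hasSum fun n => ?_
      rw [norm_mul, norm_cexp_neg_quadratic, ofReal_re]
      gcongr
      exact hc n
    rw [Real.tsum_exp_neg_mul_int_sq hb, ← Real.sqrt_eq_rpow] at h1
    have hsq : 0 < Real.sqrt b := Real.sqrt_pos.mpr hb
    have h2 : ∑' n : ℤ, Real.exp (-Real.pi / b * n ^ 2) ≤ gaussTheta := by
      have hb' : 1 ≤ 1 / b := by rw [le_div_iff₀ hb]; linarith
      have e : ∀ n : ℤ, -Real.pi / b * (n:ℝ) ^ 2 = -Real.pi * (1 / b) * n ^ 2 := fun n => by ring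
      simp_rw [e]
      refine Summable.tsum_le_tsum (fun n => ?_) (summable_exp_neg_mul_int_sq (by positivity)) (summable_exp_neg_mul_int_sq one_pos)
      apply Real.exp_le_exp.mpr
      have : 0 ≤ Real.pi * (n:ℝ) ^ 2 := by positivity
      nlinarith
    calc _ ≤ Real.sqrt b * (D * (1 / Real.sqrt b * ∑' n : ℤ, Real.exp (-Real.pi / b * n ^ 2))) := by gcongr
      _ = D * ∑' n : ℤ, Real.exp (-Real.pi / b * n ^ 2) := by field_simp
      _ ≤ _ := by gcongr

theorem norm_tsum_jacobiSym_gaussian_le_of_squarefree {N : ℕ} (hN : Odd N) (hsq : Squarefree N) (h1 : N ≠ 1) {x : ℝ}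
    (hx : 0 < x) :
    ‖∑' k : ℤ, (jacobiSym k N : ℂ) * cexp (-Real.pi * x * k ^ 2)‖ ≤ gaussTheta * Real.sqrt N := by
  have : NeZero N := ⟨by rintro rfl; simp at hN⟩
  have hN0 : (0:ℝ) < N := by exact_mod_cast NeZero.pos N
  have h := tsum_periodic_gaussian (jac N) (a := x) (by simpa using hx)
  simp_rw [jac_intCast] at h
  have hd : ∀ n : ℤ, ZMod.dft (jac N) (-n) = epsN N * (jacobiSym n N : ℂ) * (Real.sqrt N : ℂ) := by
    intro n
    rw [← gJ_squarefree hN hsq, gJ_eq, ZMod.dft_apply]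
    apply Finset.sum_congr rfl
    intro c _
    rw [smul_eq_mul, mul_comm, mul_neg, neg_neg]
  have hb0 : 0 < 1 / (x * (N:ℝ) ^ 2) := by positivity
  have key := sqrt_mul_norm_tsum_gaussian_le (c := fun n : ℤ => ZMod.dft (jac N) (-n)) (D := Real.sqrt N) (fun n => by
    rw [hd, norm_mul, norm_mul, norm_epsN, norm_real, Real.norm_of_nonneg (Real.sqrt_nonneg _), one_mul]
    calc _ ≤ 1 * Real.sqrt N := by gcongr; exact norm_jacobiSym_le _ _
      _ = _ := one_mul _) (by
    rw [hd, jacobiSym.zero_left (by have := NeZero.pos N; omega)]; simp) hb0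
  rw [h, norm_mul]
  have e1 : ‖1 / ((x:ℂ) * N ^ 2) ^ (1 / 2 : ℂ)‖ = Real.sqrt (1 / (x * (N:ℝ) ^ 2)) := by
    rw [norm_div, norm_one, show ((x:ℂ) * N ^ 2) = ((x * (N:ℝ) ^ 2 : ℝ) : ℂ) by push_cast; ring,
      norm_cpow_eq_rpow_re_of_pos (by positivity), Real.sqrt_div (by norm_num), Real.sqrt_one, Real.sqrt_eq_rpow]
    norm_num
  rw [e1, mul_comm gaussTheta]
  refine le_trans (le_of_eq ?_) key
  congr 2
  push_cast
  rfl

theorem sum_moebius_divisors_dvd (k : ℤ) (m : ℕ) (hm : m ≠ 0) :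
    ∑ e ∈ m.divisors, (if (e:ℤ) ∣ k then (ArithmeticFunction.moebius e : ℤ) else 0) = if Int.gcd k m = 1 then 1 else 0 := by
  rw [← Finset.sum_filter]
  have h1 : m.divisors.filter (fun e : ℕ => (e:ℤ) ∣ k) = (Int.gcd k m).divisors := by
    ext e
    simp only [Finset.mem_filter, Nat.mem_divisors, Int.gcd_eq_zero_iff, ne_eq]
    constructor
    · rintro ⟨⟨h1, h2⟩, h3⟩
      exact ⟨Int.dvd_gcd h3 (by exact_mod_cast h1), by simp [hm]⟩
    · rintro ⟨h1, _⟩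
      have h2 : (e:ℤ) ∣ k := (Int.natCast_dvd_natCast.mpr h1).trans (Int.gcd_dvd_left _ _)
      have h3 : (e:ℤ) ∣ m := (Int.natCast_dvd_natCast.mpr h1).trans (Int.gcd_dvd_right _ _)
      exact ⟨⟨by exact_mod_cast h3, hm⟩, h2⟩
  rw [h1, ← ArithmeticFunction.coe_mul_zeta_apply, ArithmeticFunction.moebius_mul_coe_zeta, ArithmeticFunction.one_apply]

theorem norm_tsum_jacobiSym_gaussian_le {N : ℕ} (hN : Odd N) (hsq : ¬ IsSquare N) {x : ℝ} (hx : 0 < x) :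
    ‖∑' k : ℤ, (jacobiSym k N : ℂ) * cexp (-Real.pi * x * k ^ 2)‖ ≤ gaussTheta * Real.sqrt N := by
  have hθ : 0 ≤ gaussTheta := tsum_nonneg fun _ => (Real.exp_pos _).le
  obtain ⟨a, m, hm, ha⟩ := Nat.sq_mul_squarefree N
  have hN0 : N ≠ 0 := by rintro rfl; simp at hN
  have hm0 : m ≠ 0 := by rintro rfl; simp at hm; omega
  have ha1 : a ≠ 1 := by
    rintro rfl
    exact hsq ⟨m, by rw [← hm]; ring⟩
  have hao : Odd a := by rw [← hm] at hN; exact (Nat.odd_mul.mp hN).2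
  have : NeZero m := ⟨hm0⟩
  have : NeZero a := ⟨by rintro rfl; simp at hao⟩
  have hjac : ∀ k : ℤ, (jacobiSym k N : ℂ) = ∑ e ∈ m.divisors,
      (ArithmeticFunction.moebius e : ℂ) * (if (e:ℤ) ∣ k then (jacobiSym k a : ℂ) else 0) := by
    intro k
    have h := sum_moebius_divisors_dvd k m hm0
    have h2 : jacobiSym k N = (if Int.gcd k m = 1 then 1 else 0) * jacobiSym k a := by
      rw [← hm, jacobiSym.mul_right, sq, jacobiSym.mul_right]
      split_ifs with hg
      · rw [← sq, jacobiSym.sq_one hg]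
      · rw [jacobiSym.eq_zero_iff_not_coprime.mpr hg]; simp
    rw [h2, ← h, Finset.sum_mul]
    push_cast
    apply Finset.sum_congr rfl
    intro e _
    split_ifs <;> simp
  have hbase : ∀ e ∈ m.divisors, ∑' k : ℤ, (if (e:ℤ) ∣ k then (jacobiSym k a : ℂ) else 0) * cexp (-Real.pi * x * k ^ 2)
      = (jacobiSym e a : ℂ) * ∑' k : ℤ, (jacobiSym k a : ℂ) * cexp (-Real.pi * ((x * e ^ 2 : ℝ):ℂ) * k ^ 2) := by
    intro e he
    have he0 : (e:ℤ) ≠ 0 := by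
      have := Nat.pos_of_mem_divisors he
      exact_mod_cast this.ne'
    have hinj : Function.Injective (fun j : ℤ => (e:ℤ) * j) := fun i j h => mul_left_cancel₀ he0 h
    rw [← hinj.tsum_eq]
    · rw [← tsum_mul_left]
      apply tsum_congr
      intro j
      simp only [dvd_mul_right, if_true]
      rw [jacobiSym.mul_left]
      push_cast
      rw [mul_assoc]
      congr 3
      ring
    · intro k hk
      by_contra h
      apply hk
      simp only
      rw [if_neg, zero_mul]
      rintro ⟨j, rfl⟩
      exact h ⟨j, rfl⟩
  have hsumm : ∀ e ∈ m.divisors, Summable (fun k : ℤ => (ArithmeticFunction.moebius e : ℂ) *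
      ((if (e:ℤ) ∣ k then (jacobiSym k a : ℂ) else 0) * cexp (-Real.pi * x * k ^ 2))) := by
    intro e _
    apply Summable.mul_left
    apply summable_mul_cexp_neg_quadratic (by simpa using hx) (D := 1)
    intro k
    split_ifs
    · exact norm_jacobiSym_le _ _
    · simp
  have htot : ∑' k : ℤ, (jacobiSym k N : ℂ) * cexp (-Real.pi * x * k ^ 2) = ∑ e ∈ m.divisors,
      (ArithmeticFunction.moebius e : ℂ) * ((jacobiSym e a : ℂ) *
        ∑' k : ℤ, (jacobiSym k a : ℂ) * cexp (-Real.pi * ((x * e ^ 2 : ℝ):ℂ) * k ^ 2)) := by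
    simp_rw [hjac, Finset.sum_mul, mul_assoc]
    simp_rw [mul_assoc] at hsumm
    rw [Summable.tsum_finsetSum hsumm]
    apply Finset.sum_congr rfl
    intro e he
    have := hbase e he
    simp_rw [mul_assoc] at this
    rw [tsum_mul_left, this]
  rw [htot]
  calc _ ≤ ∑ e ∈ m.divisors, gaussTheta * Real.sqrt a := by
        apply norm_sum_le_of_le
        intro e he
        have he0 : (0:ℝ) < e := by exact_mod_cast Nat.pos_of_mem_divisors he
        have h1 := norm_tsum_jacobiSym_gaussian_le_of_squarefree hao ha ha1 (x := x * e ^ 2) (by positivity)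
        have h2 : ‖(ArithmeticFunction.moebius e : ℂ)‖ ≤ 1 := by
          have := ArithmeticFunction.abs_moebius_le_one (n := e)
          rw [norm_intCast]
          exact_mod_cast this
        rw [norm_mul, norm_mul]
        calc _ ≤ 1 * (1 * (gaussTheta * Real.sqrt a)) := by
              gcongr
              exact norm_jacobiSym_le _ _
          _ = _ := by ring
    _ = m.divisors.card * (gaussTheta * Real.sqrt a) := by simp
    _ ≤ m * (gaussTheta * Real.sqrt a) := by
        gcongr
        exact_mod_cast Nat.card_divisors_le_self m
    _ = _ := by
        rw [← hm]; push_cast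
        rw [Real.sqrt_mul (by positivity), Real.sqrt_sq (by positivity)]; ring

theorem norm_polL_le_of_apply_zero {N : ℕ} [NeZero N] (Φ : ZMod N → ℂ) (hΦ : ∀ j, ‖Φ j‖ ≤ 1) (h0 : Φ 0 = 0)
    {s : ℂ} (h1 : -1 ≤ s.re) (h2 : s.re ≤ 12) :
    ‖polL Φ s‖ ≤ 30000 * (N:ℝ) ^ 3 * (1 + |s.im|) ^ 4 := by
  have hN : (1:ℝ) ≤ N := by exact_mod_cast NeZero.pos N
  have ht : 1 ≤ 1 + |s.im| := by linarith [abs_nonneg s.im]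
  have hs : ‖s‖ ≤ 12 + |s.im| := by
    refine (norm_le_abs_re_add_abs_im s).trans ?_
    gcongr
    rw [abs_le]; constructor <;> linarith
  by_cases h : 1 / 2 ≤ s.re
  · refine (norm_polL_le Φ hΦ h).trans ?_
    have e1 : (1 + ‖s‖) ^ 2 ≤ (13 * (1 + |s.im|)) ^ 2 := by
      gcongr; linarith [abs_nonneg s.im]
    have e2 : (N:ℝ) ≤ (N:ℝ) ^ 3 := le_self_pow₀ hN (by norm_num)
    have e3 : (1 + |s.im|) ^ 2 ≤ (1 + |s.im|) ^ 4 := pow_le_pow_right₀ ht (by norm_num)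
    calc 8 * N * 1 * (1 + ‖s‖) ^ 2 ≤ 8 * (N:ℝ) ^ 3 * 1 * (13 * (1 + |s.im|)) ^ 2 := by gcongr
      _ = 1352 * (N:ℝ) ^ 3 * (1 + |s.im|) ^ 2 := by ring
      _ ≤ 30000 * (N:ℝ) ^ 3 * (1 + |s.im|) ^ 4 := by gcongr; norm_num
  · push Not at h
    have hne : s ≠ 1 := by rintro rfl; norm_num at h
    rw [polL_of_ne Φ hne, norm_mul]
    have e1 := norm_LFunction_le_of_apply_zero (Φ := Φ) hΦ h0 h1 h.le
    have e2 : ‖s - 1‖ ≤ 3 * (1 + |s.im|) := by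
      refine (norm_le_abs_re_add_abs_im _).trans ?_
      have : |(s - 1).re| ≤ 2 := by
        rw [sub_re, one_re, abs_le]; constructor <;> linarith
      simp only [sub_im, one_im, sub_zero]
      linarith [abs_nonneg s.im]
    calc _ ≤ 3 * (1 + |s.im|) * (10000 * (N:ℝ) ^ 3 * (1 + |s.im|) ^ 3) := by gcongr
      _ = _ := by ring

theorem norm_polK_le {k : ℤ} (hk : k ≠ 0) {s : ℂ} (h1 : -1 ≤ s.re) (h2 : s.re ≤ 12) :
    ‖polK k s‖ ≤ 2000000 * (k.natAbs:ℝ) ^ 3 * (1 + |s.im|) ^ 4 := by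
  have : NeZero (4 * k.natAbs) := ⟨by simpa using hk⟩
  have : Fact (1 < 4 * k.natAbs) := ⟨by have := Int.natAbs_pos.mpr hk; omega⟩
  have h := norm_polL_le_of_apply_zero (chiK k hk) (fun j => (chiK k hk).norm_le_one j) (by
    exact MulChar.map_zero _) h1 h2
  rw [polK, dif_neg hk]
  refine h.trans ?_
  push_cast
  rw [mul_pow, ← mul_assoc]
  gcongr
  norm_num

theorem summable_square_pairs {b : ℝ} (hb : 0 < b) :
    Summable (fun x : ℕ × ℕ => if IsSquare (x.1 * x.2) then ((x.1 * x.2 : ℕ):ℝ) ^ (-(1 / 2 + b)) else 0) := by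
  set F := (fun x : ℕ × ℕ => if IsSquare (x.1 * x.2) then ((x.1 * x.2 : ℕ):ℝ) ^ (-(1 / 2 + b)) else 0) with hF
  have h1 : Summable (fun n : ℕ => (n:ℝ) ^ (-(1 + 2 * b))) := Real.summable_nat_rpow.mpr (by linarith)
  have h2 := h1.mul_of_nonneg (h1.mul_of_nonneg h1 (fun _ => by positivity) (fun _ => by positivity))
    (fun _ => by positivity) (fun _ => by positivity)
  have hpar : ∀ x : ↥(Function.support F), ∃ y : ℕ × ℕ × ℕ, x.1.1 = y.1 * y.2.1 ^ 2 ∧ x.1.2 = y.1 * y.2.2 ^ 2 := by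
    rintro ⟨⟨n, m⟩, hx⟩
    rw [Function.mem_support] at hx
    simp only [hF] at hx
    have hsq : IsSquare (n * m) := by
      by_contra h; rw [if_neg h] at hx; exact hx rfl
    rw [if_pos hsq] at hx
    have hnm : n * m ≠ 0 := by
      intro h; rw [h] at hx; apply hx; rw [Nat.cast_zero, Real.zero_rpow (by linarith)]
    obtain ⟨r, hr⟩ := hsq
    obtain ⟨β, α, hβ, hsf⟩ := Nat.sq_mul_squarefree n
    have hα : α ≠ 0 := by rintro rfl; simp at hβ; rw [← hβ] at hnm; simp at hnm
    have hβ0 : β ≠ 0 := hsf.ne_zero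
    have hαr : α ∣ r := by
      rw [← Nat.pow_dvd_pow_iff (n := 2) (by norm_num)]
      rw [sq r, ← hr, ← hβ, mul_assoc]; exact dvd_mul_right _ _
    obtain ⟨r', rfl⟩ := hαr
    have h3 : β * m = r' * r' := by
      have : α ^ 2 * (β * m) = α ^ 2 * (r' * r') := by rw [← mul_assoc, hβ, hr]; ring
      exact mul_left_cancel₀ (pow_ne_zero 2 hα) this
    have hβr : β ∣ r' := by
      rw [← hsf.dvd_pow_iff_dvd (n := 2) (by norm_num), sq, ← h3]; exact dvd_mul_right _ _
    obtain ⟨j, rfl⟩ := hβr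
    have h4 : m = β * j ^ 2 := by
      apply mul_left_cancel₀ hβ0
      rw [h3]; ring
    exact ⟨(β, α, j), by change n = β * α ^ 2; rw [← hβ]; ring, h4⟩
  choose σ hσ1 hσ2 using hpar
  have hinj : Function.Injective σ := by
    intro x y h
    apply Subtype.ext
    apply Prod.ext
    · rw [hσ1, hσ1, h]
    · rw [hσ2, hσ2, h]
  have h3 := h2.comp_injective hinj
  have h4 : Summable (F ∘ ((↑) : ↥(Function.support F) → ℕ × ℕ)) := by
    refine h3.congr fun x => ?_
    have hx := x.2
    rw [Function.mem_support] at hx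
    simp only [Function.comp]
    simp only [hF] at hx ⊢
    have hsq : IsSquare (x.1.1 * x.1.2) := by
      by_contra h; rw [if_neg h] at hx; exact hx rfl
    rw [if_pos hsq, hσ1, hσ2]
    push_cast
    rw [← Real.mul_rpow (by positivity) (by positivity), ← Real.mul_rpow (by positivity) (by positivity),
      show ((σ x).1 * ((σ x).2.1:ℝ) ^ 2 * ((σ x).1 * ((σ x).2.2:ℝ) ^ 2)) =
        ((σ x).1 * (((σ x).2.1:ℝ) * (σ x).2.2)) ^ (2:ℝ) by rw [Real.rpow_two]; ring,
      ← Real.rpow_mul (by positivity)]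
    congr 1; ring
  rw [← indicator_support (f := F)]
  exact summable_subtype_iff_indicator.mp h4

theorem conj_chk (k : ℤ) (n : ℕ) : (starRingEnd ℂ) (chk k n) = chk k n := by
  unfold chk; split_ifs <;> simp

theorem norm_tsum_chk_gaussian_le (ν : ℕ) {K : ℕ} (hK : 1 ≤ K) :
    ‖∑' k : ℤ, chk k ν * cexp (-Real.pi * ((1 / (K:ℝ) ^ 2 : ℝ):ℂ) * k ^ 2)‖ ≤
      gaussTheta * (Real.sqrt ν + if IsSquare ν then (K:ℝ) else 0) := by
  have hθ : 0 ≤ gaussTheta := tsum_nonneg fun _ => (Real.exp_pos _).le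
  have hK0 : (0:ℝ) < K := by exact_mod_cast hK
  have hx : 0 < 1 / (K:ℝ) ^ 2 := by positivity
  split_ifs with hsq
  · have h1 : ‖∑' k : ℤ, chk k ν * cexp (-Real.pi * ((1 / (K:ℝ) ^ 2 : ℝ):ℂ) * k ^ 2)‖ ≤
        ∑' k : ℤ, Real.exp (-Real.pi * (1 / (K:ℝ) ^ 2) * k ^ 2) := by
      refine tsum_of_norm_bounded (summable_exp_neg_mul_int_sq hx).hasSum fun k => ?_
      rw [norm_mul, norm_cexp_neg_quadratic, ofReal_re]
      calc _ ≤ 1 * Real.exp (-Real.pi * (1 / (K:ℝ) ^ 2) * k ^ 2) := by gcongr; exact norm_chk_le k ν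
        _ = _ := one_mul _
    rw [Real.tsum_exp_neg_mul_int_sq hx, ← Real.sqrt_eq_rpow, Real.sqrt_div (by norm_num), Real.sqrt_one,
      Real.sqrt_sq hK0.le, one_div_one_div] at h1
    have h2 : ∑' n : ℤ, Real.exp (-Real.pi / (1 / (K:ℝ) ^ 2) * n ^ 2) ≤ gaussTheta := by
      have e : ∀ n : ℤ, -Real.pi / (1 / (K:ℝ) ^ 2) * (n:ℝ) ^ 2 = -Real.pi * ((K:ℝ) ^ 2) * n ^ 2 := fun n => by
        field_simp
      simp_rw [e]
      refine Summable.tsum_le_tsum (fun n => ?_) (summable_exp_neg_mul_int_sq (by positivity)) (summable_exp_neg_mul_int_sq one_pos)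
      apply Real.exp_le_exp.mpr
      have : 0 ≤ Real.pi * (n:ℝ) ^ 2 := by positivity
      have h3 : (1:ℝ) ≤ (K:ℝ) ^ 2 := one_le_pow₀ (by exact_mod_cast hK)
      nlinarith
    calc _ ≤ K * gaussTheta := h1.trans (by gcongr)
      _ = gaussTheta * (0 + K) := by ring
      _ ≤ _ := by gcongr; positivity
  · rw [add_zero]
    by_cases hodd : Odd ν
    · have := norm_tsum_jacobiSym_gaussian_le hodd hsq hx
      simpa only [chk, if_pos hodd] using this
    · simp only [chk, if_neg hodd, zero_mul, tsum_zero, norm_zero]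
      positivity

/-- A large sieve inequality for the real characters `(k / ·)`. -/
theorem sum_norm_sq_twisted_le {a : ℕ → ℂ} (ha : Summable (fun n => ‖a n‖ * Real.sqrt n)) (ha0 : a 0 = 0)
    {K : ℕ} (hK : 1 ≤ K)
    (hsq : Summable (fun x : ℕ × ℕ => if IsSquare (x.1 * x.2) then ‖a x.1‖ * ‖a x.2‖ else 0)) :
    ∑ k ∈ Finset.Icc (-(K:ℤ)) K, ‖∑' n, chk k n * a n‖ ^ 2 ≤ Real.exp Real.pi * gaussTheta *
      ((∑' n, ‖a n‖ * Real.sqrt n) ^ 2 +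
        K * ∑' x : ℕ × ℕ, (if IsSquare (x.1 * x.2) then ‖a x.1‖ * ‖a x.2‖ else 0)) := by
  have hθ : 0 ≤ gaussTheta := tsum_nonneg fun _ => (Real.exp_pos _).le
  have hK0 : (0:ℝ) < K := by exact_mod_cast hK
  have hx : 0 < 1 / (K:ℝ) ^ 2 := by positivity
  have has : Summable (fun n => ‖a n‖) := by
    refine Summable.of_nonneg_of_le (fun _ => norm_nonneg _) (fun n => ?_) ha
    rcases Nat.eq_zero_or_pos n with rfl | hn
    · simp [ha0]
    · have : 1 ≤ Real.sqrt n := Real.one_le_sqrt.mpr (by exact_mod_cast hn)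
      nlinarith [norm_nonneg (a n)]
  set w : ℤ → ℂ := fun k => cexp (-Real.pi * ((1 / (K:ℝ) ^ 2 : ℝ):ℂ) * k ^ 2) with hw
  set W : ℤ → ℝ := fun k => Real.exp (-Real.pi * (1 / (K:ℝ) ^ 2) * k ^ 2) with hW
  have hwn : ∀ k, ‖w k‖ = W k := fun k => by simp only [hw, hW]; rw [norm_cexp_neg_quadratic, ofReal_re]
  have hwW : ∀ k, w k = (W k : ℂ) := fun k => by
    simp only [hw, hW]; push_cast; rfl
  have hWs : Summable W := summable_exp_neg_mul_int_sq hx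
  set A : ℤ → ℂ := fun k => ∑' n, chk k n * a n with hA
  have hAs : ∀ k, Summable (fun n => ‖chk k n * a n‖) := fun k =>
    Summable.of_nonneg_of_le (fun _ => norm_nonneg _) (fun n => by
      rw [norm_mul]; nlinarith [norm_chk_le k n, norm_nonneg (a n)]) has
  have hAb : ∀ k, ‖A k‖ ≤ ∑' n, ‖a n‖ := fun k =>
    tsum_of_norm_bounded has.hasSum fun n => by
      rw [norm_mul]; nlinarith [norm_chk_le k n, norm_nonneg (a n)]
  have hAsq : ∀ k, ((‖A k‖ ^ 2 : ℝ) : ℂ) = ∑' x : ℕ × ℕ, chk k (x.1 * x.2) * (a x.1 * (starRingEnd ℂ) (a x.2)) := by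
    intro k
    rw [show ((‖A k‖ ^ 2 : ℝ) : ℂ) = A k * (starRingEnd ℂ) (A k) by rw [mul_conj, normSq_eq_norm_sq]]
    have hc : (starRingEnd ℂ) (A k) = ∑' n, chk k n * (starRingEnd ℂ) (a n) := by
      simp only [hA]
      rw [conj_tsum]
      apply tsum_congr
      intro n; rw [map_mul, conj_chk]
    rw [hc]
    simp only [hA]
    rw [tsum_mul_tsum_of_summable_norm (hAs k) (by
      refine (hAs k).congr fun n => ?_
      rw [norm_mul, norm_mul, RCLike.norm_conj])]
    apply tsum_congr
    intro x; rw [chk_mul]; ring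
  have hprod : Summable (fun x : ℕ × ℕ => ‖a x.1‖ * ‖a x.2‖) :=
    has.mul_of_nonneg has (fun _ => norm_nonneg _) (fun _ => norm_nonneg _)
  have hbig : Summable (fun y : ℤ × (ℕ × ℕ) => w y.1 * (chk y.1 (y.2.1 * y.2.2) * (a y.2.1 * (starRingEnd ℂ) (a y.2.2)))) := by
    apply Summable.of_norm
    refine Summable.of_nonneg_of_le (fun _ => norm_nonneg _) (fun y => ?_)
      (hWs.mul_of_nonneg hprod (fun _ => (Real.exp_pos _).le) (fun _ => by positivity))
    rw [norm_mul, norm_mul, norm_mul, hwn, RCLike.norm_conj]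
    have h1 := norm_chk_le y.1 (y.2.1 * y.2.2)
    have h0 : 0 ≤ W y.1 := (Real.exp_pos _).le
    calc _ ≤ W y.1 * (1 * (‖a y.2.1‖ * ‖a y.2.2‖)) := by gcongr
      _ = _ := by ring
  have htot : (∑' k, ((W k * ‖A k‖ ^ 2 : ℝ) : ℂ)) = ∑' x : ℕ × ℕ, (a x.1 * (starRingEnd ℂ) (a x.2)) *
      ∑' k : ℤ, chk k (x.1 * x.2) * w k := by
    have e1 : ∀ k, ((W k * ‖A k‖ ^ 2 : ℝ) : ℂ) = ∑' x : ℕ × ℕ, w k * (chk k (x.1 * x.2) * (a x.1 * (starRingEnd ℂ) (a x.2))) := by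
      intro k
      rw [tsum_mul_left, ← hAsq, hwW]; push_cast; ring
    rw [tsum_congr e1, ← Summable.tsum_comm (f := fun k (x : ℕ × ℕ) => w k * (chk k (x.1 * x.2) * (a x.1 * (starRingEnd ℂ) (a x.2)))) hbig]
    apply tsum_congr
    intro x
    rw [← tsum_mul_left]
    apply tsum_congr
    intro k; ring
  have hs1 : Summable (fun x : ℕ × ℕ => (‖a x.1‖ * Real.sqrt x.1) * (‖a x.2‖ * Real.sqrt x.2)) :=
    ha.mul_of_nonneg ha (fun _ => by positivity) (fun _ => by positivity)
  have hs2 := (hs1.add (hsq.mul_left (K:ℝ))).mul_left gaussTheta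
  have hbound : ‖∑' k, ((W k * ‖A k‖ ^ 2 : ℝ) : ℂ)‖ ≤ gaussTheta *
      ((∑' n, ‖a n‖ * Real.sqrt n) ^ 2 +
        K * ∑' x : ℕ × ℕ, (if IsSquare (x.1 * x.2) then ‖a x.1‖ * ‖a x.2‖ else 0)) := by
    rw [htot, sq, tsum_mul_tsum_of_summable_norm (ha.congr fun n => (Real.norm_of_nonneg (by positivity)).symm)
      (ha.congr fun n => (Real.norm_of_nonneg (by positivity)).symm), ← tsum_mul_left, ← hs1.tsum_add (hsq.mul_left _), ← tsum_mul_left]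
    refine tsum_of_norm_bounded hs2.hasSum fun x => ?_
    rw [norm_mul, norm_mul, RCLike.norm_conj]
    have := norm_tsum_chk_gaussian_le (x.1 * x.2) hK
    calc _ ≤ ‖a x.1‖ * ‖a x.2‖ * (gaussTheta * (Real.sqrt ((x.1 * x.2 : ℕ):ℝ) + if IsSquare (x.1 * x.2) then (K:ℝ) else 0)) := by
          gcongr
      _ = _ := by
          push_cast
          rw [Real.sqrt_mul (by positivity)]
          split_ifs <;> ring
  have hWA : Summable (fun k => W k * ‖A k‖ ^ 2) := by
    refine Summable.of_nonneg_of_le (fun k => mul_nonneg (Real.exp_pos _).le (by positivity)) (fun k => ?_) (hWs.mul_right ((∑' n, ‖a n‖) ^ 2))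
    have h0 : 0 ≤ W k := (Real.exp_pos _).le
    gcongr
    exact hAb k
  have hre : ‖∑' k, ((W k * ‖A k‖ ^ 2 : ℝ) : ℂ)‖ = ∑' k, W k * ‖A k‖ ^ 2 := by
    rw [← ofReal_tsum, norm_real, Real.norm_of_nonneg]
    exact tsum_nonneg fun k => mul_nonneg (Real.exp_pos _).le (by positivity)
  rw [hre] at hbound
  calc ∑ k ∈ Finset.Icc (-(K:ℤ)) K, ‖A k‖ ^ 2 ≤ ∑ k ∈ Finset.Icc (-(K:ℤ)) K, Real.exp Real.pi * (W k * ‖A k‖ ^ 2) := by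
        apply Finset.sum_le_sum
        intro k hk
        have h1 : 1 ≤ Real.exp Real.pi * W k := by
          simp only [hW]
          rw [← Real.exp_add, Real.one_le_exp_iff]
          have hk2 : (k:ℝ) ^ 2 ≤ (K:ℝ) ^ 2 := by
            rw [Finset.mem_Icc] at hk
            rw [sq_le_sq, abs_of_pos hK0, abs_le]
            exact ⟨by exact_mod_cast hk.1, by exact_mod_cast hk.2⟩
          have : 1 / (K:ℝ) ^ 2 * k ^ 2 ≤ 1 := by
            rw [one_div, inv_mul_le_iff₀ (by positivity)]; linarith
          nlinarith [Real.pi_pos]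
        rw [← mul_assoc]
        nlinarith [sq_nonneg ‖A k‖]
    _ = Real.exp Real.pi * ∑ k ∈ Finset.Icc (-(K:ℤ)) K, (W k * ‖A k‖ ^ 2) := by rw [Finset.mul_sum]
    _ ≤ Real.exp Real.pi * ∑' k, (W k * ‖A k‖ ^ 2) := by
        gcongr
        exact hWA.sum_le_tsum _ fun k _ => mul_nonneg (Real.exp_pos _).le (by positivity)
    _ ≤ _ := by
        rw [mul_assoc]
        gcongr

theorem sq_integral_mul_le {h g : ℝ → ℝ} (hg : Integrable g) (hg0 : ∀ y, 0 ≤ g y)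
    (hhg : Integrable (fun y => h y * g y)) (hh2 : Integrable (fun y => h y ^ 2 * g y)) :
    (∫ y, h y * g y) ^ 2 ≤ (∫ y, g y) * ∫ y, h y ^ 2 * g y := by
  have key : ∀ x : ℝ, 0 ≤ (∫ y, g y) * (x * x) + (-2 * ∫ y, h y * g y) * x + ∫ y, h y ^ 2 * g y := by
    intro x
    have h1 : 0 ≤ ∫ y, (h y - x) ^ 2 * g y := integral_nonneg fun y => mul_nonneg (sq_nonneg _) (hg0 y)
    have h2 : ∫ y, (h y - x) ^ 2 * g y = ∫ y, (h y ^ 2 * g y - 2 * x * (h y * g y) + x * x * g y) :=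
      integral_congr_ae (ae_of_all _ fun y => by ring)
    rw [h2, integral_add (f := fun y => h y ^ 2 * g y - 2 * x * (h y * g y)) (hh2.sub (hhg.const_mul _)) (hg.const_mul _), integral_sub hh2 (hhg.const_mul _),
      integral_const_mul, integral_const_mul] at h1
    linarith
  have := discrim_le_zero key
  rw [discrim] at this
  nlinarith

theorem integrable_exp_neg_sq : Integrable (fun y : ℝ => Real.exp (-y ^ 2)) := by
  simpa using integrable_exp_neg_mul_sq one_pos

theorem integrable_pow_mul_exp_neg_sq (A : ℕ) : Integrable (fun y : ℝ => (1 + |y|) ^ A * Real.exp (-y ^ 2)) := by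
  obtain ⟨C, _, hC⟩ := one_add_abs_pow_mul_exp_le A
  refine (integrable_inv_one_add_sq_mul C).mono' (by fun_prop) (ae_of_all _ fun y => ?_)
  rw [Real.norm_of_nonneg (by positivity)]
  exact hC y

theorem one_add_abs_add_le (t y : ℝ) : 1 + |t + y| ≤ (1 + |t|) * (1 + |y|) := by
  nlinarith [abs_add_le t y, abs_nonneg t, abs_nonneg y]

/-- The kernel `(s + w - 1) n^{-s-w} N^w e^{w²} / w`. -/
def kerA (s : ℂ) (N : ℝ) (n : ℕ) (w : ℂ) : ℂ :=
  (s + w - 1) * (n:ℂ) ^ (-(s + w)) * (N:ℂ) ^ w * (cexp (w ^ 2) / w)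

/-- The smoothed Dirichlet coefficient of the approximation to `(s - 1) L(s, χ)`. -/
def coefA (s : ℂ) (N : ℝ) (n : ℕ) : ℂ := ∫ y : ℝ, kerA s N n ((1:ℝ) + y * I)

theorem norm_kerA_le {s : ℂ} {N e : ℝ} (hs : 0 < s.re) (hs1 : s.re ≤ 1) (hN : 1 ≤ N) (he : 0 < e) (n : ℕ) {w : ℂ}
    (hw : e ≤ w.re) (hw1 : w.re ≤ 1) :
    ‖kerA s N n w‖ ≤ (2 / e + 1) * Real.exp 1 * (1 + |s.im|) * ((n:ℝ) ^ (-(s.re + w.re)) * N ^ w.re) *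
      Real.exp (-w.im ^ 2) := by
  have hw0 : 0 < w.re := by linarith
  have hwn : e ≤ ‖w‖ := hw.trans ((le_abs_self _).trans (abs_re_le_norm w))
  have hwpos : 0 < ‖w‖ := by linarith
  unfold kerA
  rw [norm_mul, norm_mul, norm_mul, norm_div, norm_natCast_cpow_le n (by simp; linarith), add_re,
    norm_cpow_eq_rpow_re_of_pos (by linarith)]
  have h1 : ‖cexp (w ^ 2)‖ ≤ Real.exp 1 * Real.exp (-w.im ^ 2) := by
    have := norm_exp_sq w.re w.im
    rw [re_add_im] at this
    rw [this]
    gcongr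
    nlinarith
  have h2 : ‖s + w - 1‖ / ‖w‖ ≤ (2 / e + 1) * (1 + |s.im|) := by
    have e1 : ‖s - 1‖ ≤ 2 * (1 + |s.im|) := by
      refine (norm_le_abs_re_add_abs_im _).trans ?_
      have : |(s - 1).re| ≤ 1 := by rw [sub_re, one_re, abs_le]; constructor <;> linarith
      simp only [sub_im, one_im, sub_zero]
      linarith [abs_nonneg s.im]
    have e2 : ‖s + w - 1‖ ≤ ‖s - 1‖ + ‖w‖ := by
      rw [show s + w - 1 = (s - 1) + w by ring]; exact norm_add_le _ _
    rw [div_le_iff₀ hwpos]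
    have e3 : 2 / e * ‖w‖ ≥ 2 := by
      rw [ge_iff_le, div_mul_eq_mul_div, le_div_iff₀ he]; linarith
    nlinarith [abs_nonneg s.im, mul_nonneg (abs_nonneg s.im) hwpos.le]
  calc _ = (‖s + w - 1‖ / ‖w‖) * ((n:ℝ) ^ (-(s.re + w.re)) * N ^ w.re) * ‖cexp (w ^ 2)‖ := by ring
    _ ≤ ((2 / e + 1) * (1 + |s.im|)) * ((n:ℝ) ^ (-(s.re + w.re)) * N ^ w.re) * (Real.exp 1 * Real.exp (-w.im ^ 2)) := by
        gcongr
    _ = _ := by ring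

theorem norm_coefA_le {s : ℂ} {N e : ℝ} (hs : 0 < s.re) (hs1 : s.re ≤ 1) (hN : 1 ≤ N) (he : 0 < e) (he1 : e ≤ 1)
    {n : ℕ} :
    ‖coefA s N n‖ ≤ (2 / e + 1) * Real.exp 1 * (∫ y : ℝ, Real.exp (-y ^ 2)) * (1 + |s.im|) *
      ((n:ℝ) ^ (-(s.re + e)) * N ^ e) := by
  rcases Nat.eq_zero_or_pos n with rfl | hn
  · have : coefA s N 0 = 0 := by
      unfold coefA kerA
      have e0 : ∀ y : ℝ, ((0:ℕ):ℂ) ^ (-(s + ((1:ℝ) + y * I))) = 0 := by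
        intro y
        rw [Nat.cast_zero, zero_cpow]
        intro h
        have := congrArg re h
        simp at this
        linarith
      simp_rw [e0]; simp
    rw [this, norm_zero]
    have : 0 ≤ ∫ y : ℝ, Real.exp (-y ^ 2) := integral_nonneg fun _ => (Real.exp_pos _).le
    positivity
  have hn1 : (1:ℝ) ≤ n := by exact_mod_cast hn
  have hn0 : (n:ℂ) ≠ 0 := by exact_mod_cast hn.ne'
  obtain ⟨D, hD0, hD⟩ := one_add_abs_pow_mul_exp_le 0
  have hshift : coefA s N n = ∫ y : ℝ, kerA s N n (e + y * I) := by
    unfold coefA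
    symm
    refine integral_vertical_eq (C := (2 / e + 1) * Real.exp 1 * (1 + |s.im|) * (1 * N) * D) he1 (fun w h1 h2 => ?_) (fun w h1 h2 => ?_)
    · unfold kerA
      have hw0 : w ≠ 0 := by rintro rfl; simp at h1; linarith
      have hN0 : (N:ℂ) ≠ 0 := by exact_mod_cast (by linarith : N ≠ 0)
      refine DifferentiableAt.mul (DifferentiableAt.mul (DifferentiableAt.mul (by fun_prop) ?_) ?_) ?_
      · exact DifferentiableAt.const_cpow (by fun_prop) (Or.inl hn0)
      · exact DifferentiableAt.const_cpow (by fun_prop) (Or.inl hN0)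
      · exact DifferentiableAt.div (by fun_prop) (by fun_prop) hw0
    · refine (norm_kerA_le hs hs1 hN he n h1 h2).trans ?_
      have e1 := hD w.im
      rw [pow_zero, one_mul] at e1
      have e2 : (n:ℝ) ^ (-(s.re + w.re)) ≤ 1 := Real.rpow_le_one_of_one_le_of_nonpos hn1 (by linarith)
      have e3 : N ^ w.re ≤ N := by
        calc N ^ w.re ≤ N ^ (1:ℝ) := Real.rpow_le_rpow_of_exponent_le hN h2
          _ = N := Real.rpow_one N
      rw [mul_div_assoc]
      gcongr
  rw [hshift]
  have hb : ∀ y : ℝ, ‖kerA s N n (e + y * I)‖ ≤ (2 / e + 1) * Real.exp 1 * (1 + |s.im|) * ((n:ℝ) ^ (-(s.re + e)) * N ^ e) *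
      Real.exp (-y ^ 2) := by
    intro y
    have := norm_kerA_le hs hs1 hN he n (w := e + y * I) (by simp) (by simpa using he1)
    simpa using this
  refine (norm_integral_le_of_norm_le (integrable_exp_neg_sq.const_mul _) (ae_of_all _ hb)).trans (le_of_eq ?_)
  rw [integral_const_mul]; ring

theorem polK_representation {k : ℤ} (hk : k ≠ 0) {b N : ℝ} (hb : 0 < b) (hb2 : b ≤ 1 / 4) (hN : 1 ≤ N) {s : ℂ}
    (hs : s.re = 1 / 2 + b) :
    2 * Real.pi * polK k s = (∑' n, chk k n * coefA s N n) -
      ∫ y : ℝ, polK k (s + ((-(2 * b) : ℝ) + y * I)) * (N:ℂ) ^ ((-(2 * b) : ℝ) + y * I : ℂ) *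
        (cexp (((-(2 * b) : ℝ) + y * I) ^ 2) / ((-(2 * b) : ℝ) + y * I)) := by
  have hN0 : (N:ℂ) ≠ 0 := by exact_mod_cast (by linarith : N ≠ 0)
  have h := cauchy_strip (f := fun w => polK k (s + w) * (N:ℂ) ^ w) (c := 1) (c' := 2 * b)
    (C := 2000000 * (k.natAbs:ℝ) ^ 3 * (1 + |s.im|) ^ 4 * N) (A := 4) one_pos (by linarith)
    (fun w h1 h2 => ((differentiable_polK k _).comp w (by fun_prop)).mul
      (DifferentiableAt.const_cpow (by fun_prop) (Or.inl hN0))) (fun w h1 h2 => by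
      rw [norm_mul, norm_cpow_eq_rpow_re_of_pos (by linarith)]
      have e1 := norm_polK_le hk (s := s + w) (by simp; linarith) (by simp; linarith)
      have e2 : N ^ w.re ≤ N := by
        calc N ^ w.re ≤ N ^ (1:ℝ) := Real.rpow_le_rpow_of_exponent_le hN h2
          _ = N := Real.rpow_one N
      have e3 : (1 + |(s + w).im|) ^ 4 ≤ ((1 + |s.im|) * (1 + |w.im|)) ^ 4 := by
        gcongr; rw [add_im]; exact one_add_abs_add_le _ _
      calc _ ≤ (2000000 * (k.natAbs:ℝ) ^ 3 * ((1 + |s.im|) * (1 + |w.im|)) ^ 4) * N := by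
            gcongr
            exact e1.trans (by gcongr)
        _ = _ := by ring)
  rw [add_zero, cpow_zero, mul_one] at h
  rw [h]
  congr 1
  have hre : ∀ y : ℝ, (s + ((1:ℝ) + y * I)).re = 3 / 2 + b := by intro y; simp [hs]; ring
  have hF : ∀ y : ℝ, polK k (s + ((1:ℝ) + y * I)) * (N:ℂ) ^ ((1:ℝ) + y * I : ℂ) * (cexp (((1:ℝ) + y * I) ^ 2) / ((1:ℝ) + y * I)) =
      ∑' n, chk k n * kerA s N n ((1:ℝ) + y * I) := by
    intro y
    rw [polK_eq_tsum hk (by rw [hre]; linarith), ← tsum_mul_left, ← tsum_mul_right, ← tsum_mul_right]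
    apply tsum_congr
    intro n
    unfold kerA; ring
  simp_rw [hF]
  have hker : ∀ (n : ℕ) (y : ℝ), ‖chk k n * kerA s N n ((1:ℝ) + y * I)‖ ≤
      ((2 / 1 + 1) * Real.exp 1 * (1 + |s.im|) * N) * (n:ℝ) ^ (-(s.re + 1)) * Real.exp (-y ^ 2) := by
    intro n y
    have e1 := norm_kerA_le (s := s) (N := N) (e := 1) (by linarith) (by linarith) hN one_pos n (w := (1:ℝ) + y * I) (by simp) (by simp)
    rw [norm_mul]
    calc _ ≤ 1 * _ := mul_le_mul (norm_chk_le k n) e1 (norm_nonneg _) one_pos.le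
      _ = _ := by simp; ring
  have hmeas : ∀ n : ℕ, AEStronglyMeasurable (fun y : ℝ => chk k n * kerA s N n ((1:ℝ) + y * I)) := by
    intro n
    apply Measurable.aestronglyMeasurable
    unfold kerA
    fun_prop
  have h_integrable : ∀ n : ℕ, Integrable (fun y : ℝ => chk k n * kerA s N n ((1:ℝ) + y * I)) := fun n =>
    (integrable_exp_neg_sq.const_mul _).mono' (hmeas n) (ae_of_all _ (hker n))
  rw [← integral_tsum_of_summable_integral_norm h_integrable]
  · apply tsum_congr
    intro n
    rw [integral_const_mul, coefA]
  · have hsum : Summable (fun n : ℕ => ((2 / 1 + 1) * Real.exp 1 * (1 + |s.im|) * N) * (n:ℝ) ^ (-(s.re + 1)) * ∫ y : ℝ, Real.exp (-y ^ 2)) :=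
      ((Real.summable_nat_rpow.mpr (by linarith)).mul_left _).mul_right _
    refine Summable.of_nonneg_of_le (fun n => integral_nonneg fun _ => norm_nonneg _) (fun n => ?_) hsum
    rw [← integral_const_mul]
    exact integral_mono (h_integrable n).norm (integrable_exp_neg_sq.const_mul _) (hker n)

theorem exists_sum_norm_sq_coefA_le {b e : ℝ} (hb : 0 < b) (hb2 : b ≤ 1 / 4) (he : 0 < e) (he1 : e ≤ 1) :
    ∃ C : ℝ, 0 < C ∧ ∀ (K : ℕ), 1 ≤ K → ∀ (N : ℝ), 1 ≤ N → ∀ s : ℂ, s.re = 1 / 2 + b →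
      ∑ k ∈ Finset.Icc (-(K:ℤ)) K, ‖∑' n, chk k n * coefA s N n‖ ^ 2 ≤
        C * (1 + |s.im|) ^ 2 * (N ^ 2 + K * N ^ (2 * e)) := by
  have hθ : 0 ≤ gaussTheta := tsum_nonneg fun _ => (Real.exp_pos _).le
  have hG : 0 ≤ ∫ y : ℝ, Real.exp (-y ^ 2) := integral_nonneg fun _ => (Real.exp_pos _).le
  set c1 := (2 / 1 + 1) * Real.exp 1 * (∫ y : ℝ, Real.exp (-y ^ 2)) with hc1
  set ce := (2 / e + 1) * Real.exp 1 * (∫ y : ℝ, Real.exp (-y ^ 2)) with hce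
  have hc10 : 0 ≤ c1 := by positivity
  have hce0 : 0 ≤ ce := by positivity
  set Z := ∑' n : ℕ, (n:ℝ) ^ (-(1 + b)) with hZ
  have hZs : Summable (fun n : ℕ => (n:ℝ) ^ (-(1 + b))) := Real.summable_nat_rpow.mpr (by linarith)
  have hZ0 : 0 ≤ Z := tsum_nonneg fun _ => by positivity
  have hbe : 0 < b + e := by linarith
  have hPs := summable_square_pairs hbe
  set P := ∑' x : ℕ × ℕ, (if IsSquare (x.1 * x.2) then ((x.1 * x.2 : ℕ):ℝ) ^ (-(1 / 2 + (b + e))) else 0) with hP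
  have hP0 : 0 ≤ P := tsum_nonneg fun _ => by split_ifs <;> positivity
  refine ⟨Real.exp Real.pi * gaussTheta * (c1 ^ 2 * Z ^ 2 + ce ^ 2 * P) + 1, by positivity, fun K hK N hN s hs => ?_⟩
  have hN0 : 0 < N := by linarith
  set E := 1 + |s.im| with hE
  have hE0 : 0 < E := by positivity
  have hA1 : ∀ n, ‖coefA s N n‖ * Real.sqrt n ≤ c1 * E * N * (n:ℝ) ^ (-(1 + b)) := by
    intro n
    have h := norm_coefA_le (s := s) (N := N) (e := 1) (n := n) (by linarith) (by linarith) hN one_pos le_rfl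
    rcases Nat.eq_zero_or_pos n with rfl | hn
    · simp; positivity
    have hn0 : (0:ℝ) < n := by exact_mod_cast hn
    calc _ ≤ (c1 * E * ((n:ℝ) ^ (-(s.re + 1)) * N ^ (1:ℝ))) * Real.sqrt n := by gcongr
      _ = c1 * E * N * ((n:ℝ) ^ (-(s.re + 1)) * (n:ℝ) ^ (1 / 2 : ℝ)) := by
          rw [Real.rpow_one, Real.sqrt_eq_rpow]; ring
      _ = _ := by rw [← Real.rpow_add hn0, hs]; congr 2; ring
  have hAe : ∀ n, ‖coefA s N n‖ ≤ ce * E * N ^ e * (n:ℝ) ^ (-(1 / 2 + (b + e))) := by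
    intro n
    have h := norm_coefA_le (s := s) (N := N) (e := e) (n := n) (by linarith) (by linarith) hN he he1
    rw [hs, show 1 / 2 + b + e = 1 / 2 + (b + e) by ring] at h
    linarith [h]
  have ha := Summable.of_nonneg_of_le (fun n => mul_nonneg (norm_nonneg _) (Real.sqrt_nonneg _)) hA1 (hZs.mul_left (c1 * E * N))
  have ha0 : coefA s N 0 = 0 := by
    have := hAe 0
    rw [Nat.cast_zero, Real.zero_rpow (by linarith), mul_zero] at this
    exact norm_le_zero_iff.mp this
  have hpair : ∀ x : ℕ × ℕ, (if IsSquare (x.1 * x.2) then ‖coefA s N x.1‖ * ‖coefA s N x.2‖ else 0) ≤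
      (ce * E * N ^ e) ^ 2 * (if IsSquare (x.1 * x.2) then ((x.1 * x.2 : ℕ):ℝ) ^ (-(1 / 2 + (b + e))) else 0) := by
    intro x
    split_ifs
    · push_cast
      rw [Real.mul_rpow (by positivity) (by positivity)]
      calc _ ≤ (ce * E * N ^ e * (x.1:ℝ) ^ (-(1 / 2 + (b + e)))) * (ce * E * N ^ e * (x.2:ℝ) ^ (-(1 / 2 + (b + e)))) := by
            gcongr
            · exact hAe _
            · exact hAe _
        _ = _ := by ring
    · simp
  have hsq := Summable.of_nonneg_of_le (fun x => by split_ifs <;> positivity) hpair (hPs.mul_left _)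
  have h := sum_norm_sq_twisted_le ha ha0 hK hsq
  have t1 : ∑' n, ‖coefA s N n‖ * Real.sqrt n ≤ c1 * E * N * Z := by
    rw [hZ, ← tsum_mul_left]
    exact ha.tsum_le_tsum hA1 (hZs.mul_left _)
  have t10 : 0 ≤ ∑' n, ‖coefA s N n‖ * Real.sqrt n := tsum_nonneg fun _ => by positivity
  have t2 : ∑' x : ℕ × ℕ, (if IsSquare (x.1 * x.2) then ‖coefA s N x.1‖ * ‖coefA s N x.2‖ else 0) ≤ (ce * E * N ^ e) ^ 2 * P := by
    rw [hP, ← tsum_mul_left]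
    exact hsq.tsum_le_tsum hpair (hPs.mul_left _)
  have hNe : (N ^ e) ^ 2 = N ^ (2 * e) := by
    rw [← Real.rpow_natCast, ← Real.rpow_mul hN0.le]; congr 1; push_cast; ring
  have hNe0 : 0 ≤ N ^ (2 * e) := by positivity
  have hK0 : (0:ℝ) ≤ K := by positivity
  calc _ ≤ Real.exp Real.pi * gaussTheta * ((c1 * E * N * Z) ^ 2 + K * ((ce * E * N ^ e) ^ 2 * P)) := by
        refine h.trans ?_
        gcongr
    _ = Real.exp Real.pi * gaussTheta * E ^ 2 * ((c1 ^ 2 * Z ^ 2) * N ^ 2 + (ce ^ 2 * P) * (K * N ^ (2 * e))) := by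
        rw [← hNe]; ring
    _ ≤ Real.exp Real.pi * gaussTheta * E ^ 2 * ((c1 ^ 2 * Z ^ 2 + ce ^ 2 * P) * N ^ 2 + (c1 ^ 2 * Z ^ 2 + ce ^ 2 * P) * (K * N ^ (2 * e))) := by
        gcongr
        · exact le_add_of_nonneg_right (by positivity)
        · exact le_add_of_nonneg_left (by positivity)
    _ = Real.exp Real.pi * gaussTheta * (c1 ^ 2 * Z ^ 2 + ce ^ 2 * P) * E ^ 2 * (N ^ 2 + K * N ^ (2 * e)) := by ring
    _ ≤ _ := by gcongr; linarith

/-- The tail integral in the approximate formula, bounded by the values on the reflected line. -/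
theorem norm_tail_sq_le {k : ℤ} (hk : k ≠ 0) {b N : ℝ} (hb : 0 < b) (hb2 : b ≤ 1 / 4) (hN : 1 ≤ N) {s : ℂ}
    (hs : s.re = 1 / 2 + b) :
    Integrable (fun y : ℝ => ‖polK k (s + ((-(2 * b) : ℝ) + y * I))‖ ^ 2 * Real.exp (-y ^ 2)) ∧
    ‖∫ y : ℝ, polK k (s + ((-(2 * b) : ℝ) + y * I)) * (N:ℂ) ^ ((-(2 * b) : ℝ) + y * I : ℂ) *
        (cexp (((-(2 * b) : ℝ) + y * I) ^ 2) / ((-(2 * b) : ℝ) + y * I))‖ ^ 2 ≤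
      (N ^ (-(2 * b)) * (Real.exp 1 / (2 * b))) ^ 2 * ((∫ y : ℝ, Real.exp (-y ^ 2)) *
        ∫ y : ℝ, ‖polK k (s + ((-(2 * b) : ℝ) + y * I))‖ ^ 2 * Real.exp (-y ^ 2)) := by
  set h : ℝ → ℝ := fun y => ‖polK k (s + ((-(2 * b) : ℝ) + y * I))‖ with hh
  have hcont : Continuous h := by
    have := (differentiable_polK k).continuous
    simp only [hh]; fun_prop
  set D := 2000000 * (k.natAbs:ℝ) ^ 3 * (1 + |s.im|) ^ 4 with hD
  have hbd : ∀ y, h y ≤ D * (1 + |y|) ^ 4 := by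
    intro y
    have e1 := norm_polK_le hk (s := s + ((-(2 * b) : ℝ) + y * I)) (by simp; linarith) (by simp; linarith)
    have e2 : (s + ((-(2 * b) : ℝ) + y * I)).im = s.im + y := by simp
    rw [e2] at e1
    calc h y ≤ _ := e1
      _ ≤ 2000000 * (k.natAbs:ℝ) ^ 3 * ((1 + |s.im|) * (1 + |y|)) ^ 4 := by
          gcongr; exact one_add_abs_add_le _ _
      _ = _ := by rw [hD]; ring
  have hh0 : ∀ y, 0 ≤ h y := fun y => norm_nonneg _
  have hi1 : Integrable (fun y : ℝ => h y * Real.exp (-y ^ 2)) := by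
    refine ((integrable_pow_mul_exp_neg_sq 4).const_mul D).mono' (by fun_prop) (ae_of_all _ fun y => ?_)
    rw [Real.norm_of_nonneg (mul_nonneg (hh0 y) (Real.exp_pos _).le), ← mul_assoc]
    gcongr
    exact hbd y
  have hi2 : Integrable (fun y : ℝ => h y ^ 2 * Real.exp (-y ^ 2)) := by
    refine ((integrable_pow_mul_exp_neg_sq 8).const_mul (D ^ 2)).mono' (by fun_prop) (ae_of_all _ fun y => ?_)
    rw [Real.norm_of_nonneg (mul_nonneg (sq_nonneg _) (Real.exp_pos _).le), ← mul_assoc]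
    gcongr
    calc h y ^ 2 ≤ (D * (1 + |y|) ^ 4) ^ 2 := by gcongr; exact hbd y
      _ = _ := by ring
  refine ⟨hi2, ?_⟩
  have hcs := sq_integral_mul_le integrable_exp_neg_sq (fun _ => (Real.exp_pos _).le) hi1 hi2
  have hN0 : 0 < N := by linarith
  have hbound : ∀ y : ℝ, ‖polK k (s + ((-(2 * b) : ℝ) + y * I)) * (N:ℂ) ^ ((-(2 * b) : ℝ) + y * I : ℂ) *
        (cexp (((-(2 * b) : ℝ) + y * I) ^ 2) / ((-(2 * b) : ℝ) + y * I))‖ ≤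
      (N ^ (-(2 * b)) * (Real.exp 1 / (2 * b))) * (h y * Real.exp (-y ^ 2)) := by
    intro y
    rw [norm_mul, norm_mul, norm_div, norm_cpow_eq_rpow_re_of_pos hN0, norm_exp_sq]
    have e1 : ((-(2 * b) : ℝ) + y * I : ℂ).re = -(2 * b) := by simp
    have e2 : 2 * b ≤ ‖((-(2 * b) : ℝ) + y * I : ℂ)‖ := by
      have := abs_re_le_norm ((-(2 * b) : ℝ) + y * I : ℂ)
      rwa [e1, abs_neg, abs_of_pos (by linarith)] at this
    rw [e1]
    calc _ ≤ h y * N ^ (-(2 * b)) * (Real.exp 1 * Real.exp (-y ^ 2) / (2 * b)) := by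
          gcongr
          nlinarith
      _ = _ := by ring
  have h1 := norm_integral_le_of_norm_le (hi1.const_mul _) (ae_of_all _ hbound)
  rw [integral_const_mul] at h1
  calc _ ≤ ((N ^ (-(2 * b)) * (Real.exp 1 / (2 * b))) * ∫ y, h y * Real.exp (-y ^ 2)) ^ 2 := by gcongr
    _ = (N ^ (-(2 * b)) * (Real.exp 1 / (2 * b))) ^ 2 * (∫ y, h y * Real.exp (-y ^ 2)) ^ 2 := by ring
    _ ≤ _ := by gcongr

theorem sq_le_of_two_mul_le_add {x a c : ℝ} (hx : 0 ≤ x) (h : 2 * x ≤ a + c) : x ^ 2 ≤ (a ^ 2 + c ^ 2) / 2 := by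
  have h1 : (2 * x) ^ 2 ≤ (a + c) ^ 2 := by gcongr
  nlinarith [sq_nonneg (a - c)]

set_option maxHeartbeats 1000000 in
/-- A mean value bound of Lindelöf quality for the real characters `(k / ·)`. -/
theorem exists_mean_value {b ε : ℝ} (hb : 0 < b) (hb2 : b ≤ 1 / 4) (hε : 0 < ε) (hε1 : ε ≤ 1) :
    ∃ (C : ℝ) (B : ℕ), 0 < C ∧ ∀ K : ℕ, 1 ≤ K → ∀ s : ℂ, s.re = 1 / 2 + b →
      ∑ k ∈ Finset.Icc (-(K:ℤ)) K, ‖polK k s‖ ^ 2 ≤ C * (K:ℝ) ^ (1 + ε) * (1 + |s.im|) ^ B := by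
  obtain ⟨Cf, hCf, hfe⟩ := exists_norm_polK_one_sub_le hb hb2 (ε := b * ε) (by positivity)
  obtain ⟨CD, hCD, hD⟩ := exists_sum_norm_sq_coefA_le hb hb2 (e := ε / 2) (by linarith) (by linarith)
  obtain ⟨B, hB⟩ := exists_nat_ge (10 + 1 / b)
  have hb0 : 0 < 1 / b := by positivity
  have hB8 : 8 ≤ B := by
    have : (8:ℝ) ≤ B := by linarith
    exact_mod_cast this
  set G := ∫ y : ℝ, Real.exp (-y ^ 2) with hG
  have hG0 : 0 ≤ G := integral_nonneg fun _ => (Real.exp_pos _).le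
  set IB := ∫ y : ℝ, (1 + |y|) ^ (B + 2) * Real.exp (-y ^ 2) with hIB
  have hIB0 : 0 ≤ IB := integral_nonneg fun _ => by positivity
  set L := (Real.exp 1 / (2 * b)) ^ 2 * (G * (Cf ^ 2 * IB)) with hL
  set C3 := max 1 L with hC3
  have hC31 : 1 ≤ C3 := le_max_left _ _
  have hC30 : 0 < C3 := by linarith
  refine ⟨2 * (CD * (2 * C3 ^ (1 / (2 * b)))), B, by positivity, fun K hK => ?_⟩
  have hK1 : (1:ℝ) ≤ K := by exact_mod_cast hK
  have hK0 : (0:ℝ) < K := by linarith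
  set M : ℝ → ℝ := fun t => ∑ k ∈ Finset.Icc (-(K:ℤ)) K, ‖polK k ((1 / 2 + b : ℝ) + t * I)‖ ^ 2 with hM
  have hM0 : ∀ t, 0 ≤ M t := fun t => Finset.sum_nonneg fun _ _ => sq_nonneg _
  have hE1 : ∀ t : ℝ, 1 ≤ 1 + |t| := fun t => by linarith [abs_nonneg t]
  have hbdd : BddAbove (Set.range fun t => M t / (1 + |t|) ^ B) := by
    refine ⟨∑ k ∈ Finset.Icc (-(K:ℤ)) K, (2000000 * (k.natAbs:ℝ) ^ 3) ^ 2, ?_⟩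
    rintro _ ⟨t, rfl⟩
    have hE := hE1 t
    simp only
    rw [div_le_iff₀ (by positivity), Finset.sum_mul]
    apply Finset.sum_le_sum
    intro k _
    by_cases hk : k = 0
    · have : polK k ((1 / 2 + b : ℝ) + t * I) = 0 := by rw [polK, dif_pos hk]
      rw [this, norm_zero, zero_pow two_ne_zero]; positivity
    have h1 := norm_polK_le hk (s := (1 / 2 + b : ℝ) + t * I) (by simp; linarith) (by simp; linarith)
    have h2 : ((1 / 2 + b : ℝ) + t * I : ℂ).im = t := by simp
    rw [h2] at h1
    calc _ ≤ (2000000 * (k.natAbs:ℝ) ^ 3 * (1 + |t|) ^ 4) ^ 2 := by gcongr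
      _ = (2000000 * (k.natAbs:ℝ) ^ 3) ^ 2 * (1 + |t|) ^ 8 := by ring
      _ ≤ _ := by gcongr
  set S := ⨆ t, M t / (1 + |t|) ^ B with hS
  have hMS : ∀ t, M t ≤ S * (1 + |t|) ^ B := by
    intro t
    have hE := hE1 t
    rw [← div_le_iff₀ (by positivity)]
    exact le_ciSup hbdd t
  have hS0 : 0 ≤ S := by
    refine le_trans ?_ (le_ciSup hbdd 0)
    exact div_nonneg (hM0 0) (by positivity)
  set κ := (K:ℝ) ^ (2 * b * (1 + ε)) with hκ
  have hκ1 : 1 ≤ κ := Real.one_le_rpow hK1 (by positivity)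
  have hrefl : ∀ v : ℝ, ∑ k ∈ Finset.Icc (-(K:ℤ)) K, ‖polK k (1 - ((1 / 2 + b : ℝ) + v * I))‖ ^ 2 ≤
      Cf ^ 2 * κ * (1 + |v|) ^ 2 * (S * (1 + |v|) ^ B) := by
    intro v
    calc _ ≤ ∑ k ∈ Finset.Icc (-(K:ℤ)) K, Cf ^ 2 * κ * (1 + |v|) ^ 2 * ‖polK k ((1 / 2 + b : ℝ) + v * I)‖ ^ 2 := by
          apply Finset.sum_le_sum
          intro k hk
          by_cases hk0 : k = 0
          · have : ∀ s, polK k s = 0 := fun s => by rw [polK, dif_pos hk0]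
            rw [this, this]; simp
          have h1 := hfe k hk0 ((1 / 2 + b : ℝ) + v * I) (by simp)
          have h2 : ((1 / 2 + b : ℝ) + v * I : ℂ).im = v := by simp
          rw [h2] at h1
          have h3 : (k.natAbs:ℝ) ^ (b + b * ε) ≤ (K:ℝ) ^ (b * (1 + ε)) := by
            rw [show b + b * ε = b * (1 + ε) by ring]
            apply Real.rpow_le_rpow (by positivity) _ (by positivity)
            rw [Finset.mem_Icc] at hk
            exact_mod_cast (by omega : k.natAbs ≤ K)
          have h4 : ((K:ℝ) ^ (b * (1 + ε))) ^ 2 = κ := by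
            rw [hκ, ← Real.rpow_natCast, ← Real.rpow_mul hK0.le]; congr 1; push_cast; ring
          calc _ ≤ (Cf * (K:ℝ) ^ (b * (1 + ε)) * (1 + |v|) * ‖polK k ((1 / 2 + b : ℝ) + v * I)‖) ^ 2 := by
                gcongr
                refine h1.trans ?_
                gcongr
            _ = _ := by rw [← h4]; ring
      _ = Cf ^ 2 * κ * (1 + |v|) ^ 2 * M v := by rw [← Finset.mul_sum]
      _ ≤ _ := by gcongr; exact hMS v
  -- the inequality for a single `t`
  have hmain : ∀ t, M t ≤ CD * (2 * C3 ^ (1 / (2 * b))) * (K:ℝ) ^ (1 + ε) * (1 + |t|) ^ B + S * (1 + |t|) ^ B / 2 := by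
    intro t
    set E := 1 + |t| with hE
    have hE1' : 1 ≤ E := hE1 t
    have hE0 : 0 < E := by linarith
    set s : ℂ := (1 / 2 + b : ℝ) + t * I with hs
    have hsre : s.re = 1 / 2 + b := by simp [hs]
    have hsim : s.im = t := by simp [hs]
    set q := C3 * κ * E ^ 2 with hq
    have hq1 : 1 ≤ q := by
      have : 1 ≤ C3 * κ := by nlinarith
      have h2 : 1 ≤ E ^ 2 := one_le_pow₀ hE1'
      nlinarith
    have hq0 : 0 < q := by linarith
    set N := q ^ (1 / (4 * b)) with hN
    have hN1 : 1 ≤ N := Real.one_le_rpow hq1 (by positivity)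
    have hNb : (N ^ (-(2 * b))) ^ 2 = q⁻¹ := by
      rw [hN, ← Real.rpow_mul hq0.le, ← Real.rpow_natCast, ← Real.rpow_mul hq0.le, ← Real.rpow_neg_one]
      congr 1; push_cast; field_simp; norm_num
    have hN2 : N ^ 2 = C3 ^ (1 / (2 * b)) * (K:ℝ) ^ (1 + ε) * E ^ (1 / b) := by
      rw [hN, ← Real.rpow_natCast, ← Real.rpow_mul hq0.le, hq, Real.mul_rpow (by positivity) (by positivity),
        Real.mul_rpow (by positivity) (by positivity), hκ, ← Real.rpow_mul hK0.le, ← Real.rpow_natCast E 2, ← Real.rpow_mul hE0.le]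
      congr 1
      · congr 1
        · congr 1; push_cast; field_simp; norm_num
        · congr 1; push_cast; field_simp; norm_num
      · congr 1; push_cast; field_simp; norm_num
    have hNe : K * N ^ (2 * (ε / 2)) ≤ C3 ^ (1 / (2 * b)) * (K:ℝ) ^ (1 + ε) * E ^ (1 / b) := by
      have hc1 : 1 ≤ C3 ^ (1 / (2 * b)) := Real.one_le_rpow hC31 (by positivity)
      have hc2 : 1 ≤ E ^ (1 / b) := Real.one_le_rpow hE1' (by positivity)
      have e1 : N ^ (2 * (ε / 2)) = (C3 ^ (1 / (2 * b))) ^ (ε / 2) * ((K:ℝ) ^ (1 + ε)) ^ (ε / 2) * (E ^ (1 / b)) ^ (ε / 2) := by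
        rw [← Real.mul_rpow (by positivity) (by positivity), ← Real.mul_rpow (by positivity) (by positivity), ← hN2,
          Real.rpow_mul (by linarith), Real.rpow_two]
      have e2 : ∀ x : ℝ, 1 ≤ x → x ^ (ε / 2) ≤ x := fun x hx => by
        calc x ^ (ε / 2) ≤ x ^ (1:ℝ) := Real.rpow_le_rpow_of_exponent_le hx (by linarith)
          _ = x := Real.rpow_one x
      have e3 : (K:ℝ) * ((K:ℝ) ^ (1 + ε)) ^ (ε / 2) ≤ (K:ℝ) ^ (1 + ε) := by
        rw [← Real.rpow_mul hK0.le]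
        nth_rewrite 1 [← Real.rpow_one (K:ℝ)]
        rw [← Real.rpow_add hK0]
        apply Real.rpow_le_rpow_of_exponent_le hK1
        nlinarith
      rw [e1]
      calc _ = (C3 ^ (1 / (2 * b))) ^ (ε / 2) * ((K:ℝ) * ((K:ℝ) ^ (1 + ε)) ^ (ε / 2)) * (E ^ (1 / b)) ^ (ε / 2) := by ring
        _ ≤ _ := by
          gcongr
          · exact e2 _ hc1
          · exact e2 _ hc2
    have hEB : E ^ 2 * E ^ (1 / b) ≤ E ^ B := by
      rw [← Real.rpow_two, ← Real.rpow_add hE0, ← Real.rpow_natCast E B]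
      exact Real.rpow_le_rpow_of_exponent_le hE1' (by linarith)
    set T : ℤ → ℂ := fun k => ∫ y : ℝ, polK k (s + ((-(2 * b) : ℝ) + y * I)) * (N:ℂ) ^ ((-(2 * b) : ℝ) + y * I : ℂ) *
        (cexp (((-(2 * b) : ℝ) + y * I) ^ 2) / ((-(2 * b) : ℝ) + y * I)) with hT
    set A : ℤ → ℂ := fun k => ∑' n, chk k n * coefA s N n with hA
    have hsumA : ∑ k ∈ Finset.Icc (-(K:ℤ)) K, ‖A k‖ ^ 2 ≤ CD * (2 * C3 ^ (1 / (2 * b))) * (K:ℝ) ^ (1 + ε) * E ^ B := by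
      have h := hD K hK N hN1 s hsre
      rw [hsim] at h
      calc _ ≤ CD * E ^ 2 * (N ^ 2 + K * N ^ (2 * (ε / 2))) := h
        _ ≤ CD * E ^ 2 * (C3 ^ (1 / (2 * b)) * (K:ℝ) ^ (1 + ε) * E ^ (1 / b) + C3 ^ (1 / (2 * b)) * (K:ℝ) ^ (1 + ε) * E ^ (1 / b)) := by
            rw [hN2]; gcongr
        _ = CD * (2 * C3 ^ (1 / (2 * b))) * (K:ℝ) ^ (1 + ε) * (E ^ 2 * E ^ (1 / b)) := by ring
        _ ≤ _ := by gcongr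
    have hline : ∀ y : ℝ, s + ((-(2 * b) : ℝ) + y * I) = 1 - ((1 / 2 + b : ℝ) + (-(t + y) : ℝ) * I) := by
      intro y; rw [hs]; push_cast; ring
    have hT0 : ∀ k, polK k = 0 → T k = 0 := by
      intro k hk; simp only [hT, hk]; simp
    have hTk : ∀ k : ℤ, k ≠ 0 → _ := fun k hk => norm_tail_sq_le hk hb hb2 hN1 hsre
    set h2 : ℤ → ℝ → ℝ := fun k y => ‖polK k (s + ((-(2 * b) : ℝ) + y * I))‖ ^ 2 * Real.exp (-y ^ 2) with hh2
    have hpz : polK 0 = 0 := by funext s; rw [polK, dif_pos rfl]; rfl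
    have h_integrable : ∀ k, Integrable (h2 k) := by
      intro k
      by_cases hk : k = 0
      · simp only [hh2, hk, hpz]; simp
      · exact (hTk k hk).1
    have hTle : ∀ k, ‖T k‖ ^ 2 ≤ q⁻¹ * (Real.exp 1 / (2 * b)) ^ 2 * (G * ∫ y, h2 k y) := by
      intro k
      by_cases hk : k = 0
      · rw [hk, hT0 0 hpz]
        have : 0 ≤ ∫ y, h2 0 y := integral_nonneg fun y => mul_nonneg (sq_nonneg _) (Real.exp_pos _).le
        rw [norm_zero, zero_pow two_ne_zero]; positivity
      · have := (hTk k hk).2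
        rw [mul_pow, hNb] at this
        exact this
    have hsumT : ∑ k ∈ Finset.Icc (-(K:ℤ)) K, ‖T k‖ ^ 2 ≤ S * E ^ B := by
      have hI : ∑ k ∈ Finset.Icc (-(K:ℤ)) K, ∫ y, h2 k y ≤ Cf ^ 2 * κ * S * E ^ (B + 2) * IB := by
        rw [← integral_finsetSum _ (fun k _ => h_integrable k), hIB, ← integral_const_mul]
        refine integral_mono (integrable_finsetSum _ fun k _ => h_integrable k) ((integrable_pow_mul_exp_neg_sq _).const_mul _) fun y => ?_
        simp only [hh2]
        rw [← Finset.sum_mul, ← mul_assoc]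
        gcongr
        have := hrefl (-(t + y))
        simp_rw [← hline] at this
        rw [abs_neg] at this
        calc _ ≤ Cf ^ 2 * κ * (1 + |t + y|) ^ 2 * (S * (1 + |t + y|) ^ B) := this
          _ = Cf ^ 2 * κ * S * (1 + |t + y|) ^ (B + 2) := by ring
          _ ≤ Cf ^ 2 * κ * S * (E * (1 + |y|)) ^ (B + 2) := by
              gcongr; exact one_add_abs_add_le _ _
          _ = _ := by rw [mul_pow]; ring
      calc _ ≤ ∑ k ∈ Finset.Icc (-(K:ℤ)) K, q⁻¹ * (Real.exp 1 / (2 * b)) ^ 2 * (G * ∫ y, h2 k y) :=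
            Finset.sum_le_sum fun k _ => hTle k
        _ = q⁻¹ * (Real.exp 1 / (2 * b)) ^ 2 * (G * ∑ k ∈ Finset.Icc (-(K:ℤ)) K, ∫ y, h2 k y) := by
            rw [← Finset.mul_sum, ← Finset.mul_sum]
        _ ≤ q⁻¹ * (Real.exp 1 / (2 * b)) ^ 2 * (G * (Cf ^ 2 * κ * S * E ^ (B + 2) * IB)) := by gcongr
        _ = (L * (κ * E ^ 2)) / q * (S * E ^ B) := by rw [hL, pow_add]; ring
        _ ≤ 1 * (S * E ^ B) := by
            gcongr
            rw [div_le_one hq0]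
            calc L * (κ * E ^ 2) ≤ C3 * (κ * E ^ 2) :=
                  mul_le_mul_of_nonneg_right (le_max_right 1 L) (by positivity)
              _ = q := by rw [hq]; ring
        _ = _ := one_mul _
    have hrep : ∀ k : ℤ, ‖polK k s‖ ^ 2 ≤ (‖A k‖ ^ 2 + ‖T k‖ ^ 2) / 2 := by
      intro k
      by_cases hk : k = 0
      · rw [hk, hpz, Pi.zero_apply, norm_zero, zero_pow two_ne_zero]; positivity
      have h := polK_representation hk hb hb2 hN1 hsre
      have h3 := congrArg norm h
      rw [norm_mul, norm_mul, norm_real, Real.norm_of_nonneg Real.pi_pos.le, Complex.norm_ofNat] at h3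
      have h4 : 2 * Real.pi * ‖polK k s‖ ≤ ‖A k‖ + ‖T k‖ := by rw [h3]; exact norm_sub_le _ _
      have h5 : 2 * ‖polK k s‖ ≤ ‖A k‖ + ‖T k‖ := by
        refine le_trans ?_ h4
        nlinarith [Real.pi_gt_three, norm_nonneg (polK k s)]
      exact sq_le_of_two_mul_le_add (norm_nonneg _) h5
    calc M t ≤ ∑ k ∈ Finset.Icc (-(K:ℤ)) K, (‖A k‖ ^ 2 + ‖T k‖ ^ 2) / 2 := Finset.sum_le_sum fun k _ => hrep k
      _ = (∑ k ∈ Finset.Icc (-(K:ℤ)) K, ‖A k‖ ^ 2 + ∑ k ∈ Finset.Icc (-(K:ℤ)) K, ‖T k‖ ^ 2) / 2 := by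
          rw [← Finset.sum_add_distrib, Finset.sum_div]
      _ ≤ _ := by
          have : 0 ≤ CD * (2 * C3 ^ (1 / (2 * b))) * (K:ℝ) ^ (1 + ε) * E ^ B := by positivity
          linarith
  have hSle : S ≤ 2 * (CD * (2 * C3 ^ (1 / (2 * b)))) * (K:ℝ) ^ (1 + ε) := by
    have : S ≤ CD * (2 * C3 ^ (1 / (2 * b))) * (K:ℝ) ^ (1 + ε) + S / 2 := by
      apply ciSup_le
      intro t
      have hE := hE1 t
      rw [div_le_iff₀ (by positivity)]
      refine (hmain t).trans (le_of_eq ?_)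
      ring
    linarith
  intro s hs
  have := hMS s.im
  have e : ((1 / 2 + b : ℝ) : ℂ) + s.im * I = s := by rw [← hs, re_add_im]
  simp only [hM, e] at this
  refine this.trans ?_
  have hE := hE1 s.im
  gcongr

/-- The weight controlling absolutely convergent double integrals. -/
def wgt (u ζ : ℂ) : ℝ := 1 / ((1 + u.im ^ 2) * (1 + ζ.im ^ 2))

theorem wgt_pos (u ζ : ℂ) : 0 < wgt u ζ := by unfold wgt; positivity

/-- The integral of `F` over the product of two vertical lines. -/
def dblInt (a c : ℝ) (F : ℂ → ℂ → ℂ) : ℂ := ∫ p : ℝ × ℝ, F (a + p.1 * I) (c + p.2 * I)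

theorem integrable_wgt (a c : ℝ) : Integrable (fun p : ℝ × ℝ => wgt (a + p.1 * I) (c + p.2 * I)) := by
  have h := integrable_inv_one_add_sq.mul_prod integrable_inv_one_add_sq
  refine h.congr (ae_of_all _ fun p => ?_)
  simp [wgt, mul_comm]

theorem integrable_dblInt {a c C : ℝ} {F : ℂ → ℂ → ℂ}
    (hm : Measurable fun p : ℝ × ℝ => F (a + p.1 * I) (c + p.2 * I))
    (hb : ∀ u ζ : ℂ, u.re = a → ζ.re = c → ‖F u ζ‖ ≤ C * wgt u ζ) :
    Integrable (fun p : ℝ × ℝ => F (a + p.1 * I) (c + p.2 * I)) :=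
  ((integrable_wgt a c).const_mul C).mono' hm.aestronglyMeasurable
    (ae_of_all _ fun p => hb _ _ (by simp) (by simp))

theorem dblInt_shift_fst {a b c C : ℝ} {F : ℂ → ℂ → ℂ} (hab : a ≤ b)
    (hd : ∀ u ζ : ℂ, a ≤ u.re → u.re ≤ b → ζ.re = c → DifferentiableAt ℂ (fun u => F u ζ) u)
    (hb : ∀ u ζ : ℂ, a ≤ u.re → u.re ≤ b → ζ.re = c → ‖F u ζ‖ ≤ C * wgt u ζ)
    (hma : Measurable fun p : ℝ × ℝ => F (a + p.1 * I) (c + p.2 * I))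
    (hmb : Measurable fun p : ℝ × ℝ => F (b + p.1 * I) (c + p.2 * I)) :
    dblInt a c F = dblInt b c F := by
  have hia := integrable_dblInt hma (fun u ζ hu hζ => hb u ζ hu.ge (hu.le.trans hab) hζ)
  have hib := integrable_dblInt hmb (fun u ζ hu hζ => hb u ζ (hab.trans hu.ge) hu.le hζ)
  unfold dblInt
  rw [Measure.volume_eq_prod] at hia hib ⊢
  rw [integral_prod_symm _ hia, integral_prod_symm _ hib]
  congr 1
  funext y
  refine integral_vertical_eq (f := fun u => F u (c + y * I)) (C := C * (1 / (1 + y ^ 2))) hab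
    (fun u h1 h2 => hd u _ h1 h2 (by simp)) fun u h1 h2 => ?_
  refine (hb u _ h1 h2 (by simp)).trans (le_of_eq ?_)
  simp [wgt]; ring_nf

theorem dblInt_shift_snd {a c c' C : ℝ} {F : ℂ → ℂ → ℂ} (hc : c ≤ c')
    (hd : ∀ u ζ : ℂ, c ≤ ζ.re → ζ.re ≤ c' → u.re = a → DifferentiableAt ℂ (fun ζ => F u ζ) ζ)
    (hb : ∀ u ζ : ℂ, c ≤ ζ.re → ζ.re ≤ c' → u.re = a → ‖F u ζ‖ ≤ C * wgt u ζ)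
    (hma : Measurable fun p : ℝ × ℝ => F (a + p.1 * I) (c + p.2 * I))
    (hmb : Measurable fun p : ℝ × ℝ => F (a + p.1 * I) (c' + p.2 * I)) :
    dblInt a c F = dblInt a c' F := by
  have hia := integrable_dblInt hma (fun u ζ hu hζ => hb u ζ hζ.ge (hζ.le.trans hc) hu)
  have hib := integrable_dblInt hmb (fun u ζ hu hζ => hb u ζ (hc.trans hζ.ge) hζ.le hu)
  unfold dblInt
  rw [Measure.volume_eq_prod] at hia hib ⊢
  rw [integral_prod _ hia, integral_prod _ hib]
  congr 1
  funext x
  refine integral_vertical_eq (f := fun ζ => F (a + x * I) ζ) (C := C * (1 / (1 + x ^ 2))) hc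
    (fun ζ h1 h2 => hd _ ζ h1 h2 (by simp)) fun ζ h1 h2 => ?_
  refine (hb _ ζ h1 h2 (by simp)).trans (le_of_eq ?_)
  simp [wgt]; ring_nf

theorem hasSum_dblInt {a c : ℝ} {F : ℕ → ℂ → ℂ → ℂ} {B : ℕ → ℝ} (hB : Summable B)
    (hm : ∀ n, Measurable fun p : ℝ × ℝ => F n (a + p.1 * I) (c + p.2 * I))
    (hb : ∀ n (u ζ : ℂ), u.re = a → ζ.re = c → ‖F n u ζ‖ ≤ B n * wgt u ζ) :
    HasSum (fun n => dblInt a c (F n)) (dblInt a c fun u ζ => ∑' n, F n u ζ) := by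
  have hi : ∀ n, Integrable (fun p : ℝ × ℝ => F n (a + p.1 * I) (c + p.2 * I)) := fun n =>
    integrable_dblInt (hm n) (hb n)
  refine hasSum_integral_of_summable_integral_norm hi ?_
  refine Summable.of_nonneg_of_le (fun n => integral_nonneg fun _ => norm_nonneg _) (fun n => ?_)
    (hB.mul_right (∫ p : ℝ × ℝ, wgt (a + p.1 * I) (c + p.2 * I)))
  rw [← integral_const_mul]
  exact integral_mono (hi n).norm ((integrable_wgt a c).const_mul _) fun p => hb n _ _ (by simp) (by simp)

theorem norm_dblInt_le {a c C : ℝ} {F : ℂ → ℂ → ℂ} (hb : ∀ u ζ : ℂ, u.re = a → ζ.re = c → ‖F u ζ‖ ≤ C * wgt u ζ) :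
    ‖dblInt a c F‖ ≤ C * ∫ p : ℝ × ℝ, wgt (a + p.1 * I) (c + p.2 * I) := by
  rw [← integral_const_mul]
  exact norm_integral_le_of_norm_le ((integrable_wgt a c).const_mul _) (ae_of_all _ fun p => hb _ _ (by simp) (by simp))

theorem dblInt_congr {a c : ℝ} {F G : ℂ → ℂ → ℂ} (h : ∀ u ζ : ℂ, u.re = a → ζ.re = c → F u ζ = G u ζ) :
    dblInt a c F = dblInt a c G :=
  integral_congr_ae (ae_of_all _ fun p => h _ _ (by simp) (by simp))

theorem measurable_Gammaℝ : Measurable Gammaℝ := by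
  have h := differentiable_Gammaℝ_inv.continuous.measurable.inv
  have e : (fun s => (Gammaℝ s)⁻¹)⁻¹ = Gammaℝ := by funext s; simp
  rwa [e] at h

theorem measurable_Gamma : Measurable Complex.Gamma := by
  have h := Complex.differentiable_one_div_Gamma.continuous.measurable.inv
  have e : (fun s => (Complex.Gamma s)⁻¹)⁻¹ = Complex.Gamma := by funext s; simp
  rwa [e] at h

theorem measurable_riemannZeta : Measurable riemannZeta :=
  measurable_of_continuousOn_compl_singleton 1 fun _ hs =>
    (differentiableAt_riemannZeta hs).continuousAt.continuousWithinAt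

theorem measurable_zo : Measurable zo := by
  have := measurable_riemannZeta
  unfold zo; fun_prop

/-- A function of rapid decay in vertical strips, such as a Mellin transform of a bump function. -/
def RapidDecay (φ : ℂ → ℂ) : Prop :=
  ∀ A : ℕ, ∃ C : ℝ, 0 < C ∧ ∀ w : ℂ, |w.re| ≤ 10 → ‖φ w‖ * (1 + |w.im|) ^ A ≤ C

/-- The analytic kernel of the double integrals. -/
def kerH (φ : ℂ → ℂ) (X : ℝ) (u ζ : ℂ) : ℂ :=
  φ (u + ζ / 2) * (X:ℂ) ^ (u + ζ / 2) * (Gammaℝ (1 / 2 + ζ) * (8:ℂ) ^ (ζ / 2) * (cexp (ζ ^ 2) / ζ)) *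
    ((3 * u + 2 * ζ - 1) / 9)

theorem measurable_kerH {φ : ℂ → ℂ} (hφ : Differentiable ℂ φ) (X : ℝ) {α : Type*} [MeasurableSpace α] {f g : α → ℂ}
    (hf : Measurable f) (hg : Measurable g) : Measurable fun x => kerH φ X (f x) (g x) := by
  have h1 := hφ.continuous.measurable
  have h2 := measurable_Gammaℝ
  unfold kerH
  fun_prop

theorem differentiableAt_Gammaℝ {s : ℂ} (hs : 0 < s.re) : DifferentiableAt ℂ Gammaℝ s := by
  have h := (differentiable_Gammaℝ_inv s).inv (inv_ne_zero (Gammaℝ_ne_zero_of_re_pos hs))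
  have e : (fun s => (Gammaℝ s)⁻¹)⁻¹ = Gammaℝ := by funext s; simp
  rwa [e] at h

theorem differentiableAt_kerH_fst {φ : ℂ → ℂ} (hφ : Differentiable ℂ φ) {X : ℝ} (hX : 0 < X) (u ζ : ℂ) :
    DifferentiableAt ℂ (fun u => kerH φ X u ζ) u := by
  have hX0 : (X:ℂ) ≠ 0 := by exact_mod_cast hX.ne'
  unfold kerH
  refine DifferentiableAt.mul (DifferentiableAt.mul (DifferentiableAt.mul ?_ ?_) (by fun_prop)) (by fun_prop)
  · exact (hφ _).comp u (by fun_prop)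
  · exact DifferentiableAt.const_cpow (by fun_prop) (Or.inl hX0)

theorem differentiableAt_kerH_snd {φ : ℂ → ℂ} (hφ : Differentiable ℂ φ) {X : ℝ} (hX : 0 < X) (u : ℂ) {ζ : ℂ}
    (hζ : 0 < ζ.re) : DifferentiableAt ℂ (fun ζ => kerH φ X u ζ) ζ := by
  have hX0 : (X:ℂ) ≠ 0 := by exact_mod_cast hX.ne'
  have hζ0 : ζ ≠ 0 := by rintro rfl; simp at hζ
  unfold kerH
  refine DifferentiableAt.mul (DifferentiableAt.mul (DifferentiableAt.mul ?_ ?_) (DifferentiableAt.mul (DifferentiableAt.mul ?_ ?_) ?_)) (by fun_prop)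
  · exact (hφ _).comp ζ (by fun_prop)
  · exact DifferentiableAt.const_cpow (by fun_prop) (Or.inl hX0)
  · exact (differentiableAt_Gammaℝ (by simp; linarith)).comp ζ (by fun_prop)
  · exact DifferentiableAt.const_cpow (by fun_prop) (Or.inl (by norm_num))
  · exact DifferentiableAt.div (by fun_prop) (by fun_prop) hζ0

theorem exists_norm_Gammaℝ_le {a b : ℝ} (ha : 0 < a) :
    ∃ C : ℝ, 0 < C ∧ ∀ s : ℂ, a ≤ s.re → s.re ≤ b → ‖Gammaℝ s‖ ≤ C * (1 + |s.im|) ^ (⌈b⌉₊) := by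
  have hcont : ContinuousOn Real.Gamma (Icc (a / 2) (b / 2)) := fun x hx =>
    (Real.differentiableAt_Gamma fun m => by
      have : (0:ℝ) ≤ m := m.cast_nonneg
      linarith [hx.1]).continuousAt.continuousWithinAt
  obtain ⟨D, hD⟩ := isCompact_Icc.exists_bound_of_continuousOn hcont
  set n := ⌈b⌉₊
  have hbn : b ≤ n := Nat.le_ceil b
  refine ⟨Real.exp 1 * 2 ^ n * (|D| + 1), by positivity, fun s h1 h2 => ?_⟩
  have hre : (s / 2).re = s.re / 2 := by simp
  have him : |(s / 2).im| = |s.im| / 2 := by simp [abs_div]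
  have hG := norm_Gamma_le (s := s / 2) (by rw [hre]; linarith)
  have hg : Real.Gamma (s.re / 2) ≤ |D| + 1 := by
    have := hD (s.re / 2) ⟨by linarith, by linarith⟩
    rw [Real.norm_eq_abs] at this
    linarith [le_abs_self (Real.Gamma (s.re / 2)), le_abs_self D]
  have hexp : 1 ≤ Real.exp (Real.pi / 2 * |(s / 2).im|) := Real.one_le_exp (by positivity)
  rw [hre, him] at hG
  rw [him] at hexp
  have ht := abs_nonneg s.im
  have hp : (2 * (1 + |s.im| / 2)) ^ (s.re / 2) ≤ (2 * (1 + |s.im|)) ^ n := by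
    rw [← Real.rpow_natCast]
    calc _ ≤ (2 * (1 + |s.im|)) ^ (s.re / 2) := by
          apply Real.rpow_le_rpow (by positivity) (by linarith) (by linarith)
      _ ≤ _ := Real.rpow_le_rpow_of_exponent_le (by linarith) (by linarith)
  rw [Gammaℝ_def, norm_mul]
  have hpi : ‖(Real.pi:ℂ) ^ (-s / 2)‖ ≤ 1 := by
    rw [norm_cpow_eq_rpow_re_of_pos Real.pi_pos]
    apply Real.rpow_le_one_of_one_le_of_nonpos
    · linarith [Real.pi_gt_three]
    · simp; linarith
  calc _ ≤ 1 * ‖Complex.Gamma (s / 2)‖ := by gcongr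
    _ ≤ ‖Complex.Gamma (s / 2)‖ * Real.exp (Real.pi / 2 * (|s.im| / 2)) := by
        rw [one_mul]; exact le_mul_of_one_le_right (norm_nonneg _) hexp
    _ ≤ Real.exp 1 * ((2 * (1 + |s.im|)) ^ n * (|D| + 1)) := by
        refine hG.trans ?_
        have := (Real.Gamma_pos_of_pos (s := s.re / 2) (by linarith)).le
        gcongr
    _ = _ := by rw [mul_pow]; ring

theorem exists_norm_kerH_le {φ : ℂ → ℂ} (hφ : RapidDecay φ) (A : ℕ) :
    ∃ C : ℝ, 0 < C ∧ ∀ X : ℝ, 0 < X → ∀ u ζ : ℂ, -1 ≤ u.re → u.re ≤ 2 → 1 / 2 ≤ ζ.re → ζ.re ≤ 8 →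
      ‖kerH φ X u ζ‖ * ((1 + |u.im|) * (1 + |ζ.im|)) ^ A ≤ C * X ^ (u.re + ζ.re / 2) * wgt u ζ := by
  obtain ⟨Cφ, hCφ, hφ1⟩ := hφ (A + 3)
  obtain ⟨CΓ, hCΓ, hΓ⟩ := exists_norm_Gammaℝ_le (a := 1) (b := 9) one_pos
  set n := ⌈(9:ℝ)⌉₊
  obtain ⟨D, hD, hexp⟩ := one_add_abs_pow_mul_exp_le (A + 3 + 1 + A + n)
  refine ⟨Cφ * (CΓ * 8 ^ 4 * (2 * Real.exp 64)) * 23 * D, by positivity, fun X hX u ζ h1 h2 h3 h4 => ?_⟩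
  set w := u + ζ / 2 with hw
  have hwre : w.re = u.re + ζ.re / 2 := by simp [hw]
  have hwim : w.im = u.im + ζ.im / 2 := by simp [hw]
  set T := 1 + |u.im| with hT
  set Y := 1 + |ζ.im| with hY
  set V := 1 + |w.im| with hV
  have hT1 : 1 ≤ T := by linarith [abs_nonneg u.im]
  have hY1 : 1 ≤ Y := by linarith [abs_nonneg ζ.im]
  have hV1 : 1 ≤ V := by linarith [abs_nonneg w.im]
  have hTV : T ≤ V * Y := by
    have e1 : |u.im| ≤ |w.im| + |ζ.im| := by
      have e2 : u.im = w.im - ζ.im / 2 := by rw [hwim]; ring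
      rw [e2]
      refine (abs_sub _ _).trans ?_
      rw [abs_div]
      have := abs_nonneg ζ.im
      simp only [Nat.abs_ofNat]
      linarith
    have := mul_nonneg (abs_nonneg w.im) (abs_nonneg ζ.im)
    rw [hT, hV, hY]; nlinarith
  have b1 := hφ1 w (by rw [hwre, abs_le]; constructor <;> linarith)
  have b2 : ‖(X:ℂ) ^ w‖ = X ^ (u.re + ζ.re / 2) := by rw [norm_cpow_eq_rpow_re_of_pos hX, hwre]
  have b3 : ‖Gammaℝ (1 / 2 + ζ)‖ ≤ CΓ * Y ^ n := by
    have := hΓ (1 / 2 + ζ) (by simp; linarith) (by simp; linarith)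
    simpa using this
  have b4 : ‖(8:ℂ) ^ (ζ / 2)‖ ≤ 8 ^ 4 := by
    have := norm_natCast_cpow_of_pos (n := 8) (by norm_num) (ζ / 2)
    push_cast at this
    rw [this, ← Real.rpow_natCast]
    apply Real.rpow_le_rpow_of_exponent_le (by norm_num)
    have : (ζ / 2).re = ζ.re / 2 := by simp
    rw [this]; push_cast; linarith
  have b5 : ‖cexp (ζ ^ 2) / ζ‖ ≤ 2 * Real.exp 64 * Real.exp (-ζ.im ^ 2) := by
    have e1 := norm_exp_sq ζ.re ζ.im
    rw [re_add_im] at e1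
    have e2 : 1 / 2 ≤ ‖ζ‖ := h3.trans ((le_abs_self _).trans (abs_re_le_norm ζ))
    rw [norm_div, e1, div_le_iff₀ (by linarith)]
    have e3 : Real.exp (ζ.re ^ 2) ≤ Real.exp 64 := Real.exp_le_exp.mpr (by nlinarith)
    have e4 : Real.exp (ζ.re ^ 2) * Real.exp (-ζ.im ^ 2) ≤ Real.exp 64 * Real.exp (-ζ.im ^ 2) := by gcongr
    have e5 : 0 ≤ Real.exp 64 * Real.exp (-ζ.im ^ 2) := by positivity
    nlinarith
  have b6 : ‖(3 * u + 2 * ζ - 1) / 9‖ ≤ 23 * (T * Y) := by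
    have e1 := norm_le_abs_re_add_abs_im u
    have e2 := norm_le_abs_re_add_abs_im ζ
    have e3 : |u.re| ≤ 2 := by rw [abs_le]; constructor <;> linarith
    have e4 : |ζ.re| ≤ 8 := by rw [abs_le]; constructor <;> linarith
    have e5 : ‖3 * u + 2 * ζ - 1‖ ≤ 3 * ‖u‖ + 2 * ‖ζ‖ + 1 := by
      refine (norm_sub_le _ _).trans ?_
      rw [norm_one]
      gcongr
      refine (norm_add_le _ _).trans ?_
      rw [norm_mul, norm_mul]; simp
    rw [norm_div, Complex.norm_ofNat, div_le_iff₀ (by norm_num)]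
    have := mul_nonneg (abs_nonneg u.im) (abs_nonneg ζ.im)
    rw [hT, hY]; nlinarith [abs_nonneg u.im, abs_nonneg ζ.im]
  have hTsq : 1 + u.im ^ 2 ≤ T ^ 2 := by
    rw [hT, ← sq_abs u.im]; nlinarith [abs_nonneg u.im]
  have b7 := hexp ζ.im
  rw [le_div_iff₀ (by positivity)] at b7
  unfold wgt
  rw [mul_one_div, le_div_iff₀ (by positivity)]
  unfold kerH
  rw [← hw, norm_mul, norm_mul, norm_mul, norm_mul, norm_mul, b2]
  have hX0 : 0 ≤ X ^ (u.re + ζ.re / 2) := by positivity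
  calc _ ≤ ‖φ w‖ * X ^ (u.re + ζ.re / 2) * (CΓ * Y ^ n * 8 ^ 4 * (2 * Real.exp 64 * Real.exp (-ζ.im ^ 2))) *
        (23 * (T * Y)) * (T * Y) ^ A * (T ^ 2 * (1 + ζ.im ^ 2)) := by gcongr
    _ = (‖φ w‖ * T ^ (A + 3)) * X ^ (u.re + ζ.re / 2) * (CΓ * 8 ^ 4 * (2 * Real.exp 64)) * 23 *
        (Y ^ (1 + A + n) * Real.exp (-ζ.im ^ 2) * (1 + ζ.im ^ 2)) := by ring
    _ ≤ (‖φ w‖ * (V * Y) ^ (A + 3)) * X ^ (u.re + ζ.re / 2) * (CΓ * 8 ^ 4 * (2 * Real.exp 64)) * 23 *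
        (Y ^ (1 + A + n) * Real.exp (-ζ.im ^ 2) * (1 + ζ.im ^ 2)) := by gcongr
    _ = (‖φ w‖ * V ^ (A + 3)) * X ^ (u.re + ζ.re / 2) * (CΓ * 8 ^ 4 * (2 * Real.exp 64)) * 23 *
        (Y ^ (A + 3 + 1 + A + n) * Real.exp (-ζ.im ^ 2) * (1 + ζ.im ^ 2)) := by ring
    _ ≤ Cφ * X ^ (u.re + ζ.re / 2) * (CΓ * 8 ^ 4 * (2 * Real.exp 64)) * 23 * D := by gcongr
    _ = _ := by ring

theorem exists_weighted_mean_value {b ε : ℝ} (hb : 0 < b) (hb2 : b ≤ 1 / 4) (hε : 0 < ε) (hε1 : ε ≤ 1) :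
    ∃ (C : ℝ) (B : ℕ), 0 < C ∧ ∀ (K : ℕ) (s : ℂ), s.re = 1 / 2 + b →
      ∑ k ∈ Finset.Ico 1 K, (k:ℝ) ^ (-1 - 2 * ε) * (‖polK k s‖ ^ 2 + ‖polK (-k) s‖ ^ 2) ≤
        C * (1 + |s.im|) ^ B := by
  obtain ⟨C, B, hC, hmv⟩ := exists_mean_value hb hb2 hε hε1
  set r : ℝ := (2:ℝ) ^ (-ε) with hr
  have hr0 : 0 < r := by positivity
  have hr1 : r < 1 := Real.rpow_lt_one_of_one_lt_of_neg (by norm_num) (by linarith)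
  refine ⟨8 * C * (1 - r)⁻¹, B, mul_pos (by positivity) (inv_pos.mpr (by linarith)), fun K s hs => ?_⟩
  set T := (1 + |s.im|) ^ B
  have hT : 0 ≤ T := by positivity
  set a : ℕ → ℝ := fun k => ‖polK k s‖ ^ 2 + ‖polK (-k) s‖ ^ 2 with ha
  have ha0 : ∀ k, 0 ≤ a k := fun k => by positivity
  have hblock : ∀ j : ℕ, ∑ k ∈ Finset.Ico ((2:ℕ) ^ j) (2 ^ (j + 1)), (k:ℝ) ^ (-1 - 2 * ε) * a k ≤ 8 * C * T * r ^ j := by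
    intro j
    have hm := hmv (2 ^ (j + 1)) (Nat.one_le_two_pow) s hs
    have hsum : ∑ k ∈ Finset.Ico ((2:ℕ) ^ j) (2 ^ (j + 1)), a k ≤
        2 * ∑ k ∈ Finset.Icc (-((2 ^ (j + 1) : ℕ):ℤ)) ((2 ^ (j + 1) : ℕ):ℤ), ‖polK k s‖ ^ 2 := by
      simp only [ha]
      rw [Finset.sum_add_distrib, two_mul]
      refine add_le_add ?_ ?_
      · rw [← Finset.sum_image (f := fun k : ℤ => ‖polK k s‖ ^ 2) (g := fun k : ℕ => (k:ℤ)) (by intro x _ y _ h; simpa using h)]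
        refine Finset.sum_le_sum_of_subset_of_nonneg (fun m hm => ?_) fun _ _ _ => by positivity
        simp only [Finset.mem_image, Finset.mem_Ico] at hm
        obtain ⟨k, hk, rfl⟩ := hm
        rw [Finset.mem_Icc]; constructor <;> omega
      · rw [← Finset.sum_image (f := fun k : ℤ => ‖polK k s‖ ^ 2) (g := fun k : ℕ => -(k:ℤ)) (by intro x _ y _ h; simpa using h)]
        refine Finset.sum_le_sum_of_subset_of_nonneg (fun m hm => ?_) fun _ _ _ => by positivity
        simp only [Finset.mem_image, Finset.mem_Ico] at hm
        obtain ⟨k, hk, rfl⟩ := hm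
        rw [Finset.mem_Icc]; constructor <;> omega
    have hw : ∀ k ∈ Finset.Ico ((2:ℕ) ^ j) (2 ^ (j + 1)), (k:ℝ) ^ (-1 - 2 * ε) * a k ≤
        ((2:ℝ) ^ j) ^ (-1 - 2 * ε) * a k := by
      intro k hk
      rw [Finset.mem_Ico] at hk
      refine mul_le_mul_of_nonneg_right ?_ (ha0 k)
      exact Real.rpow_le_rpow_of_nonpos (by positivity) (by exact_mod_cast hk.1) (by linarith)
    have hpow : ((2:ℝ) ^ j) ^ (-1 - 2 * ε) * (2 * ((2:ℝ) ^ (j + 1)) ^ (1 + ε)) ≤ 8 * r ^ j := by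
      have e1 : ((2:ℝ) ^ j) ^ (-1 - 2 * ε) = 2 ^ ((j:ℝ) * (-1 - 2 * ε)) := by
        rw [← Real.rpow_natCast, ← Real.rpow_mul (by norm_num)]
      have e2 : ((2:ℝ) ^ (j + 1)) ^ (1 + ε) = 2 ^ (((j:ℝ) + 1) * (1 + ε)) := by
        rw [← Real.rpow_natCast, ← Real.rpow_mul (by norm_num)]; push_cast; rfl
      have e3 : r ^ j = 2 ^ (-ε * (j:ℝ)) := by rw [hr, ← Real.rpow_natCast, ← Real.rpow_mul (by norm_num)]
      have e4 : (8:ℝ) = 2 ^ (3:ℝ) := by norm_num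
      have e5 : (2:ℝ) * 2 ^ (((j:ℝ) + 1) * (1 + ε)) = 2 ^ (1 + ((j:ℝ) + 1) * (1 + ε)) := by
        rw [Real.rpow_add (by norm_num), Real.rpow_one]
      rw [e1, e2, e3, e4, e5, ← Real.rpow_add (by norm_num), ← Real.rpow_add (by norm_num)]
      exact Real.rpow_le_rpow_of_exponent_le (by norm_num) (by nlinarith)
    calc _ ≤ ∑ k ∈ Finset.Ico ((2:ℕ) ^ j) (2 ^ (j + 1)), ((2:ℝ) ^ j) ^ (-1 - 2 * ε) * a k := Finset.sum_le_sum hw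
      _ = ((2:ℝ) ^ j) ^ (-1 - 2 * ε) * ∑ k ∈ Finset.Ico ((2:ℕ) ^ j) (2 ^ (j + 1)), a k := by rw [Finset.mul_sum]
      _ ≤ ((2:ℝ) ^ j) ^ (-1 - 2 * ε) * (2 * (C * ((2 ^ (j + 1) : ℕ):ℝ) ^ (1 + ε) * T)) := by
          gcongr; exact hsum.trans (by gcongr)
      _ = (((2:ℝ) ^ j) ^ (-1 - 2 * ε) * (2 * ((2:ℝ) ^ (j + 1)) ^ (1 + ε))) * (C * T) := by push_cast; ring
      _ ≤ 8 * r ^ j * (C * T) := by gcongr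
      _ = _ := by ring
  have hall : ∀ J : ℕ, ∑ k ∈ Finset.Ico 1 ((2:ℕ) ^ J), (k:ℝ) ^ (-1 - 2 * ε) * a k ≤
      8 * C * T * ∑ j ∈ Finset.range J, r ^ j := by
    intro J
    induction J with
    | zero => simp
    | succ J ih =>
      rw [← Finset.sum_Ico_consecutive _ (Nat.one_le_two_pow (n := J)) (Nat.pow_le_pow_right (by norm_num) (Nat.le_succ J)),
        Finset.sum_range_succ, mul_add]
      exact add_le_add ih (hblock J)
  calc _ ≤ ∑ k ∈ Finset.Ico 1 ((2:ℕ) ^ K), (k:ℝ) ^ (-1 - 2 * ε) * a k := by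
        refine Finset.sum_le_sum_of_subset_of_nonneg (Finset.Ico_subset_Ico_right Nat.lt_two_pow_self.le) fun k _ _ => ?_
        have := ha0 k
        positivity
    _ ≤ 8 * C * T * ∑ j ∈ Finset.range K, r ^ j := hall K
    _ ≤ 8 * C * T * (1 - r)⁻¹ := by
        gcongr
        rw [← tsum_geometric_of_lt_one hr0.le hr1]
        exact (summable_geometric_of_lt_one hr0.le hr1).sum_le_tsum _ fun _ _ => by positivity
    _ = _ := by ring

/-- The archimedean factor of the functional equation, times `u - 1`. -/
def gfac (u : ℂ) : ℂ := (u - 1) * (2:ℂ) ^ (-u) * (2 * Real.pi : ℂ) ^ (u - 1) * Gamma (1 - u)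

/-- The trigonometric factor `cos θ + c sin θ` of the functional equation, `θ = π (1 - u) / 2`. -/
def trig (c u : ℂ) : ℂ := cos (Real.pi * (1 - u) / 2) + c * sin (Real.pi * (1 - u) / 2)

theorem norm_trig_le {c : ℂ} (hc : ‖c‖ ≤ 1) (u : ℂ) : ‖trig c u‖ ≤ 2 * Real.exp (Real.pi / 2 * |u.im|) := by
  have him : |(Real.pi * (1 - u) / 2 : ℂ).im| = Real.pi / 2 * |u.im| := by
    have : (Real.pi * (1 - u) / 2 : ℂ) = ((Real.pi / 2 : ℝ):ℂ) * (1 - u) := by push_cast; ring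
    rw [this, im_ofReal_mul, abs_mul, abs_of_pos (by positivity)]; simp
  have h1 := norm_cos_le_exp (Real.pi * (1 - u) / 2)
  have h2 := norm_sin_le_exp (Real.pi * (1 - u) / 2)
  rw [him] at h1 h2
  unfold trig
  refine (norm_add_le _ _).trans ?_
  rw [norm_mul]
  have := mul_le_mul hc h2 (norm_nonneg _) zero_le_one
  linarith

theorem exists_norm_gfac_le : ∃ C : ℝ, 0 < C ∧ ∀ u : ℂ, -1 ≤ u.re → u.re ≤ 0 →
    ‖gfac u‖ * Real.exp (Real.pi / 2 * |u.im|) ≤ C * (1 + |u.im|) ^ 3 := by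
  have hcont : ContinuousOn Real.Gamma (Icc 1 2) := fun x hx =>
    (Real.differentiableAt_Gamma fun m => by
      have : (0:ℝ) ≤ m := m.cast_nonneg
      linarith [hx.1]).continuousAt.continuousWithinAt
  obtain ⟨D, hD⟩ := isCompact_Icc.exists_bound_of_continuousOn hcont
  refine ⟨2 * 2 * (Real.exp 1 * (4 * (|D| + 1))), by positivity, fun u h1 h2 => ?_⟩
  have hre : (1 - u).re = 1 - u.re := by simp
  have him : |(1 - u).im| = |u.im| := by simp
  have hG := norm_Gamma_le (s := 1 - u) (by rw [hre]; linarith)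
  rw [hre, him] at hG
  have hg : Real.Gamma (1 - u.re) ≤ |D| + 1 := by
    have := hD (1 - u.re) ⟨by linarith, by linarith⟩
    rw [Real.norm_eq_abs] at this
    linarith [le_abs_self (Real.Gamma (1 - u.re)), le_abs_self D]
  have ht := abs_nonneg u.im
  have hp : (2 * (1 + |u.im|)) ^ (1 - u.re) ≤ (2 * (1 + |u.im|)) ^ 2 := by
    rw [← Real.rpow_natCast]
    exact Real.rpow_le_rpow_of_exponent_le (by linarith) (by push_cast; linarith)
  have c1 : ‖u - 1‖ ≤ 2 * (1 + |u.im|) := by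
    refine (norm_le_abs_re_add_abs_im _).trans ?_
    have : |(u - 1).re| ≤ 2 := by rw [abs_le]; constructor <;> simp <;> linarith
    have : |(u - 1).im| = |u.im| := by simp
    linarith
  have c2 : ‖(2:ℂ) ^ (-u)‖ ≤ 2 := by
    have := norm_natCast_cpow_of_pos (n := 2) (by norm_num) (-u)
    push_cast at this
    rw [this]
    calc (2:ℝ) ^ (-u).re ≤ 2 ^ (1:ℝ) := Real.rpow_le_rpow_of_exponent_le (by norm_num) (by simp; linarith)
      _ = 2 := by simp
  have c3 : ‖(2 * Real.pi : ℂ) ^ (u - 1)‖ ≤ 1 := by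
    have e : (2 * Real.pi : ℂ) = ((2 * Real.pi : ℝ):ℂ) := by push_cast; rfl
    rw [e, norm_cpow_eq_rpow_re_of_pos (by positivity)]
    exact Real.rpow_le_one_of_one_le_of_nonpos (by linarith [Real.pi_gt_three]) (by simp; linarith)
  unfold gfac
  rw [norm_mul, norm_mul, norm_mul]
  have hgp := (Real.Gamma_pos_of_pos (s := 1 - u.re) (by linarith)).le
  calc _ = ‖u - 1‖ * ‖(2:ℂ) ^ (-u)‖ * ‖(2 * Real.pi : ℂ) ^ (u - 1)‖ *
        (‖Gamma (1 - u)‖ * Real.exp (Real.pi / 2 * |u.im|)) := by ring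
    _ ≤ (2 * (1 + |u.im|)) * 2 * 1 * (Real.exp 1 * ((2 * (1 + |u.im|)) ^ 2 * (|D| + 1))) := by
        have hG' := hG.trans (b := _) (c := Real.exp 1 * ((2 * (1 + |u.im|)) ^ 2 * (|D| + 1))) (by gcongr)
        exact mul_le_mul (by gcongr) hG' (by positivity) (by positivity)
    _ = _ := by ring

/-- The `k`-th term of the dual side. -/
def dualTerm (φ : ℂ → ℂ) (X : ℝ) (k : ℕ) (u ζ : ℂ) : ℂ :=
  kerH φ X u ζ * izo (2 * u + ζ) ^ 2 * gfac u * ((k:ℂ) ^ (u - 1) * (-1) ^ k) *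
    (trig 1 u * (polK k (u + ζ) * polK k (3 * u + ζ) * Ek k u ζ) +
      trig (-1) u * (polK (-k) (u + ζ) * polK (-k) (3 * u + ζ) * Ek (-k) u ζ))

theorem dualTerm_zero (φ : ℂ → ℂ) (X : ℝ) (u ζ : ℂ) : dualTerm φ X 0 u ζ = 0 := by
  simp [dualTerm, polK]

/-- The size `(1 + |Im u|)(1 + |Im ζ|)`. -/
def hgt (u ζ : ℂ) : ℝ := (1 + |u.im|) * (1 + |ζ.im|)

theorem one_le_hgt (u ζ : ℂ) : 1 ≤ hgt u ζ := by
  unfold hgt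
  nlinarith [abs_nonneg u.im, abs_nonneg ζ.im, mul_nonneg (abs_nonneg u.im) (abs_nonneg ζ.im)]

theorem one_add_abs_le_hgt (u ζ : ℂ) : 1 + |u.im| ≤ hgt u ζ := by
  unfold hgt
  nlinarith [abs_nonneg u.im, abs_nonneg ζ.im, mul_nonneg (abs_nonneg u.im) (abs_nonneg ζ.im)]

theorem one_add_abs_lin_le_hgt {a b : ℝ} {m : ℝ} (ha : |a| ≤ m) (hb : |b| ≤ m) (hm : 1 ≤ m) (u ζ : ℂ) :
    1 + |(a * u + b * ζ : ℂ).im| ≤ m * hgt u ζ := by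
  have e : (a * u + b * ζ : ℂ).im = a * u.im + b * ζ.im := by simp
  rw [e]
  have h1 := abs_add_le (a * u.im) (b * ζ.im)
  rw [abs_mul, abs_mul] at h1
  have h2 := mul_le_mul_of_nonneg_right ha (abs_nonneg u.im)
  have h3 := mul_le_mul_of_nonneg_right hb (abs_nonneg ζ.im)
  have h4 := mul_nonneg (zero_le_one.trans hm) (mul_nonneg (abs_nonneg u.im) (abs_nonneg ζ.im))
  unfold hgt
  nlinarith

theorem norm_lin_le_hgt {a b : ℝ} {m : ℝ} (ha : |a| ≤ m) (hb : |b| ≤ m) (hm : 1 ≤ m) {R : ℝ} {u ζ : ℂ}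
    (hR : |(a * u + b * ζ : ℂ).re| ≤ R) : ‖(a * u + b * ζ : ℂ)‖ ≤ (R + m) * hgt u ζ := by
  have h1 := one_add_abs_lin_le_hgt ha hb hm u ζ
  have h2 := norm_le_abs_re_add_abs_im (a * u + b * ζ : ℂ)
  have h3 := one_le_hgt u ζ
  have h4 : 0 ≤ R := (abs_nonneg _).trans hR
  nlinarith

theorem exists_norm_dualTerm_le (hRH : RiemannHypothesis) {φ : ℂ → ℂ} (hφ : RapidDecay φ) {η : ℝ} (hη : 0 < η)
    (hη2 : η ≤ 1 / 16) (A : ℕ) :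
    ∃ C : ℝ, 0 < C ∧ ∀ X : ℝ, 0 < X → ∀ (k : ℕ) (u ζ : ℂ), k ≠ 0 → u.re = -η → 1 / 2 + 5 * η ≤ ζ.re → ζ.re ≤ 8 →
      ‖dualTerm φ X k u ζ‖ * hgt u ζ ^ A ≤ C * X ^ (-η + ζ.re / 2) * wgt u ζ * (k:ℝ) ^ (-1 - η / 2) *
        (‖polK k (u + ζ)‖ * ‖polK k (3 * u + ζ)‖ + ‖polK (-k) (u + ζ)‖ * ‖polK (-k) (3 * u + ζ)‖) := by
  obtain ⟨Ci, Ai, hCi, hizo⟩ := exists_norm_izo_le hRH (δ := 3 * η) (by positivity)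
  obtain ⟨Cg, hCg, hg⟩ := exists_norm_gfac_le
  obtain ⟨Ce, hCe, he⟩ := exists_norm_Ek_le hη (ε := η / 2) (by positivity)
  obtain ⟨Ck, hCk, hker⟩ := exists_norm_kerH_le hφ (2 * Ai + 3 + A)
  refine ⟨Ck * (Ci * 2 ^ Ai) ^ 2 * Cg * 2 * Ce, by positivity, fun X hX k u ζ hk hu h1 h2 => ?_⟩
  have hk0 : (0:ℝ) < k := by exact_mod_cast Nat.pos_of_ne_zero hk
  have hkz : (k:ℤ) ≠ 0 := by exact_mod_cast hk
  set M := hgt u ζ with hM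
  have hM1 : 1 ≤ M := one_le_hgt u ζ
  have b1 : ‖izo (2 * u + ζ)‖ ≤ Ci * 2 ^ Ai * M ^ Ai := by
    have e1 := hizo (2 * u + ζ) (by simp [hu]; linarith) (by simp [hu]; linarith)
    have e2 := one_add_abs_lin_le_hgt (a := 2) (b := 1) (m := 2) (by norm_num) (by norm_num) (by norm_num) u ζ
    push_cast at e2
    rw [one_mul] at e2
    calc _ ≤ _ := e1
      _ ≤ Ci * (2 * M) ^ Ai := by gcongr
      _ = _ := by rw [mul_pow]; ring
  have b2 : ‖gfac u‖ * Real.exp (Real.pi / 2 * |u.im|) ≤ Cg * M ^ 3 :=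
    (hg u (by linarith) (by linarith)).trans (by gcongr; exact one_add_abs_le_hgt u ζ)
  have b3 := norm_trig_le (c := 1) (by simp) u
  have b4 := norm_trig_le (c := -1) (by simp) u
  have b5 := he k hkz u ζ hu (by linarith)
  have b6 := he (-k) (by simpa using hkz) u ζ hu (by linarith)
  rw [Int.natAbs_natCast] at b5
  rw [Int.natAbs_neg, Int.natAbs_natCast] at b6
  have b7 : ‖(k:ℂ) ^ (u - 1) * (-1) ^ k‖ = (k:ℝ) ^ (-1 - η) := by
    rw [norm_mul, norm_pow, norm_neg, norm_one, one_pow, mul_one, norm_natCast_cpow_of_pos (Nat.pos_of_ne_zero hk)]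
    congr 1; simp [hu]; ring
  have b8 := hker X hX u ζ (by linarith) (by linarith) (by linarith) h2
  rw [hu] at b8
  change ‖kerH φ X u ζ‖ * M ^ _ ≤ _ at b8
  set E := Real.exp (Real.pi / 2 * |u.im|)
  set P := ‖polK k (u + ζ)‖ * ‖polK k (3 * u + ζ)‖
  set P' := ‖polK (-k) (u + ζ)‖ * ‖polK (-k) (3 * u + ζ)‖
  have hP : 0 ≤ P := by positivity
  have hP' : 0 ≤ P' := by positivity
  have b9 : ‖trig 1 u * (polK k (u + ζ) * polK k (3 * u + ζ) * Ek k u ζ) +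
      trig (-1) u * (polK (-k) (u + ζ) * polK (-k) (3 * u + ζ) * Ek (-k) u ζ)‖ ≤
      2 * E * (Ce * (k:ℝ) ^ (η / 2)) * (P + P') := by
    refine (norm_add_le _ _).trans ?_
    simp only [norm_mul]
    calc _ ≤ 2 * E * (P * (Ce * (k:ℝ) ^ (η / 2))) + 2 * E * (P' * (Ce * (k:ℝ) ^ (η / 2))) := by gcongr
      _ = _ := by ring
  have hkk : (k:ℝ) ^ (-1 - η) * (k:ℝ) ^ (η / 2) = (k:ℝ) ^ (-1 - η / 2) := by
    rw [← Real.rpow_add hk0]; congr 1; ring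
  unfold dualTerm
  rw [norm_mul, norm_mul _ ((k:ℂ) ^ (u - 1) * (-1) ^ k), norm_mul, norm_mul, norm_pow, b7]
  have hw := (wgt_pos u ζ).le
  calc _ ≤ ‖kerH φ X u ζ‖ * (Ci * 2 ^ Ai * M ^ Ai) ^ 2 * ‖gfac u‖ * (k:ℝ) ^ (-1 - η) *
        (2 * E * (Ce * (k:ℝ) ^ (η / 2)) * (P + P')) * M ^ A := by gcongr
    _ = ‖kerH φ X u ζ‖ * (Ci * 2 ^ Ai * M ^ Ai) ^ 2 * (‖gfac u‖ * E) * M ^ A * (2 * Ce) *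
        ((k:ℝ) ^ (-1 - η) * (k:ℝ) ^ (η / 2)) * (P + P') := by ring
    _ ≤ ‖kerH φ X u ζ‖ * (Ci * 2 ^ Ai * M ^ Ai) ^ 2 * (Cg * M ^ 3) * M ^ A * (2 * Ce) *
        ((k:ℝ) ^ (-1 - η) * (k:ℝ) ^ (η / 2)) * (P + P') := by gcongr
    _ = (‖kerH φ X u ζ‖ * M ^ (2 * Ai + 3 + A)) * ((Ci * 2 ^ Ai) ^ 2 * Cg * (2 * Ce)) *
        (k:ℝ) ^ (-1 - η / 2) * (P + P') := by rw [hkk]; ring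
    _ ≤ (Ck * X ^ (-η + ζ.re / 2) * wgt u ζ) * ((Ci * 2 ^ Ai) ^ 2 * Cg * (2 * Ce)) *
        (k:ℝ) ^ (-1 - η / 2) * (P + P') := by gcongr
    _ = _ := by ring

theorem measurable_gfac : Measurable gfac := by
  have := measurable_Gamma
  unfold gfac; fun_prop

theorem measurable_dualTerm {φ : ℂ → ℂ} (hφ : Differentiable ℂ φ) (X : ℝ) (k : ℕ)
    {η c : ℝ} (hη : 0 < η) (hc : 1 / 2 + 5 * η ≤ c) :
    Measurable fun p : ℝ × ℝ => dualTerm φ X k ((-η : ℝ) + p.1 * I) (c + p.2 * I) := by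
  have m1 : Measurable fun p : ℝ × ℝ => (((-η : ℝ):ℂ) + p.1 * I) := by fun_prop
  have m2 : Measurable fun p : ℝ × ℝ => ((c:ℂ) + p.2 * I) := by fun_prop
  have h1 := measurable_kerH hφ X m1 m2
  have h2 := measurable_izo
  have h3 := measurable_gfac
  have h4 : ∀ k, Measurable (polK k) := fun k => (differentiable_polK k).continuous.measurable
  have h5 : ∀ k, Measurable fun p : ℝ × ℝ => Ek k ((-η : ℝ) + p.1 * I) (c + p.2 * I) := fun k =>
    measurable_Ek k hη m1 m2 (fun x => by simp) fun x => by simp; linarith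
  have h6 : ∀ c, Measurable (trig c) := fun c => by unfold trig; fun_prop
  have h7 := fun k => (h4 k).comp (m1.add m2)
  have h8 := fun k => (h4 k).comp ((m1.const_mul 3).add m2)
  have h9 := fun c => (h6 c).comp m1
  have h10 := h2.comp ((m1.const_mul 2).add m2)
  have h11 := h3.comp m1
  unfold dualTerm
  refine Measurable.mul (Measurable.mul (Measurable.mul (Measurable.mul h1 (h10.pow_const 2)) h11) (by fun_prop)) ?_
  exact ((h9 1).mul (((h7 k).mul (h8 k)).mul (h5 k))).add ((h9 (-1)).mul (((h7 (-k)).mul (h8 (-k))).mul (h5 (-k))))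

theorem differentiableAt_dualTerm (hRH : RiemannHypothesis) {φ : ℂ → ℂ} (hφ : Differentiable ℂ φ) {X : ℝ} (hX : 0 < X)
    (k : ℕ) {η : ℝ} (hη : 0 < η) {u ζ : ℂ} (hu : u.re = -η) (hζ : 1 / 2 + 5 * η ≤ ζ.re) :
    DifferentiableAt ℂ (fun ζ => dualTerm φ X k u ζ) ζ := by
  have h1 := differentiableAt_kerH_snd hφ hX u (ζ := ζ) (by linarith)
  have h2 : DifferentiableAt ℂ (fun ζ => izo (2 * u + ζ)) ζ :=
    (differentiableAt_izo hRH (s := 2 * u + ζ) (by simp [hu]; linarith)).comp ζ (by fun_prop)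
  have h3 : ∀ k, DifferentiableAt ℂ (fun ζ => Ek k u ζ) ζ := fun k =>
    (differentiableOn_Ek k hη hu).differentiableAt
      ((isOpen_lt continuous_const continuous_re).mem_nhds (by change 1 / 2 + 4 * η < ζ.re; linarith))
  have h4 : ∀ k (v : ℂ), DifferentiableAt ℂ (fun ζ => polK k (v + ζ)) ζ := fun k v =>
    ((differentiable_polK k) _).comp ζ (by fun_prop)
  unfold dualTerm
  exact (((h1.mul (h2.pow 2)).mul_const _).mul_const _).mul
    ((((h4 k u).mul (h4 k (3 * u))).mul (h3 k)).const_mul _ |>.add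
      ((((h4 (-k) u).mul (h4 (-k) (3 * u))).mul (h3 (-k))).const_mul _))

theorem norm_polK_le_of_two_le {k : ℤ} (hk : k ≠ 0) {s : ℂ} (hs : 2 ≤ s.re) :
    ‖polK k s‖ ≤ (∑' n : ℕ, (n:ℝ) ^ (-2:ℝ)) * (1 + ‖s‖) := by
  rw [polK_eq_tsum hk (by linarith), norm_mul, mul_comm]
  have hsum : Summable fun n : ℕ => (n:ℝ) ^ (-2:ℝ) := Real.summable_nat_rpow.mpr (by norm_num)
  refine mul_le_mul (tsum_of_norm_bounded hsum.hasSum fun n => ?_) ((norm_sub_le _ _).trans (by rw [norm_one, add_comm]))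
    (norm_nonneg _) (tsum_nonneg fun n => by positivity)
  rw [norm_mul, norm_natCast_cpow_le n (by linarith)]
  rcases Nat.eq_zero_or_pos n with rfl | hn
  · rw [chk_zero, norm_zero, zero_mul]; positivity
  · have h1 : (1:ℝ) ≤ n := by exact_mod_cast hn
    calc _ ≤ 1 * (n:ℝ) ^ (-2:ℝ) := mul_le_mul (norm_chk_le k n)
          (Real.rpow_le_rpow_of_exponent_le h1 (by linarith)) (by positivity) zero_le_one
      _ = _ := one_mul _

theorem dblInt_dualTerm_shift (hRH : RiemannHypothesis) {φ : ℂ → ℂ} (hφd : Differentiable ℂ φ) (hφ : RapidDecay φ)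
    {η : ℝ} (hη : 0 < η) (hη2 : η ≤ 1 / 16) {X : ℝ} (hX : 0 < X) (k : ℕ) :
    dblInt (-η) (1 / 2 + 5 * η) (dualTerm φ X k) = dblInt (-η) 8 (dualTerm φ X k) := by
  rcases eq_or_ne k 0 with rfl | hk
  · simp [dblInt, dualTerm_zero]
  have hkz : (k:ℤ) ≠ 0 := by exact_mod_cast hk
  obtain ⟨C, hC, hb⟩ := exists_norm_dualTerm_le hRH hφ hη hη2 8
  set D := 2000000 * (k:ℝ) ^ 3 with hD
  have hD0 : 0 ≤ D := by positivity
  refine dblInt_shift_snd (C := C * max X 1 ^ (4:ℝ) * max X⁻¹ 1 ^ (1:ℝ) * (2 * D ^ 2 * 3 ^ 8)) (by linarith)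
    (fun u ζ h1 h2 hu => differentiableAt_dualTerm hRH hφd hX k hη hu h1) (fun u ζ h1 h2 hu => ?_)
    (measurable_dualTerm hφd X k hη le_rfl) (measurable_dualTerm hφd X k hη (by linarith))
  set M := hgt u ζ with hM
  have hM1 : 1 ≤ M := one_le_hgt u ζ
  have e1 : 1 + |(u + ζ).im| ≤ 3 * M := by
    have := one_add_abs_lin_le_hgt (a := 1) (b := 1) (m := 3) (by norm_num) (by norm_num) (by norm_num) u ζ
    push_cast at this
    rwa [one_mul, one_mul] at this
  have e2 : 1 + |(3 * u + ζ).im| ≤ 3 * M := by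
    have := one_add_abs_lin_le_hgt (a := 3) (b := 1) (m := 3) (by norm_num) (by norm_num) (by norm_num) u ζ
    push_cast at this
    rwa [one_mul] at this
  have hp : ∀ j : ℤ, j ≠ 0 → j.natAbs = k → ‖polK j (u + ζ)‖ * ‖polK j (3 * u + ζ)‖ ≤ D ^ 2 * 3 ^ 8 * M ^ 8 := by
    intro j hj hjk
    have a1 := norm_polK_le hj (s := u + ζ) (by simp [hu]; linarith) (by simp [hu]; linarith)
    have a2 := norm_polK_le hj (s := 3 * u + ζ) (by simp [hu]; linarith) (by simp [hu]; linarith)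
    rw [hjk] at a1 a2
    calc _ ≤ (D * (3 * M) ^ 4) * (D * (3 * M) ^ 4) := by
          refine mul_le_mul (a1.trans ?_) (a2.trans ?_) (norm_nonneg _) (by positivity) <;> gcongr
      _ = _ := by ring
  have hb1 := hb X hX k u ζ hk hu h1 h2
  have hXp : X ^ (-η + ζ.re / 2) ≤ max X 1 ^ (4:ℝ) * max X⁻¹ 1 ^ (1:ℝ) := by
    rw [Real.rpow_add hX, mul_comm, Real.rpow_neg hX.le, ← Real.inv_rpow hX.le]
    gcongr
    · calc _ ≤ max X 1 ^ (ζ.re / 2) := Real.rpow_le_rpow hX.le (le_max_left _ _) (by linarith)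
        _ ≤ _ := Real.rpow_le_rpow_of_exponent_le (le_max_right _ _) (by linarith)
    · calc _ ≤ max X⁻¹ 1 ^ η := Real.rpow_le_rpow (by positivity) (le_max_left _ _) hη.le
        _ ≤ _ := Real.rpow_le_rpow_of_exponent_le (le_max_right _ _) (by linarith)
  have hk1 : (k:ℝ) ^ (-1 - η / 2) ≤ 1 :=
    Real.rpow_le_one_of_one_le_of_nonpos (by exact_mod_cast Nat.pos_of_ne_zero hk) (by linarith)
  have hw := (wgt_pos u ζ).le
  have hM8 : 0 < M ^ 8 := by positivity
  refine le_of_mul_le_mul_right (hb1.trans ?_) hM8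
  have p1 := hp k hkz (by simp)
  have p2 := hp (-k) (by simpa using hkz) (by simp)
  calc _ ≤ C * (max X 1 ^ (4:ℝ) * max X⁻¹ 1 ^ (1:ℝ)) * wgt u ζ * 1 * (D ^ 2 * 3 ^ 8 * M ^ 8 + D ^ 2 * 3 ^ 8 * M ^ 8) := by
        gcongr
    _ = _ := by ring

theorem hasSum_dblInt_dualTerm (hRH : RiemannHypothesis) {φ : ℂ → ℂ} (hφd : Differentiable ℂ φ) (hφ : RapidDecay φ)
    {η : ℝ} (hη : 0 < η) (hη2 : η ≤ 1 / 16) {X : ℝ} (hX : 0 < X) :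
    HasSum (fun k => dblInt (-η) 8 (dualTerm φ X k)) (dblInt (-η) 8 fun u ζ => ∑' k, dualTerm φ X k u ζ) := by
  obtain ⟨C, hC, hb⟩ := exists_norm_dualTerm_le hRH hφ hη hη2 2
  set S := ∑' n : ℕ, (n:ℝ) ^ (-2:ℝ) with hS
  have hS0 : 0 ≤ S := tsum_nonneg fun n => by positivity
  have hsum : Summable fun k : ℕ => (k:ℝ) ^ (-1 - η / 2) := Real.summable_nat_rpow.mpr (by linarith)
  refine hasSum_dblInt (hsum.mul_left (C * X ^ (-η + 8 / 2) * (2 * (S * 12) ^ 2)))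
    (fun k => measurable_dualTerm hφd X k hη (by linarith)) fun k u ζ hu hζ => ?_
  rcases eq_or_ne k 0 with rfl | hk
  · rw [dualTerm_zero, norm_zero]
    have := (wgt_pos u ζ).le
    positivity
  have hkz : (k:ℤ) ≠ 0 := by exact_mod_cast hk
  set M := hgt u ζ with hM
  have hM1 : 1 ≤ M := one_le_hgt u ζ
  have e1 : ‖u + ζ‖ ≤ (8 + 3) * M := by
    have := norm_lin_le_hgt (a := 1) (b := 1) (m := 3) (R := 8) (u := u) (ζ := ζ) (by norm_num) (by norm_num) (by norm_num)
      (by simp [hu, hζ]; rw [abs_le]; constructor <;> linarith)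
    push_cast at this
    rwa [one_mul, one_mul] at this
  have e2 : ‖3 * u + ζ‖ ≤ (8 + 3) * M := by
    have := norm_lin_le_hgt (a := 3) (b := 1) (m := 3) (R := 8) (u := u) (ζ := ζ) (by norm_num) (by norm_num) (by norm_num)
      (by simp [hu, hζ]; rw [abs_le]; constructor <;> linarith)
    push_cast at this
    rwa [one_mul] at this
  have hp : ∀ j : ℤ, j ≠ 0 → ‖polK j (u + ζ)‖ * ‖polK j (3 * u + ζ)‖ ≤ (S * 12) ^ 2 * M ^ 2 := by
    intro j hj
    have a1 := norm_polK_le_of_two_le hj (s := u + ζ) (by simp [hu, hζ]; linarith)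
    have a2 := norm_polK_le_of_two_le hj (s := 3 * u + ζ) (by simp [hu, hζ]; linarith)
    calc _ ≤ (S * (12 * M)) * (S * (12 * M)) := by
          refine mul_le_mul (a1.trans ?_) (a2.trans ?_) (norm_nonneg _) (by positivity) <;> gcongr <;> linarith
      _ = _ := by ring
  have hb1 := hb X hX k u ζ hk hu (by linarith) (by linarith)
  rw [hζ] at hb1
  have hM8 : 0 < M ^ 2 := by positivity
  have hw := (wgt_pos u ζ).le
  refine le_of_mul_le_mul_right (hb1.trans ?_) hM8
  have p1 := hp k hkz
  have p2 := hp (-k) (by simpa using hkz)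
  calc _ ≤ C * X ^ (-η + 8 / 2) * wgt u ζ * (k:ℝ) ^ (-1 - η / 2) * ((S * 12) ^ 2 * M ^ 2 + (S * 12) ^ 2 * M ^ 2) := by
        gcongr
    _ = _ := by ring

theorem exists_norm_sum_dualTerm_le (hRH : RiemannHypothesis) {φ : ℂ → ℂ} (hφd : Differentiable ℂ φ)
    (hφ : RapidDecay φ) {η : ℝ} (hη : 0 < η) (hη2 : η ≤ 1 / 16) :
    ∃ C : ℝ, 0 < C ∧ ∀ X : ℝ, 0 < X → ∀ K : ℕ,
      ‖∑ k ∈ Finset.range K, dblInt (-η) (1 / 2 + 5 * η) (dualTerm φ X k)‖ ≤ C * X ^ (1 / 4 + 3 * η / 2) := by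
  obtain ⟨C1, B1, hC1, hmv1⟩ := exists_weighted_mean_value (b := 4 * η) (ε := η / 4) (by linarith) (by linarith)
    (by linarith) (by linarith)
  obtain ⟨C2, B2, hC2, hmv2⟩ := exists_weighted_mean_value (b := 2 * η) (ε := η / 4) (by linarith) (by linarith)
    (by linarith) (by linarith)
  obtain ⟨C, hC, hb⟩ := exists_norm_dualTerm_le hRH hφ hη hη2 (B1 + B2)
  set c := 1 / 2 + 5 * η with hc
  set W := ∫ p : ℝ × ℝ, wgt ((-η : ℝ) + p.1 * I) (c + p.2 * I) with hW
  have hW0 : 0 ≤ W := integral_nonneg fun p => (wgt_pos _ _).le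
  set D := C * (C1 * 3 ^ B1 + C2 * 3 ^ B2) with hD
  have hD0 : 0 < D := by positivity
  refine ⟨D * (W + 1), by positivity, fun X hX K => ?_⟩
  have hexp : -η + c / 2 = 1 / 4 + 3 * η / 2 := by rw [hc]; ring
  have key : ∀ u ζ : ℂ, u.re = -η → ζ.re = c →
      ∑ k ∈ Finset.range K, ‖dualTerm φ X k u ζ‖ ≤ D * X ^ (1 / 4 + 3 * η / 2) * wgt u ζ := by
    intro u ζ hu hζ
    set M := hgt u ζ with hM
    have hM1 : 1 ≤ M := one_le_hgt u ζ
    have hw := (wgt_pos u ζ).le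
    have e1 : 1 + |(u + ζ).im| ≤ 3 * M := by
      have := one_add_abs_lin_le_hgt (a := 1) (b := 1) (m := 3) (by norm_num) (by norm_num) (by norm_num) u ζ
      push_cast at this
      rwa [one_mul, one_mul] at this
    have e2 : 1 + |(3 * u + ζ).im| ≤ 3 * M := by
      have := one_add_abs_lin_le_hgt (a := 3) (b := 1) (m := 3) (by norm_num) (by norm_num) (by norm_num) u ζ
      push_cast at this
      rwa [one_mul] at this
    have m1 := hmv1 K (u + ζ) (by simp [hu, hζ, hc]; ring)
    have m2 := hmv2 K (3 * u + ζ) (by simp [hu, hζ, hc]; ring)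
    have hMp : 0 < M ^ (B1 + B2) := by positivity
    refine le_of_mul_le_mul_right ?_ hMp
    rw [Finset.sum_mul]
    have hsub : ∑ k ∈ Finset.range K, ‖dualTerm φ X k u ζ‖ * M ^ (B1 + B2) =
        ∑ k ∈ Finset.Ico 1 K, ‖dualTerm φ X k u ζ‖ * M ^ (B1 + B2) := by
      symm
      refine Finset.sum_subset (fun k hk => ?_) fun k hk hk' => ?_
      · rw [Finset.mem_Ico] at hk; rw [Finset.mem_range]; exact hk.2
      · rw [Finset.mem_range] at hk
        rw [Finset.mem_Ico] at hk'
        have : k = 0 := by omega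
        rw [this, dualTerm_zero, norm_zero, zero_mul]
    rw [hsub]
    set Q := C * X ^ (1 / 4 + 3 * η / 2) * wgt u ζ with hQ
    have hQ0 : 0 ≤ Q := by positivity
    calc _ ≤ ∑ k ∈ Finset.Ico 1 K, (Q * ((k:ℝ) ^ (-1 - 2 * (η / 4)) * (‖polK k (u + ζ)‖ ^ 2 + ‖polK (-k) (u + ζ)‖ ^ 2)) +
          Q * ((k:ℝ) ^ (-1 - 2 * (η / 4)) * (‖polK k (3 * u + ζ)‖ ^ 2 + ‖polK (-k) (3 * u + ζ)‖ ^ 2))) := by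
          refine Finset.sum_le_sum fun k hk => ?_
          rw [Finset.mem_Ico] at hk
          have h := hb X hX k u ζ (by omega) hu hζ.ge (by rw [hζ, hc]; linarith)
          rw [hζ, hexp, ← hM, ← hQ] at h
          refine h.trans ?_
          rw [show -1 - 2 * (η / 4) = -1 - η / 2 by ring]
          have hk0 : 0 ≤ (k:ℝ) ^ (-1 - η / 2) := by positivity
          have hQk := mul_nonneg hQ0 hk0
          have q1 := two_mul_le_add_sq ‖polK k (u + ζ)‖ ‖polK k (3 * u + ζ)‖
          have q2 := two_mul_le_add_sq ‖polK (-k) (u + ζ)‖ ‖polK (-k) (3 * u + ζ)‖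
          have q3 := mul_nonneg (norm_nonneg (polK k (u + ζ))) (norm_nonneg (polK k (3 * u + ζ)))
          have q4 := mul_nonneg (norm_nonneg (polK (-k) (u + ζ))) (norm_nonneg (polK (-k) (3 * u + ζ)))
          have q5 := mul_le_mul_of_nonneg_left (a := Q * (k:ℝ) ^ (-1 - η / 2))
            (b := ‖polK k (u + ζ)‖ * ‖polK k (3 * u + ζ)‖ + ‖polK (-k) (u + ζ)‖ * ‖polK (-k) (3 * u + ζ)‖)
            (c := (‖polK k (u + ζ)‖ ^ 2 + ‖polK (-k) (u + ζ)‖ ^ 2) + (‖polK k (3 * u + ζ)‖ ^ 2 + ‖polK (-k) (3 * u + ζ)‖ ^ 2))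
            (by linarith) hQk
          refine q5.trans (le_of_eq ?_)
          ring
      _ = Q * ∑ k ∈ Finset.Ico 1 K, (k:ℝ) ^ (-1 - 2 * (η / 4)) * (‖polK k (u + ζ)‖ ^ 2 + ‖polK (-k) (u + ζ)‖ ^ 2) +
          Q * ∑ k ∈ Finset.Ico 1 K, (k:ℝ) ^ (-1 - 2 * (η / 4)) * (‖polK k (3 * u + ζ)‖ ^ 2 + ‖polK (-k) (3 * u + ζ)‖ ^ 2) := by
          rw [Finset.sum_add_distrib, Finset.mul_sum, Finset.mul_sum]
      _ ≤ Q * (C1 * (3 ^ B1 * M ^ (B1 + B2))) + Q * (C2 * (3 ^ B2 * M ^ (B1 + B2))) := by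
          gcongr
          · refine m1.trans (mul_le_mul_of_nonneg_left ?_ hC1.le)
            calc _ ≤ (3 * M) ^ B1 := by gcongr
              _ = 3 ^ B1 * M ^ B1 := mul_pow _ _ _
              _ ≤ _ := by gcongr; omega
          · refine m2.trans (mul_le_mul_of_nonneg_left ?_ hC2.le)
            calc _ ≤ (3 * M) ^ B2 := by gcongr
              _ = 3 ^ B2 * M ^ B2 := mul_pow _ _ _
              _ ≤ _ := by gcongr; omega
      _ = _ := by rw [hQ, hD]; ring
  have h_integrable : ∀ k ∈ Finset.range K, Integrable fun p : ℝ × ℝ => dualTerm φ X k ((-η : ℝ) + p.1 * I) (c + p.2 * I) := by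
    intro k hk
    refine integrable_dblInt (C := D * X ^ (1 / 4 + 3 * η / 2)) (measurable_dualTerm hφd X k hη hc.ge) fun u ζ hu hζ => ?_
    exact (Finset.single_le_sum (f := fun k => ‖dualTerm φ X k u ζ‖) (fun _ _ => norm_nonneg _) hk).trans (key u ζ hu hζ)
  have e : ∑ k ∈ Finset.range K, dblInt (-η) c (dualTerm φ X k) =
      dblInt (-η) c fun u ζ => ∑ k ∈ Finset.range K, dualTerm φ X k u ζ := by
    unfold dblInt; rw [integral_finsetSum _ h_integrable]
  rw [e]
  refine (norm_dblInt_le (C := D * X ^ (1 / 4 + 3 * η / 2)) fun u ζ hu hζ => (norm_sum_le _ _).trans (key u ζ hu hζ)).trans ?_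
  rw [← hW]
  have : 0 ≤ X ^ (1 / 4 + 3 * η / 2) := by positivity
  nlinarith [mul_nonneg hD0.le this]

theorem exists_norm_dblInt_tsum_dualTerm_le (hRH : RiemannHypothesis) {φ : ℂ → ℂ} (hφd : Differentiable ℂ φ)
    (hφ : RapidDecay φ) {η : ℝ} (hη : 0 < η) (hη2 : η ≤ 1 / 16) :
    ∃ C : ℝ, 0 < C ∧ ∀ X : ℝ, 0 < X →
      ‖dblInt (-η) 8 fun u ζ => ∑' k, dualTerm φ X k u ζ‖ ≤ C * X ^ (1 / 4 + 3 * η / 2) := by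
  obtain ⟨C, hC, h⟩ := exists_norm_sum_dualTerm_le hRH hφd hφ hη hη2
  refine ⟨C, hC, fun X hX => ?_⟩
  refine le_of_tendsto (hasSum_dblInt_dualTerm hRH hφd hφ hη hη2 hX).tendsto_sum_nat.norm (Eventually.of_forall fun K => ?_)
  have := h X hX K
  simp_rw [dblInt_dualTerm_shift hRH hφd hφ hη hη2 hX] at this
  exact this

theorem norm_zo_le {s : ℂ} (hs : 2 ≤ s.re) : ‖zo s‖ ≤ 2 * ∑' n : ℕ, (n:ℝ) ^ (-2:ℝ) := by
  have hsum : Summable fun n : ℕ => (n:ℝ) ^ (-2:ℝ) := Real.summable_nat_rpow.mpr (by norm_num)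
  unfold zo
  rw [norm_mul]
  refine mul_le_mul ?_ ?_ (norm_nonneg _) zero_le_two
  · refine (norm_sub_le _ _).trans ?_
    have := norm_natCast_cpow_of_pos (n := 2) (by norm_num) (-s)
    push_cast at this
    rw [this, norm_one]
    have : (2:ℝ) ^ (-s).re ≤ 1 := Real.rpow_le_one_of_one_le_of_nonpos (by norm_num) (by simp; linarith)
    linarith
  · rw [zeta_eq_tsum_one_div_nat_cpow (by linarith)]
    refine tsum_of_norm_bounded hsum.hasSum fun n => ?_
    rw [one_div, ← cpow_neg, norm_natCast_cpow_le n (by linarith)]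
    rcases Nat.eq_zero_or_pos n with rfl | hn
    · rw [Nat.cast_zero, Real.zero_rpow (by linarith)]; positivity
    · exact Real.rpow_le_rpow_of_exponent_le (by exact_mod_cast hn) (by linarith)

/-- `(u - 1) L(u, ψ_N)`, with the convention `0` for `N = 0`. -/
def polN (N : ℕ) (u : ℂ) : ℂ :=
  if h : N = 0 then 0 else (haveI : NeZero N := ⟨h⟩; polL (psiN N) u)

theorem differentiable_polN (N : ℕ) : Differentiable ℂ (polN N) := by
  unfold polN
  split_ifs with h
  · exact differentiable_const 0
  · have : NeZero N := ⟨h⟩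
    exact differentiable_polL _

theorem polN_eq (N : ℕ) {u : ℂ} (hu : u ≠ 1) : polN N u = (u - 1) * LpsiN N u := by
  unfold polN LpsiN
  split_ifs with h
  · simp
  · have : NeZero N := ⟨h⟩
    exact polL_of_ne _ hu

theorem norm_polN_le (N : ℕ) {u : ℂ} (h1 : -1 ≤ u.re) (h2 : u.re ≤ 12) :
    ‖polN N u‖ ≤ 240000 * (N:ℝ) ^ 3 * (1 + |u.im|) ^ 4 := by
  unfold polN
  split_ifs with h
  · rw [norm_zero]; positivity
  · have : NeZero N := ⟨h⟩
    refine (norm_polL_le_of_apply_zero (psiN N) (norm_psiN_le N) psiN_zero h1 h2).trans (le_of_eq ?_)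
    push_cast; ring

/-- The `N`-th term of the intermediate series. -/
def midTerm (φ : ℂ → ℂ) (X : ℝ) (N : ℕ) (u ζ : ℂ) : ℂ :=
  if Odd N then kerH φ X u ζ * ((u + ζ - 1) * (3 * u + ζ - 1)) * (zo (2 * (u + ζ)) * izo (2 * u + ζ) ^ 2) *
    ((N:ℂ) ^ (-(1 / 2 + ζ)) * betaN u (u + ζ) N * (jacobiSym 2 N : ℂ)) * polN N u else 0

theorem measurable_midTerm {φ : ℂ → ℂ} (hφ : Differentiable ℂ φ) (X : ℝ) (N : ℕ) (a c : ℝ) :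
    Measurable fun p : ℝ × ℝ => midTerm φ X N (a + p.1 * I) (c + p.2 * I) := by
  unfold midTerm
  split_ifs with h
  swap
  · exact measurable_const
  have m1 : Measurable fun p : ℝ × ℝ => ((a:ℂ) + p.1 * I) := by fun_prop
  have m2 : Measurable fun p : ℝ × ℝ => ((c:ℂ) + p.2 * I) := by fun_prop
  have h1 := measurable_kerH hφ X m1 m2
  have h2 := measurable_izo.comp ((m1.const_mul 2).add m2)
  have h3 := measurable_zo.comp ((m1.add m2).const_mul 2)
  have h4 := (differentiable_polN N).continuous.measurable.comp m1
  have h5 : Measurable fun p : ℝ × ℝ => betaN (a + p.1 * I) (a + p.1 * I + (c + p.2 * I)) N := by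
    unfold betaN
    refine Finset.measurable_fun_prod _ fun p hp => ?_
    have hpo : Measurable (po p) := (differentiable_po (Nat.prime_of_mem_primeFactors hp)).continuous.measurable
    have q1 := hpo.comp (m1.const_mul 2)
    have q2 := hpo.comp ((m1.add m2).const_mul 2)
    have q3 := hpo.comp (m1.add (m1.add m2))
    unfold bet
    exact measurable_const.add ((q1.mul (measurable_const.sub q2)).div ((measurable_const.sub q3).pow_const 2))
  refine Measurable.mul (Measurable.mul (Measurable.mul (Measurable.mul h1 ?_) (h3.mul (h2.pow_const 2))) ?_) h4
  · fun_prop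
  · exact ((by fun_prop : Measurable fun p : ℝ × ℝ => (N:ℂ) ^ (-(1 / 2 + ((c:ℂ) + p.2 * I)))).mul h5).mul_const _

theorem differentiableAt_midTerm (hRH : RiemannHypothesis) {φ : ℂ → ℂ} (hφ : Differentiable ℂ φ) {X : ℝ} (hX : 0 < X)
    (N : ℕ) {u ζ : ℂ} (hu : -(1 / 16) ≤ u.re) (hζ : ζ.re = 8) :
    DifferentiableAt ℂ (fun u => midTerm φ X N u ζ) u := by
  unfold midTerm
  split_ifs with h
  swap
  · exact differentiableAt_const 0
  have h1 := differentiableAt_kerH_fst hφ hX u ζ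
  have h2 : DifferentiableAt ℂ (fun u => izo (2 * u + ζ)) u :=
    DifferentiableAt.comp (f := fun u => 2 * u + ζ) u (differentiableAt_izo hRH (by simp [hζ]; linarith)) (by fun_prop)
  have h3 : DifferentiableAt ℂ (fun u => zo (2 * (u + ζ))) u := by
    unfold zo
    refine DifferentiableAt.mul ?_ ?_
    · exact (differentiableAt_const _).sub (DifferentiableAt.const_cpow (by fun_prop) (by left; norm_num))
    · refine (differentiableAt_riemannZeta (s := 2 * (u + ζ)) ?_).comp u (by fun_prop)
      intro e
      have := congrArg re e
      simp [hζ] at this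
      linarith
  have h4 : DifferentiableAt ℂ (fun u => betaN u (u + ζ) N) u := by
    unfold betaN
    refine DifferentiableAt.fun_finsetProd fun p hp => ?_
    have hpp := Nat.prime_of_mem_primeFactors hp
    have hpo := differentiable_po hpp
    have q1 : DifferentiableAt ℂ (fun u => po p (2 * u)) u := (hpo _).comp u (by fun_prop)
    have q2 : DifferentiableAt ℂ (fun u => po p (2 * (u + ζ))) u := (hpo _).comp u (by fun_prop)
    have q3 : DifferentiableAt ℂ (fun u => po p (u + (u + ζ))) u := (hpo _).comp u (by fun_prop)
    unfold bet
    exact (differentiableAt_const _).add ((q1.mul ((differentiableAt_const _).sub q2)).div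
      (((differentiableAt_const _).sub q3).pow 2)
      (pow_ne_zero 2 (one_sub_po_ne_zero hpp (by simp [hζ]; linarith))))
  have h5 : DifferentiableAt ℂ (fun u : ℂ => (u + ζ - 1) * (3 * u + ζ - 1)) u := by fun_prop
  exact ((((h1.mul h5).mul (h3.mul (h2.pow 2))).mul ((h4.const_mul _).mul_const _)).mul (differentiable_polN N u))


theorem exists_norm_midTerm_le (hRH : RiemannHypothesis) {φ : ℂ → ℂ} (hφ : RapidDecay φ) {X : ℝ} (hX : 0 < X) :
    ∃ C : ℝ, 0 < C ∧ ∀ (N : ℕ) (u ζ : ℂ), -(1 / 16) ≤ u.re → u.re ≤ 3 / 2 → ζ.re = 8 →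
      ‖midTerm φ X N u ζ‖ ≤ C * (N:ℝ) ^ (-2:ℝ) * wgt u ζ := by
  obtain ⟨Ci, Ai, hCi, hizo⟩ := exists_norm_izo_le hRH (δ := 3) (by norm_num)
  obtain ⟨Ck, hCk, hker⟩ := exists_norm_kerH_le hφ (2 + 2 * Ai + 4)
  set S := 2 * ∑' n : ℕ, (n:ℝ) ^ (-2:ℝ) with hS
  have hS0 : 0 ≤ S := mul_nonneg zero_le_two (tsum_nonneg fun n => by positivity)
  refine ⟨Ck * (max X 1) ^ (6:ℝ) * (14 * 18) * ((S + 1) * (Ci * 2 ^ Ai) ^ 2) * 240000, by positivity, fun N u ζ h1 h2 hζ => ?_⟩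
  have hw := (wgt_pos u ζ).le
  unfold midTerm
  split_ifs with hN
  swap
  · rw [norm_zero]; positivity
  have hN0 : N ≠ 0 := by rintro rfl; simp at hN
  have hN1 : (1:ℝ) ≤ N := by exact_mod_cast Nat.pos_of_ne_zero hN0
  set M := hgt u ζ with hM
  have hM1 : 1 ≤ M := one_le_hgt u ζ
  have e1 : ‖u + ζ - 1‖ ≤ 14 * M := by
    have := norm_lin_le_hgt (a := 1) (b := 1) (m := 3) (R := 10) (u := u) (ζ := ζ) (by norm_num) (by norm_num) (by norm_num)
      (by simp [hζ]; rw [abs_le]; constructor <;> linarith)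
    push_cast at this
    rw [one_mul, one_mul] at this
    refine (norm_sub_le _ _).trans ?_
    rw [norm_one]; linarith
  have e2 : ‖3 * u + ζ - 1‖ ≤ 18 * M := by
    have := norm_lin_le_hgt (a := 3) (b := 1) (m := 3) (R := 14) (u := u) (ζ := ζ) (by norm_num) (by norm_num) (by norm_num)
      (by simp [hζ]; rw [abs_le]; constructor <;> linarith)
    push_cast at this
    rw [one_mul] at this
    refine (norm_sub_le _ _).trans ?_
    rw [norm_one]; linarith
  have e3 : ‖zo (2 * (u + ζ))‖ ≤ S + 1 := (norm_zo_le (by simp [hζ]; linarith)).trans (by linarith)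
  have e4 : ‖izo (2 * u + ζ)‖ ≤ Ci * 2 ^ Ai * M ^ Ai := by
    have e1 := hizo (2 * u + ζ) (by simp [hζ]; linarith) (by simp [hζ]; linarith)
    have e2 := one_add_abs_lin_le_hgt (a := 2) (b := 1) (m := 2) (by norm_num) (by norm_num) (by norm_num) u ζ
    push_cast at e2
    rw [one_mul] at e2
    calc _ ≤ _ := e1
      _ ≤ Ci * (2 * M) ^ Ai := by gcongr
      _ = _ := by rw [mul_pow]; ring
  have e5 : ‖betaN u (u + ζ) N‖ ≤ (N:ℝ) ^ 3 := (summable_GJ_coeff 0 h1 (by linarith)).1 N hN0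
  have e6 : ‖(N:ℂ) ^ (-(1 / 2 + ζ))‖ = (N:ℝ) ^ (-(17 / 2) : ℝ) := by
    rw [norm_natCast_cpow_of_pos (Nat.pos_of_ne_zero hN0)]; congr 1; simp [hζ]; norm_num
  have e7 : ‖polN N u‖ ≤ 240000 * (N:ℝ) ^ 3 * M ^ 4 :=
    (norm_polN_le N (by linarith) (by linarith)).trans (by gcongr; exact one_add_abs_le_hgt u ζ)
  have e8 : ‖(jacobiSym 2 N : ℂ)‖ ≤ 1 := norm_jacobiSym_le _ _
  have e9 := hker X hX u ζ (by linarith) (by linarith) (by linarith) (by linarith)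
  change _ * M ^ _ ≤ _ at e9
  have hXp : X ^ (u.re + ζ.re / 2) ≤ max X 1 ^ (6:ℝ) := by
    calc _ ≤ max X 1 ^ (u.re + ζ.re / 2) := Real.rpow_le_rpow hX.le (le_max_left _ _) (by linarith)
      _ ≤ _ := Real.rpow_le_rpow_of_exponent_le (le_max_right _ _) (by linarith)
  have hNp : (N:ℝ) ^ (-(17 / 2) : ℝ) * (N:ℝ) ^ 3 * (N:ℝ) ^ 3 ≤ (N:ℝ) ^ (-2:ℝ) := by
    rw [← Real.rpow_natCast, ← Real.rpow_add (by linarith), ← Real.rpow_add (by linarith)]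
    exact Real.rpow_le_rpow_of_exponent_le hN1 (by norm_num)
  simp only [norm_mul, norm_pow]
  rw [e6]
  calc _ ≤ ‖kerH φ X u ζ‖ * ((14 * M) * (18 * M)) * ((S + 1) * (Ci * 2 ^ Ai * M ^ Ai) ^ 2) *
        ((N:ℝ) ^ (-(17 / 2) : ℝ) * (N:ℝ) ^ 3 * 1) * (240000 * (N:ℝ) ^ 3 * M ^ 4) := by gcongr
    _ = (‖kerH φ X u ζ‖ * M ^ (2 + 2 * Ai + 4)) * (14 * 18) * ((S + 1) * (Ci * 2 ^ Ai) ^ 2) * 240000 *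
        ((N:ℝ) ^ (-(17 / 2) : ℝ) * (N:ℝ) ^ 3 * (N:ℝ) ^ 3) := by ring
    _ ≤ (Ck * max X 1 ^ (6:ℝ) * wgt u ζ) * (14 * 18) * ((S + 1) * (Ci * 2 ^ Ai) ^ 2) * 240000 * (N:ℝ) ^ (-2:ℝ) := by
        have e10 := e9.trans (b := _) (c := Ck * max X 1 ^ (6:ℝ) * wgt u ζ) (by gcongr)
        gcongr
    _ = _ := by ring

theorem dblInt_tsum_midTerm_shift (hRH : RiemannHypothesis) {φ : ℂ → ℂ} (hφd : Differentiable ℂ φ) (hφ : RapidDecay φ)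
    {η : ℝ} (hη : 0 < η) (hη2 : η ≤ 1 / 16) {X : ℝ} (hX : 0 < X) :
    dblInt (3 / 2) 8 (fun u ζ => ∑' N, midTerm φ X N u ζ) = dblInt (-η) 8 (fun u ζ => ∑' N, midTerm φ X N u ζ) := by
  obtain ⟨C, hC, hb⟩ := exists_norm_midTerm_le hRH hφ hX
  have hsum : Summable fun N : ℕ => C * (N:ℝ) ^ (-2:ℝ) := (Real.summable_nat_rpow.mpr (by norm_num)).mul_left C
  have h1 := hasSum_dblInt (a := 3 / 2) (c := 8) hsum (fun N => measurable_midTerm hφd X N _ _)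
    fun N u ζ hu hζ => hb N u ζ (by linarith) (by linarith) hζ
  have h2 := hasSum_dblInt (a := -η) (c := 8) hsum (fun N => measurable_midTerm hφd X N _ _)
    fun N u ζ hu hζ => hb N u ζ (by linarith) (by linarith) hζ
  refine h1.unique ?_
  convert h2 using 2 with N
  symm
  exact dblInt_shift_fst (C := C * (N:ℝ) ^ (-2:ℝ)) (by linarith)
    (fun u ζ h1 h2 h3 => differentiableAt_midTerm hRH hφd hX N (by linarith) h3)
    (fun u ζ h1 h2 h3 => hb N u ζ (by linarith) (by linarith) h3)
    (measurable_midTerm hφd X N _ _) (measurable_midTerm hφd X N _ _)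

theorem tsum_midTerm_eq_tsum_dualTerm {φ : ℂ → ℂ} {η : ℝ} (hη : 0 < η) (hη2 : η ≤ 1 / 16) {X : ℝ} {u ζ : ℂ}
    (hu : u.re = -η) (hζ : ζ.re = 8) : ∑' N, midTerm φ X N u ζ = ∑' k, dualTerm φ X k u ζ := by
  have hu1 : u ≠ 1 := by rintro rfl; simp at hu; linarith
  set z := u + ζ with hz
  set a : ℕ → ℂ := fun N => (N:ℂ) ^ (-(1 / 2 + z)) * betaN u z N with ha
  set c : ℕ → ℂ := fun k => (k:ℂ) ^ (u - 1) * (-1) ^ k with hc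
  set K := kerH φ X u ζ * izo (2 * u + ζ) ^ 2 * gfac u with hK
  set Z := (z - 1) * (3 * u + ζ - 1) * zo (2 * z) with hZ
  have hbeta := fun k => summable_GJ_coeff k (u := u) (ζ := ζ) (by linarith) (by linarith)
  have hmid : ∀ N, midTerm φ X N u ζ =
      K * Z * ∑' k : ℕ, a N * c k * (trig 1 u * GJ k N + trig (-1) u * GJ (-k) N) := by
    intro N
    unfold midTerm
    split_ifs with hN
    swap
    · have : ∀ k, GJ k N = 0 := fun k => by rw [GJ, if_neg hN]
      simp [this]
    · have hN0 : N ≠ 0 := by rintro rfl; simp at hN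
      have : NeZero N := ⟨hN0⟩
      have hFE := functional_equation_psiN hN (u := u) (by linarith)
      have hL : LpsiN N u = ZMod.LFunction (psiN N) u := by rw [LpsiN, dif_neg hN0]
      rw [← hL] at hFE
      have h2N : (2 * N : ℂ) ^ (-u) = 2 ^ (-u) * (N:ℂ) ^ (-u) := by
        have := natCast_mul_cpow 2 N (-u)
        push_cast at this
        exact this
      have hNN : (N:ℂ) ^ (-u) * (N:ℂ) ^ (-(1 / 2 + ζ)) = (N:ℂ) ^ (-(1 / 2 + z)) := by
        rw [← cpow_add _ _ (by exact_mod_cast hN0)]; congr 1; rw [hz]; ring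
      simp_rw [mul_assoc (a N)]
      rw [tsum_mul_left, polN_eq N hu1]
      have hT : ∑' k : ℕ, c k * (trig 1 u * GJ k N + trig (-1) u * GJ (-k) N) =
          ∑' k : ℕ, (k : ℂ) ^ (u - 1) * (-1) ^ k *
        ((cos (Real.pi * (1 - u) / 2) + sin (Real.pi * (1 - u) / 2)) * GJ k N +
         (cos (Real.pi * (1 - u) / 2) - sin (Real.pi * (1 - u) / 2)) * GJ (-k) N) := by
        refine tsum_congr fun k => ?_
        simp only [hc, trig]; ring
      rw [hT]
      rw [h2N] at hFE
      simp only [hK, hZ, ha, ← hNN, gfac, ← hz]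
      linear_combination (kerH φ X u ζ * ((z - 1) * (3 * u + ζ - 1)) * (zo (2 * z) * izo (2 * u + ζ) ^ 2) *
        ((N:ℂ) ^ (-(1 / 2 + ζ)) * betaN u z N) * (u - 1)) * hFE
  have hdual : ∀ k : ℕ, dualTerm φ X k u ζ =
      K * Z * ∑' N : ℕ, a N * c k * (trig 1 u * GJ k N + trig (-1) u * GJ (-k) N) := by
    intro k
    rcases eq_or_ne k 0 with rfl | hk
    · have : c 0 = 0 := by simp [hc, sub_eq_zero, hu1]
      simp [this, dualTerm_zero]
    have hkz : (k:ℤ) ≠ 0 := by exact_mod_cast hk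
    have hs : ∑' N : ℕ, a N * c k * (trig 1 u * GJ k N + trig (-1) u * GJ (-k) N) =
        c k * (trig 1 u * ∑' N, a N * GJ k N + trig (-1) u * ∑' N, a N * GJ (-k) N) := by
      rw [← tsum_mul_left, ← tsum_mul_left, ← Summable.tsum_add, ← tsum_mul_left]
      · exact tsum_congr fun N => by ring
      · exact (hbeta k).2.of_norm.mul_left _
      · exact (hbeta (-k)).2.of_norm.mul_left _
    have hid : ∀ j : ℤ, j ≠ 0 → Z * ∑' N, a N * GJ j N = polK j z * polK j (3 * u + ζ) * Ek j u ζ := by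
      intro j hj
      have := zo_mul_tsum_GJ hj hη hη2 (u := u) (ζ := ζ) hu (by linarith)
      rw [polK_eq_tsum hj (by simp [hz, hu, hζ]; linarith), polK_eq_tsum hj (by simp [hu, hζ]; linarith), hZ]
      simp only [ha]
      linear_combination (z - 1) * (3 * u + ζ - 1) * this
    rw [hs]
    have i1 := hid k hkz
    have i2 := hid (-k) (by simpa using hkz)
    unfold dualTerm
    rw [← hz, ← i1, ← i2]
    simp only [hK, hc]
    ring
  simp_rw [hmid, hdual]
  rw [tsum_mul_left, tsum_mul_left]
  congr 1
  refine (Summable.tsum_comm (f := fun N k : ℕ => a N * c k * (trig 1 u * GJ k N + trig (-1) u * GJ (-k) N)) ?_).symm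
  have s1 : Summable fun N : ℕ => ‖a N‖ * N := by
    have hs : Summable fun N : ℕ => (N:ℝ) ^ (-2:ℝ) := Real.summable_nat_rpow.mpr (by norm_num)
    refine Summable.of_nonneg_of_le (fun N => by positivity) (fun N => ?_) hs
    rcases Nat.eq_zero_or_pos N with rfl | hN
    · simp
    have hN1 : (1:ℝ) ≤ N := by exact_mod_cast hN
    have e1 := (hbeta 0).1 N hN.ne'
    simp only [ha]
    rw [norm_mul, norm_natCast_cpow_of_pos hN]
    calc _ ≤ (N:ℝ) ^ (-(1 / 2 + z)).re * (N:ℝ) ^ 3 * (N:ℝ) := by gcongr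
      _ = (N:ℝ) ^ ((-(1 / 2 + z)).re + 4) := by
          rw [Real.rpow_add (by linarith), mul_assoc, ← pow_succ]; norm_cast
      _ ≤ _ := Real.rpow_le_rpow_of_exponent_le hN1 (by simp [hz, hu, hζ]; linarith)
  have s2 : Summable fun k : ℕ => ‖c k‖ * (‖trig 1 u‖ + ‖trig (-1) u‖) := by
    refine Summable.mul_right _ ?_
    have hs : Summable fun k : ℕ => (k:ℝ) ^ (-1 - η) := Real.summable_nat_rpow.mpr (by linarith)
    refine hs.congr fun k => ?_
    simp only [hc]
    rw [norm_mul, norm_pow, norm_neg, norm_one, one_pow, mul_one,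
      norm_natCast_cpow_of_re_ne_zero k (by simp [hu]; linarith)]
    congr 1; simp [hu]; ring
  refine Summable.of_norm_bounded (s1.mul_of_nonneg s2 (fun _ => by positivity) fun _ => by positivity) ?_
  rintro ⟨N, k⟩
  simp only [Function.uncurry]
  rw [norm_mul, norm_mul]
  have g : ‖trig 1 u * GJ k N + trig (-1) u * GJ (-k) N‖ ≤ (‖trig 1 u‖ + ‖trig (-1) u‖) * N := by
    refine (norm_add_le _ _).trans ?_
    rw [norm_mul, norm_mul, add_mul]
    gcongr <;> exact norm_GJ_le _ _
  calc _ ≤ ‖a N‖ * ‖c k‖ * ((‖trig 1 u‖ + ‖trig (-1) u‖) * N) := by gcongr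
    _ = _ := by ring

/-- The `d`-th term of the original series. -/
def origTerm (φ : ℂ → ℂ) (X : ℝ) (d : ℕ) (u ζ : ℂ) : ℂ :=
  if Odd d ∧ Squarefree d then kerH φ X u ζ * ((u - 1) * ((u + ζ - 1) * (3 * u + ζ - 1))) *
    ((d:ℂ) ^ (-u) * (∑' n : ℕ, chi8 d n * (n:ℂ) ^ (-(1 / 2 + ζ))) * Mfun d u (u + ζ)) else 0

theorem tsum_origTerm_eq_tsum_midTerm {φ : ℂ → ℂ} {X : ℝ} {u ζ : ℂ}
    (hu : u.re = 3 / 2) (hζ : ζ.re = 8) : ∑' d, origTerm φ X d u ζ = ∑' N, midTerm φ X N u ζ := by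
  have hu1 : u ≠ 1 := by rintro rfl; norm_num at hu
  have h := tsum_chi8_mul_Mfun (u := u) (ζ := ζ) (by linarith) (by linarith)
  have hi : izo (2 * u + ζ) = (zo (2 * u + ζ))⁻¹ := izo_eq (by
    intro e; have := congrArg re e; simp [hu, hζ] at this; linarith)
  have e1 : ∀ d, origTerm φ X d u ζ = kerH φ X u ζ * ((u - 1) * ((u + ζ - 1) * (3 * u + ζ - 1))) *
      (if Odd d ∧ Squarefree d then
      (d:ℂ) ^ (-u) * (∑' n : ℕ, chi8 d n * (n:ℂ) ^ (-(1 / 2 + ζ))) * Mfun d u (u + ζ) else 0) := by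
    intro d; unfold origTerm; split_ifs <;> simp
  have e2 : ∀ N, midTerm φ X N u ζ = kerH φ X u ζ * ((u - 1) * ((u + ζ - 1) * (3 * u + ζ - 1))) *
      (zo (2 * (u + ζ)) / zo (2 * u + ζ) ^ 2) * (if Odd N then (N:ℂ) ^ (-(1 / 2 + ζ)) * betaN u (u + ζ) N * (jacobiSym 2 N : ℂ) *
        LpsiN N u else 0) := by
    intro N
    unfold midTerm
    split_ifs
    · rw [polN_eq N hu1, hi]; ring
    · simp
  simp_rw [e1, e2]
  rw [tsum_mul_left, tsum_mul_left, h]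
  ring

theorem norm_tsum_chi8_le (d : ℕ) {s : ℂ} (hs : 2 ≤ s.re) :
    ‖∑' n : ℕ, chi8 d n * (n:ℂ) ^ (-s)‖ ≤ ∑' n : ℕ, (n:ℝ) ^ (-2:ℝ) := by
  have hsum : Summable fun n : ℕ => (n:ℝ) ^ (-2:ℝ) := Real.summable_nat_rpow.mpr (by norm_num)
  refine tsum_of_norm_bounded hsum.hasSum fun n => ?_
  rw [norm_mul, norm_natCast_cpow_le n (by linarith)]
  rcases Nat.eq_zero_or_pos n with rfl | hn
  · rw [Nat.cast_zero, Real.zero_rpow (by linarith), mul_zero]; positivity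
  · calc _ ≤ 1 * (n:ℝ) ^ (-2:ℝ) := mul_le_mul (norm_chi8_le d n)
          (Real.rpow_le_rpow_of_exponent_le (by exact_mod_cast hn) (by linarith)) (by positivity) zero_le_one
      _ = _ := one_mul _

theorem measurable_tsum_chi8 (d : ℕ) {α : Type*} [MeasurableSpace α] {f : α → ℂ} (hf : Measurable f)
    (hf1 : ∀ x, 1 < (f x).re) : Measurable fun x => ∑' n : ℕ, chi8 d n * (n:ℂ) ^ (-f x) := by
  refine measurable_of_tendsto_metrizable (f := fun (m : ℕ) x => ∑ n ∈ Finset.range m, chi8 d n * (n:ℂ) ^ (-f x))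
    (fun m => by fun_prop) ?_
  rw [tendsto_pi_nhds]
  exact fun x => (summable_norm_mul_cpow (norm_chi8_le d) (hf1 x)).of_norm.hasSum.tendsto_sum_nat

theorem measurable_origTerm {φ : ℂ → ℂ} (hφ : Differentiable ℂ φ) (X : ℝ) (d : ℕ) :
    Measurable fun p : ℝ × ℝ => origTerm φ X d ((3 / 2 : ℝ) + p.1 * I) ((8:ℝ) + p.2 * I) := by
  unfold origTerm
  split_ifs with h
  swap
  · exact measurable_const
  have m1 : Measurable fun p : ℝ × ℝ => (((3 / 2 : ℝ):ℂ) + p.1 * I) := by fun_prop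
  have m2 : Measurable fun p : ℝ × ℝ => (((8:ℝ):ℂ) + p.2 * I) := by fun_prop
  have h1 := measurable_kerH hφ X m1 m2
  have h2 := measurable_tsum_chi8 d (m2.const_add (1 / 2)) fun x => by norm_num
  have h3 := measurable_Mfun d m1 (m1.add m2) (fun x => by norm_num) fun x => by norm_num
  exact (h1.mul (by fun_prop)).mul (((by fun_prop : Measurable fun p : ℝ × ℝ => (d:ℂ) ^ (-(((3 / 2 : ℝ):ℂ) + p.1 * I))).mul h2).mul h3)

theorem exists_norm_origTerm_le {φ : ℂ → ℂ} (hφ : RapidDecay φ) {X : ℝ} (hX : 0 < X) :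
    ∃ C : ℝ, 0 < C ∧ ∀ (d : ℕ) (u ζ : ℂ), u.re = 3 / 2 → ζ.re = 8 →
      ‖origTerm φ X d u ζ‖ ≤ C * (d:ℝ) ^ (-(3 / 2) : ℝ) * wgt u ζ := by
  obtain ⟨Ck, hCk, hker⟩ := exists_norm_kerH_le hφ 3
  obtain ⟨Cm, hCm, hMf⟩ := exists_norm_Mfun_le
  set S := ∑' n : ℕ, (n:ℝ) ^ (-2:ℝ) with hS
  have hS0 : 0 ≤ S := tsum_nonneg fun n => by positivity
  refine ⟨Ck * X ^ (3 / 2 + 8 / 2 : ℝ) * (6 * 14 * 18) * ((S + 1) * Cm), by positivity, fun d u ζ hu hζ => ?_⟩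
  have hw := (wgt_pos u ζ).le
  unfold origTerm
  split_ifs with hd
  swap
  · rw [norm_zero]; positivity
  have hd0 : d ≠ 0 := by rintro rfl; simp at hd
  set M := hgt u ζ with hM
  have hM1 : 1 ≤ M := one_le_hgt u ζ
  have e0 : ‖u - 1‖ ≤ 6 * M := by
    have := norm_lin_le_hgt (a := 1) (b := 0) (m := 3) (R := 2) (u := u) (ζ := ζ) (by norm_num) (by norm_num) (by norm_num)
      (by simp [hu]; rw [abs_le]; constructor <;> linarith)
    push_cast at this
    rw [one_mul, zero_mul, add_zero] at this
    refine (norm_sub_le _ _).trans ?_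
    rw [norm_one]; linarith
  have e1 : ‖u + ζ - 1‖ ≤ 14 * M := by
    have := norm_lin_le_hgt (a := 1) (b := 1) (m := 3) (R := 10) (u := u) (ζ := ζ) (by norm_num) (by norm_num) (by norm_num)
      (by simp [hu, hζ]; rw [abs_le]; constructor <;> linarith)
    push_cast at this
    rw [one_mul, one_mul] at this
    refine (norm_sub_le _ _).trans ?_
    rw [norm_one]; linarith
  have e2 : ‖3 * u + ζ - 1‖ ≤ 18 * M := by
    have := norm_lin_le_hgt (a := 3) (b := 1) (m := 3) (R := 14) (u := u) (ζ := ζ) (by norm_num) (by norm_num) (by norm_num)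
      (by simp [hu, hζ]; rw [abs_le]; constructor <;> linarith)
    push_cast at this
    rw [one_mul] at this
    refine (norm_sub_le _ _).trans ?_
    rw [norm_one]; linarith
  have e3 : ‖∑' n : ℕ, chi8 d n * (n:ℂ) ^ (-(1 / 2 + ζ))‖ ≤ S + 1 :=
    (norm_tsum_chi8_le d (by simp [hζ]; norm_num)).trans (by linarith)
  have e4 := hMf d u (u + ζ) (by linarith) (by simp [hu, hζ]; norm_num)
  have e5 : ‖(d:ℂ) ^ (-u)‖ = (d:ℝ) ^ (-(3 / 2) : ℝ) := by
    rw [norm_natCast_cpow_of_pos (Nat.pos_of_ne_zero hd0)]; congr 1; simp [hu]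
  have e6 := hker X hX u ζ (by linarith) (by linarith) (by linarith) (by linarith)
  change _ * M ^ _ ≤ _ at e6
  rw [hu, hζ] at e6
  simp only [norm_mul]
  rw [e5]
  calc _ ≤ ‖kerH φ X u ζ‖ * ((6 * M) * ((14 * M) * (18 * M))) * ((d:ℝ) ^ (-(3 / 2) : ℝ) * (S + 1) * Cm) := by gcongr
    _ = (‖kerH φ X u ζ‖ * M ^ 3) * (6 * 14 * 18) * ((d:ℝ) ^ (-(3 / 2) : ℝ) * (S + 1) * Cm) := by ring
    _ ≤ (Ck * X ^ (3 / 2 + 8 / 2 : ℝ) * wgt u ζ) * (6 * 14 * 18) * ((d:ℝ) ^ (-(3 / 2) : ℝ) * (S + 1) * Cm) := by gcongr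
    _ = _ := by ring

theorem exists_norm_tsum_dblInt_origTerm_le (hRH : RiemannHypothesis) {φ : ℂ → ℂ} (hφd : Differentiable ℂ φ)
    (hφ : RapidDecay φ) {η : ℝ} (hη : 0 < η) (hη2 : η ≤ 1 / 16) :
    ∃ C : ℝ, 0 < C ∧ ∀ X : ℝ, 0 < X →
      ‖∑' d, dblInt (3 / 2) 8 (origTerm φ X d)‖ ≤ C * X ^ (1 / 4 + 3 * η / 2) := by
  obtain ⟨C, hC, h⟩ := exists_norm_dblInt_tsum_dualTerm_le hRH hφd hφ hη hη2
  refine ⟨C, hC, fun X hX => ?_⟩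
  obtain ⟨D, hD, hb⟩ := exists_norm_origTerm_le hφ hX
  have hsum : Summable fun d : ℕ => D * (d:ℝ) ^ (-(3 / 2) : ℝ) := (Real.summable_nat_rpow.mpr (by norm_num)).mul_left D
  rw [(hasSum_dblInt (a := 3 / 2) (c := 8) hsum (fun d => measurable_origTerm hφd X d) hb).tsum_eq,
    dblInt_congr fun u ζ hu hζ => tsum_origTerm_eq_tsum_midTerm hu hζ, dblInt_tsum_midTerm_shift hRH hφd hφ hη hη2 hX,
    dblInt_congr fun u ζ hu hζ => tsum_midTerm_eq_tsum_dualTerm hη hη2 hu hζ]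
  exact h X hX

/-- Smooth functions supported in `[1/2, 2]`. -/
structure IsBump (f : ℝ → ℝ) : Prop where
  smooth : ContDiff ℝ (⊤ : ℕ∞) f
  supp : Function.support f ⊆ Icc (1 / 2) 2

/-- The operator `-x d/dx`. -/
def eulerD (f : ℝ → ℝ) (x : ℝ) : ℝ := -x * deriv f x

/-- The operator `-x d/dx - c`. -/
def eulerSub (c : ℝ) (f : ℝ → ℝ) (x : ℝ) : ℝ := eulerD f x - c * f x

theorem IsBump.eq_zero {f : ℝ → ℝ} (hf : IsBump f) {x : ℝ} (hx : x < 1 / 2 ∨ 2 < x) : f x = 0 := by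
  by_contra h
  have := hf.supp h
  rcases hx with hx | hx
  · linarith [this.1]
  · linarith [this.2]

theorem IsBump.eulerD {f : ℝ → ℝ} (hf : IsBump f) : IsBump (eulerD f) := by
  refine ⟨?_, fun x hx => ?_⟩
  · have : ContDiff ℝ (⊤ : ℕ∞) (deriv f) := by
      have := (contDiff_infty_iff_deriv (f := f)).mp hf.smooth
      exact this.2
    unfold _root_.eulerD
    exact contDiff_id.neg.mul this
  · have h1 : deriv f x ≠ 0 := right_ne_zero_of_mul hx
    have h2 := support_deriv_subset (f := f) h1
    exact closure_minimal hf.supp isClosed_Icc h2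

theorem IsBump.eulerSub {f : ℝ → ℝ} (hf : IsBump f) (c : ℝ) : IsBump (eulerSub c f) := by
  refine ⟨hf.eulerD.smooth.sub (contDiff_const.mul hf.smooth), fun x hx => ?_⟩
  by_contra h
  have h' : x < 1 / 2 ∨ 2 < x := by
    rw [mem_Icc, not_and_or, not_le, not_le] at h; exact h
  apply hx
  rw [_root_.eulerSub, hf.eulerD.eq_zero h', hf.eq_zero h']; ring

/-- The Mellin transform of a real function. -/
def melR (f : ℝ → ℝ) (s : ℂ) : ℂ := mellin (fun x => (f x : ℂ)) s

theorem IsBump.eventually_zero_atTop {f : ℝ → ℝ} (hf : IsBump f) (a : ℝ) :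
    (fun x => (f x : ℂ)) =O[atTop] (fun x : ℝ => x ^ a) := by
  refine (Asymptotics.isBigO_zero (E' := ℂ) _ _).congr' ?_ EventuallyEq.rfl
  filter_upwards [eventually_gt_atTop 2] with x hx
  rw [hf.eq_zero (Or.inr hx), ofReal_zero]

theorem IsBump.eventually_zero_zero {f : ℝ → ℝ} (hf : IsBump f) (a : ℝ) :
    (fun x => (f x : ℂ)) =O[𝓝[>] 0] (fun x : ℝ => x ^ a) := by
  refine (Asymptotics.isBigO_zero (E' := ℂ) _ _).congr' ?_ EventuallyEq.rfl
  filter_upwards [mem_nhdsWithin_of_mem_nhds (Iio_mem_nhds (show (0:ℝ) < 1 / 2 by norm_num))] with x hx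
  rw [hf.eq_zero (Or.inl hx), ofReal_zero]

theorem IsBump.continuous {f : ℝ → ℝ} (hf : IsBump f) : Continuous (fun x => (f x : ℂ)) :=
  continuous_ofReal.comp hf.smooth.continuous

theorem IsBump.mellinConvergent {f : ℝ → ℝ} (hf : IsBump f) (s : ℂ) : MellinConvergent (fun x => (f x : ℂ)) s :=
  mellinConvergent_of_isBigO_rpow (hf.continuous.locallyIntegrable.locallyIntegrableOn _)
    (hf.eventually_zero_atTop (-(s.re + 1))) (by linarith) (hf.eventually_zero_zero (-(s.re - 1))) (by linarith)

theorem IsBump.differentiable_melR {f : ℝ → ℝ} (hf : IsBump f) : Differentiable ℂ (melR f) := fun s =>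
  mellin_differentiableAt_of_isBigO_rpow (hf.continuous.locallyIntegrable.locallyIntegrableOn _)
    (hf.eventually_zero_atTop (-(s.re + 1))) (by linarith) (hf.eventually_zero_zero (-(s.re - 1))) (by linarith)

theorem IsBump.melR_eq {f : ℝ → ℝ} (hf : IsBump f) (s : ℂ) :
    melR f s = ∫ x in (1 / 4 : ℝ)..4, (x:ℂ) ^ (s - 1) * (f x : ℂ) := by
  rw [intervalIntegral.integral_of_le (by norm_num), melR, mellin]
  refine (setIntegral_eq_of_subset_of_forall_sdiff_eq_zero measurableSet_Ioi (fun x hx => ?_) fun x hx => ?_)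
  · exact lt_trans (by norm_num) hx.1
  · have hx' : x < 1 / 2 ∨ 2 < x := by
      by_contra h
      push Not at h
      exact hx.2 ⟨by linarith [h.1], by linarith [h.2]⟩
    rw [hf.eq_zero hx', ofReal_zero, smul_zero]

theorem IsBump.melR_eulerD {f : ℝ → ℝ} (hf : IsBump f) (s : ℂ) : melR (_root_.eulerD f) s = s * melR f s := by
  rw [hf.eulerD.melR_eq, hf.melR_eq]
  have hpos : ∀ x ∈ uIcc (1 / 4 : ℝ) 4, 0 < x := fun x hx => by
    rw [uIcc_of_le (by norm_num)] at hx; linarith [hx.1]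
  have h1 : ∀ x ∈ uIcc (1 / 4 : ℝ) 4, HasDerivAt (fun x : ℝ => (x:ℂ) ^ s) (s * (x:ℂ) ^ (s - 1)) x := fun x hx => by
    have := ((hasDerivAt_id (x:ℂ)).cpow_const (c := s) (Or.inl (by simpa using hpos x hx))).comp_ofReal
    simpa using this
  have h2 : ∀ x ∈ uIcc (1 / 4 : ℝ) 4, HasDerivAt (fun x => (f x : ℂ)) ((deriv f x : ℝ) : ℂ) x := fun x _ =>
    ((hf.smooth.differentiable (by simp)) x).hasDerivAt.ofReal_comp
  have c1 : IntervalIntegrable (fun x : ℝ => s * (x:ℂ) ^ (s - 1)) volume (1 / 4) 4 := by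
    refine ContinuousOn.intervalIntegrable fun x hx => ContinuousAt.continuousWithinAt ?_
    refine continuousAt_const.mul (ContinuousAt.cpow continuous_ofReal.continuousAt continuousAt_const ?_)
    exact Or.inl (by simpa using hpos x hx)
  have c2 : IntervalIntegrable (fun x => ((deriv f x : ℝ) : ℂ)) volume (1 / 4) 4 :=
    (continuous_ofReal.comp (hf.smooth.continuous_deriv (by simp))).intervalIntegrable _ _
  have h := intervalIntegral.integral_mul_deriv_eq_deriv_mul h1 h2 c1 c2
  rw [hf.eq_zero (Or.inr (by norm_num)), hf.eq_zero (Or.inl (by norm_num))] at h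
  simp only [ofReal_zero, mul_zero, sub_zero, zero_sub] at h
  rw [← intervalIntegral.integral_const_mul, ← neg_inj]
  have e1 : (fun x : ℝ => s * ((x:ℂ) ^ (s - 1) * (f x : ℂ))) = fun x : ℝ => s * (x:ℂ) ^ (s - 1) * (f x : ℂ) := by
    funext x; ring
  rw [e1, ← h, ← intervalIntegral.integral_neg]
  refine intervalIntegral.integral_congr fun x hx => ?_
  have hx0 : (x:ℂ) ≠ 0 := by exact_mod_cast (hpos x hx).ne'
  simp only [_root_.eulerD]
  rw [cpow_sub _ _ hx0, cpow_one]
  push_cast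
  field_simp

theorem IsBump.melR_eulerSub {f : ℝ → ℝ} (hf : IsBump f) (c : ℝ) (s : ℂ) :
    melR (_root_.eulerSub c f) s = (s - c) * melR f s := by
  rw [sub_mul, ← hf.melR_eulerD]
  have h1 := (hf.eulerD).mellinConvergent s
  have h2 := hf.mellinConvergent s
  unfold melR mellin
  rw [← integral_const_mul, ← integral_sub h1 (h2.const_mul _)]
  congr 1
  funext x
  simp only [_root_.eulerSub, smul_eq_mul]
  push_cast; ring

theorem IsBump.exists_norm_melR_le {f : ℝ → ℝ} (hf : IsBump f) :
    ∃ C : ℝ, 0 < C ∧ ∀ w : ℂ, |w.re| ≤ 10 → ‖melR f w‖ ≤ C := by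
  obtain ⟨D, hD⟩ := (isCompact_Icc (a := (1 / 4 : ℝ)) (b := 4)).exists_bound_of_continuousOn hf.continuous.continuousOn
  refine ⟨4 ^ (11:ℝ) * (|D| + 1) * |4 - 1 / 4|, by positivity, fun w hw => ?_⟩
  rw [hf.melR_eq]
  refine intervalIntegral.norm_integral_le_of_norm_le_const fun x hx => ?_
  rw [uIoc_of_le (by norm_num)] at hx
  have hx0 : 0 < x := lt_trans (by norm_num) hx.1
  rw [norm_mul, norm_cpow_eq_rpow_re_of_pos hx0]
  rw [abs_le] at hw
  have h1 : ‖(f x : ℂ)‖ ≤ |D| + 1 := (hD x ⟨hx.1.le, hx.2⟩).trans (by linarith [le_abs_self D])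
  gcongr
  simp only [sub_re, one_re]
  rcases le_total 1 x with h | h
  · calc _ ≤ x ^ (11:ℝ) := Real.rpow_le_rpow_of_exponent_le h (by linarith)
      _ ≤ _ := Real.rpow_le_rpow hx0.le hx.2 (by norm_num)
  · calc _ ≤ x ^ (-11:ℝ) := Real.rpow_le_rpow_of_exponent_ge hx0 h (by linarith)
      _ = (x⁻¹) ^ (11:ℝ) := by rw [Real.rpow_neg hx0.le, Real.inv_rpow hx0.le]
      _ ≤ _ := Real.rpow_le_rpow (by positivity) (by
          rw [inv_le_comm₀ hx0 (by norm_num)]; linarith [hx.1]) (by norm_num)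

theorem IsBump.rapidDecay_melR {f : ℝ → ℝ} (hf : IsBump f) : RapidDecay (melR f) := by
  intro A
  have key : ∀ (A : ℕ) (f : ℝ → ℝ), IsBump f → ∃ C : ℝ, 0 < C ∧ ∀ w : ℂ, |w.re| ≤ 10 → ‖melR f w‖ * (1 + ‖w‖) ^ A ≤ C := by
    intro A
    induction A with
    | zero => intro f hf; simpa using hf.exists_norm_melR_le
    | succ A ih =>
      intro f hf
      obtain ⟨C1, hC1, h1⟩ := ih f hf
      obtain ⟨C2, hC2, h2⟩ := ih _ hf.eulerD
      refine ⟨C1 + C2, by positivity, fun w hw => ?_⟩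
      have e2 := h2 w hw
      rw [hf.melR_eulerD, norm_mul] at e2
      calc _ = ‖melR f w‖ * (1 + ‖w‖) ^ A + ‖w‖ * ‖melR f w‖ * (1 + ‖w‖) ^ A := by ring
        _ ≤ _ := add_le_add (h1 w hw) e2
  obtain ⟨C, hC, h⟩ := key A f hf
  refine ⟨C, hC, fun w hw => le_trans ?_ (h w hw)⟩
  gcongr
  exact abs_im_le_norm w

theorem IsBump.mellin_inversion {f : ℝ → ℝ} (hf : IsBump f) (σ : ℝ) (hσ : |σ| ≤ 10) {x : ℝ} (hx : 0 < x) :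
    ∫ t : ℝ, (x:ℂ) ^ (-(σ + t * I)) * melR f (σ + t * I) = 2 * Real.pi * (f x : ℂ) := by
  have hv : VerticalIntegrable (mellin fun x => (f x : ℂ)) σ := by
    obtain ⟨C, hC, h⟩ := hf.rapidDecay_melR 2
    refine (integrable_inv_one_add_sq_mul C).mono' ?_ (ae_of_all _ fun y => ?_)
    · exact (hf.differentiable_melR.continuous.comp (by fun_prop : Continuous fun y : ℝ => (σ:ℂ) + y * I)).aestronglyMeasurable
    · have h1 := h (σ + y * I) (by simpa using hσ)
      have h2 : 1 + y ^ 2 ≤ (1 + |y|) ^ 2 := by rw [← sq_abs y]; nlinarith [abs_nonneg y]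
      simp only [add_im, ofReal_im, mul_im, ofReal_re, I_im, mul_one, I_re, mul_zero, add_zero, zero_add] at h1
      rw [le_div_iff₀ (by positivity)]
      exact (mul_le_mul_of_nonneg_left h2 (norm_nonneg _)).trans h1
  have h := mellinInv_mellin_eq σ (fun x => (f x : ℂ)) hx (hf.mellinConvergent σ) hv hf.continuous.continuousAt
  rw [← h, mellinInv]
  simp only [smul_eq_mul]
  have hpi : (Real.pi:ℂ) ≠ 0 := by exact_mod_cast Real.pi_ne_zero
  rw [real_smul]
  push_cast
  rw [← mul_assoc, mul_one_div_cancel (mul_ne_zero two_ne_zero hpi), one_mul]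
  rfl

theorem integral_shear {H : ℝ → ℝ → ℂ} (hm : Measurable fun p : ℝ × ℝ => H p.1 p.2)
    (hi : Integrable fun p : ℝ × ℝ => H p.1 p.2) :
    ∫ p : ℝ × ℝ, H p.1 p.2 = ∫ t : ℝ, ∫ y : ℝ, H (t - y / 2) y := by
  have mp : MeasurePreserving (fun p : ℝ × ℝ => (p.1, p.2 - p.1 / 2)) (volume.prod volume) (volume.prod volume) :=
    (MeasurePreserving.id (volume : Measure ℝ)).skew_product (g := fun y t => t - y / 2) (by fun_prop)
      (ae_of_all _ fun y => (measurePreserving_sub_right volume (y / 2)).map_eq)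
  have mp2 := (Measure.measurePreserving_swap (μ := (volume : Measure ℝ)) (ν := (volume : Measure ℝ))).comp mp
  rw [Measure.volume_eq_prod] at hi ⊢
  have hi2 := mp2.integrable_comp_of_integrable hi
  rw [← mp2.map_eq, integral_map mp2.measurable.aemeasurable hm.aestronglyMeasurable]
  exact integral_prod_symm _ hi2

/-- The even function whose Cauchy integral is the approximate functional equation. -/
def afe (d : ℕ) [NeZero d] (Ψ : ZMod (8 * d) → ℂ) (w ζ : ℂ) : ℂ :=
  (8 * d : ℂ) ^ (ζ / 2) * ZMod.completedLFunction Ψ (1 / 2 + ζ) * Mfun d (w - ζ / 2) (w + ζ / 2) *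
    ((w - ζ / 2 - 1) * (w + ζ / 2 - 1) * (3 * w - ζ / 2 - 1) * (3 * w + ζ / 2 - 1) / 9)

theorem afe_neg {d : ℕ} [NeZero d] (hd : Odd d) (hsq : Squarefree d) {Ψ : ZMod (8 * d) → ℂ}
    (hΨ : ∀ n : ℕ, Ψ n = chi8 d n) (w ζ : ℂ) : afe d Ψ w (-ζ) = afe d Ψ w ζ := by
  have h := chi8_functional_equation hd hsq Ψ hΨ ζ
  unfold afe
  rw [← sub_eq_add_neg, h, Mfun_symm]
  ring_nf

theorem completed_eq_Gammaℝ_mul {d : ℕ} [NeZero d] (hd : Odd d) (hsq : Squarefree d) {Ψ : ZMod (8 * d) → ℂ}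
    (hΨ : ∀ n : ℕ, Ψ n = chi8 d n) {s : ℂ} (hs : 0 < s.re) :
    ZMod.completedLFunction Ψ s = Gammaℝ s * ZMod.LFunction Ψ s := by
  rw [ZMod.LFunction_eq_completed_div_gammaFactor_even (chi8_even hd hsq Ψ hΨ) s
    (Or.inr (chi8_sum_zero hd hsq Ψ hΨ).1), mul_div_cancel₀ _ (Gammaℝ_ne_zero_of_re_pos hs)]

theorem differentiableAt_afe {d : ℕ} [NeZero d] (hd : Odd d) (hsq : Squarefree d) {Ψ : ZMod (8 * d) → ℂ}
    (hΨ : ∀ n : ℕ, Ψ n = chi8 d n) {w ζ : ℂ} (hw : w.re = 11 / 2) (h1 : -8 ≤ ζ.re) (h2 : ζ.re ≤ 8) :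
    DifferentiableAt ℂ (afe d Ψ w) ζ := by
  obtain ⟨h0, hs⟩ := chi8_sum_zero hd hsq Ψ hΨ
  have hd0 : (8 * d : ℂ) ≠ 0 := mul_ne_zero (by norm_num) (by exact_mod_cast NeZero.ne d)
  have hU : IsOpen {ζ : ℂ | |ζ.re| < 9} := isOpen_lt (continuous_re.abs) continuous_const
  have hM : DifferentiableOn ℂ (fun ζ => Mfun d (w - ζ / 2) (w + ζ / 2)) {ζ : ℂ | |ζ.re| < 9} := by
    refine differentiableOn_Mfun d hU (by fun_prop) (by fun_prop) (fun x hx => ?_) fun x hx => ?_ <;>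
    · have hx' := abs_lt.mp (show |x.re| < 9 from hx)
      simp [hw]; linarith [hx'.1, hx'.2]
  have hMa := hM.differentiableAt (hU.mem_nhds (show |ζ.re| < 9 by rw [abs_lt]; constructor <;> linarith))
  have hL : DifferentiableAt ℂ (fun ζ => ZMod.completedLFunction Ψ (1 / 2 + ζ)) ζ :=
    (ZMod.differentiable_completedLFunction h0 hs _).comp ζ (by fun_prop)
  have h8 : DifferentiableAt ℂ (fun ζ : ℂ => (8 * d : ℂ) ^ (ζ / 2)) ζ :=
    DifferentiableAt.const_cpow (by fun_prop) (Or.inl hd0)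
  exact ((h8.mul hL).mul hMa).mul (by fun_prop)

theorem exists_norm_afe_le {d : ℕ} [NeZero d] (hd : Odd d) (hsq : Squarefree d) {Ψ : ZMod (8 * d) → ℂ}
    (hΨ : ∀ n : ℕ, Ψ n = chi8 d n) {w : ℂ} (hw : w.re = 11 / 2) : ∃ C : ℝ, ∀ ζ : ℂ, -8 ≤ ζ.re → ζ.re ≤ 8 →
    ‖afe d Ψ w ζ‖ ≤ C * (1 + |ζ.im|) ^ (⌈(9:ℝ)⌉₊ + 5) := by
  obtain ⟨h0, hs⟩ := chi8_sum_zero hd hsq Ψ hΨ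
  obtain ⟨CΓ, hCΓ, hΓ⟩ := exists_norm_Gammaℝ_le (a := 1 / 2) (b := 9) (by norm_num)
  obtain ⟨Cm, hCm, hMf⟩ := exists_norm_Mfun_le
  set n := ⌈(9:ℝ)⌉₊
  set R := 3 * ‖w‖ + 10 with hR
  have hR0 : 0 ≤ R := by positivity
  have hΨ1 : ∀ j, ‖Ψ j‖ ≤ 1 := fun j => by
    have : NeZero (8 * d) := inferInstance
    rw [← ZMod.natCast_zmod_val j, hΨ]; exact norm_chi8_le _ _
  have key : ∀ ζ : ℂ, 0 ≤ ζ.re → ζ.re ≤ 8 →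
      ‖afe d Ψ w ζ‖ ≤ ((8 * d) ^ (4:ℝ) * (CΓ * (64 * d * 10)) * Cm * R ^ 4) * (1 + |ζ.im|) ^ (n + 5) := by
    intro ζ h1 h2
    set Y := 1 + |ζ.im| with hY
    have hY1 : 1 ≤ Y := by linarith [abs_nonneg ζ.im]
    have hd1 : (1:ℝ) ≤ d := by exact_mod_cast NeZero.one_le
    have hζ : ‖ζ‖ ≤ 8 + |ζ.im| := (norm_le_abs_re_add_abs_im ζ).trans (by
      rw [abs_of_nonneg h1]; linarith)
    have e1 : ‖(8 * d : ℂ) ^ (ζ / 2)‖ ≤ (8 * d) ^ (4:ℝ) := by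
      have e : (8 * d : ℂ) = ((8 * d : ℝ) : ℂ) := by push_cast; rfl
      rw [e, norm_cpow_eq_rpow_re_of_pos (by positivity)]
      refine Real.rpow_le_rpow_of_exponent_le (by linarith) ?_
      have : (ζ / 2).re = ζ.re / 2 := by simp
      linarith
    have e2 : ‖ZMod.completedLFunction Ψ (1 / 2 + ζ)‖ ≤ (CΓ * Y ^ n) * (64 * d * (10 * Y)) := by
      rw [completed_eq_Gammaℝ_mul hd hsq hΨ (by simp; linarith), norm_mul]
      have g1 := hΓ (1 / 2 + ζ) (by simp; linarith) (by simp; linarith)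
      have g2 := norm_LFunction_le_of_sum_eq_zero Ψ hΨ1 hs (s := 1 / 2 + ζ) (by simp; linarith)
      have g3 : ‖1 / 2 + ζ‖ ≤ 10 * Y := by
        refine (norm_add_le _ _).trans ?_
        have : ‖(1 / 2 : ℂ)‖ = 1 / 2 := by simp
        linarith [abs_nonneg ζ.im]
      have g4 : (1 / 2 + ζ).im = ζ.im := by simp
      rw [g4] at g1
      push_cast at g2
      refine mul_le_mul g1 (g2.trans ?_) (norm_nonneg _) (by positivity)
      calc _ ≤ 8 * (8 * (d:ℝ)) * 1 * (10 * Y) := by gcongr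
        _ = _ := by ring
    have e3 := hMf d (w - ζ / 2) (w + ζ / 2) (by simp [hw]; linarith) (by simp [hw]; linarith)
    have e4 : ∀ a : ℂ, ‖a‖ ≤ 3 * ‖w‖ → ∀ b : ℂ, ‖b‖ = ‖ζ‖ / 2 → ‖a + b - 1‖ ≤ R * Y := by
      intro a ha b hb
      have := norm_sub_le (a + b) 1
      have h3 := norm_add_le a b
      rw [norm_one] at this
      rw [hR, hY]
      nlinarith [abs_nonneg ζ.im, norm_nonneg w, mul_nonneg (norm_nonneg w) (abs_nonneg ζ.im)]
    have w3 : ‖w‖ ≤ 3 * ‖w‖ := by linarith [norm_nonneg w]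
    have w4 : ‖3 * w‖ ≤ 3 * ‖w‖ := by rw [norm_mul]; simp
    have z1 : ‖ζ / 2‖ = ‖ζ‖ / 2 := by simp
    have z2 : ‖-(ζ / 2)‖ = ‖ζ‖ / 2 := by rw [norm_neg, z1]
    have f1 := e4 w w3 _ z2
    have f2 := e4 w w3 _ z1
    have f3 := e4 (3 * w) w4 _ z2
    have f4 := e4 (3 * w) w4 _ z1
    rw [← sub_eq_add_neg] at f1 f3
    unfold afe
    rw [norm_mul, norm_mul, norm_mul, norm_div, norm_mul, norm_mul, norm_mul]
    calc _ ≤ (8 * d) ^ (4:ℝ) * ((CΓ * Y ^ n) * (64 * d * (10 * Y))) * Cm * ((R * Y) * (R * Y) * (R * Y) * (R * Y) / 1) := by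
          gcongr
          simp
      _ = _ := by ring
  refine ⟨(8 * d) ^ (4:ℝ) * (CΓ * (64 * d * 10)) * Cm * R ^ 4, fun ζ h1 h2 => ?_⟩
  rcases le_total 0 ζ.re with h | h
  · exact key ζ h h2
  · have := key (-ζ) (by simpa using h) (by simp; linarith)
    rwa [afe_neg hd hsq hΨ, neg_im, abs_neg] at this

theorem afe_zero {d : ℕ} [NeZero d] (Ψ : ZMod (8 * d) → ℂ) {w : ℂ} (hw : 1 ≤ w.re) :
    afe d Ψ w 0 = ZMod.completedLFunction Ψ (1 / 2) * ((w - 1) ^ 2 * (w - 1 / 3) ^ 2) := by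
  unfold afe
  simp only [zero_div, cpow_zero, add_zero, sub_zero]
  rw [Mfun_diag d hw]
  ring

theorem integral_afe {d : ℕ} [NeZero d] (hd : Odd d) (hsq : Squarefree d) {Ψ : ZMod (8 * d) → ℂ}
    (hΨ : ∀ n : ℕ, Ψ n = chi8 d n) {w : ℂ} (hw : w.re = 11 / 2) :
    ∫ y : ℝ, afe d Ψ w ((8:ℝ) + y * I) * (cexp (((8:ℝ) + y * I) ^ 2) / ((8:ℝ) + y * I)) =
      Real.pi * (ZMod.completedLFunction Ψ (1 / 2) * ((w - 1) ^ 2 * (w - 1 / 3) ^ 2)) := by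
  obtain ⟨C, hC⟩ := exists_norm_afe_le hd hsq hΨ hw
  have h := cauchy_strip (f := afe d Ψ w) (c := 8) (c' := 8) (by norm_num) (by norm_num)
    (fun s h1 h2 => differentiableAt_afe hd hsq hΨ hw h1 h2) hC
  have hsymm : ∫ y : ℝ, afe d Ψ w ((-8 : ℝ) + y * I) * (cexp (((-8 : ℝ) + y * I) ^ 2) / ((-8 : ℝ) + y * I)) =
      -∫ y : ℝ, afe d Ψ w ((8:ℝ) + y * I) * (cexp (((8:ℝ) + y * I) ^ 2) / ((8:ℝ) + y * I)) := by
    rw [← integral_neg, ← integral_neg_eq_self]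
    congr 1
    funext y
    have e : (((-8 : ℝ):ℂ) + ((-y : ℝ):ℂ) * I) = -(((8:ℝ):ℂ) + y * I) := by push_cast; ring
    rw [e, afe_neg hd hsq hΨ, neg_sq, div_neg, mul_neg]
  rw [hsymm, afe_zero Ψ (by rw [hw]; norm_num)] at h
  linear_combination -h / 2

theorem origTerm_eq {d : ℕ} [NeZero d] (hd : Odd d) (hsq : Squarefree d) {Ψ : ZMod (8 * d) → ℂ}
    (hΨ : ∀ n : ℕ, Ψ n = chi8 d n) (φ : ℂ → ℂ) (X : ℝ) (u : ℂ) {ζ : ℂ} (hζ : 8 ≤ ζ.re) :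
    origTerm φ X d u ζ = φ (u + ζ / 2) * ((X:ℂ) ^ (u + ζ / 2) * (d:ℂ) ^ (-(u + ζ / 2))) *
      (afe d Ψ (u + ζ / 2) ζ * (cexp (ζ ^ 2) / ζ)) := by
  have hs : 1 < (1 / 2 + ζ).re := by simp; linarith
  have hL : ∑' n : ℕ, chi8 d n * (n:ℂ) ^ (-(1 / 2 + ζ)) = ZMod.LFunction Ψ (1 / 2 + ζ) := by
    rw [ZMod.LFunction_eq_LSeries _ hs, LSeries]
    refine tsum_congr fun n => ?_
    rw [← hΨ]
    rcases eq_or_ne n 0 with rfl | hn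
    · simp [LSeries.term_zero, (chi8_sum_zero hd hsq Ψ hΨ).1]
    · simp only [LSeries.term_of_ne_zero hn, cpow_neg]; rw [← div_eq_mul_inv]
  have hd0 : (d:ℂ) ≠ 0 := by exact_mod_cast NeZero.ne d
  have h8 : (8 * d : ℂ) ^ (ζ / 2) = (8:ℂ) ^ (ζ / 2) * (d:ℂ) ^ (ζ / 2) := by
    have := natCast_mul_cpow 8 d (ζ / 2)
    push_cast at this
    exact this
  have hdu : (d:ℂ) ^ (-u) = (d:ℂ) ^ (ζ / 2) * (d:ℂ) ^ (-(u + ζ / 2)) := by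
    rw [← cpow_add _ _ hd0]; congr 1; ring
  unfold origTerm afe kerH
  rw [if_pos ⟨hd, hsq⟩, hL, completed_eq_Gammaℝ_mul hd hsq hΨ (by linarith), h8, hdu,
    show u + ζ / 2 - ζ / 2 = u by ring, show u + ζ / 2 + ζ / 2 = u + ζ by ring]
  ring

theorem dblInt_origTerm {d : ℕ} [NeZero d] (hd : Odd d) (hsq : Squarefree d) {Ψ : ZMod (8 * d) → ℂ}
    (hΨ : ∀ n : ℕ, Ψ n = chi8 d n) {f : ℝ → ℝ} (hf : IsBump f) {X : ℝ} (hX : 0 < X) :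
    dblInt (3 / 2) 8 (origTerm (melR f) X d) = 2 * Real.pi ^ 2 * Gammaℝ (1 / 2) * (ZMod.LFunction Ψ (1 / 2) *
      (eulerSub 1 (eulerSub 1 (eulerSub (1 / 3) (eulerSub (1 / 3) f))) (d / X) : ℝ)) := by
  have hd0 : (0:ℝ) < d := by exact_mod_cast NeZero.pos d
  set f1 := eulerSub (1 / 3) f
  have hf1 : IsBump f1 := hf.eulerSub _
  set f2 := eulerSub (1 / 3) f1
  have hf2 : IsBump f2 := hf1.eulerSub _
  set f3 := eulerSub 1 f2
  have hf3 : IsBump f3 := hf2.eulerSub _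
  have hf4 : IsBump (eulerSub 1 f3) := hf3.eulerSub _
  obtain ⟨C, hC, hb⟩ := exists_norm_origTerm_le hf.rapidDecay_melR hX
  have hm := measurable_origTerm hf.differentiable_melR X d
  have hi := integrable_dblInt (a := 3 / 2) (c := 8) hm (hb d)
  have hinv := hf4.mellin_inversion (11 / 2) (by rw [abs_le]; constructor <;> norm_num) (div_pos hd0 hX)
  have hsh := integral_shear (H := fun t y : ℝ => origTerm (melR f) X d ((3 / 2 : ℝ) + t * I) ((8:ℝ) + y * I)) hm hi
  unfold dblInt
  rw [hsh]
  have hinner : ∀ t : ℝ, ∫ y : ℝ, origTerm (melR f) X d ((3 / 2 : ℝ) + ((t - y / 2 : ℝ):ℂ) * I) ((8:ℝ) + y * I) =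
      (Real.pi * ZMod.completedLFunction Ψ (1 / 2)) * ((((d / X : ℝ)):ℂ) ^ (-(((11 / 2 : ℝ):ℂ) + t * I)) *
        melR (eulerSub 1 f3) ((11 / 2 : ℝ) + t * I)) := by
    intro t
    set w : ℂ := (11 / 2 : ℝ) + t * I with hw
    have hwre : w.re = 11 / 2 := by simp [hw]
    have he : ∀ y : ℝ, ((3 / 2 : ℝ):ℂ) + ((t - y / 2 : ℝ):ℂ) * I + (((8:ℝ):ℂ) + y * I) / 2 = w := fun y => by
      rw [hw]; push_cast; ring
    have h1 : ∀ y : ℝ, origTerm (melR f) X d ((3 / 2 : ℝ) + ((t - y / 2 : ℝ):ℂ) * I) ((8:ℝ) + y * I) =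
        melR f w * ((X:ℂ) ^ w * (d:ℂ) ^ (-w)) * (afe d Ψ w ((8:ℝ) + y * I) *
          (cexp (((8:ℝ) + y * I) ^ 2) / ((8:ℝ) + y * I))) := fun y => by
      rw [origTerm_eq hd hsq hΨ _ _ _ (by simp), he]
    simp_rw [h1]
    rw [integral_const_mul, integral_afe hd hsq hΨ hwre, hf3.melR_eulerSub, hf2.melR_eulerSub, hf1.melR_eulerSub,
      hf.melR_eulerSub]
    have hx : (((d / X : ℝ)):ℂ) ^ (-w) = (X:ℂ) ^ w * (d:ℂ) ^ (-w) := by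
      have e : (d / X : ℝ) = d * X⁻¹ := div_eq_mul_inv _ _
      rw [e, ofReal_mul, mul_cpow_ofReal_nonneg hd0.le (by positivity), ofReal_inv,
        inv_cpow _ _ (by rw [arg_ofReal_of_nonneg hX.le]; exact Real.pi_ne_zero.symm), cpow_neg (X:ℂ), inv_inv, mul_comm]
      simp
    rw [hx]
    push_cast
    ring
  simp_rw [hinner]
  rw [integral_const_mul, hinv, completed_eq_Gammaℝ_mul hd hsq hΨ (by norm_num)]
  ring

theorem LFunction_half_real {d : ℕ} [NeZero d] (hd : Odd d) (hsq : Squarefree d) {Ψ : ZMod (8 * d) → ℂ}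
    (hΨ : ∀ n : ℕ, Ψ n = chi8 d n) : ((ZMod.LFunction Ψ (1 / 2)).re : ℂ) = ZMod.LFunction Ψ (1 / 2) := by
  obtain ⟨h0, hs⟩ := chi8_sum_zero hd hsq Ψ hΨ
  have hdiff := ZMod.differentiable_LFunction_of_sum_zero hs
  have hdiff2 : Differentiable ℂ (starRingEnd ℂ ∘ ZMod.LFunction Ψ ∘ starRingEnd ℂ) := fun s => by
    simpa using (hdiff (starRingEnd ℂ s)).conj_conj
  have hev : starRingEnd ℂ ∘ ZMod.LFunction Ψ ∘ starRingEnd ℂ =ᶠ[𝓝 2] ZMod.LFunction Ψ := by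
    filter_upwards [(isOpen_lt continuous_const continuous_re).mem_nhds (show (1:ℝ) < (2:ℂ).re by norm_num)] with s hs
    have hs1 : 1 < (starRingEnd ℂ s).re := by simpa using hs
    simp only [Function.comp_apply]
    rw [ZMod.LFunction_eq_LSeries _ hs1, ZMod.LFunction_eq_LSeries _ hs, LSeries, LSeries, conj_tsum]
    refine tsum_congr fun n => ?_
    rcases eq_or_ne n 0 with rfl | hn
    · simp
    · rw [LSeries.term_of_ne_zero hn, LSeries.term_of_ne_zero hn, map_div₀, hΨ]
      have h1 : starRingEnd ℂ (chi8 d n) = chi8 d n := by unfold chi8; split_ifs <;> simp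
      have h2 : starRingEnd ℂ ((n:ℂ) ^ (starRingEnd ℂ s)) = (n:ℂ) ^ s := by
        rw [cpow_conj _ _ (by rw [natCast_arg]; exact Real.pi_ne_zero.symm), conj_conj, conj_natCast]
      rw [h1, h2]
  have heq := AnalyticOnNhd.eq_of_eventuallyEq (fun z _ => hdiff2.analyticAt z) (fun z _ => hdiff.analyticAt z) hev
  have h := congrFun heq (1 / 2)
  simp only [Function.comp_apply] at h
  have hc : starRingEnd ℂ (1 / 2 : ℂ) = 1 / 2 := by
    have := conj_ofReal (1 / 2)
    push_cast at this; exact this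
  rw [hc] at h
  exact conj_eq_iff_re.mp h

/-- `r` is `O(e^{(1/4+ε)v})` on the whole line for every small `ε`. -/
def SmallExp (r : ℝ → ℝ) : Prop :=
  ∀ ε : ℝ, 0 < ε → ε ≤ 1 / 24 → ∃ C : ℝ, 0 < C ∧ ∀ v : ℝ, |r v| ≤ C * Real.exp ((1 / 4 + ε) * v)

theorem SmallExp.exists_sub_exp {h r : ℝ → ℝ} {l : ℝ} (hl : 1 / 3 ≤ l)
    (hh : ∀ v, HasDerivAt h (l * h v + r v) v) (hr : SmallExp r) :
    ∃ c : ℝ, SmallExp fun v => h v - c * Real.exp (l * v) := by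
  set k : ℝ → ℝ := fun v => Real.exp (-l * v) * h v with hk
  have hkd : ∀ v, HasDerivAt k (Real.exp (-l * v) * r v) v := by
    intro v
    have h1 : HasDerivAt (fun v => Real.exp (-l * v)) (Real.exp (-l * v) * (-l * 1)) v :=
      ((hasDerivAt_id v).const_mul (-l)).exp
    have := h1.mul (hh v)
    refine this.congr_deriv ?_
    ring
  have key : ∀ ε : ℝ, 0 < ε → ε ≤ 1 / 24 → ∃ D m : ℝ, 0 < D ∧ 0 < m ∧ l - m = 1 / 4 + ε ∧
      Monotone (fun v => k v - D * Real.exp (-m * v)) ∧ Antitone (fun v => k v + D * Real.exp (-m * v)) := by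
    intro ε h0 h1
    obtain ⟨C, hC, hb⟩ := hr ε h0 h1
    have hm : 0 < l - 1 / 4 - ε := by linarith
    set m := l - 1 / 4 - ε with hmdef
    have hE : ∀ v, HasDerivAt (fun v => C / m * Real.exp (-m * v)) (-C * Real.exp (-m * v)) v := by
      intro v
      have := (((hasDerivAt_id v).const_mul (-m)).exp).const_mul (C / m)
      refine this.congr_deriv ?_
      simp only [id]
      field_simp
    have hle : ∀ v, |Real.exp (-l * v) * r v| ≤ C * Real.exp (-m * v) := by
      intro v
      rw [abs_mul, abs_of_pos (Real.exp_pos _)]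
      calc _ ≤ Real.exp (-l * v) * (C * Real.exp ((1 / 4 + ε) * v)) := by gcongr; exact hb v
        _ = C * (Real.exp (-l * v) * Real.exp ((1 / 4 + ε) * v)) := by ring
        _ = _ := by rw [← Real.exp_add]; congr 2; rw [hmdef]; ring
    refine ⟨C / m, m, by positivity, hm, by rw [hmdef]; ring, ?_, ?_⟩
    · refine monotone_of_hasDerivAt_nonneg (fun v => (hkd v).sub (hE v)) fun v => ?_
      have := neg_le_of_abs_le (hle v)
      simp only [Pi.zero_apply]; linarith
    · refine antitone_of_hasDerivAt_nonpos (fun v => (hkd v).add (hE v)) fun v => ?_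
      have := le_of_abs_le (hle v)
      simp only [Pi.zero_apply]; linarith
  have hz : ∀ D m : ℝ, 0 < m → Tendsto (fun v => D * Real.exp (-m * v)) atTop (𝓝 0) := by
    intro D m hm
    have : Tendsto (fun v : ℝ => -m * v) atTop atBot := tendsto_id.const_mul_atTop_of_neg (by linarith)
    simpa using (Real.tendsto_exp_atBot.comp this).const_mul D
  obtain ⟨c, hc⟩ : ∃ c, Tendsto k atTop (𝓝 c) := by
    obtain ⟨D, m, hD, hm, -, hmon, hant⟩ := key (1 / 24) (by norm_num) le_rfl
    have hbdd : BddAbove (range fun v => k v - D * Real.exp (-m * v)) := by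
      refine ⟨k 0 + D, ?_⟩
      rintro _ ⟨v, rfl⟩
      have p1 : 0 < D * Real.exp (-m * max v 0) := by positivity
      have h1 := hmon (le_max_left v 0)
      have h2 := hant (le_max_right v 0)
      simp only [mul_zero, Real.exp_zero, mul_one] at h1 h2 ⊢
      linarith
    refine ⟨⨆ v, (k v - D * Real.exp (-m * v)), ?_⟩
    have := (tendsto_atTop_ciSup hmon hbdd).add (hz D m hm)
    simpa using this
  refine ⟨c, fun ε h0 h1 => ?_⟩
  obtain ⟨D, m, hD, hm, hlm, hmon, hant⟩ := key ε h0 h1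
  refine ⟨D, hD, fun v => ?_⟩
  have t1 : Tendsto (fun v => k v - D * Real.exp (-m * v)) atTop (𝓝 c) := by simpa using hc.sub (hz D m hm)
  have t2 : Tendsto (fun v => k v + D * Real.exp (-m * v)) atTop (𝓝 c) := by simpa using hc.add (hz D m hm)
  have b1 := hmon.ge_of_tendsto t1 v
  have b2 := hant.le_of_tendsto t2 v
  have e1 : h v - c * Real.exp (l * v) = (k v - c) * Real.exp (l * v) := by
    simp only [hk]
    rw [sub_mul, mul_right_comm, ← Real.exp_add]
    simp
  beta_reduce
  rw [e1, abs_mul, abs_of_pos (Real.exp_pos _)]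
  have b3 : |k v - c| ≤ D * Real.exp (-m * v) := by rw [abs_le]; constructor <;> linarith
  calc _ ≤ D * Real.exp (-m * v) * Real.exp (l * v) := by gcongr
    _ = _ := by rw [mul_assoc, ← Real.exp_add, ← hlm]; congr 2; ring

/-- The smoothed sum `∑ a_d f(d / e^v)`. -/
def smSum (a : ℕ → ℝ) (f : ℝ → ℝ) (v : ℝ) : ℝ := ∑' d : ℕ, a d * f (d / Real.exp v)

theorem IsBump.smSum_eq_sum {f : ℝ → ℝ} (hf : IsBump f) (a : ℕ → ℝ) {v : ℝ} {M : ℕ} (hM : 2 * Real.exp v < M) :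
    smSum a f v = ∑ d ∈ Finset.range M, a d * f (d / Real.exp v) := by
  refine tsum_eq_sum fun d hd => ?_
  rw [Finset.mem_range, not_lt] at hd
  rw [hf.eq_zero (Or.inr ?_), mul_zero]
  rw [lt_div_iff₀ (Real.exp_pos v)]
  exact hM.trans_le (by exact_mod_cast hd)

theorem IsBump.hasDerivAt_smSum {f : ℝ → ℝ} (hf : IsBump f) (a : ℕ → ℝ) (c v : ℝ) :
    HasDerivAt (smSum a f) (c * smSum a f v + smSum a (_root_.eulerSub c f) v) v := by
  obtain ⟨M, hM⟩ := exists_nat_gt (2 * Real.exp (v + 1))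
  have hM' : ∀ x < v + 1, 2 * Real.exp x < M := fun x hx =>
    lt_trans (by have := Real.exp_lt_exp.mpr hx; linarith) hM
  have hev : smSum a f =ᶠ[𝓝 v] fun x => ∑ d ∈ Finset.range M, a d * f (d / Real.exp x) := by
    filter_upwards [Iio_mem_nhds (lt_add_one v)] with x hx
    exact hf.smSum_eq_sum a (hM' x hx)
  have hv := hM' v (lt_add_one v)
  rw [hf.smSum_eq_sum a hv, (hf.eulerSub c).smSum_eq_sum a hv, Finset.mul_sum, ← Finset.sum_add_distrib]
  refine HasDerivAt.congr_of_eventuallyEq ?_ hev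
  refine HasDerivAt.fun_sum fun d _ => ?_
  have h1 : HasDerivAt (fun x => (d:ℝ) / Real.exp x) (-((d:ℝ) / Real.exp v)) v := by
    have e : (fun x => (d:ℝ) / Real.exp x) = fun x => (d:ℝ) * Real.exp (-x) := by
      funext x; rw [Real.exp_neg, div_eq_mul_inv]
    rw [e]
    have := ((hasDerivAt_neg v).exp).const_mul (d:ℝ)
    refine this.congr_deriv ?_
    rw [Real.exp_neg]; field_simp
  have h2 := ((hf.smooth.differentiable (by simp)) ((d:ℝ) / Real.exp v)).hasDerivAt.comp v h1
  refine (h2.const_mul (a d)).congr_deriv ?_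
  simp only [_root_.eulerSub, _root_.eulerD]
  ring

theorem HasDerivAt.sub_particular {h : ℝ → ℝ} {l g v : ℝ} (hh : HasDerivAt h (l * h v + g) v) {p : ℝ → ℝ} {q : ℝ}
    (hp : HasDerivAt p (l * p v + q) v) : HasDerivAt (fun v => h v - p v) (l * (h v - p v) + (g - q)) v :=
  (hh.sub hp).congr_deriv (by ring)

theorem hasDerivAt_linear_mul_exp (a b l v : ℝ) :
    HasDerivAt (fun v => (a + b * v) * Real.exp (l * v)) ((b + l * (a + b * v)) * Real.exp (l * v)) v := by
  have h1 : HasDerivAt (fun v => a + b * v) b v := by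
    simpa using ((hasDerivAt_id v).const_mul b).const_add a
  have h2 : HasDerivAt (fun v => Real.exp (l * v)) (Real.exp (l * v) * (l * 1)) v :=
    ((hasDerivAt_id v).const_mul l).exp
  exact (h1.mul h2).congr_deriv (by ring)

theorem IsBump.exists_asymptotic {f : ℝ → ℝ} (hf : IsBump f) (a : ℕ → ℝ)
    (hs : SmallExp (smSum a (_root_.eulerSub 1 (_root_.eulerSub 1 (_root_.eulerSub (1 / 3) (_root_.eulerSub (1 / 3) f)))))) :
    ∃ a₀ a₁ b₀ b₁ : ℝ, SmallExp fun v => smSum a f v -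
      ((a₀ + a₁ * v) * Real.exp v + (b₀ + b₁ * v) * Real.exp (1 / 3 * v)) := by
  have hf1 : IsBump (_root_.eulerSub (1 / 3) f) := hf.eulerSub _
  have hf2 : IsBump (_root_.eulerSub (1 / 3) (_root_.eulerSub (1 / 3) f)) := hf1.eulerSub _
  have hf3 := hf2.eulerSub 1
  have d0 := hf.hasDerivAt_smSum a (1 / 3)
  have d1 := hf1.hasDerivAt_smSum a (1 / 3)
  have d2 := hf2.hasDerivAt_smSum a 1
  have d3 := hf3.hasDerivAt_smSum a 1
  obtain ⟨c3, hc3⟩ := hs.exists_sub_exp (by norm_num) d3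
  have p2 : ∀ v, HasDerivAt (fun v => (0 + c3 * v) * Real.exp (1 * v))
      (1 * ((0 + c3 * v) * Real.exp (1 * v)) + c3 * Real.exp (1 * v)) v := fun v =>
    (hasDerivAt_linear_mul_exp 0 c3 1 v).congr_deriv (by ring)
  obtain ⟨c2, hc2⟩ := hc3.exists_sub_exp (by norm_num) fun v => (d2 v).sub_particular (p2 v)
  have p1 : ∀ v, HasDerivAt (fun v => (3 / 2 * (c2 - 3 / 2 * c3) + 3 / 2 * c3 * v) * Real.exp (1 * v))
      (1 / 3 * ((3 / 2 * (c2 - 3 / 2 * c3) + 3 / 2 * c3 * v) * Real.exp (1 * v)) +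
        ((0 + c3 * v) * Real.exp (1 * v) + c2 * Real.exp (1 * v))) v := fun v =>
    (hasDerivAt_linear_mul_exp _ _ 1 v).congr_deriv (by ring)
  simp only [sub_sub] at hc2
  obtain ⟨c1, hc1⟩ := hc2.exists_sub_exp (l := 1 / 3) le_rfl fun v => (d1 v).sub_particular (p1 v)
  simp only [sub_sub] at hc1
  set α := 3 / 2 * (c2 - 3 / 2 * c3)
  set β := 3 / 2 * c3
  have p0 : ∀ v, HasDerivAt (fun v => (3 / 2 * (α - 3 / 2 * β) + 3 / 2 * β * v) * Real.exp (1 * v) +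
        (0 + c1 * v) * Real.exp (1 / 3 * v))
      (1 / 3 * ((3 / 2 * (α - 3 / 2 * β) + 3 / 2 * β * v) * Real.exp (1 * v) + (0 + c1 * v) * Real.exp (1 / 3 * v)) +
        ((α + β * v) * Real.exp (1 * v) + c1 * Real.exp (1 / 3 * v))) v := fun v =>
    ((hasDerivAt_linear_mul_exp _ _ 1 v).add (hasDerivAt_linear_mul_exp _ _ (1 / 3) v)).congr_deriv (by ring)
  obtain ⟨c0, hc0⟩ := hc1.exists_sub_exp (l := 1 / 3) le_rfl fun v => (d0 v).sub_particular (p0 v)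
  refine ⟨3 / 2 * (α - 3 / 2 * β), 3 / 2 * β, c0, c1, ?_⟩
  convert hc0 using 2 with v
  rw [one_mul]
  ring

theorem smallExp_smSum (hRH : RiemannHypothesis) {f : ℝ → ℝ} (hf : IsBump f) {a : ℕ → ℝ}
    (ha : ∀ (d : ℕ) [NeZero d], Odd d → Squarefree d →
      ∃ Ψ : ZMod (8 * d) → ℂ, (∀ n : ℕ, Ψ n = chi8 d n) ∧ (a d : ℂ) = ZMod.LFunction Ψ (1 / 2))
    (ha0 : ∀ d, ¬(Odd d ∧ Squarefree d) → a d = 0) :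
    SmallExp (smSum a (eulerSub 1 (eulerSub 1 (eulerSub (1 / 3) (eulerSub (1 / 3) f))))) := by
  intro ε h0 h1
  obtain ⟨C, hC, hb⟩ := exists_norm_tsum_dblInt_origTerm_le hRH hf.differentiable_melR hf.rapidDecay_melR
    (η := 2 / 3 * ε) (by linarith) (by linarith)
  set K : ℂ := 2 * Real.pi ^ 2 * Gammaℝ (1 / 2) with hK
  have hK0 : K ≠ 0 := by
    have hpi : (Real.pi:ℂ) ≠ 0 := by exact_mod_cast Real.pi_ne_zero
    exact mul_ne_zero (mul_ne_zero two_ne_zero (pow_ne_zero 2 hpi)) (Gammaℝ_ne_zero_of_re_pos (by norm_num))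
  have hKp : 0 < ‖K‖ := norm_pos_iff.mpr hK0
  refine ⟨C / ‖K‖, by positivity, fun v => ?_⟩
  have hX := Real.exp_pos v
  set g := eulerSub 1 (eulerSub 1 (eulerSub (1 / 3) (eulerSub (1 / 3) f)))
  have hterm : ∀ d : ℕ, dblInt (3 / 2) 8 (origTerm (melR f) (Real.exp v) d) =
      K * ((a d * g (d / Real.exp v) : ℝ) : ℂ) := by
    intro d
    by_cases hd : Odd d ∧ Squarefree d
    · have : NeZero d := ⟨by rintro rfl; simp at hd⟩
      obtain ⟨Ψ, hΨ, hL⟩ := ha d hd.1 hd.2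
      rw [dblInt_origTerm hd.1 hd.2 hΨ hf hX, ofReal_mul, hL]
    · rw [ha0 d hd]
      simp [dblInt, origTerm, hd]
  have h := hb (Real.exp v) hX
  simp_rw [hterm] at h
  rw [tsum_mul_left, ← ofReal_tsum, norm_mul, norm_real, Real.norm_eq_abs] at h
  rw [div_mul_eq_mul_div, le_div_iff₀ hKp, mul_comm]
  refine h.trans (le_of_eq ?_)
  rw [← Real.exp_mul]
  congr 2; ring

end

/-- assuming RH and GLH, the smoothed first moment of `L(1/2,χ_{8d})` over odd `d`
equals `X P₁(log X) + X^{1/3} P₂(log X) + O(X^{1/4+ε})` for some linear polynomials `P₁, P₂`. -/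
theorem statement0
    (hRH : RiemannHypothesis) (hGLH : GLH)
    (Φ : ℝ → ℝ) (hΦsmooth : ContDiff ℝ (⊤ : ℕ∞) Φ) (hΦnonneg : ∀ x, 0 ≤ Φ x)
    (hΦsupp : Function.support Φ ⊆ Set.Icc (1 / 2) 2)
    (χ : (d : ℕ) → DirichletCharacter ℂ (8 * d))
    (hχ : ∀ d : ℕ, Odd d → Squarefree d →
      (∀ n : ℕ, Odd n → χ d (n : ZMod (8 * d)) = ((jacobiSym (8 * d) n : ℤ) : ℂ)) ∧
      (∀ n : ℕ, Even n → χ d (n : ZMod (8 * d)) = 0)) :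
    ∃ P₁ P₂ : Polynomial ℝ, P₁.degree ≤ 1 ∧ P₂.degree ≤ 1 ∧
      ∀ ε : ℝ, 0 < ε → ∃ C : ℝ, 0 < C ∧ ∀ X : ℝ, 2 ≤ X →
        ‖(∑' d : ℕ, if h : Odd d then
            haveI : NeZero (8 * d) := ⟨by rcases h with ⟨k, rfl⟩; omega⟩
            ((ArithmeticFunction.moebius d : ℤ) : ℂ) ^ 2 * (Φ (d / X) : ℂ) *
              (χ d).LFunction (1 / 2) else 0)
          - (X : ℂ) * (P₁.eval (Real.log X) : ℝ)
          - ((X ^ ((1 : ℝ) / 3) : ℝ) : ℂ) * (P₂.eval (Real.log X) : ℝ)‖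
          ≤ C * X ^ ((1 / 4 : ℝ) + ε) := by
  have hf : IsBump Φ := ⟨hΦsmooth, hΦsupp⟩
  have hne : ∀ {d : ℕ}, Odd d → NeZero (8 * d) := fun {d} h => ⟨by rcases h with ⟨k, rfl⟩; omega⟩
  set a : ℕ → ℝ := fun d => if h : Odd d ∧ Squarefree d then
    (haveI := hne h.1; (χ d).LFunction (1 / 2)).re else 0 with ha
  have hval : ∀ d : ℕ, Odd d → Squarefree d → ∀ n : ℕ, χ d n = chi8 d n := by
    intro d hd hsq n
    unfold chi8
    split_ifs with hn
    · exact (hχ d hd hsq).1 n hn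
    · exact (hχ d hd hsq).2 n (Nat.not_odd_iff_even.mp hn)
  have hreal : ∀ (d : ℕ) [NeZero d] (hd : Odd d) (hsq : Squarefree d),
      (a d : ℂ) = ZMod.LFunction (χ d) (1 / 2) := by
    intro d _ hd hsq
    simp only [ha]
    rw [dif_pos ⟨hd, hsq⟩]
    exact LFunction_half_real hd hsq (Ψ := χ d) (hval d hd hsq)
  have hsmall := smallExp_smSum hRH hf (a := a) (fun d _ hd hsq => ⟨χ d, hval d hd hsq, hreal d hd hsq⟩)
    fun d hd => by simp only [ha]; rw [dif_neg hd]
  obtain ⟨a₀, a₁, b₀, b₁, hasy⟩ := hf.exists_asymptotic a hsmall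
  refine ⟨Polynomial.C a₁ * Polynomial.X + Polynomial.C a₀, Polynomial.C b₁ * Polynomial.X + Polynomial.C b₀,
    Polynomial.degree_linear_le, Polynomial.degree_linear_le, fun ε hε => ?_⟩
  obtain ⟨C, hC, hb⟩ := hasy (min ε (1 / 24)) (lt_min hε (by norm_num)) (min_le_right _ _)
  refine ⟨C, hC, fun X hX => ?_⟩
  have hX0 : 0 < X := by linarith
  have hsum : (∑' d : ℕ, if h : Odd d then
      haveI : NeZero (8 * d) := ⟨by rcases h with ⟨k, rfl⟩; omega⟩
      ((ArithmeticFunction.moebius d : ℤ) : ℂ) ^ 2 * (Φ (d / X) : ℂ) *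
        (χ d).LFunction (1 / 2) else 0) = ((smSum a Φ (Real.log X) : ℝ) : ℂ) := by
    rw [smSum, Complex.ofReal_tsum, Real.exp_log hX0]
    refine tsum_congr fun d => ?_
    by_cases hd : Odd d
    · rw [dif_pos hd]
      by_cases hsq : Squarefree d
      · have : NeZero d := ⟨by rintro rfl; simp at hd⟩
        rw [Complex.ofReal_mul, hreal d hd hsq]
        have hmu : ((ArithmeticFunction.moebius d : ℤ) : ℂ) ^ 2 = 1 := by
          have := ArithmeticFunction.moebius_sq_eq_one_of_squarefree hsq
          exact_mod_cast this
        rw [hmu, one_mul, mul_comm]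
        rfl
      · rw [ArithmeticFunction.moebius_eq_zero_of_not_squarefree hsq]
        simp [ha, hsq]
    · rw [dif_neg hd]
      simp [ha, hd]
  rw [hsum]
  have hbX := hb (Real.log X)
  beta_reduce at hbX
  rw [Real.exp_log hX0] at hbX
  have e1 : Real.exp (1 / 3 * Real.log X) = X ^ ((1 : ℝ) / 3) := by
    rw [Real.rpow_def_of_pos hX0, mul_comm]
  have e2 : Real.exp ((1 / 4 + min ε (1 / 24)) * Real.log X) ≤ X ^ ((1 / 4 : ℝ) + ε) := by
    rw [mul_comm, ← Real.rpow_def_of_pos hX0]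
    exact Real.rpow_le_rpow_of_exponent_le (by linarith) (by linarith [min_le_left ε (1 / 24)])
  rw [e1] at hbX
  have e3 : ((smSum a Φ (Real.log X) : ℝ) : ℂ) -
      (X : ℂ) * ((Polynomial.C a₁ * Polynomial.X + Polynomial.C a₀).eval (Real.log X) : ℝ) -
      ((X ^ ((1 : ℝ) / 3) : ℝ) : ℂ) * ((Polynomial.C b₁ * Polynomial.X + Polynomial.C b₀).eval (Real.log X) : ℝ) =
      ((smSum a Φ (Real.log X) - ((a₀ + a₁ * Real.log X) * X + (b₀ + b₁ * Real.log X) * X ^ ((1 : ℝ) / 3)) : ℝ) : ℂ) := by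
    simp only [Polynomial.eval_add, Polynomial.eval_mul, Polynomial.eval_C, Polynomial.eval_X]
    push_cast
    ring
  rw [e3, Complex.norm_real, Real.norm_eq_abs]
  exact hbX.trans (by gcongr)
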